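/- Let d ≥ 4 be an integer, let η > 1 be real, let p_i denote the i-th prime, and let R = {r > 0 : ∃ j ∈ ℕ≥1 with r² = 1 + ∏_{i ≤ 2^{j^η}} p_i}. Then for every real p with d/(d−2) ≤ p < ∞ there exists C such that ‖sup_{r∈R}|A_r f|‖_{ℓ^p(ℤ^d)} ≤ C‖f‖_{ℓ^p(ℤ^d)} for all f : ℤ^d → ℂ. -/

import Mathlib

open scoped ENNReal NNReal BigOperators
open MeasureTheory

noncomputable section

/-- `e(t) = exp(2πit)`. -/
def eC (t : ℝ) : ℂ := Complex.exp (2 * Real.pi * Complex.I * t)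

/-- `|x|²` for `x ∈ ℤ^d`. -/
def normSqZ {d : ℕ} (x : Fin d → ℤ) : ℤ := ∑ i, (x i) ^ 2

/-- The natural number `r²` of an admissible radius `r`. -/
def radSq (r : ℝ) : ℕ := ⌊r ^ 2⌋₊

/-- `r` is an admissible radius: `r > 0` and `r² ∈ ℕ`. -/
def IsAdmissible (r : ℝ) : Prop := 0 < r ∧ ∃ n : ℕ, r ^ 2 = (n : ℝ)

/-- A set of positive reals is lacunary. -/
def Lacunary (R : Set ℝ) : Prop := ∃ c : ℝ, 1 < c ∧ ∀ r ∈ R, ∀ s ∈ R, r < s → c * r ≤ s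

/-- `N_d(r)`: the number of lattice points on the sphere of radius `r` in `ℤ^d`. -/
def sphereCount (d : ℕ) (r : ℝ) : ℕ := Nat.card {x : Fin d → ℤ // normSqZ x = (radSq r : ℤ)}

/-- The discrete spherical average `A_r f`. -/
def sphAvg (d : ℕ) (r : ℝ) (f : (Fin d → ℤ) → ℂ) (x : Fin d → ℤ) : ℂ :=
  (sphereCount d r : ℂ)⁻¹ *
    ∑' y : Fin d → ℤ, if normSqZ y = (radSq r : ℤ) then f (x - y) else 0

/-- The `ℓ^p(ℤ^d)` norm, valued in `ℝ≥0∞`. -/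
def lpNorm (d : ℕ) (p : ℝ) (f : (Fin d → ℤ) → ℂ) : ℝ≥0∞ :=
  (∑' x : Fin d → ℤ, (‖f x‖₊ : ℝ≥0∞) ^ p) ^ (1 / p)

/-- `(G, B)` is an admissible good/bad prime dichotomy for the set of radii `R`,
with parameter `s`. -/
def GoodBadDichotomy (R : Set ℝ) (G B : Set ℕ) (s : ℝ) : Prop :=
  (∀ p : ℕ, p.Prime → p ∈ G ∪ B) ∧
  (∀ p ∈ G, Nat.Prime p) ∧
  (∀ p ∈ B, Nat.Prime p) ∧
  (∀ p ∈ G, ∀ r ∈ R, IsUnit ((radSq r : ZMod p))) ∧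
  (∀ ε : ℝ, 0 < ε → ∃ C : ℝ, 0 < C ∧ ∀ p ∈ G,
    (({z : ZMod p | ∃ r ∈ R, z = (radSq r : ZMod p)}.ncard : ℝ)) ≤ C * (p : ℝ) ^ ε) ∧
  Summable (fun q : B => (q : ℝ) ^ (-s))

/-- `∏_{i ≤ T} p_i`, the product of the first `⌊T⌋` primes. -/
def primorialUpTo (T : ℝ) : ℕ := ∏ i ∈ Finset.range ⌊T⌋₊, Nat.nth Nat.Prime i

/-- `∏_{j₀ ≤ i ≤ T} p_i` where `p_i` is the `i`-th prime (`1`-indexed). -/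
def prodPrimesFrom (j₀ : ℕ) (T : ℝ) : ℕ :=
  ∏ i ∈ Finset.Icc j₀ ⌊T⌋₊, Nat.nth Nat.Prime (i - 1)

/-- `n_j = 1 + ∏_{i ≤ 2^{j^η}} p_i`. -/
def nseq (η : ℝ) (j : ℕ) : ℕ := 1 + primorialUpTo ((2 : ℝ) ^ ((j : ℝ) ^ η))

/-- The normalized Kloosterman sum `K(q, N; n)`. -/
def kloosterman (d q : ℕ) (N : ℤ) (n : Fin d → ℤ) : ℂ :=
  ((q : ℂ)⁻¹) ^ d *
    ∑ u : Fin q,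
      if Nat.Coprime (u : ℕ) q then
        eC (-(((u : ℕ) : ℝ) * (N : ℝ)) / q) *
          ∑ b : Fin d → Fin q,
            eC ((((u : ℕ) : ℝ) * ∑ i, (((b i : ℕ) : ℝ)) ^ 2
                + ∑ i, ((b i : ℕ) : ℝ) * ((n i : ℝ))) / q)
      else 0

/-- The Ramanujan sum `c_q(N)`. -/
def ramanujanSum (q : ℕ) (N : ℤ) : ℂ :=
  ∑ u : Fin q, if Nat.Coprime (u : ℕ) q then eC ((((u : ℕ) : ℝ) * (N : ℝ)) / q) else 0

/-- The measure `dσ_r = (2 r^{d-1})⁻¹ ℋ^{d-1} ⌞ {|x| = r}` on `ℝ^d`. -/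
def sphMeasure (d : ℕ) (r : ℝ) : Measure (EuclideanSpace ℝ (Fin d)) :=
  (ENNReal.ofReal (2 * r ^ (d - 1)))⁻¹ •
    (μH[((d : ℝ) - 1)] : Measure (EuclideanSpace ℝ (Fin d))).restrict (Metric.sphere 0 r)

/-- The Fourier transform `𝓕dσ_r(ξ) = ∫ e(x·ξ) dσ_r(x)`. -/
def fourierSphMeasure (d : ℕ) (r : ℝ) (ξ : Fin d → ℝ) : ℂ :=
  ∫ x : EuclideanSpace ℝ (Fin d), eC (∑ i, x i * ξ i) ∂(sphMeasure d r)

/-- `Ψ` is a smooth bump: supported in `[-1/4,1/4]^d` and `1` on `[-1/8,1/8]^d`. -/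
def IsBump (d : ℕ) (Ψ : (Fin d → ℝ) → ℝ) : Prop :=
  ContDiff ℝ (⊤ : ℕ∞) Ψ ∧
  (∀ x, x ∉ Set.Icc (fun _ => -(1/4 : ℝ)) (fun _ => (1/4 : ℝ)) → Ψ x = 0) ∧
  (∀ x ∈ Set.Icc (fun _ => -(1/8 : ℝ)) (fun _ => (1/8 : ℝ)), Ψ x = 1)

/-- `Ψ'` is a smooth cutoff with `1_{[-1/4,1/4]^d} ≤ Ψ' ≤ 1_{[-1/2,1/2]^d}`. -/
def IsCutoff (d : ℕ) (Ψ' : (Fin d → ℝ) → ℝ) : Prop :=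
  ContDiff ℝ (⊤ : ℕ∞) Ψ' ∧
  (∀ x, Set.indicator (Set.Icc (fun _ => -(1/4 : ℝ)) (fun _ => (1/4 : ℝ)))
      (fun _ => (1 : ℝ)) x ≤ Ψ' x) ∧
  (∀ x, Ψ' x ≤ Set.indicator (Set.Icc (fun _ => -(1/2 : ℝ)) (fun _ => (1/2 : ℝ)))
      (fun _ => (1 : ℝ)) x)

/-- The Fourier transform of `f : ℤ^d → ℂ`, `f̂(ξ) = ∑_n f(n) e(n·ξ)`. -/
def ftZ {d : ℕ} (f : (Fin d → ℤ) → ℂ) (ξ : Fin d → ℝ) : ℂ :=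
  ∑' n : Fin d → ℤ, f n * eC (∑ i, (n i : ℝ) * ξ i)

/-- The Fourier multiplier operator on `ℤ^d` with 1-periodic multiplier `m`. -/
def mulOp (d : ℕ) (m : (Fin d → ℝ) → ℂ) (f : (Fin d → ℤ) → ℂ) (x : Fin d → ℤ) : ℂ :=
  ∫ ξ in Set.Icc (0 : Fin d → ℝ) 1, m ξ * ftZ f ξ * eC (-∑ i, (x i : ℝ) * ξ i)

/-- The multiplier of `H^q_r`. -/
def mHqr (d q : ℕ) (r : ℝ) (Ψ : (Fin d → ℝ) → ℝ) (ξ : Fin d → ℝ) : ℂ :=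
  ∑' n : Fin d → ℤ,
    kloosterman d q ((radSq r : ℤ)) n * ((Ψ (fun i => (q : ℝ) * ξ i - (n i : ℝ)) : ℝ) : ℂ) *
      fourierSphMeasure d r (fun i => ξ i - (n i : ℝ) / q)

/-- The multiplier of `U^{1,q}_r` for `q = q₁q₂`. -/
def mU1 (d q₁ q₂ : ℕ) (r : ℝ) (Ψ' : (Fin d → ℝ) → ℝ) (ξ : Fin d → ℝ) : ℂ :=
  ∑' n : Fin d → ℤ,
    kloosterman d q₁ ((radSq r : ℤ)) n *
      ((Ψ' (fun i => ((q₁ * q₂ : ℕ) : ℝ) * ξ i - (n i : ℝ)) : ℝ) : ℂ)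

/-- The `ℓ^p(ℤ^d) → ℓ^p(ℤ^d)` operator norm (as a supremum over finitely supported
functions in the unit ball). -/
def opNormLp (d : ℕ) (p : ℝ) (T : ((Fin d → ℤ) → ℂ) → ((Fin d → ℤ) → ℂ)) : ℝ≥0∞ :=
  ⨆ f : {f : (Fin d → ℤ) → ℂ // (Function.support f).Finite ∧ lpNorm d p f ≤ 1},
    lpNorm d p (T f.1)

/-- `𝓕Ψ_q(ζ) = ∫_{ℝ^d} Ψ(qy) e(y·ζ) dy`. -/
def ftPsiQ (d q : ℕ) (Ψ : (Fin d → ℝ) → ℝ) (ζ : Fin d → ℝ) : ℂ :=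
  ∫ y : Fin d → ℝ, ((Ψ (fun i => (q : ℝ) * y i) : ℝ) : ℂ) * eC (∑ i, y i * ζ i)

/-- The kernel `K^q_r(x) = c_q(r² - |x|²) · ((𝓕Ψ_q) * dσ_r)(x)`. -/
def kernelK (d q : ℕ) (r : ℝ) (Ψ : (Fin d → ℝ) → ℝ) (x : Fin d → ℤ) : ℂ :=
  ramanujanSum q ((radSq r : ℤ) - normSqZ x) *
    ∫ y : EuclideanSpace ℝ (Fin d), ftPsiQ d q Ψ (fun i => ((x i : ℝ)) - y i) ∂(sphMeasure d r)

/-- Discrete convolution on `ℤ^d`. -/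
def dconv {d : ℕ} (f g : (Fin d → ℤ) → ℂ) (x : Fin d → ℤ) : ℂ :=
  ∑' y : Fin d → ℤ, f y * g (x - y)

/-- `Ã_r f = f * σ_r` with `σ_r = r^{2-d} 1_{sphere}`. -/
def tildeAvg (d : ℕ) (r : ℝ) (f : (Fin d → ℤ) → ℂ) (x : Fin d → ℤ) : ℂ :=
  (r : ℂ) ^ ((2 : ℤ) - (d : ℤ)) *
    ∑' y : Fin d → ℤ, if normSqZ y = (radSq r : ℤ) then f (x - y) else 0

/-- The error operator `E_r f = Ã_r f - ∑_{1 ≤ q ≤ r} C^q_r f`. -/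
def errOp (d : ℕ) (r : ℝ) (Ψ : (Fin d → ℝ) → ℝ) (f : (Fin d → ℤ) → ℂ) (x : Fin d → ℤ) : ℂ :=
  tildeAvg d r f x - ∑ q ∈ Finset.Icc 1 ⌊r⌋₊, dconv f (kernelK d q r Ψ) x

/-- The Euclidean norm `|x|` of `x ∈ ℤ^d`. -/
def euclNormZ {d : ℕ} (x : Fin d → ℤ) : ℝ := Real.sqrt (∑ i, ((x i : ℝ)) ^ 2)

/-- The `ℓ^p` norm of a nonnegative extended-valued function. -/
def nrm {G : Type*} (p : ℝ) (F : G → ℝ≥0∞) : ℝ≥0∞ := (∑' x, F x ^ p) ^ (1 / p)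

/-- Convolution of nonnegative extended-valued functions. -/
def cv {G : Type*} [AddCommGroup G] (k F : G → ℝ≥0∞) (x : G) : ℝ≥0∞ := ∑' y, k y * F (x - y)

section Nrm
variable {G : Type*}

lemma nrm_mono {p : ℝ} (hp : 0 < p) {F H : G → ℝ≥0∞} (h : ∀ x, F x ≤ H x) : nrm p F ≤ nrm p H := by
  unfold nrm
  gcongr with x
  exact h x

lemma nrm_rpow {p : ℝ} (hp : 0 < p) (F : G → ℝ≥0∞) : nrm p F ^ p = ∑' x, F x ^ p := by
  unfold nrm
  rw [← ENNReal.rpow_mul, one_div_mul_cancel hp.ne', ENNReal.rpow_one]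

lemma nrm_le_of_rpow_le {p : ℝ} (hp : 0 < p) {F : G → ℝ≥0∞} {M : ℝ≥0∞}
    (h : ∑' x, F x ^ p ≤ M ^ p) : nrm p F ≤ M := by
  rw [← nrm_rpow hp] at h
  exact (ENNReal.rpow_le_rpow_iff hp).1 h

lemma nrm_const_mul {p : ℝ} (hp : 0 < p) (c : ℝ≥0∞) (F : G → ℝ≥0∞) :
    nrm p (fun x => c * F x) = c * nrm p F := by
  unfold nrm
  simp_rw [ENNReal.mul_rpow_of_nonneg _ _ hp.le]
  rw [ENNReal.tsum_mul_left, ENNReal.mul_rpow_of_nonneg _ _ (by positivity), ← ENNReal.rpow_mul,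
    mul_one_div_cancel hp.ne', ENNReal.rpow_one]

lemma nrm_zero {p : ℝ} (hp : 0 < p) : nrm p (fun _ : G => 0) = 0 := by
  have := nrm_const_mul (G := G) hp 0 (fun _ => 0)
  simpa using this

lemma nrm_add_le {p : ℝ} (hp : 1 ≤ p) (F H : G → ℝ≥0∞) :
    nrm p (fun x => F x + H x) ≤ nrm p F + nrm p H := by
  let : MeasurableSpace G := ⊤
  have := ENNReal.lintegral_Lp_add_le (μ := Measure.count) (f := F) (g := H)
    (measurable_from_top).aemeasurable (measurable_from_top).aemeasurable hp
  simpa [lintegral_count, nrm] using this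

lemma holder_tsum {p q : ℝ} (hpq : p.HolderConjugate q) (F H : G → ℝ≥0∞) :
    ∑' x, F x * H x ≤ nrm p F * nrm q H := by
  let : MeasurableSpace G := ⊤
  have := ENNReal.lintegral_mul_le_Lp_mul_Lq (μ := Measure.count) hpq (f := F) (g := H)
    (measurable_from_top).aemeasurable (measurable_from_top).aemeasurable
  simpa [lintegral_count, nrm] using this

lemma nrm_sum_le {p : ℝ} (hp : 1 ≤ p) {ι : Type*} (s : Finset ι) (F : ι → G → ℝ≥0∞) :
    nrm p (fun x => ∑ i ∈ s, F i x) ≤ ∑ i ∈ s, nrm p (F i) := by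
  classical
  induction s using Finset.induction_on with
  | empty => simp [nrm_zero (by linarith : (0:ℝ) < p)]
  | insert a s ha ih =>
    simp only [Finset.sum_insert ha]
    exact (nrm_add_le hp _ _).trans (by gcongr)

lemma nrm_le_of_finset {p : ℝ} (hp : 0 < p) {F : G → ℝ≥0∞} {M : ℝ≥0∞}
    (h : ∀ s : Finset G, ∑ x ∈ s, F x ^ p ≤ M ^ p) : nrm p F ≤ M := by
  refine nrm_le_of_rpow_le hp ?_
  rw [ENNReal.tsum_eq_iSup_sum]
  exact iSup_le h

lemma nrm_tsum_le {p : ℝ} (hp : 1 ≤ p) {ι : Type*} (F : ι → G → ℝ≥0∞) :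
    nrm p (fun x => ∑' i, F i x) ≤ ∑' i, nrm p (F i) := by
  have hp0 : 0 < p := by linarith
  refine nrm_le_of_finset hp0 fun s => ?_
  have h1 : Filter.Tendsto (fun t : Finset ι => ∑ x ∈ s, (∑ i ∈ t, F i x) ^ p) Filter.atTop
      (nhds (∑ x ∈ s, (∑' i, F i x) ^ p)) := by
    refine tendsto_finsetSum _ fun x _ => ?_
    exact ((ENNReal.continuous_rpow_const (y := p)).tendsto _).comp
      (ENNReal.summable (f := fun i => F i x)).hasSum
  refine le_of_tendsto' h1 fun t => ?_
  calc ∑ x ∈ s, (∑ i ∈ t, F i x) ^ p ≤ ∑' x, (∑ i ∈ t, F i x) ^ p := ENNReal.sum_le_tsum s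
    _ = nrm p (fun x => ∑ i ∈ t, F i x) ^ p := (nrm_rpow hp0 _).symm
    _ ≤ (∑' i, nrm p (F i)) ^ p := by
        gcongr
        exact (nrm_sum_le hp t F).trans (ENNReal.sum_le_tsum t)

lemma nrm_iSup_le {p : ℝ} (hp : 0 < p) {ι : Type*} (F : ι → G → ℝ≥0∞) :
    nrm p (fun x => ⨆ i, F i x) ≤ (∑' i, nrm p (F i) ^ p) ^ (1 / p) := by
  refine nrm_le_of_rpow_le hp ?_
  rw [← ENNReal.rpow_mul, one_div_mul_cancel hp.ne', ENNReal.rpow_one]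
  simp_rw [nrm_rpow hp]
  rw [ENNReal.tsum_comm]
  gcongr with x
  rw [← ENNReal.le_rpow_inv_iff hp]
  refine iSup_le fun i => ?_
  rw [ENNReal.le_rpow_inv_iff hp]
  exact ENNReal.le_tsum i

variable [AddCommGroup G]

lemma nrm_translate (p : ℝ) (F : G → ℝ≥0∞) (y : G) : nrm p (fun x => F (x - y)) = nrm p F := by
  unfold nrm
  congr 1
  exact (Equiv.subRight y).tsum_eq (fun x => F x ^ p)

lemma nrm_translate' (p : ℝ) (F : G → ℝ≥0∞) (y : G) : nrm p (fun x => F (x + y)) = nrm p F := by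
  unfold nrm
  congr 1
  exact (Equiv.addRight y).tsum_eq (fun x => F x ^ p)

lemma nrm_cv_le {p : ℝ} (hp : 1 ≤ p) (k F : G → ℝ≥0∞) :
    nrm p (cv k F) ≤ (∑' y, k y) * nrm p F := by
  have hp0 : 0 < p := by linarith
  calc nrm p (cv k F) ≤ ∑' y, nrm p (fun x => k y * F (x - y)) := nrm_tsum_le hp _
    _ = ∑' y, k y * nrm p F := by
        congr 1; ext y
        rw [nrm_const_mul hp0 (k y) (fun x => F (x - y)), nrm_translate]
    _ = _ := ENNReal.tsum_mul_right

lemma cv_mono {k k' F F' : G → ℝ≥0∞} (h : ∀ x, k x ≤ k' x) (h' : ∀ x, F x ≤ F' x) (x : G) :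
    cv k F x ≤ cv k' F' x := by
  unfold cv
  gcongr with y
  · exact h y
  · exact h' _

end Nrm

lemma le_nrm {G : Type*} {p : ℝ} (hp : 0 < p) (F : G → ℝ≥0∞) (x : G) : F x ≤ nrm p F := by
  rw [← ENNReal.rpow_le_rpow_iff hp, nrm_rpow hp]
  exact ENNReal.le_tsum (f := fun x => F x ^ p) x

/-- Boundedness, with constant `M`, of the bilinear form of convolution by `k` on
`ℓ^p × ℓ^q` (finitely supported functions). -/
def BilP {G : Type*} [AddCommGroup G] (p q : ℝ) (k : G → ℂ) (M : ℝ) : Prop :=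
  ∀ (S : Finset G) (f g : G → ℂ), ‖∑ x ∈ S, ∑ y ∈ S, k (x - y) * f y * g x‖ ≤
    M * (∑ y ∈ S, ‖f y‖ ^ p) ^ (1 / p) * (∑ x ∈ S, ‖g x‖ ^ q) ^ (1 / q)

section Torus
attribute [local instance] instMeasureSpaceUnitAddCircle instIsAddHaarMeasureUnitAddCircleVolume
  instIsProbabilityMeasureUnitAddCircleVolume
variable {d : ℕ}
open UnitAddTorus

lemma integral_mFourier (n : Fin d → ℤ) :
    ∫ t, mFourier n t = if n = 0 then 1 else 0 := by
  have h := (orthonormal_iff_ite.mp (orthonormal_mFourier (d := Fin d))) 0 n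
  simp only [ContinuousMap.inner_toLp, ← mFourier_neg, ← mFourier_add] at h
  simp only [neg_zero, add_zero, eq_comm (a := (0 : Fin d → ℤ))] at h
  exact h

lemma norm_mFourier_apply (n : Fin d → ℤ) (t : UnitAddTorus (Fin d)) : ‖mFourier n t‖ = 1 := by
  simp only [mFourier, ContinuousMap.coe_mk, fourier_apply, norm_prod, Circle.norm_coe,
    Finset.prod_const_one]

lemma integral_norm_sq_trigPoly (S : Finset (Fin d → ℤ)) (f : (Fin d → ℤ) → ℂ) :
    ∫ t, ‖∑ y ∈ S, f y * mFourier y t‖ ^ 2 = ∑ y ∈ S, ‖f y‖ ^ 2 := by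
  have key : ∀ t, (((‖∑ y ∈ S, f y * mFourier y t‖ ^ 2 : ℝ)) : ℂ) =
      ∑ x ∈ S, ∑ y ∈ S, f x * (starRingEnd ℂ) (f y) * mFourier (x - y) t := by
    intro t
    rw [← Complex.normSq_eq_norm_sq, ← Complex.mul_conj, map_sum, Finset.sum_mul_sum]
    refine Finset.sum_congr rfl fun x _ => Finset.sum_congr rfl fun y _ => ?_
    rw [sub_eq_add_neg, mFourier_add, mFourier_neg, map_mul]
    ring
  have hc : ((∫ t, ‖∑ y ∈ S, f y * mFourier y t‖ ^ 2 : ℝ) : ℂ) =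
      ((∑ y ∈ S, ‖f y‖ ^ 2 : ℝ) : ℂ) := by
    rw [← integral_complex_ofReal]
    simp_rw [key]
    have hi : ∀ (c : ℂ) (n : Fin d → ℤ), Integrable (fun t => c * mFourier n t) := fun c n =>
      ((mFourier n).continuous.integrable_of_hasCompactSupport
        (HasCompactSupport.of_compactSpace _)).const_mul c
    rw [integral_finsetSum _ fun x _ => integrable_finsetSum _ fun y _ => hi _ _]
    push_cast
    refine Finset.sum_congr rfl fun x hx => ?_
    rw [integral_finsetSum _ fun y _ => hi _ _, Finset.sum_eq_single x]
    · rw [integral_const_mul, integral_mFourier]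
      simp only [sub_self, if_true, mul_one]
      rw [Complex.mul_conj, Complex.normSq_eq_norm_sq]
      push_cast; ring
    · intro y _ hy
      rw [integral_const_mul, integral_mFourier, if_neg (sub_ne_zero.2 hy.symm), mul_zero]
    · exact fun h => absurd hx h
  exact_mod_cast hc

lemma bilP_two_of_torus {k : (Fin d → ℤ) → ℂ} (hk : Summable fun x => ‖k x‖) {M : ℝ}
    (hM : ∀ t : UnitAddTorus (Fin d), ‖∑' x, k x * mFourier x t‖ ≤ M) : BilP 2 2 k M := by
  intro S f g
  have hM0 : 0 ≤ M := (norm_nonneg _).trans (hM 0)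
  set Fh : UnitAddTorus (Fin d) → ℂ := fun t => ∑ y ∈ S, f y * mFourier y t with hFh
  set Gh : UnitAddTorus (Fin d) → ℂ := fun t => ∑ x ∈ S, (starRingEnd ℂ) (g x) * mFourier x t
  have hFc : Continuous Fh := by fun_prop
  have hGc : Continuous Gh := by fun_prop
  have hmc : Continuous fun t : UnitAddTorus (Fin d) => ∑' x, k x * mFourier x t := by
    refine continuous_tsum (fun x => by fun_prop) hk fun x t => ?_
    rw [norm_mul, norm_mFourier_apply, mul_one]
  have hcoef : ∀ w : Fin d → ℤ, ∫ t, (∑' x, k x * mFourier x t) * mFourier (-w) t = k w := by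
    intro w
    simp_rw [← tsum_mul_right]
    rw [← integral_tsum_of_summable_integral_norm]
    · rw [tsum_eq_single w]
      · simp_rw [mul_assoc, ← mFourier_add]
        rw [integral_const_mul, integral_mFourier, if_pos (add_neg_cancel w), mul_one]
      · intro x hx
        simp_rw [mul_assoc, ← mFourier_add]
        rw [integral_const_mul, integral_mFourier, if_neg, mul_zero]
        rwa [← sub_eq_add_neg, sub_eq_zero]
    · intro x
      refine Continuous.integrable_of_hasCompactSupport (by fun_prop)
        (HasCompactSupport.of_compactSpace _)
    · simpa [norm_mFourier_apply] using hk
  have hB : ∑ x ∈ S, ∑ y ∈ S, k (x - y) * f y * g x =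
      ∫ t, (∑' x, k x * mFourier x t) * Fh t * (starRingEnd ℂ) (Gh t) := by
    have hexp : ∀ t, (∑' x, k x * mFourier x t) * Fh t * (starRingEnd ℂ) (Gh t) =
        ∑ x ∈ S, ∑ y ∈ S, (f y * g x) * ((∑' x, k x * mFourier x t) * mFourier (-(x - y)) t) := by
      intro t
      simp only [Fh, Gh, map_sum]
      rw [mul_assoc, Finset.sum_mul_sum, Finset.mul_sum, Finset.sum_comm]
      simp_rw [Finset.mul_sum]
      refine Finset.sum_congr rfl fun x _ => Finset.sum_congr rfl fun y _ => ?_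
      rw [neg_sub, sub_eq_add_neg, mFourier_add, mFourier_neg, map_mul, Complex.conj_conj]
      ring
    simp_rw [hexp]
    have hi : ∀ (c : ℂ) (n : Fin d → ℤ), Integrable
        (fun t => c * ((∑' x, k x * mFourier x t) * mFourier n t)) := fun c n =>
      Continuous.integrable_of_hasCompactSupport (by fun_prop) (HasCompactSupport.of_compactSpace _)
    rw [integral_finsetSum _ fun x _ => integrable_finsetSum _ fun y _ => hi _ _]
    refine Finset.sum_congr rfl fun x _ => ?_
    rw [integral_finsetSum _ fun y _ => hi _ _]
    refine Finset.sum_congr rfl fun y _ => ?_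
    rw [integral_const_mul, hcoef]
    ring
  rw [hB]
  have hF2 : ∫ t, ‖Fh t‖ ^ (2 : ℝ) = ∑ y ∈ S, ‖f y‖ ^ (2 : ℝ) := by
    simp_rw [Real.rpow_two]; exact integral_norm_sq_trigPoly S f
  have hG2 : ∫ t, ‖Gh t‖ ^ (2 : ℝ) = ∑ y ∈ S, ‖g y‖ ^ (2 : ℝ) := by
    simp_rw [Real.rpow_two]
    simpa using integral_norm_sq_trigPoly S fun x => (starRingEnd ℂ) (g x)
  have h_int : ∀ {u : UnitAddTorus (Fin d) → ℝ}, Continuous u → Integrable u := fun hu =>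
    hu.integrable_of_hasCompactSupport (HasCompactSupport.of_compactSpace _)
  calc _ ≤ ∫ t, ‖(∑' x, k x * mFourier x t) * Fh t * (starRingEnd ℂ) (Gh t)‖ :=
        norm_integral_le_integral_norm _
    _ ≤ ∫ t, M * (‖Fh t‖ * ‖Gh t‖) := by
        refine integral_mono (h_int (by fun_prop)) (h_int (by fun_prop)) fun t => ?_
        simp only [norm_mul, RCLike.norm_conj]
        rw [mul_assoc]
        gcongr
        exact hM t
    _ = M * ∫ t, ‖Fh t‖ * ‖Gh t‖ := integral_const_mul _ _
    _ ≤ M * ((∫ t, ‖Fh t‖ ^ (2:ℝ)) ^ (1 / (2:ℝ)) * (∫ t, ‖Gh t‖ ^ (2:ℝ)) ^ (1 / (2:ℝ))) := by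
        gcongr
        refine integral_mul_le_Lp_mul_Lq_of_nonneg ⟨by norm_num, by norm_num, by norm_num⟩
          (Filter.Eventually.of_forall fun t => norm_nonneg _)
          (Filter.Eventually.of_forall fun t => norm_nonneg _) ?_ ?_
        · exact hFc.norm.memLp_of_hasCompactSupport (HasCompactSupport.of_compactSpace _)
        · exact hGc.norm.memLp_of_hasCompactSupport (HasCompactSupport.of_compactSpace _)
    _ = _ := by rw [hF2, hG2, mul_assoc]

/-- A summable kernel on `ℤ^d` with multiplier bounded by `M` is bounded on `ℓ²`. -/
lemma bilP_two_of_multiplier {k : (Fin d → ℤ) → ℂ} (hk : Summable fun x => ‖k x‖) {M : ℝ}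
    (hM : ∀ ξ : Fin d → ℝ, ‖∑' x, k x * eC (∑ i, (x i : ℝ) * ξ i)‖ ≤ M) : BilP 2 2 k M := by
  refine bilP_two_of_torus hk fun t => ?_
  obtain ⟨ξ, rfl⟩ : ∃ ξ : Fin d → ℝ, (fun i => (ξ i : AddCircle (1:ℝ))) = t := by
    choose ξ hξ using fun i => QuotientAddGroup.mk_surjective (t i)
    exact ⟨ξ, funext hξ⟩
  convert hM ξ using 6 with x
  simp only [mFourier, ContinuousMap.coe_mk, fourier_coe_apply, eC]
  rw [← Complex.exp_sum]
  congr 1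
  push_cast
  rw [Finset.mul_sum]
  refine Finset.sum_congr rfl fun i _ => ?_
  ring

end Torus

section Interpolation
variable {G : Type*} [AddCommGroup G]

/-- `‖w‖^s · w/‖w‖` as an entire function of `s`; it vanishes for `w = 0`. -/
def cpowDir (w : ℂ) (s : ℂ) : ℂ :=
  if w = 0 then 0 else w / ‖w‖ * Complex.exp (s * Real.log ‖w‖)

lemma cpowDir_one (w : ℂ) : cpowDir w 1 = w := by
  unfold cpowDir
  split_ifs with h
  · exact h.symm
  · rw [one_mul, ← Complex.ofReal_exp, Real.exp_log (norm_pos_iff.2 h), div_mul_cancel₀]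
    simpa using h

lemma norm_cpowDir_le (w s : ℂ) : ‖cpowDir w s‖ ≤ ‖w‖ ^ s.re := by
  unfold cpowDir
  split_ifs with h
  · simp [Real.rpow_nonneg]
  · have hw : 0 < ‖w‖ := norm_pos_iff.2 h
    rw [norm_mul, norm_div, Complex.norm_real, norm_norm, div_self hw.ne', one_mul,
      Complex.norm_exp, Real.rpow_def_of_pos hw]
    simp [mul_comm]

lemma differentiable_cpowDir (w : ℂ) : Differentiable ℂ (cpowDir w) := by
  unfold cpowDir
  split_ifs with h
  · exact differentiable_const _
  · fun_prop

/-- Riesz-Thorin interpolation between `ℓ¹` and `ℓ²` for convolution operators. -/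
lemma bilP_interpolate {k : G → ℂ} {M₁ M₂ θ p q : ℝ} (hM₁ : 0 ≤ M₁)
    (h₁ : ∀ T : Finset G, ∑ x ∈ T, ‖k x‖ ≤ M₁) (hM₂ : 0 ≤ M₂) (h₂ : BilP 2 2 k M₂)
    (hθ0 : 0 < θ) (hθ1 : θ ≤ 1) (hp : 1 / p = 1 - θ / 2) (hq : 1 / q = θ / 2) :
    BilP p q k (M₁ ^ (1 - θ) * M₂ ^ θ) := by
  classical
  intro S f g
  have hp0 : 0 < p := one_div_pos.1 (by rw [hp]; linarith)
  have hq0 : 0 < q := one_div_pos.1 (by rw [hq]; linarith)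
  set A := ∑ y ∈ S, ‖f y‖ ^ p with hA
  set B := ∑ x ∈ S, ‖g x‖ ^ q with hB
  have hA0 : 0 ≤ A := Finset.sum_nonneg fun y _ => Real.rpow_nonneg (norm_nonneg _) _
  have hB0 : 0 ≤ B := Finset.sum_nonneg fun y _ => Real.rpow_nonneg (norm_nonneg _) _
  set F : ℂ → ℂ := fun z => ∑ x ∈ S, ∑ y ∈ S,
    k (x - y) * cpowDir (f y) (p * (1 - z / 2)) * cpowDir (g x) (q * z / 2) with hF
  have hFd : Differentiable ℂ F := by
    refine Differentiable.fun_sum fun x _ => Differentiable.fun_sum fun y _ => ?_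
    exact ((differentiable_const _).mul ((differentiable_cpowDir _).comp (by fun_prop))).mul
      ((differentiable_cpowDir _).comp (by fun_prop))
  have hre1 : ∀ z : ℂ, ((p : ℂ) * (1 - z / 2)).re = p * (1 - z.re / 2) := by
    intro z; simp
  have hre2 : ∀ z : ℂ, ((q : ℂ) * z / 2).re = q * z.re / 2 := by
    intro z; simp
  have hbd : ∀ z : ℂ, ‖F z‖ ≤ ∑ x ∈ S, ∑ y ∈ S,
      ‖k (x - y)‖ * ‖cpowDir (f y) (p * (1 - z / 2))‖ * ‖cpowDir (g x) (q * z / 2)‖ := by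
    intro z
    refine (norm_sum_le _ _).trans (Finset.sum_le_sum fun x _ => (norm_sum_le _ _).trans ?_)
    simp only [norm_mul]
    exact le_rfl
  have hmain := Complex.HadamardThreeLines.norm_le_interp_of_mem_verticalClosedStrip₀₁' F
    (z := (θ : ℂ)) (a := M₁ * A) (b := M₂ * A ^ (1 / (2 : ℝ)) * B ^ (1 / (2 : ℝ)))
    ⟨by simpa using hθ0.le, by simpa using hθ1⟩ hFd.diffContOnCl ?_ ?_ ?_
  · have e1 : (p : ℂ) * (1 - θ / 2) = 1 := by
      have : p * (1 - θ / 2) = 1 := by rw [← hp]; field_simp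
      exact_mod_cast this
    have e2 : (q : ℂ) * θ / 2 = 1 := by
      have : q * θ / 2 = 1 := by rw [mul_div_assoc, ← hq]; field_simp
      exact_mod_cast this
    have hFθ : F θ = ∑ x ∈ S, ∑ y ∈ S, k (x - y) * f y * g x := by
      simp only [hF, e1, e2, cpowDir_one]
    rw [hFθ] at hmain
    refine hmain.trans (le_of_eq ?_)
    rw [Complex.ofReal_re, Real.mul_rpow hM₁ hA0,
      Real.mul_rpow (by positivity) (by positivity), Real.mul_rpow hM₂ (by positivity),
      ← Real.rpow_mul hA0, ← Real.rpow_mul hB0, hp, hq]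
    have : A ^ (1 - θ / 2) = A ^ (1 - θ) * A ^ (1 / 2 * θ) := by
      rw [← Real.rpow_add_of_nonneg hA0 (by linarith) (by linarith)]
      congr 1; ring
    rw [this, show (1 / 2 * θ : ℝ) = θ / 2 by ring]
    ring
  · refine ⟨∑ x ∈ S, ∑ y ∈ S,
      ‖k (x - y)‖ * (1 + ‖f y‖) ^ p * (1 + ‖g x‖) ^ q, ?_⟩
    rintro _ ⟨z, ⟨hz0, hz1⟩, rfl⟩
    refine (hbd z).trans (Finset.sum_le_sum fun x _ => Finset.sum_le_sum fun y _ => ?_)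
    have aux : ∀ (w s : ℂ) (t : ℝ), 0 ≤ s.re → s.re ≤ t → ‖cpowDir w s‖ ≤ (1 + ‖w‖) ^ t := by
      intro w s t h0 h1
      calc _ ≤ ‖w‖ ^ s.re := norm_cpowDir_le w s
        _ ≤ (1 + ‖w‖) ^ s.re := by gcongr; linarith
        _ ≤ _ := Real.rpow_le_rpow_of_exponent_le (by linarith [norm_nonneg w]) h1
    gcongr
    · exact aux _ _ _ (by rw [hre1]; nlinarith) (by rw [hre1]; nlinarith)
    · exact aux _ _ _ (by rw [hre2]; positivity) (by rw [hre2]; nlinarith)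
  · intro z hz
    have hz' : z.re = 0 := hz
    calc ‖F z‖ ≤ _ := hbd z
      _ ≤ ∑ x ∈ S, ∑ y ∈ S, ‖k (x - y)‖ * ‖f y‖ ^ p := by
        refine Finset.sum_le_sum fun x _ => Finset.sum_le_sum fun y _ => ?_
        have t1 := norm_cpowDir_le (f y) (p * (1 - z / 2))
        have t2 := norm_cpowDir_le (g x) (q * z / 2)
        rw [hre1, hz'] at t1
        rw [hre2, hz'] at t2
        simp only [zero_div, sub_zero, mul_one, mul_zero, Real.rpow_zero] at t1 t2
        calc _ ≤ ‖k (x - y)‖ * ‖f y‖ ^ p * 1 := by gcongr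
          _ = _ := mul_one _
      _ = ∑ y ∈ S, (∑ x ∈ S, ‖k (x - y)‖) * ‖f y‖ ^ p := by
        rw [Finset.sum_comm]
        simp_rw [Finset.sum_mul]
      _ ≤ ∑ y ∈ S, M₁ * ‖f y‖ ^ p := by
        gcongr with y
        have := h₁ (S.image fun x => x - y)
        rwa [Finset.sum_image fun a _ b _ h => sub_left_injective h] at this
      _ = _ := (Finset.mul_sum _ _ _).symm
  · intro z hz
    have hz' : z.re = 1 := hz
    refine (h₂ S (fun y => cpowDir (f y) (p * (1 - z / 2)))
      (fun x => cpowDir (g x) (q * z / 2))).trans ?_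
    have aux : ∀ (w s : ℂ) (t : ℝ), s.re = t / 2 → ‖cpowDir w s‖ ^ (2 : ℝ) ≤ ‖w‖ ^ t := by
      intro w s t h
      calc _ ≤ (‖w‖ ^ s.re) ^ (2 : ℝ) := by gcongr; exact norm_cpowDir_le w s
        _ = _ := by rw [← Real.rpow_mul (norm_nonneg _), h]; congr 1; ring
    gcongr
    · exact Finset.sum_le_sum fun y _ => aux _ _ p (by rw [hre1, hz']; ring)
    · exact Finset.sum_le_sum fun y _ => aux _ _ q (by rw [hre2, hz', mul_one])

/-- From the bilinear form to the operator. -/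
lemma BilP.nrm_le {p q : ℝ} (hpq : p.HolderConjugate q) {k : G → ℂ} {M : ℝ} (hM : 0 ≤ M)
    (h : BilP p q k M) (S : Finset G) (f : G → ℂ) :
    nrm p (fun x => ‖∑ y ∈ S, k (x - y) * f y‖ₑ) ≤
      ENNReal.ofReal (M * (∑ y ∈ S, ‖f y‖ ^ p) ^ (1 / p)) := by
  classical
  have hp0 : 0 < p := hpq.pos
  have hq0 : 0 < q := hpq.symm.pos
  refine nrm_le_of_finset hp0 fun s => ?_
  set c : G → ℂ := fun x => ∑ y ∈ S, k (x - y) * f y with hc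
  set g : G → ℂ := fun x => if x ∈ s then (starRingEnd ℂ) (cpowDir (c x) (p - 1 : ℝ)) else 0
  set f' : G → ℂ := fun y => if y ∈ S then f y else 0
  have key := h (s ∪ S) f' g
  set B := ∑ x ∈ s, ‖c x‖ ^ p with hB
  have hB0 : 0 ≤ B := Finset.sum_nonneg fun y _ => Real.rpow_nonneg (norm_nonneg _) _
  set A := (∑ y ∈ S, ‖f y‖ ^ p) ^ (1 / p)
  have hA0 : 0 ≤ A := Real.rpow_nonneg
    (Finset.sum_nonneg fun y _ => Real.rpow_nonneg (norm_nonneg _) _) _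
  have hcg : ∀ x, c x * (starRingEnd ℂ) (cpowDir (c x) (p - 1 : ℝ)) = ((‖c x‖ ^ p : ℝ) : ℂ) := by
    intro x
    unfold cpowDir
    split_ifs with hx
    · simp [hx, Real.zero_rpow hp0.ne']
    · have hx' : 0 < ‖c x‖ := norm_pos_iff.2 hx
      rw [← Complex.ofReal_mul, ← Complex.ofReal_exp, map_mul, map_div₀, Complex.conj_ofReal,
        Complex.conj_ofReal, ← mul_assoc, ← mul_div_assoc, Complex.mul_conj,
        Complex.normSq_eq_norm_sq, ← Complex.ofReal_div, ← Complex.ofReal_mul]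
      congr 1
      rw [Real.rpow_def_of_pos hx', mul_comm (p - 1), mul_sub, Real.exp_sub, mul_one,
        Real.exp_log hx']
      field_simp
  have e1 : ∑ x ∈ s ∪ S, ∑ y ∈ s ∪ S, k (x - y) * f' y * g x = ((B : ℝ) : ℂ) := by
    have : ∀ x, ∑ y ∈ s ∪ S, k (x - y) * f' y * g x = c x * g x := by
      intro x
      rw [← Finset.sum_mul, hc]
      congr 1
      rw [← Finset.sum_subset (Finset.subset_union_right (s₁ := s) (s₂ := S))]
      · exact Finset.sum_congr rfl fun y hy => by simp [f', hy]
      · intro y _ hy; simp [f', hy]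
    simp_rw [this]
    rw [← Finset.sum_subset (Finset.subset_union_left (s₁ := s) (s₂ := S))]
    · rw [hB]
      push_cast
      refine Finset.sum_congr rfl fun x hx => ?_
      simp only [g, hx, if_true]
      rw [hcg]
    · intro y _ hy; simp [g, hy]
  have e2 : ∑ y ∈ s ∪ S, ‖f' y‖ ^ p = ∑ y ∈ S, ‖f y‖ ^ p := by
    rw [← Finset.sum_subset (Finset.subset_union_right (s₁ := s) (s₂ := S))]
    · exact Finset.sum_congr rfl fun y hy => by simp [f', hy]
    · intro y _ hy; simp [f', hy, Real.zero_rpow hp0.ne']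
  have e3 : ∑ x ∈ s ∪ S, ‖g x‖ ^ q ≤ B := by
    rw [← Finset.sum_subset (Finset.subset_union_left (s₁ := s) (s₂ := S))]
    · refine Finset.sum_le_sum fun x hx => ?_
      simp only [g, hx, if_true, RCLike.norm_conj]
      calc _ ≤ (‖c x‖ ^ (p - 1)) ^ q := by
            gcongr
            simpa using norm_cpowDir_le (c x) ((p - 1 : ℝ) : ℂ)
        _ = ‖c x‖ ^ p := by
            rw [← Real.rpow_mul (norm_nonneg _), hpq.sub_one_mul_conj]
    · intro y _ hy; simp [g, hy, Real.zero_rpow hq0.ne']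
  rw [e1, Complex.norm_real, Real.norm_of_nonneg hB0, e2] at key
  have hBM : B ≤ (M * A) ^ p := by
    rcases hB0.eq_or_lt with h0 | hpos
    · rw [← h0]; positivity
    have h3 : B ≤ M * A * B ^ (1 / q) := key.trans (by gcongr)
    have h4 : B ^ (1 / p) ≤ M * A := by
      have hs : B = B ^ (1 / p) * B ^ (1 / q) := by
        rw [← Real.rpow_add hpos, one_div, one_div, hpq.inv_add_inv_eq_one, Real.rpow_one]
      have h3 : B ^ (1 / p) * B ^ (1 / q) ≤ M * A * B ^ (1 / q) := hs ▸ h3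
      exact le_of_mul_le_mul_right h3 (by positivity)
    calc B = (B ^ (1 / p)) ^ p := by
          rw [← Real.rpow_mul hB0, one_div_mul_cancel hp0.ne', Real.rpow_one]
      _ ≤ _ := by gcongr
  have e4 : ∑ x ∈ s, ‖c x‖ₑ ^ p = ENNReal.ofReal B := by
    rw [hB, ENNReal.ofReal_sum_of_nonneg fun x _ => by positivity]
    refine Finset.sum_congr rfl fun x _ => ?_
    rw [← ENNReal.ofReal_rpow_of_nonneg (norm_nonneg _) hp0.le, ofReal_norm]
  rw [e4, ENNReal.ofReal_rpow_of_nonneg (by positivity) hp0.le]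
  exact ENNReal.ofReal_le_ofReal hBM

end Interpolation

section Superlacunary

lemma ENNReal.add_rpow_le_add_mul {k : ℝ} (hk : 1 ≤ k) (a b : ℝ≥0∞) :
    (a + b) ^ k ≤ b ^ k + ENNReal.ofReal k * a * (a + b) ^ (k - 1) := by
  have hk0 : 0 < k := by linarith
  by_cases hb : b = ∞
  · simp [hb, hk0]
  rcases eq_or_ne a 0 with ha0 | ha0
  · simp [ha0]
  by_cases ha : a = ∞
  · subst ha
    rcases hk.eq_or_lt with rfl | hk1
    · simp
    · have : (∞ : ℝ≥0∞) ^ (k - 1) = ∞ := by simp; linarith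
      simp [this, hk0]
  lift a to ℝ≥0 using ha
  lift b to ℝ≥0 using hb
  rw [← ENNReal.coe_add, ← ENNReal.coe_rpow_of_nonneg _ hk0.le,
    ← ENNReal.coe_rpow_of_nonneg _ hk0.le, ← ENNReal.coe_rpow_of_nonneg _ (by linarith : 0 ≤ k - 1),
    ENNReal.ofReal]
  norm_cast
  rw [← NNReal.coe_le_coe]
  push_cast
  rw [Real.coe_toNNReal _ hk0.le]
  have ha' : (0 : ℝ) < a := by
    have : (a : ℝ≥0) ≠ 0 := by exact_mod_cast ha0
    exact_mod_cast pos_iff_ne_zero.2 this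
  have hs : (0 : ℝ) < a + b := by positivity
  have hber := one_add_mul_self_le_rpow_one_add (s := -(a : ℝ) / (a + b)) (p := k)
    (by rw [le_div_iff₀ hs]; linarith [b.coe_nonneg]) hk
  have e1 : 1 + -(a : ℝ) / (a + b) = b / (a + b) := by field_simp; ring
  rw [e1, Real.div_rpow b.coe_nonneg hs.le, le_div_iff₀ (by positivity)] at hber
  have e2 : ((a : ℝ) + b) ^ k = (a + b) ^ (k - 1) * (a + b) := by
    rw [← Real.rpow_add_one hs.ne']; congr 1; ring
  have e3 : (1 + k * (-(a : ℝ) / (a + b))) * (a + b) ^ k =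
      (a + b) ^ k - k * a * (a + b) ^ (k - 1) := by
    rw [e2]; field_simp; ring
  linarith

lemma ENNReal.add_rpow_le_two_mul {k : ℝ} (hk : 0 ≤ k) (a b : ℝ≥0∞) :
    (a + b) ^ k ≤ 2 ^ k * (a ^ k + b ^ k) := by
  rcases le_total a b with h | h
  · calc (a + b) ^ k ≤ (2 * b) ^ k := by gcongr; rw [two_mul]; gcongr
      _ = 2 ^ k * b ^ k := ENNReal.mul_rpow_of_nonneg _ _ hk
      _ ≤ _ := by gcongr; exact le_add_self
  · calc (a + b) ^ k ≤ (2 * a) ^ k := by gcongr; rw [two_mul]; gcongr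
      _ = 2 ^ k * a ^ k := ENNReal.mul_rpow_of_nonneg _ _ hk
      _ ≤ _ := by gcongr; exact le_self_add

variable {G : Type*} [AddCommGroup G]

lemma tail_rpow_le {k : ℝ} (hk : 1 ≤ k) (J : ℕ) (a : ℕ → ℝ≥0∞) :
    (∑ l ∈ Finset.range J, a l) ^ k ≤ ∑ j ∈ Finset.range J,
      ENNReal.ofReal k * a j * (a j + ∑ l ∈ Finset.Ico (j + 1) J, a l) ^ (k - 1) := by
  have key : ∀ m ≤ J, (∑ l ∈ Finset.Ico (J - m) J, a l) ^ k ≤ ∑ j ∈ Finset.Ico (J - m) J,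
      ENNReal.ofReal k * a j * (a j + ∑ l ∈ Finset.Ico (j + 1) J, a l) ^ (k - 1) := by
    intro m
    induction m with
    | zero => intro _; simp; linarith
    | succ m ih =>
      intro hm
      have h1 : J - (m + 1) + 1 = J - m := by omega
      have h2 : J - (m + 1) < J := by omega
      rw [Finset.sum_eq_sum_Ico_succ_bot h2, Finset.sum_eq_sum_Ico_succ_bot h2, h1, add_comm (_ * _)]
      exact (ENNReal.add_rpow_le_add_mul hk _ _).trans (add_le_add_left (ih (by omega)) _)
  have := key J le_rfl
  rwa [Nat.sub_self, ← Finset.range_eq_Ico] at this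

/-- The adjoint of convolution by `w`. -/
def adj (w g : G → ℝ≥0∞) (y : G) : ℝ≥0∞ := ∑' z, w z * g (y + z)

lemma nrm_adj_le {p : ℝ} (hp : 1 ≤ p) (w g : G → ℝ≥0∞) :
    nrm p (adj w g) ≤ (∑' z, w z) * nrm p g := by
  have hp0 : 0 < p := by linarith
  calc nrm p (adj w g) ≤ ∑' z, nrm p (fun y => w z * g (y + z)) := nrm_tsum_le hp _
    _ = ∑' z, w z * nrm p g := by
        congr 1; ext z
        rw [nrm_const_mul hp0 (w z) (fun x => g (x + z)), nrm_translate']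
    _ = _ := ENNReal.tsum_mul_right

lemma tsum_adj_mul (w g F : G → ℝ≥0∞) :
    ∑' y, adj w g y * F y = ∑' z, w z * ∑' x, g x * F (x - z) := by
  unfold adj
  simp_rw [← ENNReal.tsum_mul_right, ← ENNReal.tsum_mul_left]
  rw [ENNReal.tsum_comm]
  congr 1; ext z
  rw [← (Equiv.addRight z).tsum_eq (fun x => w z * (g x * F (x - z)))]
  simp [mul_assoc]

/-- The modulus of continuity in `ℓ¹` of a kernel. -/
def modulus (w : G → ℝ≥0∞) (z : G) : ℝ≥0∞ := ∑' x, (w (x + z) - w x)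

lemma adj_sub_le (w g : G → ℝ≥0∞) (x z : G) :
    adj w g (x - z) ≤ adj w g x + adj (fun u => w (u + z) - w u) g x := by
  unfold adj
  rw [← ENNReal.tsum_add, ← (Equiv.addRight z).tsum_eq]
  refine ENNReal.tsum_le_tsum fun u => ?_
  simp only [Equiv.coe_addRight]
  rw [← add_mul, show x - z + (u + z) = x + u by abel]
  gcongr
  exact le_add_tsub

/-- The dual form of the superlacunary maximal inequality. -/
lemma superlacunary_dual {k k' : ℝ} (hk : k.HolderConjugate k') (J : ℕ) (w : ℕ → G → ℝ≥0∞)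
    {A B : ℝ≥0∞} (hA : ∀ j, ∑' z, w j z ≤ A)
    (hB : ∑ j ∈ Finset.range J, ∑' z, w j z *
      (∑ l ∈ Finset.Ico (j + 1) J, modulus (w l) z) ^ (k - 1) ≤ B) (hAt : A ≠ ∞)
    (g : ℕ → G → ℝ≥0∞) (hg : nrm k (fun x => ∑ j ∈ Finset.range J, g j x) ≠ ∞) :
    nrm k (fun x => ∑ j ∈ Finset.range J, adj (w j) (g j) x) ≤
      (1 + ENNReal.ofReal k * 4 ^ k * (A ^ k + A + B)) *
        nrm k (fun x => ∑ j ∈ Finset.range J, g j x) := by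
  have hk1 : 1 < k := hk.lt
  have hk0 : 0 < k := hk.pos
  set U := nrm k (fun x => ∑ j ∈ Finset.range J, g j x) with hU
  set h : G → ℝ≥0∞ := fun x => ∑ j ∈ Finset.range J, adj (w j) (g j) x with hh
  set H := nrm k h with hH
  set t : ℕ → G → ℝ≥0∞ := fun j x => ∑ l ∈ Finset.Ico (j + 1) J, adj (w l) (g l) x with ht
  have hth : ∀ j x, t j x ≤ h x := fun j x =>
    Finset.sum_le_sum_of_subset fun l hl => by
      simp only [Finset.mem_Ico, Finset.mem_range] at hl ⊢; exact hl.2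
  have hgU : ∀ j ∈ Finset.range J, nrm k (g j) ≤ U := fun j hj =>
    nrm_mono hk0 fun x => Finset.single_le_sum (f := fun j => g j x) (fun _ _ => zero_le) hj
  have hHfin : H ≠ ∞ := by
    have : H ≤ ∑ j ∈ Finset.range J, A * U := by
      refine (nrm_sum_le hk1.le _ _).trans (Finset.sum_le_sum fun j hj => ?_)
      refine (nrm_adj_le hk1.le _ _).trans ?_
      gcongr
      · exact hA j
      · exact hgU j hj
    refine ne_top_of_le_ne_top ?_ this
    rw [Finset.sum_const, nsmul_eq_mul]
    exact ENNReal.mul_ne_top (by simp) (ENNReal.mul_ne_top hAt hg)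
  have e1 : ∀ a : ℝ≥0∞, a * a ^ (k - 1) = a ^ k := fun a => by
    nth_rw 1 [← ENNReal.rpow_one a]
    rw [← ENNReal.rpow_add_of_nonneg _ _ zero_le_one (by linarith)]
    simp
  have hsumk : ∑ j ∈ Finset.range J, nrm k (g j) ^ k ≤ U ^ k := by
    simp_rw [hU, nrm_rpow hk0]
    rw [← Summable.tsum_finsetSum (fun _ _ => ENNReal.summable)]
    refine ENNReal.tsum_le_tsum fun x => ?_
    rw [← e1 (∑ j ∈ Finset.range J, g j x), Finset.sum_mul]
    refine Finset.sum_le_sum fun j hj => ?_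
    rw [← e1]
    gcongr
    · exact Finset.single_le_sum (f := fun j => g j x) (fun _ _ => zero_le) hj
  have hpow : ∀ e : G → ℝ≥0∞, nrm k' (fun x => e x ^ (k - 1)) = nrm k e ^ (k - 1) := fun e => by
    have hk'0 := hk.symm.pos
    have h1 : (k - 1) * k' = k := hk.sub_one_mul_conj
    have h2 : 1 / k' = 1 / k * (k - 1) := by
      field_simp; linarith
    simp only [nrm, ← ENNReal.rpow_mul, h1, h2]
  have hcross : ∀ j ∈ Finset.range J, ∑' x, adj (w j) (g j) x * t j x ^ (k - 1) ≤
      2 ^ (k - 1) * ((A * ∑' x, g j x * h x ^ (k - 1)) + U ^ k * ∑' z, w j z *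
      (∑ l ∈ Finset.Ico (j + 1) J, modulus (w l) z) ^ (k - 1)) := by
    intro j hj
    rw [tsum_adj_mul]
    have hz : ∀ z, ∑' x, g j x * t j (x - z) ^ (k - 1) ≤ 2 ^ (k - 1) *
        (∑' x, g j x * h x ^ (k - 1) +
          U ^ k * (∑ l ∈ Finset.Ico (j + 1) J, modulus (w l) z) ^ (k - 1)) := by
      intro z
      set e : G → ℝ≥0∞ := fun x =>
        ∑ l ∈ Finset.Ico (j + 1) J, adj (fun u => w l (u + z) - w l u) (g l) x with he
      have h1 : ∀ x, t j (x - z) ≤ h x + e x := fun x =>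
        calc t j (x - z) ≤ t j x + e x := by
              simp only [ht, he, ← Finset.sum_add_distrib]
              exact Finset.sum_le_sum fun l _ => adj_sub_le _ _ _ _
          _ ≤ _ := add_le_add_left (hth j x) _
      have h2 : nrm k e ≤ (∑ l ∈ Finset.Ico (j + 1) J, modulus (w l) z) * U := by
        rw [Finset.sum_mul]
        refine (nrm_sum_le hk1.le _ _).trans (Finset.sum_le_sum fun l hl => ?_)
        refine (nrm_adj_le hk1.le _ _).trans ?_
        gcongr
        · exact le_rfl
        · exact hgU l (by simp only [Finset.mem_Ico, Finset.mem_range] at hl ⊢; exact hl.2)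
      have h3 : ∑' x, g j x * e x ^ (k - 1) ≤
          U ^ k * (∑ l ∈ Finset.Ico (j + 1) J, modulus (w l) z) ^ (k - 1) := by
        refine (holder_tsum hk _ _).trans ?_
        rw [hpow]
        calc nrm k (g j) * nrm k e ^ (k - 1) ≤
            U * ((∑ l ∈ Finset.Ico (j + 1) J, modulus (w l) z) * U) ^ (k - 1) := by
              gcongr
              exact hgU j hj
          _ = _ := by
            rw [ENNReal.mul_rpow_of_nonneg _ _ (by linarith), mul_comm (_ ^ _) (U ^ _), ← mul_assoc,
              e1]
      calc ∑' x, g j x * t j (x - z) ^ (k - 1)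
          ≤ ∑' x, 2 ^ (k - 1) * (g j x * h x ^ (k - 1) + g j x * e x ^ (k - 1)) := by
            refine ENNReal.tsum_le_tsum fun x => ?_
            rw [← mul_add, mul_left_comm]
            gcongr
            exact (ENNReal.rpow_le_rpow (h1 x) (by linarith)).trans
              (ENNReal.add_rpow_le_two_mul (by linarith) _ _)
        _ = 2 ^ (k - 1) * (∑' x, g j x * h x ^ (k - 1) + ∑' x, g j x * e x ^ (k - 1)) := by
            rw [ENNReal.tsum_mul_left, ENNReal.tsum_add]
        _ ≤ _ := by gcongr
    calc _ ≤ ∑' z, 2 ^ (k - 1) * (w j z * ∑' x, g j x * h x ^ (k - 1) +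
          U ^ k * (w j z * (∑ l ∈ Finset.Ico (j + 1) J, modulus (w l) z) ^ (k - 1))) := by
            refine ENNReal.tsum_le_tsum fun z => ?_
            refine (mul_le_mul_right (hz z) _).trans (le_of_eq ?_)
            ring
      _ = 2 ^ (k - 1) * ((∑' z, w j z) * (∑' x, g j x * h x ^ (k - 1)) +
          U ^ k * ∑' z, w j z * (∑ l ∈ Finset.Ico (j + 1) J, modulus (w l) z) ^ (k - 1)) := by
            rw [ENNReal.tsum_mul_left, ENNReal.tsum_add, ENNReal.tsum_mul_left,
              ENNReal.tsum_mul_right]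
      _ ≤ _ := by gcongr; exact hA j
  have hmain : H ^ k ≤ ENNReal.ofReal k * 4 ^ k * ((A ^ k + B) * U ^ k + A * (U * H ^ (k - 1))) := by
    have e2 : (2 : ℝ≥0∞) ^ (k - 1) ≤ 2 ^ k :=
      ENNReal.rpow_le_rpow_of_exponent_le (by norm_num) (by linarith)
    have e3 : (1 : ℝ≥0∞) ≤ 2 ^ k := ENNReal.one_le_rpow (by norm_num) hk0
    have e4 : (4 : ℝ≥0∞) ^ k = 2 ^ k * 2 ^ k := by
      rw [← ENNReal.mul_rpow_of_nonneg _ _ hk0.le]; norm_num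
    have h1 : H ^ k ≤ ∑ j ∈ Finset.range J, ENNReal.ofReal k * (2 ^ (k - 1) *
        (∑' x, adj (w j) (g j) x ^ k + ∑' x, adj (w j) (g j) x * t j x ^ (k - 1))) := by
      rw [hH, nrm_rpow hk0]
      simp_rw [← ENNReal.tsum_add, ← ENNReal.tsum_mul_left]
      rw [← Summable.tsum_finsetSum (fun _ _ => ENNReal.summable)]
      refine ENNReal.tsum_le_tsum fun x => ?_
      refine (tail_rpow_le hk1.le J _).trans (Finset.sum_le_sum fun j _ => ?_)
      rw [mul_assoc]
      refine mul_le_mul_right ?_ _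
      rw [← e1, ← mul_add, mul_left_comm]
      exact mul_le_mul_right (ENNReal.add_rpow_le_two_mul (by linarith) _ _) _
    have h2 : ∑ j ∈ Finset.range J, ∑' x, adj (w j) (g j) x ^ k ≤ A ^ k * U ^ k := by
      calc _ ≤ ∑ j ∈ Finset.range J, A ^ k * nrm k (g j) ^ k := by
            refine Finset.sum_le_sum fun j _ => ?_
            rw [← nrm_rpow hk0, ← ENNReal.mul_rpow_of_nonneg _ _ hk0.le]
            gcongr
            exact (nrm_adj_le hk1.le _ _).trans (by gcongr; exact hA j)
        _ ≤ _ := by rw [← Finset.mul_sum]; gcongr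
    have h3 : ∑ j ∈ Finset.range J, ∑' x, g j x * h x ^ (k - 1) ≤ U * H ^ (k - 1) := by
      rw [← Summable.tsum_finsetSum (fun _ _ => ENNReal.summable)]
      simp_rw [← Finset.sum_mul]
      refine (holder_tsum hk _ _).trans ?_
      rw [hpow]
    have h4 : ∑ j ∈ Finset.range J, ∑' x, adj (w j) (g j) x * t j x ^ (k - 1) ≤
        2 ^ k * (A * (U * H ^ (k - 1)) + U ^ k * B) := by
      refine (Finset.sum_le_sum hcross).trans ?_
      rw [← Finset.mul_sum, Finset.sum_add_distrib, ← Finset.mul_sum, ← Finset.mul_sum]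
      gcongr
    refine h1.trans ?_
    rw [← Finset.mul_sum, ← Finset.mul_sum, Finset.sum_add_distrib, mul_assoc, e4, mul_assoc]
    gcongr
    calc _ ≤ 2 ^ k * (A ^ k * U ^ k) + 2 ^ k * (A * (U * H ^ (k - 1)) + U ^ k * B) := by
          gcongr
          exact h2.trans (le_mul_of_one_le_left' e3)
      _ = _ := by ring
  rcases le_total H U with hHU | hHU
  · exact hHU.trans (le_mul_of_one_le_left' le_self_add)
  by_cases hH0 : H = 0
  · rw [hH0]; exact zero_le
  have hUk : U ^ k ≤ U * H ^ (k - 1) := by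
    rw [← e1]; gcongr
  have hfin : H * H ^ (k - 1) ≤ (ENNReal.ofReal k * 4 ^ k * (A ^ k + A + B) * U) * H ^ (k - 1) := by
    rw [e1]
    refine hmain.trans ?_
    calc _ ≤ ENNReal.ofReal k * 4 ^ k * ((A ^ k + B) * (U * H ^ (k - 1)) +
          A * (U * H ^ (k - 1))) := by gcongr
      _ = _ := by ring
  have hne : H ^ (k - 1) ≠ 0 := by
    simp [ENNReal.rpow_eq_zero_iff, hH0, hHfin]
  have hnt : H ^ (k - 1) ≠ ∞ := ENNReal.rpow_ne_top_of_nonneg (by linarith) hHfin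
  have := (ENNReal.mul_le_mul_iff_left hne hnt).1 hfin
  refine this.trans ?_
  gcongr
  exact le_add_self

/-- The superlacunary maximal inequality. -/
lemma superlacunary_maximal {k p : ℝ} (hk : k.HolderConjugate p) (J : ℕ) (w : ℕ → G → ℝ≥0∞)
    {A B : ℝ≥0∞} (hA : ∀ j, ∑' z, w j z ≤ A)
    (hB : ∑ j ∈ Finset.range J, ∑' z, w j z *
      (∑ l ∈ Finset.Ico (j + 1) J, modulus (w l) z) ^ (k - 1) ≤ B) (hAt : A ≠ ∞)
    (F : G → ℝ≥0∞) :
    nrm p (fun x => (Finset.range J).sup fun j => cv (w j) F x) ≤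
      (1 + ENNReal.ofReal k * 4 ^ k * (A ^ k + A + B)) * nrm p F := by
  have hp1 : 1 < p := hk.symm.lt
  have hp0 : 0 < p := hk.symm.pos
  have hk0 : 0 < k := hk.pos
  set C := 1 + ENNReal.ofReal k * 4 ^ k * (A ^ k + A + B) with hC
  have hC0 : C ≠ 0 := by simp [hC]
  by_cases hF : nrm p F = ∞
  · rw [hF, ENNReal.mul_top hC0]; exact le_top
  set Φ : G → ℝ≥0∞ := fun x => (Finset.range J).sup fun j => cv (w j) F x with hΦ
  have hfin : ∀ j x, cv (w j) F x ≠ ∞ := by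
    intro j x
    have h1 : cv (w j) F x ≤ A * nrm p F := by
      unfold cv
      calc _ ≤ ∑' y, w j y * nrm p F := by
            refine ENNReal.tsum_le_tsum fun y => ?_
            gcongr
            exact le_nrm hp0 F _
        _ ≤ _ := by rw [ENNReal.tsum_mul_right]; gcongr; exact hA j
    exact ne_top_of_le_ne_top (ENNReal.mul_ne_top hAt hF) h1
  rcases Nat.eq_zero_or_pos J with rfl | hJ
  · have : Φ = fun _ => 0 := by ext x; simp [hΦ]
    rw [this, nrm_zero hp0]; exact zero_le
  have hmax : ∀ x, ∃ j ∈ Finset.range J, Φ x = cv (w j) F x := fun x =>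
    Finset.exists_mem_eq_sup _ ⟨0, by simpa using hJ⟩ _
  choose m hmJ hm using hmax
  have hΦfin : ∀ x, Φ x ≠ ∞ := fun x => by rw [hm x]; exact hfin _ _
  refine nrm_le_of_finset hp0 fun s => ?_
  set S := ∑ x ∈ s, Φ x ^ p with hS
  have hSfin : S ≠ ∞ := ENNReal.sum_ne_top.2 fun x _ => ENNReal.rpow_ne_top_of_nonneg hp0.le (hΦfin x)
  by_cases hS0 : S = 0
  · rw [hS0]; exact zero_le
  classical
  set g : ℕ → G → ℝ≥0∞ := fun j x => if x ∈ s ∧ m x = j then Φ x ^ (p - 1) else 0 with hg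
  have hgsum : ∀ x, ∑ j ∈ Finset.range J, g j x = if x ∈ s then Φ x ^ (p - 1) else 0 := by
    intro x
    rw [Finset.sum_eq_single (m x)]
    · simp [hg]
    · intro j _ hj; simp [hg, hj.symm]
    · intro h; exact absurd (hmJ x) h
  have e1 : ∀ a : ℝ≥0∞, a ^ (p - 1) * a = a ^ p := fun a => by
    nth_rw 2 [← ENNReal.rpow_one a]
    rw [← ENNReal.rpow_add_of_nonneg _ _ (by linarith) zero_le_one]
    simp
  have hU : nrm k (fun x => ∑ j ∈ Finset.range J, g j x) = S ^ (1 / k) := by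
    simp_rw [hgsum]
    unfold nrm
    congr 1
    rw [tsum_eq_sum (s := s)]
    · refine Finset.sum_congr rfl fun x hx => ?_
      simp only [if_pos hx]
      rw [← ENNReal.rpow_mul, hk.symm.sub_one_mul_conj]
    · intro x hx; simp [hx, hk0]
  have hSsum : S = ∑' y, (∑ j ∈ Finset.range J, adj (w j) (g j) y) * F y := by
    simp_rw [Finset.sum_mul]
    rw [Summable.tsum_finsetSum (fun _ _ => ENNReal.summable)]
    simp_rw [tsum_adj_mul]
    have : ∀ j, ∑' z, w j z * ∑' x, g j x * F (x - z) = ∑' x, g j x * cv (w j) F x := by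
      intro j
      unfold cv
      simp_rw [← ENNReal.tsum_mul_left]
      rw [ENNReal.tsum_comm]
      congr 1; ext x; congr 1; ext z; ring
    simp_rw [this]
    rw [← Summable.tsum_finsetSum (fun _ _ => ENNReal.summable), tsum_eq_sum (s := s)]
    · refine Finset.sum_congr rfl fun x hx => ?_
      rw [Finset.sum_eq_single (m x)]
      · simp only [hg, hx, and_self, if_true]
        rw [← hm x, e1]
      · intro j _ hj; simp [hg, hj.symm]
      · intro h; exact absurd (hmJ x) h
    · intro x hx; simp [hg, hx]
  have hdual := superlacunary_dual hk J w hA hB hAt g (by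
    rw [hU]; exact ENNReal.rpow_ne_top_of_nonneg (by positivity) hSfin)
  have hle : S ≤ C * S ^ (1 / k) * nrm p F := by
    conv_lhs => rw [hSsum]
    refine (holder_tsum hk _ _).trans ?_
    rw [hU] at hdual
    gcongr
  have hexp : 1 / k + 1 / p = 1 := by
    have := hk.inv_add_inv_eq_one; simpa using this
  have hle2 : S ^ (1 / k) * S ^ (1 / p) ≤ S ^ (1 / k) * (C * nrm p F) := by
    rw [← ENNReal.rpow_add _ _ hS0 hSfin, hexp, ENNReal.rpow_one]
    exact hle.trans (le_of_eq (by ring))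
  have hle3 : S ^ (1 / p) ≤ C * nrm p F := by
    refine (ENNReal.mul_le_mul_iff_right ?_ ?_).1 hle2
    · simp [ENNReal.rpow_eq_zero_iff, hS0, hSfin]
    · exact ENNReal.rpow_ne_top_of_nonneg (by positivity) hSfin
  calc S = (S ^ (1 / p)) ^ p := by
        rw [← ENNReal.rpow_mul, one_div_mul_cancel hp0.ne', ENNReal.rpow_one]
    _ ≤ _ := by gcongr

end Superlacunary

section DivisorBounds

lemma exists_card_divisors_le {ε : ℝ} (hε : 0 < ε) :
    ∃ C : ℝ, 1 ≤ C ∧ ∀ q : ℕ, q ≠ 0 → (q.divisors.card : ℝ) ≤ C * (q : ℝ) ^ ε := by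
  set P : ℕ := ⌈(2 : ℝ) ^ (1 / ε)⌉₊ with hP
  set D : ℝ := 1 + 1 / (ε * Real.log 2) with hD
  have hl2 : 0 < Real.log 2 := Real.log_pos (by norm_num)
  have hD1 : 1 ≤ D := by rw [hD]; have : 0 < 1 / (ε * Real.log 2) := by positivity
                         linarith
  refine ⟨D ^ P, one_le_pow₀ hD1, fun q hq => ?_⟩
  have h1 : ∀ p ∈ q.primeFactors, ((q.factorization p + 1 : ℕ) : ℝ) ≤
      (if p < P then D else 1) * ((p : ℝ) ^ (q.factorization p)) ^ ε := by
    intro p hp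
    have hpp := Nat.prime_of_mem_primeFactors hp
    have hp0 : (0 : ℝ) < p := by exact_mod_cast hpp.pos
    set v := q.factorization p
    have hpv : ((p : ℝ) ^ v) ^ ε = ((p : ℝ) ^ ε) ^ v := by
      rw [← Real.rpow_natCast, ← Real.rpow_mul hp0.le, mul_comm, Real.rpow_mul hp0.le,
        Real.rpow_natCast]
    rw [hpv]
    split_ifs with h
    · have h2 : (2 : ℝ) ^ ε ≤ (p : ℝ) ^ ε := by
        gcongr; exact_mod_cast hpp.two_le
      have h3 : 1 + (v : ℝ) * (ε * Real.log 2) ≤ ((2 : ℝ) ^ ε) ^ v := by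
        rw [Real.rpow_def_of_pos (by norm_num), ← Real.exp_nat_mul]
        have := Real.add_one_le_exp ((v : ℝ) * (Real.log 2 * ε))
        linarith
      have h4 : ((2 : ℝ) ^ ε) ^ v ≤ ((p : ℝ) ^ ε) ^ v := by gcongr
      calc ((v + 1 : ℕ) : ℝ) ≤ D * (1 + (v : ℝ) * (ε * Real.log 2)) := by
            rw [hD]; push_cast
            have : (1 + 1 / (ε * Real.log 2)) * (1 + (v : ℝ) * (ε * Real.log 2)) =
              1 + v + (v : ℝ) * (ε * Real.log 2) + 1 / (ε * Real.log 2) := by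
              field_simp; ring
            rw [this]
            have : 0 ≤ (v : ℝ) * (ε * Real.log 2) := by positivity
            have : 0 < 1 / (ε * Real.log 2) := by positivity
            linarith
        _ ≤ _ := by gcongr; linarith
    · have h2 : (2 : ℝ) ≤ (p : ℝ) ^ ε := by
        have : (2 : ℝ) ^ (1 / ε) ≤ p := (Nat.le_ceil _).trans (by exact_mod_cast not_lt.1 h)
        calc (2 : ℝ) = ((2 : ℝ) ^ (1 / ε)) ^ ε := by
              rw [← Real.rpow_mul (by norm_num), one_div_mul_cancel hε.ne', Real.rpow_one]
          _ ≤ _ := by gcongr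
      rw [one_mul]
      calc ((v + 1 : ℕ) : ℝ) ≤ 2 ^ v := by exact_mod_cast Nat.lt_two_pow_self
        _ ≤ _ := by gcongr
  rw [Nat.card_divisors hq]
  push_cast
  have h2 : (q : ℝ) ^ ε = ∏ p ∈ q.primeFactors, ((p : ℝ) ^ (q.factorization p)) ^ ε := by
    rw [Real.finsetProd_rpow _ _ (fun p _ => by positivity)]
    congr 1
    conv_lhs => rw [← Nat.prod_factorization_pow_eq_self hq]
    rw [Finsupp.prod]; push_cast; rfl
  calc ∏ p ∈ q.primeFactors, ((q.factorization p : ℝ) + 1)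
      ≤ ∏ p ∈ q.primeFactors,
        ((if p < P then D else 1) * ((p : ℝ) ^ (q.factorization p)) ^ ε) := by
        refine Finset.prod_le_prod (fun _ _ => by positivity) fun p hp => ?_
        exact_mod_cast h1 p hp
    _ = (∏ p ∈ q.primeFactors, (if p < P then D else 1)) * (q : ℝ) ^ ε := by
        rw [Finset.prod_mul_distrib, h2]
    _ ≤ D ^ P * (q : ℝ) ^ ε := by
        gcongr
        rw [Finset.prod_ite, Finset.prod_const, Finset.prod_const_one, mul_one]
        refine pow_le_pow_right₀ hD1 ?_
        calc _ ≤ (Finset.range P).card := Finset.card_le_card fun p hp => by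
              simp only [Finset.mem_filter, Finset.mem_range] at hp ⊢; exact hp.2
          _ = P := Finset.card_range P

lemma card_dvd_val (q e : ℕ) [NeZero q] (he : e ∣ q) :
    (Finset.univ.filter fun x : ZMod q => e ∣ x.val).card = q / e := by
  have h : (Finset.univ.filter fun x : ZMod q => e ∣ x.val).card =
      ((Finset.range q).filter fun x => e ∣ x).card := by
    refine Finset.card_bij (fun x _ => x.val) ?_ ?_ ?_
    · intro x hx; simp only [Finset.mem_filter, Finset.mem_univ, true_and, Finset.mem_range] at hx ⊢
      exact ⟨ZMod.val_lt x, hx⟩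
    · intro x _ y _ h; exact ZMod.val_injective q h
    · intro m hm
      simp only [Finset.mem_filter, Finset.mem_range] at hm
      refine ⟨(m : ZMod q), ?_, ZMod.val_natCast_of_lt hm.1⟩
      simp [ZMod.val_natCast_of_lt hm.1, hm.2]
  rw [h]
  have he0 : 0 < e := Nat.pos_of_dvd_of_pos he (NeZero.pos q)
  obtain ⟨m, rfl⟩ := he
  rw [Nat.mul_div_cancel_left _ he0]
  have h2 : ((Finset.range (e * m)).filter fun x => e ∣ x) = (Finset.range m).image (e * ·) := by
    ext x; simp only [Finset.mem_filter, Finset.mem_range, Finset.mem_image]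
    constructor
    · rintro ⟨h1, y, rfl⟩; exact ⟨y, Nat.lt_of_mul_lt_mul_left h1, rfl⟩
    · rintro ⟨y, hy, rfl⟩; exact ⟨Nat.mul_lt_mul_of_pos_left hy he0, dvd_mul_right _ _⟩
  rw [h2, Finset.card_image_of_injective _ (fun a b h => Nat.eq_of_mul_eq_mul_left he0 h), Finset.card_range]

/-- Sums of a nonnegative function of `gcd(x, q)`. -/
lemma sum_gcd_le (q : ℕ) [NeZero q] (F : ℕ → ℝ) (hF : ∀ e, 0 ≤ F e) :
    ∑ x : ZMod q, F (Nat.gcd x.val q) ≤ ∑ e ∈ q.divisors, F e * ((q : ℝ) / e) := by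
  have hq := NeZero.ne q
  have h1 : ∀ x : ZMod q, F (Nat.gcd x.val q) ≤
      ∑ e ∈ q.divisors, if e ∣ x.val then F e else 0 := by
    intro x
    have hm : Nat.gcd x.val q ∈ q.divisors :=
      Nat.mem_divisors.2 ⟨Nat.gcd_dvd_right _ _, hq⟩
    refine le_trans ?_ (Finset.single_le_sum (f := fun e => if e ∣ x.val then F e else 0)
      (fun e _ => by split_ifs; exacts [hF e, le_rfl]) hm)
    simp [Nat.gcd_dvd_left]
  refine (Finset.sum_le_sum fun x _ => h1 x).trans ?_
  rw [Finset.sum_comm]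
  refine Finset.sum_le_sum fun e he => ?_
  rw [← Finset.sum_filter, Finset.sum_const, card_dvd_val q e (Nat.dvd_of_mem_divisors he),
    nsmul_eq_mul, mul_comm, Nat.cast_div_charZero (Nat.dvd_of_mem_divisors he)]

end DivisorBounds

section GaussSums

variable {q : ℕ} [NeZero q]

/-- The quadratic Gauss sum with a linear term. -/
def gs (u b : ZMod q) : ℂ := ∑ x : ZMod q, ZMod.stdAddChar (u * x ^ 2 + b * x)

/-- The Ramanujan sum as a function on `ℤ/q`. -/
def rs (h : ZMod q) : ℂ := ∑ u : (ZMod q)ˣ, ZMod.stdAddChar ((u : ZMod q) * h)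

/-- The Fourier coefficients of the arithmetic factor, up to normalisation. -/
def tq {d : ℕ} (n : ZMod q) (b : Fin d → ZMod q) : ℂ :=
  ∑ u : (ZMod q)ˣ, ZMod.stdAddChar (-((u : ZMod q) * n)) * ∏ i, gs (u : ZMod q) (b i)

lemma norm_stdAddChar (x : ZMod q) : ‖(ZMod.stdAddChar x : ℂ)‖ = 1 := by
  rw [ZMod.stdAddChar_apply]; exact Circle.norm_coe _

lemma star_stdAddChar (x : ZMod q) :
    (starRingEnd ℂ) (ZMod.stdAddChar x) = ZMod.stdAddChar (-x) := by
  rw [ZMod.stdAddChar_apply, ZMod.stdAddChar_apply, AddChar.map_neg_eq_inv, Circle.coe_inv_eq_conj]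

lemma sum_stdAddChar_mul (b : ZMod q) :
    ∑ x : ZMod q, (ZMod.stdAddChar (x * b) : ℂ) = if b = 0 then (q : ℂ) else 0 := by
  have := AddChar.sum_mulShift b (ZMod.isPrimitive_stdAddChar q)
  simpa [ZMod.card] using this

lemma card_two_mul_mul_eq_zero_le (u : ZMod q) :
    (Finset.univ.filter fun z : ZMod q => 2 * u * z = 0).card ≤ 2 * Nat.gcd u.val q := by
  set g := Nat.gcd u.val q with hg
  have hg0 : 0 < g := Nat.gcd_pos_of_pos_right _ (NeZero.pos q)
  have hsub : (Finset.univ.filter fun z : ZMod q => 2 * u * z = 0) ⊆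
      Finset.univ.filter fun z : ZMod q => (2 * g) • z = 0 := by
    intro z hz
    simp only [Finset.mem_filter, Finset.mem_univ, true_and] at hz ⊢
    have hb := Nat.gcd_eq_gcd_ab u.val q
    have h2 : ((g : ℤ) : ZMod q) = u * (Nat.gcdA u.val q : ZMod q) := by
      rw [hg, hb]; push_cast; simp
    have h3 : (g : ZMod q) = u * (Nat.gcdA u.val q : ZMod q) := by exact_mod_cast h2
    rw [nsmul_eq_mul]; push_cast
    rw [h3]
    linear_combination (Nat.gcdA u.val q : ZMod q) * hz
  exact (Finset.card_le_card hsub).trans (IsAddCyclic.card_nsmul_eq_zero_le (by positivity))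

lemma gs_norm_sq_le (u b : ZMod q) : ‖gs u b‖ ^ 2 ≤ q * (2 * Nat.gcd u.val q) := by
  have h1 : gs u b * (starRingEnd ℂ) (gs u b) =
      ∑ z : ZMod q, if 2 * u * z = 0 then (q : ℂ) * ZMod.stdAddChar (u * z ^ 2 + b * z) else 0 := by
    unfold gs
    rw [map_sum, Finset.sum_mul_sum, Finset.sum_comm]
    simp_rw [star_stdAddChar, ← AddChar.map_add_eq_mul]
    have : ∀ y : ZMod q, ∑ x : ZMod q, (ZMod.stdAddChar (u * x ^ 2 + b * x + -(u * y ^ 2 + b * y)) : ℂ)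
        = ∑ z : ZMod q, ZMod.stdAddChar (u * z ^ 2 + b * z) * ZMod.stdAddChar (y * (2 * u * z)) := by
      intro y
      rw [← Equiv.sum_comp (Equiv.addRight y) (fun x : ZMod q => (ZMod.stdAddChar (u * x ^ 2 + b * x + -(u * y ^ 2 + b * y)) : ℂ))]
      refine Finset.sum_congr rfl fun z _ => ?_
      rw [← AddChar.map_add_eq_mul]
      congr 1
      simp only [Equiv.coe_addRight]; ring
    simp_rw [this]
    rw [Finset.sum_comm]
    refine Finset.sum_congr rfl fun z _ => ?_
    rw [← Finset.mul_sum, sum_stdAddChar_mul]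
    split_ifs
    · ring
    · simp
  have h2 : (‖gs u b‖ ^ 2 : ℝ) = ‖gs u b * (starRingEnd ℂ) (gs u b)‖ := by
    rw [norm_mul, RCLike.norm_conj, sq]
  rw [h2, h1]
  refine (norm_sum_le _ _).trans ?_
  calc _ ≤ ∑ z : ZMod q, if 2 * u * z = 0 then (q : ℝ) else 0 := by
        refine Finset.sum_le_sum fun z _ => ?_
        split_ifs
        · rw [norm_mul, norm_stdAddChar]; simp
        · simp
    _ = q * (Finset.univ.filter fun z : ZMod q => 2 * u * z = 0).card := by
        rw [← Finset.sum_filter, Finset.sum_const, nsmul_eq_mul, mul_comm]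
    _ ≤ _ := by gcongr; exact_mod_cast card_two_mul_mul_eq_zero_le u

lemma gs_unit_norm_le (u : (ZMod q)ˣ) (b : ZMod q) : ‖gs (u : ZMod q) b‖ ≤ (2 * q : ℝ) ^ (1 / 2 : ℝ) := by
  have h := gs_norm_sq_le (u : ZMod q) b
  rw [Nat.Coprime.gcd_eq_one (ZMod.val_coe_unit_coprime u)] at h
  rw [← Real.sqrt_eq_rpow]
  exact Real.le_sqrt_of_sq_le (by push_cast at h; linarith)

lemma norm_tq_le {d : ℕ} (n : ZMod q) (b : Fin d → ZMod q) :
    ‖tq n b‖ ≤ q * (2 * q : ℝ) ^ ((d : ℝ) / 2) := by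
  unfold tq
  refine (norm_sum_le _ _).trans ?_
  calc _ ≤ ∑ u : (ZMod q)ˣ, (2 * q : ℝ) ^ ((d : ℝ) / 2) := by
        refine Finset.sum_le_sum fun u _ => ?_
        rw [norm_mul, norm_stdAddChar, one_mul, norm_prod]
        calc _ ≤ ∏ i : Fin d, (2 * q : ℝ) ^ (1 / 2 : ℝ) :=
              Finset.prod_le_prod (fun _ _ => norm_nonneg _) fun i _ => gs_unit_norm_le u (b i)
          _ = _ := by
              rw [Finset.prod_const, Finset.card_univ, Fintype.card_fin, ← Real.rpow_natCast,
                ← Real.rpow_mul (by positivity)]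
              congr 1; ring
    _ ≤ _ := by
        rw [Finset.sum_const, nsmul_eq_mul, Finset.card_univ, ZMod.card_units_eq_totient]
        gcongr
        exact Nat.totient_le q

lemma stdAddChar_sq_eq (u x : ZMod q) :
    (ZMod.stdAddChar (u * x ^ 2) : ℂ) = (q : ℂ)⁻¹ * ∑ b : ZMod q, gs u b * ZMod.stdAddChar (-(b * x)) := by
  have hq : (q : ℂ) ≠ 0 := by exact_mod_cast NeZero.ne q
  unfold gs
  simp_rw [Finset.sum_mul, ← AddChar.map_add_eq_mul]
  rw [Finset.sum_comm]
  have : ∀ y : ZMod q, ∑ b : ZMod q, (ZMod.stdAddChar (u * y ^ 2 + b * y + -(b * x)) : ℂ) =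
      if y = x then (q : ℂ) * ZMod.stdAddChar (u * x ^ 2) else 0 := by
    intro y
    have e : ∀ b : ZMod q, u * y ^ 2 + b * y + -(b * x) = u * y ^ 2 + b * (y - x) := fun b => by ring
    simp_rw [e, AddChar.map_add_eq_mul, ← Finset.mul_sum, sum_stdAddChar_mul, sub_eq_zero]
    split_ifs with h
    · rw [h]; ring
    · simp
  simp_rw [this]
  simp [hq]

lemma AddChar.map_finset_sum_eq_prod {A M ι : Type*} [AddCommMonoid A] [CommMonoid M]
    (ψ : AddChar A M) (s : Finset ι) (f : ι → A) : ψ (∑ i ∈ s, f i) = ∏ i ∈ s, ψ (f i) := by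
  classical
  induction s using Finset.induction_on with
  | empty => simp
  | insert a s ha ih => rw [Finset.sum_insert ha, Finset.prod_insert ha, AddChar.map_add_eq_mul, ih]

/-- Fourier expansion of the arithmetic factor. -/
lemma rs_sum_sq_eq {d : ℕ} (n : ZMod q) (x : Fin d → ZMod q) :
    rs (∑ i, x i ^ 2 - n) = ∑ b : Fin d → ZMod q,
      ((q : ℂ)⁻¹ ^ d * tq n b) * ZMod.stdAddChar (-∑ i, b i * x i) := by
  unfold rs tq
  simp_rw [Finset.mul_sum, Finset.sum_mul]
  rw [Finset.sum_comm]
  refine Finset.sum_congr rfl fun u _ => ?_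
  have e1 : (u : ZMod q) * (∑ i, x i ^ 2 - n) = -((u : ZMod q) * n) + ∑ i, (u : ZMod q) * x i ^ 2 := by
    rw [mul_sub, Finset.mul_sum]; ring
  rw [e1, AddChar.map_add_eq_mul, AddChar.map_finset_sum_eq_prod]
  simp_rw [stdAddChar_sq_eq]
  rw [Finset.prod_mul_distrib, Finset.prod_univ_sum, Finset.prod_const, Finset.card_univ,
    Fintype.card_fin, Finset.mul_sum, Finset.mul_sum, Fintype.piFinset_univ]
  refine Finset.sum_congr rfl fun b _ => ?_
  rw [Finset.prod_mul_distrib, ← AddChar.map_finset_sum_eq_prod, Finset.sum_neg_distrib]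
  ring

end GaussSums

section Ramanujan

lemma eC_eq_stdAddChar (q : ℕ) [NeZero q] (m : ℤ) :
    eC ((m : ℝ) / q) = ZMod.stdAddChar (m : ZMod q) := by
  rw [ZMod.stdAddChar_coe, eC]
  push_cast
  congr 1; ring

lemma ramanujanSum_eq_range (q : ℕ) (h : ℤ) :
    ramanujanSum q h = ∑ a ∈ (Finset.range q).filter (fun a => q.Coprime a),
      eC ((a : ℝ) * h / q) := by
  rw [ramanujanSum, Finset.sum_filter,
    Finset.sum_range (fun u => if q.Coprime u then eC ((u : ℝ) * h / q) else 0)]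
  refine Finset.sum_congr rfl fun u _ => ?_
  simp only [Nat.coprime_comm]

lemma ramanujanSum_eq_rs (q : ℕ) [NeZero q] (h : ℤ) : ramanujanSum q h = rs (h : ZMod q) := by
  rw [ramanujanSum_eq_range, rs]
  symm
  refine Finset.sum_bij (fun u _ => (u : ZMod q).val) ?_ ?_ ?_ ?_
  · intro u _
    simp only [Finset.mem_filter, Finset.mem_range]
    exact ⟨ZMod.val_lt _, (ZMod.val_coe_unit_coprime u).symm⟩
  · intro u _ v _ huv
    exact Units.ext (ZMod.val_injective q huv)
  · intro a ha
    simp only [Finset.mem_filter, Finset.mem_range] at ha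
    refine ⟨ZMod.unitOfCoprime a ha.2.symm, Finset.mem_univ _, ?_⟩
    rw [ZMod.coe_unitOfCoprime, ZMod.val_natCast_of_lt ha.1]
  · intro u _
    have := eC_eq_stdAddChar q ((u : ZMod q).val * h)
    push_cast at this
    rw [this]
    simp

lemma norm_eC (t : ℝ) : ‖eC t‖ = 1 := by
  rw [eC, show 2 * (Real.pi : ℂ) * Complex.I * (t : ℂ) = ((2 * Real.pi * t : ℝ) : ℂ) * Complex.I by
    push_cast; ring, Complex.norm_exp_ofReal_mul_I]

lemma norm_ramanujanSum_le (q : ℕ) (h : ℤ) : ‖ramanujanSum q h‖ ≤ q := by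
  rw [ramanujanSum_eq_range]
  refine (norm_sum_le _ _).trans ?_
  simp_rw [norm_eC]
  rw [Finset.sum_const, nsmul_eq_mul, mul_one]
  exact_mod_cast (Finset.card_filter_le _ _).trans (Finset.card_range q).le

lemma sum_ramanujanSum (D : ℕ) (hD : D ≠ 0) (h : ℤ) :
    ∑ q ∈ D.divisors, ramanujanSum q h = if (D : ℤ) ∣ h then (D : ℂ) else 0 := by
  have : NeZero D := ⟨hD⟩
  have h1 : ∑ a ∈ Finset.range D, eC ((a : ℝ) * h / D) = if (D : ℤ) ∣ h then (D : ℂ) else 0 := by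
    have := sum_stdAddChar_mul (q := D) (h : ZMod D)
    simp only [ZMod.intCast_zmod_eq_zero_iff_dvd] at this
    rw [← this]
    refine Finset.sum_bij (fun a _ => (a : ZMod D)) (fun _ _ => Finset.mem_univ _) ?_ ?_ ?_
    · intro a ha b hb hab
      simp only [Finset.mem_range] at ha hb
      have := congrArg ZMod.val hab
      rwa [ZMod.val_natCast_of_lt ha, ZMod.val_natCast_of_lt hb] at this
    · intro b _
      exact ⟨b.val, by simpa using ZMod.val_lt b, by simp⟩
    · intro a _
      have := eC_eq_stdAddChar D (a * h)
      push_cast at this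
      rw [this]
  rw [← h1, ← Finset.sum_fiberwise_of_maps_to (s := Finset.range D) (t := D.divisors)
    (g := fun a => D / Nat.gcd D a)
    (fun a _ => Nat.mem_divisors.2 ⟨Nat.div_dvd_of_dvd (Nat.gcd_dvd_left D a), hD⟩)]
  refine Finset.sum_congr rfl fun q hq => ?_
  rw [ramanujanSum_eq_range]
  have hqD := Nat.dvd_of_mem_divisors hq
  obtain ⟨m, rfl⟩ := hqD
  have hq0 : q ≠ 0 := by rintro rfl; simp at hD
  have hm0 : m ≠ 0 := by rintro rfl; simp at hD
  refine Finset.sum_bij (fun a _ => m * a) ?_ ?_ ?_ ?_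
  · intro a ha
    simp only [Finset.mem_filter, Finset.mem_range] at ha ⊢
    refine ⟨by rw [mul_comm q]; exact Nat.mul_lt_mul_of_pos_left ha.1 (Nat.pos_of_ne_zero hm0), ?_⟩
    rw [mul_comm q, Nat.gcd_mul_left, ha.2.gcd_eq_one, mul_one,
      Nat.mul_div_cancel_left _ (Nat.pos_of_ne_zero hm0)]
  · intro a _ b _ hab; exact Nat.eq_of_mul_eq_mul_left (Nat.pos_of_ne_zero hm0) hab
  · intro a ha
    simp only [Finset.mem_filter, Finset.mem_range] at ha
    have hg : Nat.gcd (q * m) a = m := by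
      have h2 := Nat.div_mul_cancel (Nat.gcd_dvd_left (q * m) a)
      rw [ha.2] at h2
      exact Nat.eq_of_mul_eq_mul_left (Nat.pos_of_ne_zero hq0) h2
    obtain ⟨c, hc⟩ : m ∣ a := hg ▸ Nat.gcd_dvd_right (q * m) a
    subst hc
    refine ⟨c, ?_, rfl⟩
    simp only [Finset.mem_filter, Finset.mem_range]
    constructor
    · have := ha.1; rw [mul_comm q] at this; exact Nat.lt_of_mul_lt_mul_left this
    · rw [mul_comm q, Nat.gcd_mul_left] at hg
      exact Nat.eq_of_mul_eq_mul_left (Nat.pos_of_ne_zero hm0) (by rw [hg, mul_one])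
  · intro a _
    congr 1
    have : (m : ℝ) ≠ 0 := by exact_mod_cast hm0
    have : (q : ℝ) ≠ 0 := by exact_mod_cast hq0
    push_cast; field_simp

lemma norm_ramanujanSum_le_sum (q : ℕ) (hq : q ≠ 0) (h : ℤ) :
    ‖ramanujanSum q h‖ ≤ ∑ e ∈ q.divisors, if (e : ℤ) ∣ h then (e : ℝ) else 0 := by
  have key := (ArithmeticFunction.sum_eq_iff_sum_mul_moebius_eq (R := ℂ)
    (f := fun q => ramanujanSum q h) (g := fun D => if (D : ℤ) ∣ h then (D : ℂ) else 0)).1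
    (fun D hD => sum_ramanujanSum D hD.ne' h) q (Nat.pos_of_ne_zero hq)
  rw [← key]
  refine (norm_sum_le _ _).trans ?_
  rw [← Nat.sum_divisorsAntidiagonal' (f := fun _ e => if (e : ℤ) ∣ h then (e : ℝ) else 0)]
  refine Finset.sum_le_sum fun x _ => ?_
  have hmu : ‖((ArithmeticFunction.moebius x.1 : ℤ) : ℂ)‖ ≤ 1 := by
    rw [Complex.norm_intCast]
    exact_mod_cast ArithmeticFunction.abs_moebius_le_one
  rw [norm_mul]
  split_ifs
  · rw [Complex.norm_natCast]
    exact mul_le_of_le_one_left (Nat.cast_nonneg _) hmu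
  · simp

end Ramanujan

section CongruenceCount

/-- The number of solutions of `|a|² = n` in `(ℤ/e)^d`. -/
def sqCount (d e : ℕ) [NeZero e] (n : ZMod e) : ℕ :=
  (Finset.univ.filter fun a : Fin d → ZMod e => ∑ i, a i ^ 2 = n).card

lemma sqCount_mul_eq (d e : ℕ) [NeZero e] (n : ZMod e) :
    (e : ℂ) * sqCount d e n =
      ∑ u : ZMod e, ZMod.stdAddChar (-(u * n)) * gs u 0 ^ d := by
  have h1 : (e : ℂ) * sqCount d e n =
      ∑ a : Fin d → ZMod e, ∑ u : ZMod e, ZMod.stdAddChar (u * (∑ i, a i ^ 2 - n)) := by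
    simp_rw [sum_stdAddChar_mul, sub_eq_zero]
    rw [← Finset.sum_filter, Finset.sum_const, nsmul_eq_mul, mul_comm]; rfl
  rw [h1, Finset.sum_comm]
  refine Finset.sum_congr rfl fun u _ => ?_
  have h2 : gs u 0 ^ d = ∑ a : Fin d → ZMod e, ∏ i, (ZMod.stdAddChar (u * a i ^ 2) : ℂ) := by
    have := Finset.prod_univ_sum (fun _ : Fin d => (Finset.univ : Finset (ZMod e)))
      (fun _ x => (ZMod.stdAddChar (u * x ^ 2) : ℂ))
    rw [Fintype.piFinset_univ] at this
    rw [← this, Finset.prod_const, Finset.card_univ, Fintype.card_fin]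
    simp [gs]
  rw [h2, Finset.mul_sum]
  refine Finset.sum_congr rfl fun a _ => ?_
  rw [← AddChar.map_finset_sum_eq_prod, ← AddChar.map_add_eq_mul, ← Finset.mul_sum]
  congr 1; ring

lemma exists_sqCount_le (d : ℕ) (hd : 5 ≤ d) : ∃ C : ℝ, 0 ≤ C ∧
    ∀ (e : ℕ) [NeZero e] (n : ZMod e), (sqCount d e n : ℝ) ≤ C * (e : ℝ) ^ (d - 1) := by
  set σ : ℝ := (d : ℝ) / 2 - 1 with hσ
  have hd' : (5 : ℝ) ≤ d := by exact_mod_cast hd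
  have hs : Summable fun g : ℕ => ((g : ℝ) ^ σ)⁻¹ := Real.summable_nat_rpow_inv.2 (by rw [hσ]; linarith)
  set S := ∑' g : ℕ, ((g : ℝ) ^ σ)⁻¹ with hS
  have hS0 : 0 ≤ S := tsum_nonneg fun g => by positivity
  refine ⟨2 ^ ((d : ℝ) / 2) * S, by positivity, fun e _ n => ?_⟩
  have he : (0 : ℝ) < e := by exact_mod_cast NeZero.pos e
  have h1 : (e : ℝ) * sqCount d e n ≤ ∑ u : ZMod e,
      (2 * e : ℝ) ^ ((d : ℝ) / 2) * (Nat.gcd u.val e : ℝ) ^ ((d : ℝ) / 2) := by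
    have : (e : ℝ) * sqCount d e n = ‖(e : ℂ) * sqCount d e n‖ := by
      rw [norm_mul, Complex.norm_natCast, Complex.norm_natCast]
    rw [this, sqCount_mul_eq]
    refine (norm_sum_le _ _).trans (Finset.sum_le_sum fun u _ => ?_)
    rw [norm_mul, norm_stdAddChar, one_mul, norm_pow, ← Real.mul_rpow (by positivity) (by positivity)]
    have h2 := gs_norm_sq_le u 0
    have h3 : ‖gs u 0‖ ^ d = (‖gs u 0‖ ^ 2) ^ ((d : ℝ) / 2) := by
      rw [← Real.rpow_natCast, ← Real.rpow_natCast, ← Real.rpow_mul (norm_nonneg _)]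
      congr 1; push_cast; ring
    rw [h3]
    refine Real.rpow_le_rpow (by positivity) (h2.trans (le_of_eq (by ring))) (by positivity)
  have h2 := sum_gcd_le e (fun g => (g : ℝ) ^ ((d : ℝ) / 2)) (fun g => by positivity)
  have h3 : ∑ g ∈ e.divisors, (g : ℝ) ^ ((d : ℝ) / 2) * ((e : ℝ) / g) ≤ e * ((e : ℝ) ^ σ * S) := by
    calc ∑ g ∈ e.divisors, (g : ℝ) ^ ((d : ℝ) / 2) * ((e : ℝ) / g)
        = ∑ g ∈ e.divisors, e * (g : ℝ) ^ σ := by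
          refine Finset.sum_congr rfl fun g hg => ?_
          have : (0 : ℝ) < g := by exact_mod_cast Nat.pos_of_mem_divisors hg
          rw [hσ, Real.rpow_sub_one this.ne']; field_simp
      _ = ∑ g ∈ e.divisors, e * ((e / g : ℕ) : ℝ) ^ σ :=
          (Nat.sum_div_divisors e (fun g => (e : ℝ) * (g : ℝ) ^ σ)).symm
      _ = e * ((e : ℝ) ^ σ * ∑ g ∈ e.divisors, ((g : ℝ) ^ σ)⁻¹) := by
          rw [Finset.mul_sum, Finset.mul_sum]
          refine Finset.sum_congr rfl fun g hg => ?_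
          rw [Nat.cast_div_charZero (Nat.dvd_of_mem_divisors hg), Real.div_rpow he.le (by positivity)]
          rfl
      _ ≤ _ := by
          gcongr
          exact hs.sum_le_tsum _ fun g _ => by positivity
  have h4 : (e : ℝ) * sqCount d e n ≤ (2 * e : ℝ) ^ ((d : ℝ) / 2) * (e * ((e : ℝ) ^ σ * S)) := by
    refine h1.trans ?_
    rw [← Finset.mul_sum]
    gcongr
    exact h2.trans h3
  have h5 : (2 * e : ℝ) ^ ((d : ℝ) / 2) * (e * ((e : ℝ) ^ σ * S)) =
      e * (2 ^ ((d : ℝ) / 2) * S * (e : ℝ) ^ (d - 1)) := by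
    have : (e : ℝ) ^ (d - 1) = (e : ℝ) ^ ((d : ℝ) / 2) * (e : ℝ) ^ σ := by
      rw [← Real.rpow_add he, ← Real.rpow_natCast]
      congr 1; rw [hσ, Nat.cast_sub (by omega)]; push_cast; ring
    rw [this, Real.mul_rpow (by norm_num) he.le]; ring
  rw [h5] at h4
  exact le_of_mul_le_mul_left h4 he

lemma card_fiber_castHom (q e : ℕ) [NeZero q] [NeZero e] (he : e ∣ q) (b : ZMod e) :
    (Finset.univ.filter fun x : ZMod q => ZMod.castHom he (ZMod e) x = b).card = q / e := by
  rw [← card_dvd_val q e he]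
  obtain ⟨c, hc⟩ := ZMod.castHom_surjective he b
  refine Finset.card_bij (fun x _ => x - c) ?_ ?_ ?_
  · intro x hx
    simp only [Finset.mem_filter, Finset.mem_univ, true_and] at hx ⊢
    rw [← ZMod.natCast_eq_zero_iff]
    have : ZMod.castHom he (ZMod e) (x - c) = 0 := by rw [map_sub, hx, hc, sub_self]
    rw [← this]
    conv_rhs => rw [← ZMod.natCast_zmod_val (x - c), map_natCast]
  · intro x _ y _ h; simpa using h
  · intro x hx
    simp only [Finset.mem_filter, Finset.mem_univ, true_and] at hx
    refine ⟨x + c, ?_, by ring⟩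
    simp only [Finset.mem_filter, Finset.mem_univ, true_and]
    rw [map_add, hc]
    have : ZMod.castHom he (ZMod e) x = 0 := by
      conv_lhs => rw [← ZMod.natCast_zmod_val x, map_natCast]
      rwa [ZMod.natCast_eq_zero_iff]
    rw [this, zero_add]

lemma card_filter_castHom_sq (d q e : ℕ) [NeZero q] [NeZero e] (he : e ∣ q) (n : ZMod e) :
    (Finset.univ.filter fun a : Fin d → ZMod q =>
      ∑ i, (ZMod.castHom he (ZMod e) (a i)) ^ 2 = n).card = (q / e) ^ d * sqCount d e n := by
  rw [sqCount, Finset.card_eq_sum_card_fiberwise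
    (f := fun a : Fin d → ZMod q => fun i => ZMod.castHom he (ZMod e) (a i))
    (t := Finset.univ.filter fun a : Fin d → ZMod e => ∑ i, a i ^ 2 = n)]
  · rw [Finset.sum_congr rfl (g := fun _ => (q / e) ^ d), Finset.sum_const, smul_eq_mul, mul_comm]
    intro b hb
    simp only [Finset.mem_filter, Finset.mem_univ, true_and] at hb
    have : (Finset.univ.filter fun a : Fin d → ZMod q =>
        ∑ i, (ZMod.castHom he (ZMod e) (a i)) ^ 2 = n).filter
        (fun a => (fun i => ZMod.castHom he (ZMod e) (a i)) = b) =
        Fintype.piFinset fun i => Finset.univ.filter fun x : ZMod q =>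
          ZMod.castHom he (ZMod e) x = b i := by
      ext a
      simp only [Finset.mem_filter, Finset.mem_univ, true_and, Fintype.mem_piFinset]
      constructor
      · rintro ⟨_, h⟩ i; exact congrFun h i
      · intro h
        refine ⟨?_, funext h⟩
        simp_rw [h]; exact hb
    rw [this, Fintype.card_piFinset]
    simp_rw [card_fiber_castHom]
    simp
  · intro a ha
    simp only [Finset.coe_filter, Finset.mem_univ, true_and, Set.mem_ofPred_eq] at ha ⊢
    exact ha

/-- The `ℓ¹` average of the Ramanujan sum over a period. -/
lemma exists_sum_norm_rs_le (d : ℕ) (hd : 5 ≤ d) : ∃ C : ℝ, 0 ≤ C ∧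
    ∀ (q : ℕ) [NeZero q] (n : ℤ), ∑ a : Fin d → ZMod q, ‖rs (∑ i, a i ^ 2 - (n : ZMod q))‖ ≤
      C * q.divisors.card * (q : ℝ) ^ d := by
  obtain ⟨C, hC0, hC⟩ := exists_sqCount_le d hd
  refine ⟨C, hC0, fun q _ n => ?_⟩
  have h1 : ∀ a : Fin d → ZMod q, ‖rs (∑ i, a i ^ 2 - (n : ZMod q))‖ ≤
      ∑ e ∈ q.divisors, if (e : ℤ) ∣ (∑ i, ((a i).val : ℤ) ^ 2 - n) then (e : ℝ) else 0 := by
    intro a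
    have := norm_ramanujanSum_le_sum q (NeZero.ne q) (∑ i, ((a i).val : ℤ) ^ 2 - n)
    rw [ramanujanSum_eq_rs] at this
    push_cast at this
    simpa using this
  refine (Finset.sum_le_sum fun a _ => h1 a).trans ?_
  rw [Finset.sum_comm]
  calc _ ≤ ∑ e ∈ q.divisors, C * (q : ℝ) ^ d := by
        refine Finset.sum_le_sum fun e heq => ?_
        have he := Nat.dvd_of_mem_divisors heq
        have hepos := Nat.pos_of_mem_divisors heq
        have : NeZero e := ⟨hepos.ne'⟩
        have he0 : (0 : ℝ) < e := by exact_mod_cast hepos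
        have h2 : (Finset.univ.filter fun a : Fin d → ZMod q =>
            (e : ℤ) ∣ (∑ i, ((a i).val : ℤ) ^ 2 - n)) = Finset.univ.filter fun a : Fin d → ZMod q =>
            ∑ i, (ZMod.castHom he (ZMod e) (a i)) ^ 2 = (n : ZMod e) := by
          ext a
          simp only [Finset.mem_filter, Finset.mem_univ, true_and]
          rw [← ZMod.intCast_zmod_eq_zero_iff_dvd]
          push_cast
          rw [sub_eq_zero]
          have : ∀ x : ZMod q, ((x.val : ℕ) : ZMod e) = ZMod.castHom he (ZMod e) x := fun x => by
            conv_rhs => rw [← ZMod.natCast_zmod_val x, map_natCast]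
          simp_rw [this]
        rw [← Finset.sum_filter, Finset.sum_const, nsmul_eq_mul, h2, card_filter_castHom_sq]
        push_cast
        rw [Nat.cast_div_charZero he]
        calc ((q : ℝ) / e) ^ d * (sqCount d e (n : ZMod e)) * e
            ≤ ((q : ℝ) / e) ^ d * (C * (e : ℝ) ^ (d - 1)) * e := by
              gcongr; exact hC e _
          _ = C * (q : ℝ) ^ d := by
              have : (e : ℝ) ^ (d - 1) * e = e ^ d := by
                rw [← pow_succ]; congr 1; omega
              rw [mul_assoc, mul_assoc C, this, div_pow]; field_simp
    _ = _ := by rw [Finset.sum_const, nsmul_eq_mul]; ring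

end CongruenceCount

section Kloosterman

variable {q : ℕ} [NeZero q]

lemma le_totient_mul_card_divisors (q : ℕ) (hq : q ≠ 0) : q ≤ q.totient * q.divisors.card := by
  conv_lhs => rw [← Nat.sum_totient q]
  calc _ ≤ ∑ _e ∈ q.divisors, q.totient := Finset.sum_le_sum fun e he =>
        Nat.le_of_dvd (Nat.totient_pos.2 (Nat.pos_of_ne_zero hq))
          (Nat.totient_dvd_of_dvd (Nat.dvd_of_mem_divisors he))
    _ = _ := by rw [Finset.sum_const, smul_eq_mul, mul_comm]

lemma gs_mul_sq (u c : (ZMod q)ˣ) (b : ZMod q) :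
    gs ((u * c ^ 2 : (ZMod q)ˣ) : ZMod q) b = gs (u : ZMod q) (b * (c⁻¹ : (ZMod q)ˣ)) := by
  unfold gs
  rw [← Equiv.sum_comp (Units.mulRight c⁻¹)
    (fun x : ZMod q => (ZMod.stdAddChar (((u * c ^ 2 : (ZMod q)ˣ) : ZMod q) * x ^ 2 + b * x) : ℂ))]
  refine Finset.sum_congr rfl fun x _ => ?_
  congr 1
  have : (c : ZMod q) * (c⁻¹ : (ZMod q)ˣ) = 1 := by simp
  simp only [Units.mulRight_apply, Units.val_mul, Units.val_pow_eq_pow_val]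
  linear_combination (u : ZMod q) * x ^ 2 * ((c : ZMod q) * (c⁻¹ : (ZMod q)ˣ) + 1) * this

lemma gs_add_two_mul (u : (ZMod q)ˣ) (b m : ZMod q) :
    gs (u : ZMod q) (b + 2 * b * m) =
      ZMod.stdAddChar (-((u⁻¹ : (ZMod q)ˣ) : ZMod q) * (b ^ 2 * (m ^ 2 + m))) * gs (u : ZMod q) b := by
  unfold gs
  rw [← Equiv.sum_comp (Equiv.addRight (-((u⁻¹ : (ZMod q)ˣ) : ZMod q) * b * m))
    (fun x : ZMod q => (ZMod.stdAddChar ((u : ZMod q) * x ^ 2 + (b + 2 * b * m) * x) : ℂ)),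
    Finset.mul_sum]
  refine Finset.sum_congr rfl fun x _ => ?_
  rw [← AddChar.map_add_eq_mul]
  congr 1
  have : (u : ZMod q) * (u⁻¹ : (ZMod q)ˣ) = 1 := by simp
  simp only [Equiv.coe_addRight]
  linear_combination (-2 * x * b * m + ((u⁻¹ : (ZMod q)ˣ) : ZMod q) * b ^ 2 * m ^ 2) * this

lemma exists_unit_sub_one (c : (ZMod q)ˣ) : ∃ m : ZMod q, (c : ZMod q) = 1 + 2 * m := by
  have hc := ZMod.val_coe_unit_coprime c
  rcases Nat.even_or_odd q with hq | hq
  · have : Odd (c : ZMod q).val := by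
      rw [← Nat.not_even_iff_odd]; intro h
      have := Nat.dvd_gcd h.two_dvd hq.two_dvd
      rw [hc.gcd_eq_one] at this; omega
    obtain ⟨k, hk⟩ := this
    refine ⟨k, ?_⟩
    rw [← ZMod.natCast_zmod_val (c : ZMod q), hk]; push_cast; ring
  · have h2 : IsUnit (2 : ZMod q) := by
      have := (ZMod.isUnit_iff_coprime 2 q).2 hq.coprime_two_left
      exact_mod_cast this
    obtain ⟨v, hv⟩ := h2
    refine ⟨(v⁻¹ : (ZMod q)ˣ) * ((c : ZMod q) - 1), ?_⟩
    rw [← hv, ← mul_assoc]; simp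

/-- The twisted Kloosterman-type sum. -/
def ks (w : (ZMod q)ˣ → ℂ) (s t : ZMod q) : ℂ :=
  ∑ u : (ZMod q)ˣ, w u * ZMod.stdAddChar ((u : ZMod q) * s + ((u⁻¹ : (ZMod q)ˣ) : ZMod q) * t)

lemma tq_eq_ks {d : ℕ} (n : ZMod q) (b : Fin d → ZMod q) (c : (ZMod q)ˣ) :
    ∃ t : ZMod q, tq n b = ks (fun u => ∏ i, gs (u : ZMod q) (b i)) (-((c : ZMod q) ^ 2 * n)) t := by
  obtain ⟨m, hm⟩ := exists_unit_sub_one c⁻¹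
  refine ⟨-∑ i, (b i) ^ 2 * (m ^ 2 + m), ?_⟩
  unfold tq ks
  rw [← Equiv.sum_comp (Equiv.mulRight (c ^ 2))]
  refine Finset.sum_congr rfl fun u _ => ?_
  simp only [Equiv.coe_mulRight]
  have h1 : ∀ i, gs ((u * c ^ 2 : (ZMod q)ˣ) : ZMod q) (b i) =
      ZMod.stdAddChar (-((u⁻¹ : (ZMod q)ˣ) : ZMod q) * ((b i) ^ 2 * (m ^ 2 + m))) * gs (u : ZMod q) (b i) := by
    intro i
    rw [gs_mul_sq, hm, mul_add, mul_one, ← gs_add_two_mul]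
    congr 1; ring
  simp_rw [h1]
  rw [Finset.prod_mul_distrib, ← AddChar.map_finset_sum_eq_prod, mul_comm (ZMod.stdAddChar (∑ i, _)),
    mul_left_comm, ← AddChar.map_add_eq_mul]
  congr 2
  rw [← Finset.mul_sum]
  push_cast; ring

lemma parseval_two {ι : Type*} [Fintype ι] (a : ι → ℂ) (α β : ι → ZMod q) {W : ℝ} (hW : ∀ i, ‖a i‖ ≤ W) :
    ∑ s : ZMod q, ∑ t : ZMod q, ‖∑ i, a i * ZMod.stdAddChar (α i * s + β i * t)‖ ^ 2 ≤
      (q : ℝ) ^ 2 * W ^ 2 *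
        ((Finset.univ.filter fun x : ι × ι => α x.1 = α x.2 ∧ β x.1 = β x.2).card : ℝ) := by
  have h1 : ∀ s t : ZMod q, ((‖∑ i, a i * ZMod.stdAddChar (α i * s + β i * t)‖ ^ 2 : ℝ) : ℂ) =
      ∑ x : ι × ι, (a x.1 * (starRingEnd ℂ) (a x.2)) *
        (ZMod.stdAddChar (s * (α x.1 - α x.2)) * ZMod.stdAddChar (t * (β x.1 - β x.2))) := by
    intro s t
    rw [← Complex.normSq_eq_norm_sq, ← Complex.mul_conj, map_sum, Finset.sum_mul_sum,
      ← Finset.univ_product_univ, Finset.sum_product]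
    refine Finset.sum_congr rfl fun i _ => Finset.sum_congr rfl fun j _ => ?_
    rw [map_mul, star_stdAddChar, ← AddChar.map_add_eq_mul, mul_mul_mul_comm,
      ← AddChar.map_add_eq_mul]
    congr 2; ring
  have h2 : ((∑ s : ZMod q, ∑ t : ZMod q,
      ‖∑ i, a i * ZMod.stdAddChar (α i * s + β i * t)‖ ^ 2 : ℝ) : ℂ) =
      ∑ x : ι × ι, if α x.1 = α x.2 ∧ β x.1 = β x.2 then
        (q : ℂ) ^ 2 * (a x.1 * (starRingEnd ℂ) (a x.2)) else 0 := by
    push_cast [← Complex.ofReal_pow]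
    simp_rw [h1]
    rw [Finset.sum_congr rfl fun s _ => Finset.sum_comm, Finset.sum_comm]
    refine Finset.sum_congr rfl fun x _ => ?_
    simp_rw [← Finset.mul_sum, sum_stdAddChar_mul, ← Finset.sum_mul, sum_stdAddChar_mul, sub_eq_zero]
    split_ifs <;> simp_all; ring
  have h3 : ∑ s : ZMod q, ∑ t : ZMod q, ‖∑ i, a i * ZMod.stdAddChar (α i * s + β i * t)‖ ^ 2 =
      ‖((∑ s : ZMod q, ∑ t : ZMod q,
      ‖∑ i, a i * ZMod.stdAddChar (α i * s + β i * t)‖ ^ 2 : ℝ) : ℂ)‖ := by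
    rw [Complex.norm_real, Real.norm_of_nonneg]; positivity
  rw [h3, h2]
  refine (norm_sum_le _ _).trans ?_
  calc _ ≤ ∑ x : ι × ι, if α x.1 = α x.2 ∧ β x.1 = β x.2 then (q : ℝ) ^ 2 * W ^ 2 else 0 := by
        refine Finset.sum_le_sum fun x _ => ?_
        split_ifs
        · rw [norm_mul, norm_mul, RCLike.norm_conj, norm_pow, Complex.norm_natCast, sq W]
          gcongr
          · exact (norm_nonneg _).trans (hW x.1)
          · exact hW _
          · exact hW _
        · simp
    _ = _ := by rw [← Finset.sum_filter, Finset.sum_const, nsmul_eq_mul, mul_comm]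

lemma gcd_smul_of_mul_eq_zero (x z : ZMod q) (h : x * z = 0) : (Nat.gcd x.val q : ZMod q) * z = 0 := by
  have hb := Nat.gcd_eq_gcd_ab x.val q
  have h2 : ((Nat.gcd x.val q : ℤ) : ZMod q) = x * (Nat.gcdA x.val q : ZMod q) := by
    rw [hb]; push_cast; simp
  have h3 : (Nat.gcd x.val q : ZMod q) = x * (Nat.gcdA x.val q : ZMod q) := by exact_mod_cast h2
  rw [h3, mul_right_comm, h, zero_mul]

lemma card_mul_mul_eq_zero_le (x y : ZMod q) :
    (Finset.univ.filter fun z : ZMod q => x * y * z = 0).card ≤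
      Nat.gcd x.val q * Nat.gcd y.val q := by
  have hx : 0 < Nat.gcd x.val q := Nat.gcd_pos_of_pos_right _ (NeZero.pos q)
  have hy : 0 < Nat.gcd y.val q := Nat.gcd_pos_of_pos_right _ (NeZero.pos q)
  have hsub : (Finset.univ.filter fun z : ZMod q => x * y * z = 0) ⊆
      Finset.univ.filter fun z : ZMod q => (Nat.gcd x.val q * Nat.gcd y.val q) • z = 0 := by
    intro z hz
    simp only [Finset.mem_filter, Finset.mem_univ, true_and] at hz ⊢
    have h1 := gcd_smul_of_mul_eq_zero x (y * z) (by rw [← mul_assoc]; exact hz)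
    have h2 := gcd_smul_of_mul_eq_zero y ((Nat.gcd x.val q : ZMod q) * z) (by rw [← h1]; ring)
    rw [nsmul_eq_mul]; push_cast
    rw [← h2]; ring
  exact (Finset.card_le_card hsub).trans (IsAddCyclic.card_nsmul_eq_zero_le (by positivity))

lemma card_prod_eq_zero_le :
    (Finset.univ.filter fun x : ZMod q × ZMod q × ZMod q => x.1 * x.2.1 * x.2.2 = 0).card ≤
      (q * q.divisors.card) ^ 2 := by
  have hsum : ∑ x : ZMod q, Nat.gcd x.val q ≤ q * q.divisors.card := by
    have := sum_gcd_le q (fun e => (e : ℝ)) (fun e => by positivity)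
    have h2 : ∑ e ∈ q.divisors, (e : ℝ) * ((q : ℝ) / e) = q * q.divisors.card := by
      rw [Finset.sum_congr rfl (g := fun _ => (q : ℝ)), Finset.sum_const, nsmul_eq_mul, mul_comm]
      intro e he
      have : (e : ℝ) ≠ 0 := by exact_mod_cast (Nat.pos_of_mem_divisors he).ne'
      field_simp
    rw [h2] at this
    exact_mod_cast this
  have h1 : (Finset.univ.filter fun x : ZMod q × ZMod q × ZMod q => x.1 * x.2.1 * x.2.2 = 0).card =
      ∑ x : ZMod q, ∑ y : ZMod q, (Finset.univ.filter fun z : ZMod q => x * y * z = 0).card := by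
    simp_rw [Finset.card_filter]
    rw [← Finset.univ_product_univ, Finset.sum_product]
    refine Finset.sum_congr rfl fun x _ => ?_
    rw [← Finset.univ_product_univ, Finset.sum_product]
  rw [h1]
  calc _ ≤ ∑ x : ZMod q, ∑ y : ZMod q, Nat.gcd x.val q * Nat.gcd y.val q :=
        Finset.sum_le_sum fun x _ => Finset.sum_le_sum fun y _ => card_mul_mul_eq_zero_le x y
    _ = (∑ x : ZMod q, Nat.gcd x.val q) ^ 2 := by rw [sq, Finset.sum_mul_sum]
    _ ≤ _ := by gcongr

lemma card_quadruples_le :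
    (Finset.univ.filter fun x : ((ZMod q)ˣ × (ZMod q)ˣ) × ((ZMod q)ˣ × (ZMod q)ˣ) =>
      (x.1.1 : ZMod q) + x.1.2 = x.2.1 + x.2.2 ∧
      ((x.1.1⁻¹ : (ZMod q)ˣ) : ZMod q) + (x.1.2⁻¹ : (ZMod q)ˣ) =
        (x.2.1⁻¹ : (ZMod q)ˣ) + (x.2.2⁻¹ : (ZMod q)ˣ)).card ≤ 2 * (q * q.divisors.card) ^ 2 := by
  refine le_trans ?_ (Nat.mul_le_mul_left 2 (card_prod_eq_zero_le (q := q)))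
  refine Finset.card_le_mul_card_image_of_maps_to
    (f := fun x : ((ZMod q)ˣ × (ZMod q)ˣ) × ((ZMod q)ˣ × (ZMod q)ˣ) =>
      ((x.1.1 : ZMod q) + x.1.2, (x.2.1 : ZMod q) - x.1.1, (x.2.1 : ZMod q) - x.1.2)) ?_ 2 ?_
  · rintro ⟨⟨u1, u2⟩, ⟨u3, u4⟩⟩ hx
    simp only [Finset.mem_filter, Finset.mem_univ, true_and] at hx ⊢
    obtain ⟨h1, h2⟩ := hx
    have e1 : (u1 : ZMod q) * (u1⁻¹ : (ZMod q)ˣ) = 1 := by simp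
    have e2 : (u2 : ZMod q) * (u2⁻¹ : (ZMod q)ˣ) = 1 := by simp
    have e3 : (u3 : ZMod q) * (u3⁻¹ : (ZMod q)ˣ) = 1 := by simp
    have e4 : (u4 : ZMod q) * (u4⁻¹ : (ZMod q)ˣ) = 1 := by simp
    have h4 : (u4 : ZMod q) = u1 + u2 - u3 := by rw [h1]; ring
    generalize ((u1⁻¹ : (ZMod q)ˣ) : ZMod q) = v1 at *
    generalize ((u2⁻¹ : (ZMod q)ˣ) : ZMod q) = v2 at *
    generalize ((u3⁻¹ : (ZMod q)ˣ) : ZMod q) = v3 at *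
    generalize ((u4⁻¹ : (ZMod q)ˣ) : ZMod q) = v4 at *
    generalize (u1 : ZMod q) = a1 at *
    generalize (u2 : ZMod q) = a2 at *
    generalize (u3 : ZMod q) = a3 at *
    generalize (u4 : ZMod q) = a4 at *
    have k1 : (a1 + a2) * (a3 * a4) = (a3 + a4) * (a1 * a2) := by
      have : a1 * a2 * (a3 * a4) * (v1 + v2) = a1 * a2 * (a3 * a4) * (v3 + v4) := by rw [h2]
      linear_combination this - a2 * (a3 * a4) * e1 - a1 * (a3 * a4) * e2
        + a1 * a2 * a4 * e3 + a1 * a2 * a3 * e4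
    rw [h4] at k1
    linear_combination -k1
  · intro p _
    classical
    rcases Finset.eq_empty_or_nonempty ((Finset.univ.filter fun x : ((ZMod q)ˣ × (ZMod q)ˣ) × ((ZMod q)ˣ × (ZMod q)ˣ) =>
      (x.1.1 : ZMod q) + x.1.2 = x.2.1 + x.2.2 ∧
      ((x.1.1⁻¹ : (ZMod q)ˣ) : ZMod q) + (x.1.2⁻¹ : (ZMod q)ˣ) =
        (x.2.1⁻¹ : (ZMod q)ˣ) + (x.2.2⁻¹ : (ZMod q)ˣ)).filter fun x =>
        ((x.1.1 : ZMod q) + x.1.2, (x.2.1 : ZMod q) - x.1.1, (x.2.1 : ZMod q) - x.1.2) = p) with h | ⟨y, hy⟩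
    · rw [h]; simp
    · refine le_trans (Finset.card_le_card_of_injOn
        (t := Finset.univ.filter fun z : ZMod q => 2 • z = 0)
        (fun x => (x.1.1 : ZMod q) - y.1.1) ?_ ?_) (IsAddCyclic.card_nsmul_eq_zero_le two_pos)
      · intro x hx
        simp only [Finset.coe_filter, Finset.mem_filter, Finset.mem_univ, true_and, Set.mem_ofPred_eq] at hx hy ⊢
        have := hx.2.trans hy.2.symm
        simp only [Prod.mk.injEq] at this
        rw [nsmul_eq_mul]; push_cast
        linear_combination this.1 - this.2.1 + this.2.2
      · intro x hx z hz hxz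
        simp only [Finset.coe_filter, Finset.mem_filter, Finset.mem_univ, true_and, Set.mem_ofPred_eq] at hx hz hxz
        have := hx.2.trans hz.2.symm
        simp only [Prod.mk.injEq] at this
        have k1 : (x.1.1 : ZMod q) = z.1.1 := by linear_combination hxz
        have k2 : (x.1.2 : ZMod q) = z.1.2 := by linear_combination this.1 - k1
        have k3 : (x.2.1 : ZMod q) = z.2.1 := by linear_combination this.2.1 + k1
        have k4 : (x.2.2 : ZMod q) = z.2.2 := by
          linear_combination k1 + k2 - k3 - hx.1.1 + hz.1.1
        exact Prod.ext (Prod.ext (Units.ext k1) (Units.ext k2)) (Prod.ext (Units.ext k3) (Units.ext k4))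

lemma card_dvd_val_add_two {f : ℕ} (hf : f ∣ q) :
    (Finset.univ.filter fun y : ZMod q => f ∣ y.val + 2).card = q / f := by
  rw [← card_dvd_val q f hf]
  refine Finset.card_bij (fun y _ => y + 2) ?_ ?_ ?_
  · intro y hy
    simp only [Finset.mem_filter, Finset.mem_univ, true_and] at hy ⊢
    have h1 : ((y + 2).val : ZMod q) = ((y.val + 2 : ℕ) : ZMod q) := by
      push_cast; simp
    rw [ZMod.natCast_eq_natCast_iff] at h1
    exact (h1.of_dvd hf).dvd_iff dvd_rfl |>.2 hy
  · intro a _ b _ h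
    exact add_right_cancel h
  · intro y hy
    simp only [Finset.mem_filter, Finset.mem_univ, true_and] at hy
    refine ⟨y - 2, ?_, by ring⟩
    simp only [Finset.mem_filter, Finset.mem_univ, true_and]
    have h1 : (y.val : ZMod q) = (((y - 2).val + 2 : ℕ) : ZMod q) := by
      push_cast; simp
    rw [ZMod.natCast_eq_natCast_iff] at h1
    exact (h1.of_dvd hf).dvd_iff dvd_rfl |>.1 hy

/-- Few units have a prescribed value of `c² n`. -/
lemma card_sq_mul_eq_le (n s : ZMod q) :
    ((Finset.univ.filter fun c : (ZMod q)ˣ => -((c : ZMod q) ^ 2 * n) = s).card : ℝ) ≤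
      q.divisors.card * Real.sqrt (q * Nat.gcd n.val q) := by
  classical
  have hq : 0 < q := NeZero.pos q
  rcases Finset.eq_empty_or_nonempty
    (Finset.univ.filter fun c : (ZMod q)ˣ => -((c : ZMod q) ^ 2 * n) = s) with h | ⟨c₀, hc₀⟩
  · rw [h]; simp; positivity
  simp only [Finset.mem_filter, Finset.mem_univ, true_and] at hc₀
  set g := Nat.gcd n.val q with hg
  have hgq : g ∣ q := Nat.gcd_dvd_right _ _
  have hg0 : 0 < g := Nat.gcd_pos_of_pos_right _ hq
  set Q := q / g with hQ
  have hQg : Q * g = q := Nat.div_mul_cancel hgq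
  have hQ0 : 0 < Q := Nat.pos_of_ne_zero fun h => by rw [h] at hQg; omega
  have hQq : Q ∣ q := ⟨g, hQg.symm⟩
  have h1 : (Finset.univ.filter fun c : (ZMod q)ˣ => -((c : ZMod q) ^ 2 * n) = s).card ≤
      (Q.divisors.biUnion fun e => Finset.univ.filter fun y : ZMod q =>
        e ∣ y.val ∧ Q / e ∣ y.val + 2).card := by
    refine Finset.card_le_card_of_injOn
      (fun c => (c : ZMod q) * (c₀⁻¹ : (ZMod q)ˣ) - 1) ?_ ?_
    · intro c hc
      simp only [Finset.coe_filter, Finset.mem_univ, true_and, Set.mem_ofPred_eq] at hc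
      simp only [Finset.coe_biUnion, Finset.mem_coe, Set.mem_iUnion, Finset.coe_filter,
        Finset.mem_univ, true_and, Set.mem_ofPred_eq]
      set y : ZMod q := (c : ZMod q) * (c₀⁻¹ : (ZMod q)ˣ) - 1 with hy
      have e0 : (c₀ : ZMod q) * (c₀⁻¹ : (ZMod q)ˣ) = 1 := by simp
      have hyy : n * (y * (y + 2)) = 0 := by
        have : (c : ZMod q) ^ 2 * n = (c₀ : ZMod q) ^ 2 * n := by
          linear_combination hc₀ - hc
        rw [hy]
        linear_combination ((c₀⁻¹ : (ZMod q)ˣ) : ZMod q) ^ 2 * this +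
          n * ((c₀ : ZMod q) * (c₀⁻¹ : (ZMod q)ˣ) + 1) * e0
      have h2 := gcd_smul_of_mul_eq_zero n _ hyy
      rw [← hg] at h2
      have h3 : ((g * (y.val * (y.val + 2)) : ℕ) : ZMod q) = 0 := by
        push_cast; simpa using h2
      rw [ZMod.natCast_eq_zero_iff] at h3
      have h4 : Q ∣ y.val * (y.val + 2) :=
        Nat.dvd_of_mul_dvd_mul_left hg0 (by rwa [mul_comm g Q, hQg])
      refine ⟨Nat.gcd y.val Q, Nat.mem_divisors.2 ⟨Nat.gcd_dvd_right _ _, hQ0.ne'⟩,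
        Nat.gcd_dvd_left _ _, ?_⟩
      have hcop := Nat.coprime_div_gcd_div_gcd (Nat.gcd_pos_of_pos_right y.val hQ0)
      refine hcop.symm.dvd_of_dvd_mul_left ?_
      have h5 := Nat.div_dvd_div (Nat.gcd_dvd_right y.val Q) h4
      rwa [Nat.mul_div_right_comm (Nat.gcd_dvd_left y.val Q)] at h5
    · intro c _ c' _ h
      have h' : (c : ZMod q) * (c₀⁻¹ : (ZMod q)ˣ) = c' * (c₀⁻¹ : (ZMod q)ˣ) := by
        linear_combination h
      exact mul_right_cancel (Units.ext (by push_cast; exact h'))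
  have h2 : ∀ e ∈ Q.divisors, ((Finset.univ.filter fun y : ZMod q =>
        e ∣ y.val ∧ Q / e ∣ y.val + 2).card : ℝ) ≤ Real.sqrt (q * g) := by
    intro e he
    have heQ := Nat.dvd_of_mem_divisors he
    have he0 := Nat.pos_of_mem_divisors he
    have a1 : (Finset.univ.filter fun y : ZMod q => e ∣ y.val ∧ Q / e ∣ y.val + 2).card ≤ q / e := by
      rw [← card_dvd_val q e (heQ.trans hQq)]
      exact Finset.card_le_card (Finset.monotone_filter_right _ fun y _ h => h.1)
    have a2 : (Finset.univ.filter fun y : ZMod q => e ∣ y.val ∧ Q / e ∣ y.val + 2).card ≤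
        q / (Q / e) := by
      rw [← card_dvd_val_add_two ((Nat.div_dvd_of_dvd heQ).trans hQq)]
      exact Finset.card_le_card (Finset.monotone_filter_right _ fun y _ h => h.2)
    have a3 : q / (Q / e) = g * e := by
      refine Nat.div_eq_of_eq_mul_left (Nat.div_pos (Nat.le_of_dvd hQ0 heQ) he0) ?_
      rw [mul_assoc, Nat.mul_div_cancel' heQ, mul_comm, hQg]
    have a4 : q / e * (g * e) = q * g := by
      rw [mul_comm g e, ← mul_assoc, Nat.div_mul_cancel (heQ.trans hQq)]
    rw [a3] at a2
    refine Real.le_sqrt_of_sq_le ?_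
    rw [sq]
    have := Nat.mul_le_mul a1 a2
    rw [a4] at this
    exact_mod_cast this
  calc _ ≤ (((Q.divisors.biUnion fun e => Finset.univ.filter fun y : ZMod q =>
        e ∣ y.val ∧ Q / e ∣ y.val + 2).card : ℕ) : ℝ) := by exact_mod_cast h1
    _ ≤ ∑ e ∈ Q.divisors, ((Finset.univ.filter fun y : ZMod q =>
        e ∣ y.val ∧ Q / e ∣ y.val + 2).card : ℝ) := by exact_mod_cast Finset.card_biUnion_le
    _ ≤ ∑ e ∈ Q.divisors, Real.sqrt (q * g) := Finset.sum_le_sum h2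
    _ = Q.divisors.card * Real.sqrt (q * g) := by rw [Finset.sum_const, nsmul_eq_mul]
    _ ≤ _ := by
      gcongr

lemma sum_norm_ks_pow_four_le (w : (ZMod q)ˣ → ℂ) {W : ℝ} (hW : ∀ u, ‖w u‖ ≤ W) :
    ∑ s : ZMod q, ∑ t : ZMod q, ‖ks w s t‖ ^ 4 ≤
      (q : ℝ) ^ 2 * (W ^ 2) ^ 2 * (2 * ((q : ℝ) * q.divisors.card) ^ 2) := by
  have hW0 : 0 ≤ W := (norm_nonneg _).trans (hW 1)
  have h := parseval_two (ι := (ZMod q)ˣ × (ZMod q)ˣ) (fun x => w x.1 * w x.2)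
    (fun x => (x.1 : ZMod q) + (x.2 : ZMod q))
    (fun x => ((x.1⁻¹ : (ZMod q)ˣ) : ZMod q) + ((x.2⁻¹ : (ZMod q)ˣ) : ZMod q)) (W := W ^ 2)
    (fun x => by
      rw [norm_mul, sq]
      exact mul_le_mul (hW _) (hW _) (norm_nonneg _) hW0)
  have h4 : ∀ s t : ZMod q, ‖ks w s t‖ ^ 4 = ‖∑ x : (ZMod q)ˣ × (ZMod q)ˣ, w x.1 * w x.2 *
      ZMod.stdAddChar (((x.1 : ZMod q) + (x.2 : ZMod q)) * s +
        (((x.1⁻¹ : (ZMod q)ˣ) : ZMod q) + ((x.2⁻¹ : (ZMod q)ˣ) : ZMod q)) * t)‖ ^ 2 := by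
    intro s t
    rw [show (4 : ℕ) = 2 * 2 from rfl, pow_mul, ← norm_pow, sq (ks w s t)]
    congr 3
    unfold ks
    rw [Finset.sum_mul_sum, ← Finset.univ_product_univ, Finset.sum_product]
    refine Finset.sum_congr rfl fun x _ => Finset.sum_congr rfl fun y _ => ?_
    rw [mul_mul_mul_comm, ← AddChar.map_add_eq_mul]
    congr 2; ring
  simp_rw [h4]
  refine h.trans ?_
  gcongr
  exact_mod_cast card_quadruples_le (q := q)

lemma norm_tq_four_le (n : ZMod q) (b : Fin 4 → ZMod q) :
    ‖tq n b‖ ≤ 5 * q.divisors.card * (q : ℝ) ^ (23 / 8 : ℝ) *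
      (Nat.gcd n.val q : ℝ) ^ (1 / 8 : ℝ) := by
  classical
  have hq : (0 : ℝ) < q := by exact_mod_cast NeZero.pos q
  set τ : ℝ := (q.divisors.card : ℝ) with hτ
  have hτ0 : 0 < τ := by
    have : 0 < q.divisors.card := Finset.card_pos.2 ⟨1, by simp [NeZero.ne q]⟩
    rw [hτ]; exact_mod_cast this
  set g : ℝ := (Nat.gcd n.val q : ℝ) with hg
  have hg0 : 0 < g := by
    have := Nat.gcd_pos_of_pos_right n.val (NeZero.pos q)
    rw [hg]; exact_mod_cast this
  set w : (ZMod q)ˣ → ℂ := fun u => ∏ i, gs (u : ZMod q) (b i) with hw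
  have hW : ∀ u, ‖w u‖ ≤ 4 * (q : ℝ) ^ 2 := by
    intro u
    rw [hw, norm_prod]
    calc _ ≤ ∏ _i : Fin 4, (2 * q : ℝ) ^ (1 / 2 : ℝ) :=
          Finset.prod_le_prod (fun _ _ => norm_nonneg _) fun i _ => gs_unit_norm_le u (b i)
      _ = 4 * (q : ℝ) ^ 2 := by
        rw [Finset.prod_const, Finset.card_univ, Fintype.card_fin, ← Real.rpow_natCast,
          ← Real.rpow_mul (by positivity), show (1 / 2 : ℝ) * (4 : ℕ) = (2 : ℕ) by norm_num,
          Real.rpow_natCast]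
        ring
  have h4 := sum_norm_ks_pow_four_le w hW
  choose t ht using fun c : (ZMod q)ˣ => tq_eq_ks n b c
  have h1 : (Fintype.card (ZMod q)ˣ : ℝ) * ‖tq n b‖ ^ 4 ≤
      (τ * Real.sqrt (q * g)) * ∑ s : ZMod q, ∑ t : ZMod q, ‖ks w s t‖ ^ 4 := by
    calc _ = ∑ c : (ZMod q)ˣ, ‖tq n b‖ ^ 4 := by
          rw [Finset.sum_const, nsmul_eq_mul, Finset.card_univ]
      _ = ∑ c : (ZMod q)ˣ, ‖ks w (-((c : ZMod q) ^ 2 * n)) (t c)‖ ^ 4 :=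
          Finset.sum_congr rfl fun c _ => by rw [ht c]
      _ ≤ ∑ c : (ZMod q)ˣ, ∑ t : ZMod q, ‖ks w (-((c : ZMod q) ^ 2 * n)) t‖ ^ 4 :=
          Finset.sum_le_sum fun c _ => Finset.single_le_sum
            (f := fun t => ‖ks w (-((c : ZMod q) ^ 2 * n)) t‖ ^ 4)
            (fun _ _ => by positivity) (Finset.mem_univ _)
      _ = ∑ s : ZMod q, ∑ c ∈ Finset.univ.filter (fun c : (ZMod q)ˣ => -((c : ZMod q) ^ 2 * n) = s),
            ∑ t : ZMod q, ‖ks w (-((c : ZMod q) ^ 2 * n)) t‖ ^ 4 :=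
          (Finset.sum_fiberwise _ _ _).symm
      _ = ∑ s : ZMod q, ((Finset.univ.filter
            (fun c : (ZMod q)ˣ => -((c : ZMod q) ^ 2 * n) = s)).card : ℝ) *
            ∑ t : ZMod q, ‖ks w s t‖ ^ 4 := by
          refine Finset.sum_congr rfl fun s _ => ?_
          rw [← nsmul_eq_mul, ← Finset.sum_const]
          refine Finset.sum_congr rfl fun c hc => ?_
          rw [(Finset.mem_filter.1 hc).2]
      _ ≤ ∑ s : ZMod q, (τ * Real.sqrt (q * g)) * ∑ t : ZMod q, ‖ks w s t‖ ^ 4 := by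
          refine Finset.sum_le_sum fun s _ => ?_
          gcongr
          exact card_sq_mul_eq_le n s
      _ = _ := by rw [Finset.mul_sum]
  have hφ : (q : ℝ) ≤ (Fintype.card (ZMod q)ˣ : ℝ) * τ := by
    rw [ZMod.card_units_eq_totient, hτ]
    exact_mod_cast le_totient_mul_card_divisors q (NeZero.ne q)
  have h5 : ‖tq n b‖ ^ 4 ≤ 512 * τ ^ 4 * (q : ℝ) ^ 11 * Real.sqrt (q * g) := by
    have h6 : (q : ℝ) * ‖tq n b‖ ^ 4 ≤ q * (512 * τ ^ 4 * (q : ℝ) ^ 11 * Real.sqrt (q * g)) := by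
      calc _ ≤ ((Fintype.card (ZMod q)ˣ : ℝ) * τ) * ‖tq n b‖ ^ 4 := by gcongr
        _ = τ * ((Fintype.card (ZMod q)ˣ : ℝ) * ‖tq n b‖ ^ 4) := by ring
        _ ≤ τ * ((τ * Real.sqrt (q * g)) * ((q : ℝ) ^ 2 * ((4 * (q : ℝ) ^ 2) ^ 2) ^ 2 *
            (2 * ((q : ℝ) * q.divisors.card) ^ 2))) := by
            refine mul_le_mul_of_nonneg_left (h1.trans ?_) hτ0.le
            exact mul_le_mul_of_nonneg_left h4 (by positivity)
        _ = _ := by rw [← hτ]; ring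
    exact le_of_mul_le_mul_left h6 hq
  refine le_of_pow_le_pow_left₀ (n := 4) (by norm_num) (by positivity) (h5.trans ?_)
  have e1 : ((q : ℝ) ^ (23 / 8 : ℝ)) ^ 4 = (q : ℝ) ^ 11 * (q : ℝ) ^ (1 / 2 : ℝ) := by
    rw [← Real.rpow_natCast, ← Real.rpow_mul hq.le, ← Real.rpow_natCast, ← Real.rpow_add hq]
    norm_num
  have e2 : (g ^ (1 / 8 : ℝ)) ^ 4 = g ^ (1 / 2 : ℝ) := by
    rw [← Real.rpow_natCast, ← Real.rpow_mul hg0.le]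
    norm_num
  rw [mul_pow, mul_pow, mul_pow, e1, e2, Real.sqrt_eq_rpow, Real.mul_rpow hq.le hg0.le]
  have : 0 ≤ τ ^ 4 * (q : ℝ) ^ 11 * (q : ℝ) ^ (1 / 2 : ℝ) * g ^ (1 / 2 : ℝ) := by positivity
  nlinarith

end Kloosterman

section RadiiSequence

/-- The number of primes used in `nseq η j`. -/
def primeLen (η : ℝ) (j : ℕ) : ℕ := ⌊(2 : ℝ) ^ ((j : ℝ) ^ η)⌋₊

lemma nseq_eq (η : ℝ) (j : ℕ) :
    nseq η j = 1 + ∏ i ∈ Finset.range (primeLen η j), Nat.nth Nat.Prime i := rfl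

lemma two_pow_le_primeLen {η : ℝ} (hη : 1 < η) (j : ℕ) : 2 ^ j ≤ primeLen η j := by
  refine Nat.le_floor ?_
  push_cast
  rw [← Real.rpow_natCast]
  refine Real.rpow_le_rpow_of_exponent_le (by norm_num) ?_
  rcases Nat.eq_zero_or_pos j with rfl | hj
  · simp [Real.zero_rpow (by linarith : η ≠ 0)]
  · have : (1 : ℝ) ≤ j := by exact_mod_cast hj
    calc (j : ℝ) = (j : ℝ) ^ (1 : ℝ) := (Real.rpow_one _).symm
      _ ≤ _ := Real.rpow_le_rpow_of_exponent_le this hη.le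

lemma primeLen_mono {η : ℝ} (hη : 1 < η) : Monotone (primeLen η) := by
  intro i j hij
  refine Nat.floor_mono (Real.rpow_le_rpow_of_exponent_le (by norm_num) ?_)
  exact Real.rpow_le_rpow (by positivity) (by exact_mod_cast hij) (by linarith)

/-- Consecutive lengths are far apart. -/
lemma primeLen_add_two_pow_le {η : ℝ} (hη : 1 < η) (j : ℕ) (hj : 1 ≤ j) :
    primeLen η j + 2 ^ j ≤ primeLen η (j + 1) + 1 := by
  have hj1 : (1 : ℝ) ≤ j := by exact_mod_cast hj
  have h1 : (j : ℝ) ^ η + 1 ≤ ((j + 1 : ℕ) : ℝ) ^ η := by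
    push_cast
    have hb := one_add_mul_self_le_rpow_one_add (s := (1 / j : ℝ)) (p := η)
      (by have : (0 : ℝ) ≤ 1 / j := by positivity
          linarith) hη.le
    have : ((j : ℝ) + 1) ^ η = (j : ℝ) ^ η * (1 + 1 / j) ^ η := by
      rw [← Real.mul_rpow (by positivity) (by positivity)]
      congr 1; field_simp
    rw [this]
    have h2 : (j : ℝ) ≤ (j : ℝ) ^ η := by
      conv_lhs => rw [← Real.rpow_one (j : ℝ)]
      exact Real.rpow_le_rpow_of_exponent_le hj1 hη.le
    calc (j : ℝ) ^ η + 1 ≤ (j : ℝ) ^ η + (j : ℝ) ^ η * (1 / j) := by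
          gcongr
          rw [mul_one_div, le_div_iff₀ (by linarith), one_mul]; exact h2
      _ ≤ (j : ℝ) ^ η * (1 + η * (1 / j)) := by
          rw [mul_add, mul_one]; gcongr
          have : (0 : ℝ) ≤ 1 / j := by positivity
          nlinarith
      _ ≤ _ := by gcongr
  have h3 : (2 : ℝ) ^ ((j : ℝ) ^ η) * 2 ≤ (2 : ℝ) ^ (((j + 1 : ℕ) : ℝ) ^ η) := by
    calc _ = (2 : ℝ) ^ ((j : ℝ) ^ η + 1) := by rw [Real.rpow_add (by norm_num), Real.rpow_one]
      _ ≤ _ := Real.rpow_le_rpow_of_exponent_le (by norm_num) h1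
  have h4 : primeLen η j * 2 ≤ primeLen η (j + 1) := by
    refine Nat.le_floor ?_
    refine le_trans ?_ h3
    push_cast
    gcongr
    exact Nat.floor_le (by positivity)
  have := two_pow_le_primeLen hη j
  omega

lemma nth_prime_pos (i : ℕ) : 2 ≤ Nat.nth Nat.Prime i :=
  (Nat.prime_nth_prime i).two_le

/-- Growth of the radii. -/
lemma nseq_growth (η : ℝ) {j l : ℕ} (h : primeLen η j ≤ primeLen η l) :
    nseq η j * 2 ^ (primeLen η l - primeLen η j) ≤ 2 * nseq η l := by
  rw [nseq_eq, nseq_eq, ← Finset.prod_range_mul_prod_Ico _ h]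
  set P := ∏ i ∈ Finset.range (primeLen η j), Nat.nth Nat.Prime i
  have hP : 1 ≤ P := Finset.one_le_prod'' (fun i => by have := nth_prime_pos i; omega)
  have hQ : 2 ^ (primeLen η l - primeLen η j) ≤
      ∏ i ∈ Finset.Ico (primeLen η j) (primeLen η l), Nat.nth Nat.Prime i := by
    rw [← Nat.card_Ico, ← Finset.prod_const]
    exact Finset.prod_le_prod' fun i _ => nth_prime_pos i
  calc _ ≤ (2 * P) * 2 ^ (primeLen η l - primeLen η j) := by gcongr; omega
    _ ≤ (2 * P) * ∏ i ∈ Finset.Ico (primeLen η j) (primeLen η l), Nat.nth Nat.Prime i := by gcongr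
    _ ≤ _ := by rw [mul_assoc]; omega

lemma two_pow_le_nseq (η : ℝ) (j : ℕ) : 2 ^ primeLen η j ≤ nseq η j := by
  rw [nseq_eq]
  calc 2 ^ primeLen η j = ∏ i ∈ Finset.range (primeLen η j), 2 := by simp
    _ ≤ ∏ i ∈ Finset.range (primeLen η j), Nat.nth Nat.Prime i :=
      Finset.prod_le_prod' fun i _ => nth_prime_pos i
    _ ≤ _ := by omega

lemma nseq_odd {η : ℝ} (hη : 1 < η) (j : ℕ) : Odd (nseq η j) := by
  rw [nseq_eq, Nat.odd_add, ← not_iff_not]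
  have h0 : 0 ∈ Finset.range (primeLen η j) := by
    have := two_pow_le_primeLen hη j
    have h2 : 0 < 2 ^ j := by positivity
    simp; omega
  have : 2 ∣ ∏ i ∈ Finset.range (primeLen η j), Nat.nth Nat.Prime i := by
    have := Finset.dvd_prod_of_mem (Nat.nth Nat.Prime) h0
    rwa [Nat.nth_prime_zero_eq_two] at this
  simp [even_iff_two_dvd, this]

lemma prime_dvd_primorial {η : ℝ} {j : ℕ} {p : ℕ} (hp : p.Prime) (h : p ≤ primeLen η j) :
    p ∣ ∏ i ∈ Finset.range (primeLen η j), Nat.nth Nat.Prime i := by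
  rw [← Nat.nth_count hp]
  refine Finset.dvd_prod_of_mem (Nat.nth Nat.Prime) ?_
  rw [Finset.mem_range]
  have := Nat.count_le (p := Nat.Prime) (n := p)
  refine lt_of_le_of_ne (this.trans h) fun hne => ?_
  have h1 : Nat.count Nat.Prime p = p := le_antisymm this (by omega)
  have h2 := (Nat.count_iff_forall (p := Nat.Prime) (n := p)).1 h1
  exact Nat.not_prime_zero (h2 _ hp.pos)

/-- Small squarefree numbers divide `n_j - 1`. -/
lemma squarefree_dvd_nseq_sub_one {η : ℝ} {j s : ℕ} (hs : Squarefree s) (h : s ≤ primeLen η j) :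
    (s : ℤ) ∣ (nseq η j : ℤ) - 1 := by
  rw [nseq_eq]
  push_cast
  rw [add_sub_cancel_left]
  have : s ∣ ∏ i ∈ Finset.range (primeLen η j), Nat.nth Nat.Prime i := by
    rw [← Nat.prod_primeFactors_of_squarefree hs]
    refine Finset.prod_primes_dvd _ (fun p hp => (Nat.prime_of_mem_primeFactors hp).prime) ?_
    intro p hp
    exact prime_dvd_primorial (Nat.prime_of_mem_primeFactors hp)
      ((Nat.le_of_mem_primeFactors hp).trans h)
  exact_mod_cast this

lemma coprime_nseq {η : ℝ} {j q : ℕ} (hq : q ≠ 0) (h : q ≤ primeLen η j) :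
    Nat.Coprime (nseq η j) q := by
  refine Nat.Coprime.symm (Nat.coprime_of_dvd fun p hp hpq hpn => ?_)
  have h1 := prime_dvd_primorial (η := η) (j := j) hp ((Nat.le_of_dvd (Nat.pos_of_ne_zero hq) hpq).trans h)
  rw [nseq_eq, Nat.dvd_add_iff_left h1 |>.symm] at hpn
  exact hp.one_lt.ne' (Nat.dvd_one.1 hpn)

lemma nth_prime_le_of_prime_dvd_nseq {η : ℝ} {j p : ℕ} (hp : p.Prime) (h : p ∣ nseq η j) :
    Nat.nth Nat.Prime (primeLen η j) ≤ p := by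
  by_contra! hlt
  rw [← Nat.nth_count hp] at hlt
  have h2 := (Nat.nth_lt_nth Nat.infinite_setOfPred_prime).1 hlt
  have h1 : p ∣ ∏ i ∈ Finset.range (primeLen η j), Nat.nth Nat.Prime i := by
    conv_lhs => rw [← Nat.nth_count hp]
    exact Finset.dvd_prod_of_mem (Nat.nth Nat.Prime) (Finset.mem_range.2 h2)
  rw [nseq_eq, Nat.dvd_add_iff_left h1 |>.symm] at h
  exact hp.one_lt.ne' (Nat.dvd_one.1 h)

/-- Multiplicity bound for the prime factors of `n_j`. -/
lemma primeFactorsList_length_le {η : ℝ} (hη : 1 < η) (j : ℕ) :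
    (nseq η j).primeFactorsList.length ≤ primeLen η j := by
  set Z := primeLen η j with hZ
  set y := Nat.nth Nat.Prime Z with hy
  have h0 : nseq η j ≠ 0 := by rw [nseq_eq]; omega
  have hy2 : 2 ≤ y := nth_prime_pos _
  have h1 : y ^ (nseq η j).primeFactorsList.length ≤ nseq η j := by
    conv_rhs => rw [← Nat.prod_primeFactorsList h0]
    refine List.pow_card_le_prod _ _ fun p hp => ?_
    exact nth_prime_le_of_prime_dvd_nseq (Nat.prime_of_mem_primeFactorsList hp)
      (Nat.dvd_of_mem_primeFactorsList hp)
  have h2 : nseq η j < y ^ (Z + 1) := by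
    rw [nseq_eq]
    have : ∏ i ∈ Finset.range Z, Nat.nth Nat.Prime i ≤ y ^ Z := by
      calc _ ≤ ∏ i ∈ Finset.range Z, y := Finset.prod_le_prod' fun i hi =>
            (Nat.nth_monotone Nat.infinite_setOfPred_prime) (Finset.mem_range.1 hi).le
        _ = _ := by simp
    rw [pow_succ]
    have hz : 0 < Z := lt_of_lt_of_le (by positivity) (two_pow_le_primeLen hη j)
    have : 2 ≤ y ^ Z := hy2.trans (Nat.le_self_pow hz.ne' _)
    nlinarith
  have h3 := (Nat.pow_lt_pow_iff_right (by omega)).1 (h1.trans_lt h2)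
  omega

end RadiiSequence

section RoughDivisorSum

lemma sum_inv_divisors_mul_le (n p : ℕ) (hn : n ≠ 0) (hp : p.Prime) :
    ∑ a ∈ (p * n).divisors, (1 / (a : ℝ)) ≤ (1 + 1 / p) * ∑ a ∈ n.divisors, (1 / (a : ℝ)) := by
  have hp0 : (p : ℝ) ≠ 0 := by exact_mod_cast hp.ne_zero
  have hsub : (p * n).divisors ⊆ n.divisors ∪ n.divisors.image (p * ·) := by
    intro a ha
    have hd := Nat.dvd_of_mem_divisors ha
    rw [Finset.mem_union, Finset.mem_image]
    by_cases h : p ∣ a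
    · obtain ⟨c, rfl⟩ := h
      exact Or.inr ⟨c, Nat.mem_divisors.2 ⟨Nat.dvd_of_mul_dvd_mul_left hp.pos hd, hn⟩, rfl⟩
    · refine Or.inl (Nat.mem_divisors.2 ⟨?_, hn⟩)
      exact (Nat.Coprime.symm ((Nat.Prime.coprime_iff_not_dvd hp).2 h)).dvd_of_dvd_mul_left hd
  calc _ ≤ ∑ a ∈ n.divisors ∪ n.divisors.image (p * ·), (1 / (a : ℝ)) :=
        Finset.sum_le_sum_of_subset_of_nonneg hsub fun _ _ _ => by positivity
    _ ≤ ∑ a ∈ n.divisors, (1 / (a : ℝ)) + ∑ a ∈ n.divisors.image (p * ·), (1 / (a : ℝ)) := by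
        rw [← Finset.sum_union_inter]
        have : 0 ≤ ∑ a ∈ n.divisors ∩ n.divisors.image (p * ·), (1 / (a : ℝ)) :=
          Finset.sum_nonneg fun _ _ => by positivity
        linarith
    _ = _ := by
        rw [Finset.sum_image fun a _ b _ h => Nat.eq_of_mul_eq_mul_left hp.pos h, add_mul, one_mul,
          Finset.mul_sum]
        congr 1
        refine Finset.sum_congr rfl fun a _ => ?_
        push_cast; rw [one_div_mul_one_div]

lemma sum_inv_divisors_le {y : ℝ} (hy : 0 < y) (l : List ℕ) (hl : ∀ p ∈ l, p.Prime ∧ y ≤ p) :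
    ∑ a ∈ l.prod.divisors, (1 / (a : ℝ)) ≤ (1 + 1 / y) ^ l.length := by
  induction l with
  | nil => simp
  | cons p l ih =>
    have hp := hl p (by simp)
    have hl' : ∀ p ∈ l, p.Prime ∧ y ≤ p := fun p h => hl p (by simp [h])
    have h0 : l.prod ≠ 0 := List.prod_ne_zero fun h => (hl' 0 h).1.ne_zero rfl
    rw [List.prod_cons, List.length_cons, pow_succ']
    refine (sum_inv_divisors_mul_le _ _ h0 hp.1).trans ?_
    have := hp.2
    gcongr
    exact ih hl'

lemma sum_card_divisors_div_le (n : ℕ) :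
    ∑ g ∈ n.divisors, ((g.divisors.card : ℝ) / g) ≤ (∑ a ∈ n.divisors, (1 / (a : ℝ))) ^ 2 := by
  have h1 : ∀ g ∈ n.divisors, ((g.divisors.card : ℝ) / g) =
      ∑ x ∈ g.divisorsAntidiagonal, (1 / (x.1 : ℝ)) * (1 / (x.2 : ℝ)) := by
    intro g _
    rw [Finset.sum_congr rfl (g := fun _ => 1 / (g : ℝ)), Finset.sum_const, nsmul_eq_mul,
      mul_one_div, ← Nat.map_div_right_divisors, Finset.card_map]
    intro x hx
    rw [← (Nat.mem_divisorsAntidiagonal.1 hx).1]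
    push_cast; rw [one_div_mul_one_div]
  rw [Finset.sum_congr rfl h1, sq, Finset.sum_mul_sum, ← Finset.sum_product', Finset.sum_sigma']
  have hinj : Set.InjOn (fun x : (_ : ℕ) × ℕ × ℕ => x.2)
      (n.divisors.sigma fun g => g.divisorsAntidiagonal : Finset ((_ : ℕ) × ℕ × ℕ)) := by
    rintro ⟨g, x⟩ hx ⟨g', x'⟩ hx' h
    simp only [Finset.coe_sigma, Set.mem_sigma_iff, Finset.mem_coe, Nat.mem_divisorsAntidiagonal] at hx hx'
    simp only at h
    subst h
    have : g = g' := hx.2.1.symm.trans hx'.2.1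
    rw [this]
  rw [← Finset.sum_image (f := fun x : ℕ × ℕ => (1 / (x.1 : ℝ)) * (1 / (x.2 : ℝ)))
    (g := fun x : (_ : ℕ) × ℕ × ℕ => x.2) hinj]
  refine Finset.sum_le_sum_of_subset_of_nonneg ?_ fun _ _ _ => by positivity
  rintro x hx
  rw [Finset.mem_image] at hx
  obtain ⟨⟨g, x'⟩, hx, rfl⟩ := hx
  simp only [Finset.mem_sigma, Nat.mem_divisorsAntidiagonal, Nat.mem_divisors] at hx
  simp only [Finset.mem_product, Nat.mem_divisors]
  exact ⟨⟨(Dvd.intro _ hx.2.1).trans hx.1.1, hx.1.2⟩, ⟨(Dvd.intro_left _ hx.2.1).trans hx.1.1, hx.1.2⟩⟩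

lemma sum_rough_le {n : ℕ} (hn : n ≠ 0) {y : ℝ} {Z : ℕ} (hy : 0 < y) (hZy : Z ≤ y)
    (hp : ∀ p, p.Prime → p ∣ n → y ≤ p) (hZ : n.primeFactorsList.length ≤ Z) :
    ∑ g ∈ n.divisors.erase 1, ((g.divisors.card : ℝ) / g) ≤ 15 * (Z / y) := by
  have h1 := sum_inv_divisors_le hy n.primeFactorsList fun p h =>
    ⟨Nat.prime_of_mem_primeFactorsList h, hp p (Nat.prime_of_mem_primeFactorsList h)
      (Nat.dvd_of_mem_primeFactorsList h)⟩
  rw [Nat.prod_primeFactorsList hn] at h1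
  have h2 := sum_card_divisors_div_le n
  have h3 : (1 + 1 / y) ^ n.primeFactorsList.length ≤ Real.exp (Z / y) := by
    calc _ ≤ (Real.exp (1 / y)) ^ n.primeFactorsList.length := by
          gcongr
          linarith [Real.add_one_le_exp (1 / y)]
      _ = Real.exp (n.primeFactorsList.length * (1 / y)) := by rw [← Real.exp_nat_mul]
      _ ≤ Real.exp (Z * (1 / y)) := by gcongr
      _ = _ := by rw [mul_one_div]
  set S := ∑ a ∈ n.divisors, (1 / (a : ℝ))
  have hS : 0 ≤ S := Finset.sum_nonneg fun _ _ => by positivity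
  have h4 : S ^ 2 ≤ Real.exp (2 * (Z / y)) := by
    calc S ^ 2 ≤ (Real.exp (Z / y)) ^ 2 := by gcongr; exact h1.trans h3
      _ = _ := by rw [← Real.exp_nat_mul]; norm_num
  have h5 := Finset.sum_erase_add n.divisors (fun g => ((g.divisors.card : ℝ) / g)) (a := 1)
    (by simp [hn])
  have h6 : ∑ g ∈ n.divisors.erase 1, ((g.divisors.card : ℝ) / g) ≤ Real.exp (2 * (Z / y)) - 1 := by
    have : ((Nat.divisors 1).card : ℝ) / (1 : ℕ) = 1 := by simp
    linarith
  refine h6.trans ?_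
  set t := (Z : ℝ) / y with ht
  have ht0 : 0 ≤ t := by positivity
  have ht1 : t ≤ 1 := by rw [ht, div_le_one hy]; exact hZy
  have h7 : Real.exp (2 * t) * (1 - 2 * t) ≤ 1 := by
    have := Real.add_one_le_exp (-(2 * t))
    calc _ ≤ Real.exp (2 * t) * Real.exp (-(2 * t)) := by gcongr; linarith
      _ = 1 := by rw [← Real.exp_add]; simp
  have h8 : Real.exp (2 * t) ≤ 7.4 := by
    calc Real.exp (2 * t) ≤ Real.exp (2 * 1) := by gcongr
      _ = (Real.exp 1) ^ 2 := by rw [← Real.exp_nat_mul]; norm_num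
      _ ≤ _ := by have := Real.exp_one_lt_d9; have := Real.exp_pos 1; nlinarith
  nlinarith

lemma primeLen_div_nth_le (η : ℝ) (j : ℕ) (hj : 1 ≤ j) :
    (primeLen η j : ℝ) / (Nat.nth Nat.Prime (primeLen η j) : ℝ) ≤ 8 / (j : ℝ) ^ η := by
  set Z := primeLen η j with hZ
  set y := Nat.nth Nat.Prime Z with hy
  have hy2 : Z + 2 ≤ y := Nat.add_two_le_nth_prime Z
  have hyr : (2 : ℝ) ^ ((j : ℝ) ^ η) < y := by
    calc (2 : ℝ) ^ ((j : ℝ) ^ η) < Z + 1 := Nat.lt_floor_add_one _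
      _ ≤ y := by exact_mod_cast (by omega : Z + 1 ≤ y)
  have hj0 : (0 : ℝ) < j := by exact_mod_cast hj
  have hjη : 0 < (j : ℝ) ^ η := by positivity
  have hy1 : (1 : ℝ) < y := lt_trans (Real.one_lt_rpow (by norm_num) hjη) hyr
  have hlog : (j : ℝ) ^ η * Real.log 2 ≤ Real.log y := by
    rw [← Real.log_rpow (by norm_num)]
    exact Real.log_le_log (by positivity) hyr.le
  have hpi := Chebyshev.pi_le_log4_mul_div hy1
  rw [Nat.floor_natCast] at hpi
  have hZpi : (Z : ℝ) ≤ Nat.primeCounting y := by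
    have : Z ≤ Nat.primeCounting' y := by
      rw [Nat.primeCounting', hy, Nat.count_nth_of_infinite Nat.infinite_setOfPred_prime]
    exact_mod_cast this.trans (Nat.count_monotone _ (Nat.le_succ y))
  have hl0 : 0 < Real.log y := Real.log_pos hy1
  have hs : Real.log √y = Real.log y / 2 := Real.log_sqrt (by linarith)
  have hs0 : 0 < √(y : ℝ) := Real.sqrt_pos.2 (by linarith)
  have hs2 : Real.log y ≤ 2 * √y := by
    have := Real.log_le_self hs0.le
    linarith
  have hl4 : Real.log 4 ≤ 1.4 := by
    rw [show (4 : ℝ) = 2 ^ (2 : ℕ) by norm_num, Real.log_pow]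
    have := Real.log_two_lt_d9; push_cast; linarith
  have hsq : √(y : ℝ) * √y = y := Real.mul_self_sqrt (by linarith)
  have h1 : (Z : ℝ) * Real.log y ≤ 5 * y := by
    have h2 : (Z : ℝ) ≤ Real.log 4 * y / (Real.log y / 2) + √y := by rw [← hs]; exact hZpi.trans hpi
    calc (Z : ℝ) * Real.log y ≤ (Real.log 4 * y / (Real.log y / 2) + √y) * Real.log y := by gcongr
      _ = 2 * Real.log 4 * y + √y * Real.log y := by field_simp
      _ ≤ 2 * 1.4 * y + √y * (2 * √y) := by gcongr
      _ ≤ 5 * y := by nlinarith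
  have h2 : (Z : ℝ) * ((j : ℝ) ^ η * Real.log 2) ≤ 5 * y := le_trans (by gcongr) h1
  rw [div_le_div_iff₀ (by linarith) hjη]
  have := Real.log_two_gt_d9
  have h3 : 0 ≤ (Z : ℝ) * (j : ℝ) ^ η := by positivity
  nlinarith

lemma sum_divisors_nseq_le {η : ℝ} (hη : 1 < η) (j : ℕ) (hj : 1 ≤ j) :
    ∑ g ∈ (nseq η j).divisors.erase 1, ((g.divisors.card : ℝ) / g) ≤ 120 / (j : ℝ) ^ η := by
  have hy2 := Nat.add_two_le_nth_prime (primeLen η j)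
  have h := sum_rough_le (n := nseq η j) (y := Nat.nth Nat.Prime (primeLen η j)) (Z := primeLen η j)
    (by rw [nseq_eq]; omega) (by exact_mod_cast (by omega))
    (by exact_mod_cast (by omega))
    (fun p hp hd => by exact_mod_cast nth_prime_le_of_prime_dvd_nseq hp hd)
    (primeFactorsList_length_le hη j)
  refine h.trans ?_
  have := primeLen_div_nth_le η j hj
  calc _ ≤ 15 * (8 / (j : ℝ) ^ η) := by gcongr
    _ = _ := by ring

end RoughDivisorSum

section CoefficientBounds

lemma sum_Ioc_rpow_le {s : ℝ} (hs : 0 < s) {W : ℕ} (hW : 1 ≤ W) (Q : ℕ) (hQ : W ≤ Q) :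
    ∑ q ∈ Finset.Ioc W Q, (q : ℝ) ^ (-1 - s) ≤ 1 / s * ((W : ℝ) ^ (-s) - (Q : ℝ) ^ (-s)) := by
  induction Q, hQ using Nat.le_induction with
  | base => simp
  | succ Q hQ ih =>
    rw [Finset.sum_Ioc_succ_top (by omega)]
    have hQ1 : (1 : ℝ) ≤ Q := by exact_mod_cast hW.trans hQ
    set x : ℝ := ((Q + 1 : ℕ) : ℝ) with hx
    have hxQ : (Q : ℝ) = x - 1 := by rw [hx]; push_cast; ring
    have hx2 : 2 ≤ x := by linarith
    have h1 : x ^ (-s) * (1 + s / x) ≤ (Q : ℝ) ^ (-s) := by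
      have e : (Q : ℝ) = x * (1 - 1 / x) := by rw [hxQ]; field_simp
      have hpos : 0 < 1 - 1 / x := by
        rw [sub_pos, div_lt_one (by linarith)]; linarith
      rw [e, Real.mul_rpow (by linarith) hpos.le]
      gcongr
      rw [Real.rpow_def_of_pos hpos]
      refine le_trans ?_ (Real.add_one_le_exp _)
      have hl : Real.log (1 - 1 / x) ≤ - (1 / x) := by
        have := Real.log_le_sub_one_of_pos hpos; linarith
      have : s / x = -(-(1 / x) * s) := by ring
      rw [this]
      nlinarith
    have h2 : x ^ (-1 - s) = x ^ (-s) * (1 / x) := by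
      rw [sub_eq_add_neg, add_comm, Real.rpow_add (by linarith), Real.rpow_neg_one, one_div]
    have h3 : x ^ (-1 - s) ≤ 1 / s * ((Q : ℝ) ^ (-s) - x ^ (-s)) := by
      rw [h2, one_div_mul_eq_div, le_div_iff₀ hs]
      have : x ^ (-s) * (s / x) = x ^ (-s) * (1 / x) * s := by ring
      nlinarith
    calc _ ≤ 1 / s * ((W : ℝ) ^ (-s) - (Q : ℝ) ^ (-s)) + 1 / s * ((Q : ℝ) ^ (-s) - x ^ (-s)) :=
          add_le_add ih h3
      _ = _ := by ring

lemma sum_Ioc_rpow_le' {s : ℝ} (hs : 0 < s) {W : ℕ} (hW : 1 ≤ W) (Q : ℕ) :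
    ∑ q ∈ Finset.Ioc W Q, (q : ℝ) ^ (-1 - s) ≤ 1 / s * (W : ℝ) ^ (-s) := by
  rcases le_total W Q with h | h
  · refine (sum_Ioc_rpow_le hs hW Q h).trans ?_
    gcongr
    have : 0 ≤ (Q : ℝ) ^ (-s) := by positivity
    linarith
  · rw [Finset.Ioc_eq_empty (by omega), Finset.sum_empty]; positivity

lemma sum_Ioc_zero_rpow_le {s : ℝ} (hs : 0 < s) (Q : ℕ) :
    ∑ q ∈ Finset.Ioc 0 Q, (q : ℝ) ^ (-1 - s) ≤ 1 + 1 / s := by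
  rcases Nat.eq_zero_or_pos Q with rfl | hQ
  · simp; positivity
  · rw [← Finset.sum_Ioc_consecutive _ (Nat.zero_le 1) hQ]
    have := sum_Ioc_rpow_le' hs le_rfl Q
    simp at this ⊢
    linarith

/-- Bound for the normalised Gauss-sum coefficients. -/
def kap (d q n : ℕ) : ℝ :=
  if d = 4 then 5 * q.divisors.card * (q : ℝ) ^ (-9 / 8 : ℝ) * (Nat.gcd n q : ℝ) ^ (1 / 8 : ℝ)
  else 2 ^ ((d : ℝ) / 2) * (q : ℝ) ^ (1 - (d : ℝ) / 2)

lemma kap_nonneg (d q n : ℕ) : 0 ≤ kap d q n := by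
  unfold kap; split_ifs <;> positivity

lemma norm_coeff_le {d : ℕ} (q : ℕ) [NeZero q] (n : ℕ) (b : Fin d → ZMod q) :
    ‖(q : ℂ)⁻¹ ^ d * tq (n : ZMod q) b‖ ≤ kap d q n := by
  have hq : (0 : ℝ) < q := by exact_mod_cast NeZero.pos q
  rw [norm_mul, norm_pow, norm_inv, Complex.norm_natCast]
  unfold kap
  split_ifs with h
  · subst h
    have h1 := norm_tq_four_le (n : ZMod q) b
    rw [ZMod.val_natCast, ← Nat.gcd_rec, Nat.gcd_comm] at h1
    calc _ ≤ (q : ℝ)⁻¹ ^ 4 * (5 * q.divisors.card * (q : ℝ) ^ (23 / 8 : ℝ) *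
      (Nat.gcd n q : ℝ) ^ (1 / 8 : ℝ)) := by gcongr
      _ = 5 * q.divisors.card * ((q : ℝ)⁻¹ ^ 4 * (q : ℝ) ^ (23 / 8 : ℝ)) *
      (Nat.gcd n q : ℝ) ^ (1 / 8 : ℝ) := by ring
      _ = _ := by
        congr 2
        rw [inv_pow, ← Real.rpow_natCast, ← Real.rpow_neg hq.le, ← Real.rpow_add hq]
        norm_num
  · calc _ ≤ (q : ℝ)⁻¹ ^ d * (q * (2 * q : ℝ) ^ ((d : ℝ) / 2)) := by
          gcongr; exact norm_tq_le _ b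
      _ = _ := by
        rw [Real.mul_rpow (by norm_num) hq.le, inv_pow, ← Real.rpow_natCast, ← Real.rpow_neg hq.le]
        have : (q : ℝ) ^ (1 - (d : ℝ) / 2) = (q : ℝ) ^ (-(d : ℝ)) * (q * (q : ℝ) ^ ((d : ℝ) / 2)) := by
          nth_rewrite 3 [← Real.rpow_one (q : ℝ)]
          rw [← Real.rpow_add hq, ← Real.rpow_add hq]
          congr 1; ring
        rw [this]; ring

lemma card_divisors_mul_le (a b : ℕ) : (a * b).divisors.card ≤ a.divisors.card * b.divisors.card := by
  rw [Nat.divisors_mul]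
  exact Finset.card_mul_le

lemma exists_sum_kap_four_le : ∃ C : ℝ, 0 < C ∧ ∀ (n W Q : ℕ), n ≠ 0 → 1 ≤ W →
    ∑ q ∈ Finset.Ioc W Q, kap 4 q n ≤ C * ((W : ℝ) ^ (-(1 / 16) : ℝ) +
      ∑ g ∈ n.divisors.erase 1, ((g.divisors.card : ℝ) / g)) := by
  obtain ⟨C, hC1, hC⟩ := exists_card_divisors_le (ε := 1 / 16) (by norm_num)
  refine ⟨5 * C * 17, by positivity, fun n W Q hn hW => ?_⟩
  set T : ℕ → ℝ := fun q => q.divisors.card * (q : ℝ) ^ (-9 / 8 : ℝ) with hT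
  have hT0 : ∀ q, 0 ≤ T q := fun q => by positivity
  have hTle : ∀ q : ℕ, q ≠ 0 → T q ≤ C * (q : ℝ) ^ (-1 - 1 / 16 : ℝ) := by
    intro q hq
    have : (0 : ℝ) < q := by exact_mod_cast Nat.pos_of_ne_zero hq
    calc T q ≤ (C * (q : ℝ) ^ (1 / 16 : ℝ)) * (q : ℝ) ^ (-9 / 8 : ℝ) := by
          simp only [hT]; gcongr; exact hC q hq
      _ = _ := by rw [mul_assoc, ← Real.rpow_add this]; norm_num
  have hTW : ∑ q ∈ Finset.Ioc W Q, T q ≤ C * (16 * (W : ℝ) ^ (-(1 / 16) : ℝ)) := by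
    calc _ ≤ ∑ q ∈ Finset.Ioc W Q, C * (q : ℝ) ^ (-1 - 1 / 16 : ℝ) :=
          Finset.sum_le_sum fun q hq => hTle q (by have := Finset.mem_Ioc.1 hq; omega)
      _ ≤ _ := by
          rw [← Finset.mul_sum]; gcongr
          simpa using sum_Ioc_rpow_le' (s := 1 / 16) (by norm_num) hW Q
  have hT1 : ∑ q ∈ Finset.Ioc 0 Q, T q ≤ C * 17 := by
    calc _ ≤ ∑ q ∈ Finset.Ioc 0 Q, C * (q : ℝ) ^ (-1 - 1 / 16 : ℝ) :=
          Finset.sum_le_sum fun q hq => hTle q (by have := Finset.mem_Ioc.1 hq; omega)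
      _ ≤ _ := by
          rw [← Finset.mul_sum]; gcongr
          refine (sum_Ioc_zero_rpow_le (s := 1 / 16) (by norm_num) Q).trans (by norm_num)
  have key : ∀ g ∈ n.divisors, ∑ q ∈ (Finset.Ioc W Q).filter (fun q => Nat.gcd n q = g), kap 4 q n ≤
      ∑ q ∈ (Finset.Ioc W Q).filter (fun q => Nat.gcd n q = g), 5 * ((g.divisors.card : ℝ) / g) * T (q / g) := by
    intro g hg
    have hg0 : (0 : ℝ) < g := by exact_mod_cast Nat.pos_of_mem_divisors hg
    refine Finset.sum_le_sum fun q hq => ?_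
    obtain ⟨hq1, hq2⟩ := Finset.mem_filter.1 hq
    have hgq : g ∣ q := hq2 ▸ Nat.gcd_dvd_right n q
    have e : g * (q / g) = q := Nat.mul_div_cancel' hgq
    set r := q / g
    simp only [kap, if_true, hq2, hT]
    have h1 : (q : ℝ) = g * r := by rw [← e]; push_cast; ring
    have h2 : (q.divisors.card : ℝ) ≤ g.divisors.card * r.divisors.card := by
      rw [← e]; exact_mod_cast card_divisors_mul_le g r
    rw [h1, Real.mul_rpow hg0.le (by positivity)]
    have e3 : (g : ℝ) ^ (-9 / 8 : ℝ) * (g : ℝ) ^ (1 / 8 : ℝ) = 1 / g := by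
      rw [← Real.rpow_add hg0, show (-9 / 8 + 1 / 8 : ℝ) = -1 by norm_num, Real.rpow_neg_one, one_div]
    calc _ ≤ 5 * (g.divisors.card * r.divisors.card : ℝ) * ((g : ℝ) ^ (-9 / 8 : ℝ) * (r : ℝ) ^ (-9 / 8 : ℝ)) *
          (g : ℝ) ^ (1 / 8 : ℝ) := by gcongr
      _ = 5 * (g.divisors.card * r.divisors.card : ℝ) * (r : ℝ) ^ (-9 / 8 : ℝ) *
          ((g : ℝ) ^ (-9 / 8 : ℝ) * (g : ℝ) ^ (1 / 8 : ℝ)) := by ring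
      _ = _ := by rw [e3]; ring
  have hsplit : ∑ q ∈ Finset.Ioc W Q, kap 4 q n =
      ∑ g ∈ n.divisors, ∑ q ∈ (Finset.Ioc W Q).filter (fun q => Nat.gcd n q = g), kap 4 q n :=
    (Finset.sum_fiberwise_of_maps_to (fun q _ => Nat.mem_divisors.2 ⟨Nat.gcd_dvd_left n q, hn⟩) _).symm
  rw [hsplit, ← Finset.sum_erase_add _ _ (show 1 ∈ n.divisors by simp [hn])]
  have hone : ∑ q ∈ (Finset.Ioc W Q).filter (fun q => Nat.gcd n q = 1), kap 4 q n ≤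
      5 * (C * (16 * (W : ℝ) ^ (-(1 / 16) : ℝ))) := by
    refine (key 1 (by simp [hn])).trans ?_
    simp only [Nat.divisors_one, Finset.card_singleton, Nat.cast_one, div_one, mul_one, Nat.div_one]
    rw [← Finset.mul_sum]
    gcongr
    exact (Finset.sum_le_sum_of_subset_of_nonneg (Finset.filter_subset _ _) fun _ _ _ => hT0 _).trans hTW
  have hrest : ∀ g ∈ n.divisors.erase 1,
      ∑ q ∈ (Finset.Ioc W Q).filter (fun q => Nat.gcd n q = g), kap 4 q n ≤
      5 * (C * 17) * ((g.divisors.card : ℝ) / g) := by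
    intro g hg
    have hg := Finset.mem_of_mem_erase hg
    have hg0 := Nat.pos_of_mem_divisors hg
    refine (key g hg).trans ?_
    rw [← Finset.mul_sum, mul_assoc 5, mul_assoc 5, mul_comm (C * 17)]
    gcongr
    rw [← Finset.sum_image (f := T) (g := fun q => q / g)]
    · refine (Finset.sum_le_sum_of_subset_of_nonneg ?_ fun _ _ _ => hT0 _).trans hT1
      intro r hr
      obtain ⟨q, hq, rfl⟩ := Finset.mem_image.1 hr
      obtain ⟨hq1, hq2⟩ := Finset.mem_filter.1 hq
      have hgq : g ∣ q := hq2 ▸ Nat.gcd_dvd_right n q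
      rw [Finset.mem_Ioc] at hq1 ⊢
      exact ⟨Nat.div_pos (Nat.le_of_dvd (by omega) hgq) hg0, (Nat.div_le_self _ _).trans hq1.2⟩
    · intro q hq q' hq' h
      have h1 := (Finset.mem_filter.1 (Finset.mem_coe.1 hq)).2 ▸ Nat.gcd_dvd_right n q
      have h2 := (Finset.mem_filter.1 (Finset.mem_coe.1 hq')).2 ▸ Nat.gcd_dvd_right n q'
      simp only at h
      rw [← Nat.div_mul_cancel h1, ← Nat.div_mul_cancel h2, h]
  have h0 : 0 ≤ (W : ℝ) ^ (-(1 / 16) : ℝ) := by positivity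
  calc _ ≤ ∑ g ∈ n.divisors.erase 1, 5 * (C * 17) * ((g.divisors.card : ℝ) / g) +
        5 * (C * (16 * (W : ℝ) ^ (-(1 / 16) : ℝ))) := add_le_add (Finset.sum_le_sum hrest) hone
    _ ≤ _ := by
      rw [← Finset.mul_sum]
      nlinarith

end CoefficientBounds

lemma exists_forall_mul_le_two_pow (c : ℕ) : ∃ j₀ : ℕ, ∀ j, j₀ ≤ j → j * c ≤ 2 ^ j := by
  have h := tendsto_pow_const_div_const_pow_of_one_lt 1 (r := (2 : ℝ)) one_lt_two
  have h1 : ∀ᶠ j : ℕ in Filter.atTop, ((j : ℝ) ^ 1 / 2 ^ j) < 1 / (c + 1) :=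
    h.eventually_lt_const (by positivity)
  obtain ⟨j₀, hj⟩ := Filter.eventually_atTop.1 h1
  refine ⟨j₀, fun j hj' => ?_⟩
  have h2 := hj j hj'
  rw [div_lt_div_iff₀ (by positivity) (by positivity), pow_one, one_mul] at h2
  have h3 : (j : ℝ) * c ≤ 2 ^ j := by
    have : (0 : ℝ) ≤ j := by positivity
    nlinarith
  exact_mod_cast h3

lemma exists_nseq_growth {η : ℝ} (hη : 1 < η) (B : ℕ) : ∃ j₀ : ℕ, 2 ≤ j₀ ∧ ∀ l, j₀ ≤ l → ∀ j, j < l →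
    ((2 : ℝ) ^ l) ^ B * √(nseq η j) ≤ √(nseq η l) := by
  obtain ⟨j₀, h⟩ := exists_forall_mul_le_two_pow (4 * B + 4)
  refine ⟨max j₀ 2, le_max_right _ _, fun l hl j hj => ?_⟩
  have hl2 : 2 ≤ l := (le_max_right _ _).trans hl
  have h1 := h l ((le_max_left _ _).trans hl)
  have h2 := primeLen_add_two_pow_le hη (l - 1) (by omega)
  rw [Nat.sub_add_cancel (by omega)] at h2
  have h3 : 2 ^ l = 2 * 2 ^ (l - 1) := by rw [← pow_succ']; congr 1; omega
  have h4 : primeLen η j ≤ primeLen η (l - 1) := primeLen_mono hη (by omega)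
  have h5 : l * (2 * B) + 1 ≤ primeLen η l - primeLen η j := by
    have : l * (4 * B + 4) = 2 * (l * (2 * B)) + 4 * l := by ring
    omega
  have h6 := nseq_growth η (j := j) (l := l) (by omega)
  have h7 : 2 ^ (l * (2 * B)) * nseq η j ≤ nseq η l := by
    have : 2 ^ (l * (2 * B) + 1) ≤ 2 ^ (primeLen η l - primeLen η j) := Nat.pow_le_pow_right (by norm_num) h5
    have h8 : nseq η j * 2 ^ (l * (2 * B) + 1) ≤ 2 * nseq η l :=
      (Nat.mul_le_mul_left _ this).trans h6
    rw [pow_succ] at h8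
    linarith
  have h9 : ((2 : ℝ) ^ (l * B)) ^ 2 * nseq η j ≤ nseq η l := by
    rw [← pow_mul, mul_assoc, mul_comm B 2]
    exact_mod_cast h7
  rw [← pow_mul]
  refine Real.le_sqrt_of_sq_le ?_
  rwa [mul_pow, Real.sq_sqrt (by positivity)]

section LiouvilleIdentity

/-- Odd positive solutions of `ab + ce = 2n`. -/
def quadSol (n : ℤ) : Finset (ℤ × ℤ × ℤ × ℤ) :=
  (Finset.Icc 1 (2 * n) ×ˢ Finset.Icc 1 (2 * n) ×ˢ Finset.Icc 1 (2 * n) ×ˢ Finset.Icc 1 (2 * n)).filter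
    fun w => Odd w.1 ∧ Odd w.2.1 ∧ Odd w.2.2.1 ∧ Odd w.2.2.2 ∧ w.1 * w.2.1 + w.2.2.1 * w.2.2.2 = 2 * n

lemma mem_quadSol {n a b c e : ℤ} : (a, b, c, e) ∈ quadSol n ↔
    (0 < a ∧ 0 < b ∧ 0 < c ∧ 0 < e) ∧ (Odd a ∧ Odd b ∧ Odd c ∧ Odd e) ∧ a * b + c * e = 2 * n := by
  simp only [quadSol, Finset.mem_filter, Finset.mem_product, Finset.mem_Icc]
  constructor
  · rintro ⟨⟨⟨h1, -⟩, ⟨h2, -⟩, ⟨h3, -⟩, ⟨h4, -⟩⟩, h⟩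
    exact ⟨⟨by omega, by omega, by omega, by omega⟩, ⟨h.1, h.2.1, h.2.2.1, h.2.2.2.1⟩, h.2.2.2.2⟩
  · rintro ⟨⟨ha, hb, hc, he⟩, ⟨h1, h2, h3, h4⟩, h⟩
    exact ⟨⟨⟨ha, by nlinarith⟩, ⟨hb, by nlinarith⟩, ⟨hc, by nlinarith⟩, ⟨he, by nlinarith⟩⟩,
      h1, h2, h3, h4, h⟩

/-- The parametrised form of the solutions with `a > c`. -/
def paramSol (n : ℤ) : Finset (ℤ × ℤ × ℤ × ℤ) :=
  (Finset.Icc (-(2 * n)) (2 * n) ×ˢ Finset.Icc (-(2 * n)) (2 * n) ×ˢ Finset.Icc (-(2 * n)) (2 * n) ×ˢ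
    Finset.Icc (-(2 * n)) (2 * n)).filter
    fun w => 0 < w.2.1 ∧ w.2.1 < w.1 ∧ |w.2.2.2| < w.2.2.1 ∧ Odd (w.1 + w.2.1) ∧
      Odd (w.2.2.1 + w.2.2.2) ∧ w.1 * w.2.2.1 - w.2.1 * w.2.2.2 = n

lemma mem_paramSol {n x y z t : ℤ} : (x, y, z, t) ∈ paramSol n ↔
    0 < y ∧ y < x ∧ |t| < z ∧ Odd (x + y) ∧ Odd (z + t) ∧ x * z - y * t = n := by
  simp only [paramSol, Finset.mem_filter, Finset.mem_product, Finset.mem_Icc]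
  refine ⟨fun h => h.2, fun h => ⟨?_, h⟩⟩
  obtain ⟨h1, h2, h3, -, -, h4⟩ := h
  obtain ⟨h5, h6⟩ := abs_lt.1 h3
  have hz : 0 < z := (abs_nonneg t).trans_lt h3
  have k1 : (x + y) * (z - t) + (x - y) * (z + t) = 2 * n := by rw [← h4]; ring
  have k2 : x + y ≤ (x + y) * (z - t) := by nlinarith
  have k3 : z - t ≤ (x + y) * (z - t) := by nlinarith
  have k4 : z + t ≤ (x - y) * (z + t) := by nlinarith
  have k5 : 0 < (x - y) * (z + t) := by nlinarith
  have k6 : 0 < (x + y) * (z - t) := by nlinarith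
  exact ⟨⟨by omega, by omega⟩, ⟨by omega, by omega⟩, ⟨by omega, by omega⟩, ⟨by omega, by omega⟩⟩

/-- The sign of a parametrised solution. -/
def paramSign (w : ℤ × ℤ × ℤ × ℤ) : ℤ := if Even w.2.1 then 1 else -1

/-- The sign-reversing involution. -/
def paramInv (w : ℤ × ℤ × ℤ × ℤ) : ℤ × ℤ × ℤ × ℤ :=
  let u := (w.1 + w.2.1) / (2 * w.2.1)
  (2 * u * w.2.2.1 - w.2.2.2, w.2.2.1, w.2.1, 2 * u * w.2.1 - w.1)

lemma paramInv_key {n x y z t : ℤ} (h : (x, y, z, t) ∈ paramSol n) {u : ℤ}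
    (hu : u = (x + y) / (2 * y)) : (2 * u - 1) * y < x ∧ x < (2 * u + 1) * y ∧ 1 ≤ u := by
  obtain ⟨h1, h2, h3, h4, h5, h6⟩ := mem_paramSol.1 h
  have e1 := Int.mul_ediv_add_emod (x + y) (2 * y)
  have e2 := Int.emod_nonneg (x + y) (show 2 * y ≠ 0 by omega)
  have e3 := Int.emod_lt_of_pos (x + y) (show 0 < 2 * y by omega)
  rw [← hu] at e1
  set r := (x + y) % (2 * y)
  have e4 : r ≠ 0 := by
    intro hr
    rw [hr] at e1
    rw [← e1] at h4
    exact (Int.not_odd_iff_even.2 ⟨y * u, by ring⟩) h4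
  refine ⟨by nlinarith [lt_of_le_of_ne e2 (Ne.symm e4)], by nlinarith, ?_⟩
  by_contra! hlt
  have : u ≤ 0 := by omega
  nlinarith

lemma paramInv_mem {n : ℤ} {w : ℤ × ℤ × ℤ × ℤ} (h : w ∈ paramSol n) :
    paramInv w ∈ paramSol n ∧ paramInv (paramInv w) = w := by
  obtain ⟨x, y, z, t⟩ := w
  obtain ⟨k1, k2, k3⟩ := paramInv_key h rfl
  obtain ⟨h1, h2, h3, h4, h5, h6⟩ := mem_paramSol.1 h
  obtain ⟨h7, h8⟩ := abs_lt.1 h3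
  have hz : 0 < z := (abs_nonneg t).trans_lt h3
  set u := (x + y) / (2 * y) with hu
  have e : paramInv (x, y, z, t) = (2 * u * z - t, z, y, 2 * u * y - x) := rfl
  have hu' : (2 * u * z - t + z) / (2 * z) = u := by
    rw [Int.ediv_eq_iff_of_pos (by omega)]
    constructor <;> nlinarith
  rw [e]
  refine ⟨mem_paramSol.2 ⟨hz, by nlinarith, abs_lt.2 ⟨by nlinarith, by nlinarith⟩, ?_, ?_, ?_⟩, ?_⟩
  · rw [show 2 * u * z - t + z = z + t + 2 * (u * z - t) by ring]
    exact h5.add_even (even_two_mul _)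
  · rw [show y + (2 * u * y - x) = x + y + 2 * (u * y - x) by ring]
    exact h4.add_even (even_two_mul _)
  · rw [← h6]; ring
  · simp only [paramInv, hu', Prod.mk.injEq]
    refine ⟨by ring, trivial, trivial, by ring⟩

lemma sum_paramSign {n : ℤ} (hn : Odd n) : ∑ w ∈ paramSol n, paramSign w = 0 := by
  have hsign : ∀ w ∈ paramSol n, paramSign w + paramSign (paramInv w) = 0 := by
    rintro ⟨x, y, z, t⟩ h
    obtain ⟨h1, h2, h3, h4, h5, h6⟩ := mem_paramSol.1 h
    simp only [paramSign, paramInv]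
    rw [← h6] at hn
    have : Even y ↔ ¬ Even z := by
      rw [← Int.not_even_iff_odd, Int.even_sub, Int.even_mul, Int.even_mul] at hn
      rw [← Int.not_even_iff_odd, Int.even_add] at h4 h5
      tauto
    by_cases hz : Even z
    · simp [hz, this.not.2 (not_not.2 hz)]
    · simp [hz, this.2 hz]
  refine Finset.sum_involution (fun w _ => paramInv w) hsign ?_ (fun w h => (paramInv_mem h).1)
    (fun w h => (paramInv_mem h).2)
  intro w h h0 heq
  have := hsign w h
  rw [heq] at this
  omega

lemma chi_mul_chi {x y : ℤ} (h : Odd (x + y)) :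
    (ZMod.χ₄ ((x + y : ℤ) : ZMod 4)) * ZMod.χ₄ ((x - y : ℤ) : ZMod 4) = if Even y then 1 else -1 := by
  rw [← map_mul, ← Int.cast_mul, show (x + y) * (x - y) = x ^ 2 - y ^ 2 by ring]
  rcases Int.even_or_odd y with hy | hy
  · have hx : Odd x := by rw [Int.odd_add] at h; exact h.2 hy
    rw [if_pos hy]
    refine ZMod.χ₄_int_one_mod_four ?_
    have := Int.sq_mod_four_eq_one_of_odd hx
    obtain ⟨k, rfl⟩ := hy
    have : (k + k) ^ 2 = 4 * k ^ 2 := by ring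
    omega
  · have hx : Even x := by
      by_contra hx
      rw [Int.not_even_iff_odd] at hx
      exact Int.not_odd_iff_even.2 (hx.add_odd hy) h
    rw [if_neg (Int.not_even_iff_odd.2 hy)]
    refine ZMod.χ₄_int_three_mod_four ?_
    have := Int.sq_mod_four_eq_one_of_odd hy
    obtain ⟨k, rfl⟩ := hx
    have : (k + k) ^ 2 = 4 * k ^ 2 := by ring
    omega

lemma sum_quadSol_gt {n : ℤ} (hn : Odd n) :
    ∑ w ∈ (quadSol n).filter (fun w => w.2.2.1 < w.1),
      ZMod.χ₄ (w.1 : ZMod 4) * ZMod.χ₄ (w.2.2.1 : ZMod 4) = 0 := by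
  rw [← sum_paramSign hn]
  symm
  refine Finset.sum_bij (fun w _ => (w.1 + w.2.1, w.2.2.1 - w.2.2.2, w.1 - w.2.1, w.2.2.1 + w.2.2.2))
    ?_ ?_ ?_ ?_
  · rintro ⟨x, y, z, t⟩ h
    obtain ⟨h1, h2, h3, h4, h5, h6⟩ := mem_paramSol.1 h
    obtain ⟨h7, h8⟩ := abs_lt.1 h3
    rw [Finset.mem_filter, mem_quadSol]
    simp only
    refine ⟨⟨⟨by omega, by omega, by omega, by omega⟩, ⟨h4, ?_, ?_, h5⟩, ?_⟩, ?_⟩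
    · rw [show z - t = z + t - 2 * t by ring]; exact h5.sub_even (even_two_mul _)
    · rw [show x - y = x + y - 2 * y by ring]; exact h4.sub_even (even_two_mul _)
    · rw [← h6]; ring
    · omega
  · rintro ⟨x, y, z, t⟩ - ⟨x', y', z', t'⟩ - h
    simp only [Prod.mk.injEq] at h ⊢
    omega
  · rintro ⟨a, b, c, e⟩ h
    rw [Finset.mem_filter, mem_quadSol] at h
    obtain ⟨⟨⟨ha, hb, hc, he⟩, ⟨⟨a', rfl⟩, ⟨b', rfl⟩, ⟨c', rfl⟩, ⟨e', rfl⟩⟩, h⟩, hlt⟩ := h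
    simp only at hlt
    refine ⟨(a' + c' + 1, a' - c', b' + e' + 1, e' - b'), ?_, ?_⟩
    · rw [mem_paramSol]
      refine ⟨by omega, by omega, abs_lt.2 ⟨by omega, by omega⟩, ⟨a', by ring⟩, ⟨e', by ring⟩, by nlinarith⟩
    · simp only [Prod.mk.injEq]; refine ⟨by ring, by ring, by ring, by ring⟩
  · rintro ⟨x, y, z, t⟩ h
    exact (chi_mul_chi (mem_paramSol.1 h).2.2.2.1).symm

/-- The Liouville-type lower bound. -/
lemma le_sum_quadSol {n : ℤ} (hn : Odd n) (hn0 : 0 < n) :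
    n ≤ ∑ w ∈ quadSol n, ZMod.χ₄ (w.1 : ZMod 4) * ZMod.χ₄ (w.2.2.1 : ZMod 4) := by
  set F : ℤ × ℤ × ℤ × ℤ → ℤ := fun w => ZMod.χ₄ (w.1 : ZMod 4) * ZMod.χ₄ (w.2.2.1 : ZMod 4) with hF
  have h1 := sum_quadSol_gt hn
  have h2 : ∑ w ∈ (quadSol n).filter (fun w => w.1 < w.2.2.1), F w = 0 := by
    rw [← h1]
    refine Finset.sum_bij (fun w _ => (w.2.2.1, w.2.2.2, w.1, w.2.1)) ?_ ?_ ?_ ?_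
    · rintro ⟨a, b, c, e⟩ h
      rw [Finset.mem_filter, mem_quadSol] at h ⊢
      simp only at h ⊢
      obtain ⟨⟨⟨ha, hb, hc, he⟩, ⟨h1, h2, h3, h4⟩, h⟩, hlt⟩ := h
      exact ⟨⟨⟨hc, he, ha, hb⟩, ⟨h3, h4, h1, h2⟩, by linarith⟩, hlt⟩
    · rintro ⟨x, y, z, t⟩ - ⟨x', y', z', t'⟩ - h
      simp only [Prod.mk.injEq] at h ⊢
      omega
    · rintro ⟨a, b, c, e⟩ h
      rw [Finset.mem_filter, mem_quadSol] at h
      simp only at h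
      obtain ⟨⟨⟨ha, hb, hc, he⟩, ⟨h1, h2, h3, h4⟩, h⟩, hlt⟩ := h
      refine ⟨(c, e, a, b), ?_, rfl⟩
      rw [Finset.mem_filter, mem_quadSol]
      exact ⟨⟨⟨hc, he, ha, hb⟩, ⟨h3, h4, h1, h2⟩, by linarith⟩, hlt⟩
    · rintro ⟨a, b, c, e⟩ h
      exact mul_comm _ _
  have h3 : ∀ w ∈ (quadSol n).filter (fun w => w.1 = w.2.2.1), F w = 1 := by
    rintro ⟨a, b, c, e⟩ h
    rw [Finset.mem_filter, mem_quadSol] at h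
    simp only at h
    obtain ⟨⟨-, ⟨h1, -⟩, -⟩, rfl⟩ := h
    simp only [hF]
    have h5 := Int.odd_iff.1 h1
    rcases (show a % 4 = 1 ∨ a % 4 = 3 by omega) with h | h
    · rw [ZMod.χ₄_int_one_mod_four h]; rfl
    · rw [ZMod.χ₄_int_three_mod_four h]; rfl
  have hsplit : ∑ w ∈ quadSol n, F w = ∑ w ∈ (quadSol n).filter (fun w => w.2.2.1 < w.1), F w +
      (∑ w ∈ (quadSol n).filter (fun w => w.1 < w.2.2.1), F w +
      ∑ w ∈ (quadSol n).filter (fun w => w.1 = w.2.2.1), F w) := by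
    rw [Finset.sum_filter, Finset.sum_filter, Finset.sum_filter, ← Finset.sum_add_distrib,
      ← Finset.sum_add_distrib]
    refine Finset.sum_congr rfl fun w _ => ?_
    rcases lt_trichotomy w.1 w.2.2.1 with h | h | h
    · simp [h, h.not_gt, h.ne]
    · simp [h]
    · simp [h, h.not_gt, h.ne']
  rw [hsplit, h1, h2, zero_add, zero_add, Finset.sum_congr rfl h3, Finset.sum_const, nsmul_eq_mul, mul_one]
  have hc : ((Finset.Ico 0 n).image fun i => ((1, 2 * i + 1, 1, 2 * n - (2 * i + 1)) : ℤ × ℤ × ℤ × ℤ)).card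
      = n.toNat := by
    rw [Finset.card_image_of_injective, Int.card_Ico, sub_zero]
    intro i i' h
    simp only [Prod.mk.injEq] at h
    omega
  have hle : n.toNat ≤ ((quadSol n).filter (fun w => w.1 = w.2.2.1)).card := by
    rw [← hc]
    refine Finset.card_le_card ?_
    intro w hw
    obtain ⟨i, hi, rfl⟩ := Finset.mem_image.1 hw
    rw [Finset.mem_Ico] at hi
    rw [Finset.mem_filter, mem_quadSol]
    refine ⟨⟨⟨by omega, by omega, by omega, by omega⟩, ⟨odd_one, ⟨i, rfl⟩, odd_one, ⟨n - i - 1, by ring⟩⟩,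
      by ring⟩, rfl⟩
  have : (n.toNat : ℤ) = n := Int.toNat_of_nonneg hn0.le
  omega

end LiouvilleIdentity

section TwoSquares

/-- `∑_{a ∣ k} χ₄(a)`. -/
def chiSum (k : ℕ) : ℤ := ∑ a ∈ k.divisors, ZMod.χ₄ (a : ZMod 4)

lemma chiSum_mul {m n : ℕ} (h : m.Coprime n) : chiSum (m * n) = chiSum m * chiSum n := by
  open scoped Pointwise in
  rw [chiSum, Nat.divisors_mul, Finset.mul_def, Finset.sum_image h.mul_injOn_divisors,
    Finset.sum_product, chiSum, chiSum, Finset.sum_mul_sum]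
  simp only [Nat.cast_mul, map_mul]

lemma chiSum_prime_pow {p : ℕ} (hp : p.Prime) (e : ℕ) :
    chiSum (p ^ e) = ∑ i ∈ Finset.range (e + 1), ZMod.χ₄ (p : ZMod 4) ^ i := by
  rw [chiSum, Nat.sum_divisors_prime_pow hp]
  simp only [Nat.cast_pow, map_pow]

lemma isCoprime_of_norm {z w : GaussianInt} (h : IsCoprime z.norm w.norm) : IsCoprime z w := by
  have h1 : IsCoprime ((z.norm : ℤ) : GaussianInt) ((w.norm : ℤ) : GaussianInt) :=
    h.map (Int.castRingHom GaussianInt)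
  rw [Zsqrtd.norm_eq_mul_conj, Zsqrtd.norm_eq_mul_conj] at h1
  exact h1.of_mul_left_left.of_mul_right_left

lemma associated_of_dvd_of_norm_eq {z w : GaussianInt} (h : z ∣ w) (hn : z.norm = w.norm)
    (hz : z.norm ≠ 0) : Associated z w := by
  obtain ⟨u, rfl⟩ := h
  rw [Zsqrtd.norm_mul] at hn
  have : u.norm = 1 := by
    apply mul_left_cancel₀ hz
    linarith
  rw [Zsqrtd.norm_eq_one_iff' (by norm_num)] at this
  obtain ⟨u, rfl⟩ := this
  exact ⟨u, rfl⟩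

lemma exists_gaussian_mul {m n : ℕ} (hm : m ≠ 0) (hn : n ≠ 0) (h : m.Coprime n)
    {S T : Finset GaussianInt}
    (hS : ∀ z ∈ S, z.norm = m) (hS' : ∀ z ∈ S, ∀ w ∈ S, Associated z w → z = w)
    (hT : ∀ z ∈ T, z.norm = n) (hT' : ∀ z ∈ T, ∀ w ∈ T, Associated z w → z = w) :
    ∃ U : Finset GaussianInt, (∀ z ∈ U, z.norm = (m * n : ℕ)) ∧
      (∀ z ∈ U, ∀ w ∈ U, Associated z w → z = w) ∧ S.card * T.card = U.card := by
  have key : ∀ z ∈ S, ∀ z' ∈ S, ∀ w ∈ T, ∀ w' ∈ T, Associated (z * w) (z' * w') → z = z' ∧ w = w' := by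
    intro z hz z' hz' w hw w' hw' ha
    have hc : ∀ a ∈ S, ∀ b ∈ T, IsCoprime a b := fun a ha b hb => by
      apply isCoprime_of_norm
      rw [hS a ha, hT b hb]
      exact Nat.isCoprime_iff_coprime.2 h
    constructor
    · apply hS' z hz z' hz'
      refine associated_of_dvd_of_norm_eq ((hc z hz w' hw').dvd_of_dvd_mul_right
        ((dvd_mul_right z w).trans ha.dvd)) (by rw [hS z hz, hS z' hz']) ?_
      rw [hS z hz]; exact_mod_cast hm
    · apply hT' w hw w' hw'
      refine associated_of_dvd_of_norm_eq ((hc z' hz' w hw).symm.dvd_of_dvd_mul_left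
        ((dvd_mul_left w z).trans ha.dvd)) (by rw [hT w hw, hT w' hw']) ?_
      rw [hT w hw]; exact_mod_cast hn
  refine ⟨(S ×ˢ T).image fun x => x.1 * x.2, ?_, ?_, ?_⟩
  · intro z hz
    obtain ⟨⟨a, b⟩, hab, rfl⟩ := Finset.mem_image.1 hz
    rw [Finset.mem_product] at hab
    rw [Zsqrtd.norm_mul, hS _ hab.1, hT _ hab.2]
    push_cast; rfl
  · intro z hz w hw ha
    obtain ⟨⟨a, b⟩, hab, rfl⟩ := Finset.mem_image.1 hz
    obtain ⟨⟨a', b'⟩, hab', rfl⟩ := Finset.mem_image.1 hw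
    rw [Finset.mem_product] at hab hab'
    obtain ⟨h1, h2⟩ := key a hab.1 a' hab'.1 b hab.2 b' hab'.2 ha
    simp only [h1, h2]
  · rw [Finset.card_image_of_injOn, Finset.card_product]
    rintro ⟨a, b⟩ hab ⟨a', b'⟩ hab' he
    rw [Finset.mem_coe, Finset.mem_product] at hab hab'
    obtain ⟨h1, h2⟩ := key a hab.1 a' hab'.1 b hab.2 b' hab'.2 (by
      simp only at he; rw [he])
    simp only [h1, h2]

lemma isCoprime_star {a b : ℤ} {p : ℕ} (hp : p.Prime) (hp2 : p ≠ 2) (h : a ^ 2 + b ^ 2 = p) :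
    IsCoprime (⟨a, b⟩ : GaussianInt) ⟨a, -b⟩ := by
  have hpi : Prime (p : ℤ) := Nat.prime_iff_prime_int.1 hp
  have h1 : IsCoprime (p : ℤ) (2 * a) := by
    rw [hpi.irreducible.coprime_iff_not_dvd]
    intro hd
    rcases hpi.dvd_or_dvd hd with hd | hd
    · have : p ∣ 2 := by exact_mod_cast hd
      exact hp2 ((Nat.prime_dvd_prime_iff_eq hp Nat.prime_two).1 this)
    · have hb : (p : ℤ) ∣ b := by
        apply hpi.dvd_of_dvd_pow (n := 2)
        have : b ^ 2 = p - a ^ 2 := by linarith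
        rw [this]
        exact dvd_sub dvd_rfl (hd.trans (dvd_pow_self a two_ne_zero))
      have h2 : (p : ℤ) ^ 2 ∣ p := by
        have := dvd_add (pow_dvd_pow_of_dvd hd 2) (pow_dvd_pow_of_dvd hb 2)
        rwa [h] at this
      have h3 := Int.le_of_dvd (by exact_mod_cast hp.pos) h2
      have h4 : (2 : ℤ) ≤ p := by exact_mod_cast hp.two_le
      nlinarith
  obtain ⟨u, v, huv⟩ := h1
  refine ⟨(v : GaussianInt) + u * ⟨a, -b⟩, v, ?_⟩
  have e1 : (⟨a, b⟩ : GaussianInt) * ⟨a, -b⟩ = ((p : ℤ) : GaussianInt) := by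
    rw [← h]; ext <;> (simp only [Zsqrtd.re_mul, Zsqrtd.im_mul, Zsqrtd.re_intCast, Zsqrtd.im_intCast]; ring)
  have e2 : (⟨a, b⟩ : GaussianInt) + ⟨a, -b⟩ = ((2 * a : ℤ) : GaussianInt) := by
    ext
    · simp; ring
    · simp
  have e3 : ((u * p + v * (2 * a) : ℤ) : GaussianInt) = 1 := by rw [huv]; simp
  rw [Int.cast_add, Int.cast_mul, Int.cast_mul, ← e1, ← e2] at e3
  linear_combination e3

lemma exists_gaussian (k : ℕ) : 0 ≤ chiSum k ∧ ∃ S : Finset GaussianInt, (∀ z ∈ S, z.norm = k) ∧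
    (∀ z ∈ S, ∀ w ∈ S, Associated z w → z = w) ∧ chiSum k ≤ S.card := by
  induction k using Nat.recOnPrimeCoprime with
  | zero => exact ⟨by simp [chiSum], ∅, by simp, by simp, by simp [chiSum]⟩
  | prime_pow p e hp =>
    rw [chiSum_prime_pow hp]
    rcases hp.eq_two_or_odd with rfl | hodd
    · have h1 : ∑ i ∈ Finset.range (e + 1), ZMod.χ₄ ((2 : ℕ) : ZMod 4) ^ i = 1 := by
        have : ZMod.χ₄ ((2 : ℕ) : ZMod 4) = 0 := by decide
        rw [this, Finset.sum_range_succ']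
        simp
      rw [h1]
      refine ⟨zero_le_one, {(⟨1, 1⟩ : GaussianInt) ^ e}, ?_, by simp, by simp⟩
      intro z hz
      rw [Finset.mem_singleton.1 hz]
      have : ((⟨1, 1⟩ : GaussianInt) ^ e).norm = (⟨1, 1⟩ : GaussianInt).norm ^ e :=
        map_pow Zsqrtd.normMonoidHom _ _
      rw [this]
      simp [Zsqrtd.norm]
    · rcases (show p % 4 = 1 ∨ p % 4 = 3 by omega) with h | h
      · rw [ZMod.χ₄_nat_one_mod_four h]
        simp only [one_pow, Finset.sum_const, Finset.card_range, nsmul_eq_mul, mul_one]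
        refine ⟨by positivity, ?_⟩
        have : Fact p.Prime := ⟨hp⟩
        obtain ⟨a, b, hab⟩ := Nat.Prime.sq_add_sq (p := p) (by omega)
        have hco := isCoprime_star (a := a) (b := b) hp (by omega) (by exact_mod_cast hab)
        set π : GaussianInt := ⟨a, b⟩ with hπ
        set π' : GaussianInt := ⟨a, -b⟩ with hπ'
        have hn : π.norm = p := by rw [hπ, Zsqrtd.norm, ← hab]; push_cast; ring
        have hn' : π'.norm = p := by rw [hπ', Zsqrtd.norm, ← hab]; push_cast; ring
        have hnu : ¬ IsUnit π' := by
          rw [← Zsqrtd.norm_eq_one_iff' (by norm_num), hn']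
          exact_mod_cast hp.one_lt.ne'
        have h0 : ∀ z : GaussianInt, z.norm = p → z ≠ 0 := by
          rintro z hz rfl
          rw [Zsqrtd.norm_zero] at hz
          exact hp.ne_zero (by exact_mod_cast hz.symm)
        have key : ∀ i j, i < j → j ≤ e → ¬ Associated (π ^ i * π' ^ (e - i)) (π ^ j * π' ^ (e - j)) := by
          intro i j hij hj hA
          obtain ⟨t, rfl⟩ := Nat.exists_eq_add_of_lt hij
          have e1 : e - i = (t + 1) + (e - (i + t + 1)) := by omega
          rw [e1, pow_add π', show i + t + 1 = i + (t + 1) by ring, pow_add π, mul_assoc] at hA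
          have hA1 := hA.of_mul_left (Associated.refl _) (pow_ne_zero _ (h0 _ hn))
          have hA2 := hA1.of_mul_right (Associated.refl _) (pow_ne_zero _ (h0 _ hn'))
          have hc : IsCoprime (π ^ (t + 1)) (π' ^ (t + 1)) := hco.pow
          have : IsUnit (π' ^ (t + 1)) := hc.isUnit_of_dvd' hA2.dvd dvd_rfl
          exact hnu ((isUnit_pow_iff (by omega)).1 this)
        have key' : ∀ i ≤ e, ∀ j ≤ e, Associated (π ^ i * π' ^ (e - i)) (π ^ j * π' ^ (e - j)) → i = j := by
          intro i hi j hj hA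
          rcases lt_trichotomy i j with hl | hl | hl
          · exact absurd hA (key i j hl hj)
          · exact hl
          · exact absurd hA.symm (key j i hl hi)
        refine ⟨(Finset.range (e + 1)).image fun i => π ^ i * π' ^ (e - i), ?_, ?_, ?_⟩
        · intro z hz
          obtain ⟨i, hi, rfl⟩ := Finset.mem_image.1 hz
          have hi' := Finset.mem_range.1 hi
          have hpw : ∀ (z : GaussianInt) (m : ℕ), (z ^ m).norm = z.norm ^ m := fun z m =>
            map_pow Zsqrtd.normMonoidHom _ _
          rw [Zsqrtd.norm_mul, hpw, hpw, hn, hn', ← pow_add]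
          push_cast
          congr 1; omega
        · intro z hz w hw hA
          obtain ⟨i, hi, rfl⟩ := Finset.mem_image.1 hz
          obtain ⟨j, hj, rfl⟩ := Finset.mem_image.1 hw
          rw [Finset.mem_range] at hi hj
          rw [key' i (by omega) j (by omega) hA]
        · rw [Finset.card_image_of_injOn, Finset.card_range]
          intro i hi j hj hE
          rw [Finset.coe_range, Set.mem_Iio] at hi hj
          exact key' i (by omega) j (by omega) (by simp only at hE; rw [hE])
      · rw [ZMod.χ₄_nat_three_mod_four h, neg_one_geom_sum]
        by_cases he : Even e
        · rw [if_neg (by rw [Nat.not_even_iff_odd]; exact he.add_one)]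
          obtain ⟨t, rfl⟩ := he
          refine ⟨zero_le_one, {((p ^ t : ℕ) : GaussianInt)}, ?_, by simp, by simp⟩
          intro z hz
          rw [Finset.mem_singleton.1 hz, Zsqrtd.norm_natCast]
          push_cast; ring
        · rw [if_pos (Nat.not_even_iff_odd.1 he).add_one]
          exact ⟨le_rfl, ∅, by simp, by simp, by simp⟩
  | coprime a b ha hb hab iha ihb =>
    obtain ⟨ha0, S, hS, hS', hSc⟩ := iha
    obtain ⟨hb0, T, hT, hT', hTc⟩ := ihb
    obtain ⟨U, hU, hU', hUc⟩ := exists_gaussian_mul (by omega) (by omega) hab hS hS' hT hT'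
    rw [chiSum_mul hab]
    refine ⟨mul_nonneg ha0 hb0, U, hU, hU', ?_⟩
    rw [← hUc]
    push_cast
    exact mul_le_mul hSc hTc hb0 (by positivity)

lemma chiSum_nonneg (k : ℕ) : 0 ≤ chiSum k := (exists_gaussian k).1

/-- Representations of `k` as a sum of two squares. -/
def twoSq (k : ℤ) : Finset (ℤ × ℤ) :=
  (Finset.Icc (-k) k ×ˢ Finset.Icc (-k) k).filter fun w => w.1 ^ 2 + w.2 ^ 2 = k

lemma mem_twoSq {k x y : ℤ} : (x, y) ∈ twoSq k ↔ x ^ 2 + y ^ 2 = k := by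
  simp only [twoSq, Finset.mem_filter, Finset.mem_product, Finset.mem_Icc]
  refine ⟨fun h => h.2, fun h => ⟨?_, h⟩⟩
  have hx : |x| ≤ x ^ 2 := by rw [← sq_abs]; exact Int.le_self_sq _
  have hy : |y| ≤ y ^ 2 := by rw [← sq_abs]; exact Int.le_self_sq _
  have := sq_nonneg x
  have := sq_nonneg y
  exact ⟨abs_le.1 (by linarith), abs_le.1 (by linarith)⟩

lemma chiSum_le_card_twoSq (k : ℕ) : chiSum k ≤ (twoSq k).card := by
  obtain ⟨-, S, hS, -, hc⟩ := exists_gaussian k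
  refine hc.trans ?_
  have : (S.image fun z => (z.re, z.im)).card = S.card := by
    rw [Finset.card_image_of_injective]
    intro z w h
    simp only [Prod.mk.injEq] at h
    exact Zsqrtd.ext h.1 h.2
  rw [← this]
  norm_cast
  refine Finset.card_le_card fun w hw => ?_
  obtain ⟨z, hz, rfl⟩ := Finset.mem_image.1 hw
  rw [mem_twoSq, ← hS z hz, Zsqrtd.norm]
  ring

end TwoSquares

section FourSquares

/-- The lattice sphere of squared radius `n`. -/
def sph (d : ℕ) (n : ℤ) : Finset (Fin d → ℤ) :=
  (Fintype.piFinset fun _ => Finset.Icc (-n) n).filter fun x => normSqZ x = n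

lemma mem_sph {d : ℕ} {n : ℤ} {x : Fin d → ℤ} : x ∈ sph d n ↔ normSqZ x = n := by
  simp only [sph, Finset.mem_filter, Fintype.mem_piFinset, Finset.mem_Icc]
  refine ⟨fun h => h.2, fun h => ⟨fun i => ?_, h⟩⟩
  have hi : |x i| ≤ x i ^ 2 := by rw [← sq_abs]; exact Int.le_self_sq _
  have h1 : x i ^ 2 ≤ normSqZ x :=
    Finset.single_le_sum (f := fun i => x i ^ 2) (fun i _ => sq_nonneg _) (Finset.mem_univ i)
  exact abs_le.1 (by linarith)

lemma sum_quadSol (n : ℕ) :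
    ∑ w ∈ quadSol n, ZMod.χ₄ (w.1 : ZMod 4) * ZMod.χ₄ (w.2.2.1 : ZMod 4) =
      ∑ k ∈ (Finset.range (2 * n)).filter Odd, chiSum k * chiSum (2 * n - k) := by
  rw [← Finset.sum_fiberwise_of_maps_to (t := (Finset.range (2 * n)).filter Odd)
    (g := fun w : ℤ × ℤ × ℤ × ℤ => (w.1 * w.2.1).toNat)]
  · refine Finset.sum_congr rfl fun k hk => ?_
    rw [Finset.mem_filter, Finset.mem_range] at hk
    obtain ⟨hk, hodd⟩ := hk
    have hodd' : Odd (2 * n - k) := by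
      obtain ⟨t, rfl⟩ := hodd
      exact ⟨n - t - 1, by omega⟩
    have hk0 : k ≠ 0 := by rintro rfl; simp at hodd
    rw [chiSum, chiSum, Finset.sum_mul_sum, ← Finset.sum_product']
    refine Finset.sum_bij' (fun w _ => (w.1.toNat, w.2.2.1.toNat))
      (fun u _ => ((u.1 : ℤ), ((k / u.1 : ℕ) : ℤ), (u.2 : ℤ), (((2 * n - k) / u.2 : ℕ) : ℤ))) ?_ ?_ ?_ ?_ ?_
    · rintro ⟨a, b, c, e⟩ h
      rw [Finset.mem_filter, mem_quadSol] at h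
      obtain ⟨⟨⟨ha, hb, hc, he⟩, -, h⟩, hab⟩ := h
      lift a to ℕ using ha.le
      lift b to ℕ using hb.le
      lift c to ℕ using hc.le
      lift e to ℕ using he.le
      norm_cast at *
      simp only [Finset.mem_product, Nat.mem_divisors]
      simp only [Int.toNat_natCast] at hab ⊢
      exact ⟨⟨⟨b, hab.symm⟩, hk0⟩, ⟨e, by omega⟩, by omega⟩
    · rintro ⟨a, c⟩ h
      simp only [Finset.mem_product, Nat.mem_divisors] at h
      obtain ⟨⟨⟨b, hb⟩, -⟩, ⟨e, he⟩, hne⟩ := h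
      have ha0 : 0 < a := Nat.pos_of_ne_zero (by rintro rfl; simp at hb; omega)
      have hb0 : 0 < b := Nat.pos_of_ne_zero (by rintro rfl; simp at hb; omega)
      have hc0 : 0 < c := Nat.pos_of_ne_zero (by rintro rfl; simp at he; omega)
      have he0 : 0 < e := Nat.pos_of_ne_zero (by rintro rfl; simp at he; omega)
      have e1 : k / a = b := by rw [hb, Nat.mul_div_cancel_left _ ha0]
      have e2 : (2 * n - k) / c = e := by rw [he, Nat.mul_div_cancel_left _ hc0]
      rw [hb, Nat.odd_mul] at hodd
      rw [he, Nat.odd_mul] at hodd'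
      rw [Finset.mem_filter, mem_quadSol]
      simp only [e1, e2]
      norm_cast
      refine ⟨⟨⟨ha0, hb0, hc0, he0⟩, ⟨hodd.1, hodd.2, hodd'.1, hodd'.2⟩, by omega⟩, ?_⟩
      exact hb.symm
    · rintro ⟨a, b, c, e⟩ h
      rw [Finset.mem_filter, mem_quadSol] at h
      obtain ⟨⟨⟨ha, hb, hc, he⟩, -, h⟩, hab⟩ := h
      lift a to ℕ using ha.le
      lift b to ℕ using hb.le
      lift c to ℕ using hc.le
      lift e to ℕ using he.le
      norm_cast at *
      simp only [Int.toNat_natCast] at hab ⊢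
      have hab' : a * b = k := hab
      have e1 : k / a = b := by rw [← hab', Nat.mul_div_cancel_left _ ha]
      have e2 : (2 * n - k) / c = e := by
        rw [show 2 * n - k = c * e by omega, Nat.mul_div_cancel_left _ hc]
      simp only [e1, e2]
    · rintro ⟨a, c⟩ -
      simp
    · rintro ⟨a, b, c, e⟩ h
      rw [Finset.mem_filter, mem_quadSol] at h
      obtain ⟨⟨⟨ha, hb, hc, he⟩, -, h⟩, hab⟩ := h
      lift a to ℕ using ha.le
      lift c to ℕ using hc.le
      simp only [Int.toNat_natCast, Int.cast_natCast]
  · rintro ⟨a, b, c, e⟩ h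
    rw [mem_quadSol] at h
    obtain ⟨⟨ha, hb, hc, he⟩, ⟨h1, h2, -, -⟩, h⟩ := h
    have hce : 0 < c * e := mul_pos hc he
    have hab : 0 < a * b := mul_pos ha hb
    rw [Finset.mem_filter, Finset.mem_range]
    refine ⟨by simp only; omega, ?_⟩
    have := h1.mul h2
    simp only
    rw [← Int.odd_coe_nat, Int.toNat_of_nonneg hab.le]
    exact this

/-- Representations of `2n` as a sum of four squares whose first two coordinates have odd sum of
squares. -/
def oddFour (n : ℕ) : Finset (ℤ × ℤ × ℤ × ℤ) :=
  ((Finset.range (2 * n)).filter Odd).biUnion fun k =>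
    (twoSq k ×ˢ twoSq (2 * n - k : ℕ)).image fun w => (w.1.1, w.1.2, w.2.1, w.2.2)

lemma card_oddFour (n : ℕ) : (oddFour n).card =
    ∑ k ∈ (Finset.range (2 * n)).filter Odd, (twoSq k).card * (twoSq (2 * n - k : ℕ)).card := by
  rw [oddFour, Finset.card_biUnion]
  · refine Finset.sum_congr rfl fun k _ => ?_
    rw [Finset.card_image_of_injective, Finset.card_product]
    rintro ⟨⟨a, b⟩, c, e⟩ ⟨⟨a', b'⟩, c', e'⟩ h
    simp only [Prod.mk.injEq] at h ⊢
    tauto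
  · intro k _ l _ hkl
    rw [Function.onFun, Finset.disjoint_left]
    rintro ⟨a, b, c, e⟩ h1 h2
    simp only [Finset.mem_image, Finset.mem_product, Prod.exists, Prod.mk.injEq, mem_twoSq] at h1 h2
    obtain ⟨_, _, _, _, h1, rfl, rfl, rfl, rfl⟩ := h1
    obtain ⟨_, _, _, _, h2, rfl, rfl, rfl, rfl⟩ := h2
    exact hkl (by exact_mod_cast h1.1.symm.trans h2.1)

lemma mem_oddFour {n : ℕ} {a b c e : ℤ} : (a, b, c, e) ∈ oddFour n ↔
    Odd (a + b) ∧ Odd (c + e) ∧ a ^ 2 + b ^ 2 + c ^ 2 + e ^ 2 = 2 * n := by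
  simp only [oddFour, Finset.mem_biUnion, Finset.mem_filter, Finset.mem_range, Finset.mem_image,
    Finset.mem_product, Prod.exists, Prod.mk.injEq, mem_twoSq]
  have par : ∀ x y : ℤ, Odd (x ^ 2 + y ^ 2) ↔ Odd (x + y) := fun x y => by
    simp [Int.odd_add, parity_simps]
  constructor
  · rintro ⟨k, ⟨hk, hodd⟩, _, _, _, _, ⟨h1, h2⟩, rfl, rfl, rfl, rfl⟩
    push_cast [hk.le] at h2
    refine ⟨(par _ _).1 (by rw [h1]; exact_mod_cast hodd), (par _ _).1 ?_, by linarith⟩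
    rw [h2]
    obtain ⟨t, rfl⟩ := hodd
    exact ⟨(n : ℤ) - t - 1, by push_cast; ring⟩
  · rintro ⟨h1, h2, h⟩
    rw [← par] at h1 h2
    lift a ^ 2 + b ^ 2 to ℕ using by positivity with k hk
    have h3 : 0 < c ^ 2 + e ^ 2 := lt_of_le_of_ne (by positivity) fun h0 => by simp [← h0] at h2
    refine ⟨k, ⟨by omega, by exact_mod_cast h1⟩, a, b, c, e, ⟨hk.symm, ?_⟩, rfl, rfl, rfl, rfl⟩
    omega

lemma le_card_oddFour {n : ℕ} (hn : Odd n) : n ≤ (oddFour n).card := by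
  have h := le_sum_quadSol (n := n) (by exact_mod_cast hn) (by exact_mod_cast hn.pos)
  rw [sum_quadSol] at h
  rw [card_oddFour]
  zify
  refine h.trans (Finset.sum_le_sum fun k _ => ?_)
  exact mul_le_mul (chiSum_le_card_twoSq _) (chiSum_le_card_twoSq _) (chiSum_nonneg _) (by positivity)

lemma card_filter_oddFour_le (n : ℕ) :
    ((oddFour n).filter fun w => Even (w.1 + w.2.2.1)).card ≤ (sph 4 n).card := by
  refine Finset.card_le_card_of_injOn
    (fun w => ![(w.1 + w.2.2.1) / 2, (w.1 - w.2.2.1) / 2, (w.2.1 + w.2.2.2) / 2, (w.2.1 - w.2.2.2) / 2]) ?_ ?_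
  · rintro ⟨a, b, c, e⟩ h
    rw [Finset.mem_coe, Finset.mem_filter] at h
    obtain ⟨h, ⟨u, hu⟩⟩ := h
    obtain ⟨⟨s, hs⟩, ⟨t, ht⟩, h⟩ := mem_oddFour.1 h
    simp only at hu
    rw [Finset.mem_coe, mem_sph, normSqZ, Fin.sum_univ_four]
    simp only [Matrix.cons_val]
    have e1 : (a + c) / 2 = u := by omega
    have e2 : (a - c) / 2 = u - c := by omega
    have e3 : (b + e) / 2 = s + t + 1 - u := by omega
    have e4 : (b - e) / 2 = s + t + 1 - u - e := by omega
    rw [e1, e2, e3, e4]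
    have ha : a = 2 * u - c := by omega
    have hb : b = 2 * (s + t + 1 - u) - e := by omega
    rw [ha, hb] at h
    linarith
  · rintro ⟨a, b, c, e⟩ h ⟨a', b', c', e'⟩ h' heq
    rw [Finset.mem_coe, Finset.mem_filter] at h h'
    obtain ⟨h, ⟨u, hu⟩⟩ := h
    obtain ⟨⟨s, hs⟩, ⟨t, ht⟩, -⟩ := mem_oddFour.1 h
    obtain ⟨h', ⟨u', hu'⟩⟩ := h'
    obtain ⟨⟨s', hs'⟩, ⟨t', ht'⟩, -⟩ := mem_oddFour.1 h'
    have q0 := congrFun heq 0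
    have q1 := congrFun heq 1
    have q2 := congrFun heq 2
    have q3 := congrFun heq 3
    simp only [Matrix.cons_val] at q0 q1 q2 q3 hu hu'
    simp only [Prod.mk.injEq]
    omega

lemma le_two_mul_card_sph_four {n : ℕ} (hn : Odd n) : n ≤ 2 * (sph 4 n).card := by
  refine (le_card_oddFour hn).trans ?_
  rw [← Finset.card_filter_add_card_filter_not (s := oddFour n) (p := fun w => Even (w.1 + w.2.2.1)), two_mul]
  refine add_le_add (card_filter_oddFour_le n) (le_trans ?_ (card_filter_oddFour_le n))
  refine Finset.card_le_card_of_injOn (fun w => (w.1, w.2.1, w.2.2.2, w.2.2.1)) ?_ ?_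
  · rintro ⟨a, b, c, e⟩ h
    rw [Finset.mem_coe, Finset.mem_filter, mem_oddFour] at h ⊢
    obtain ⟨⟨hab, hce, h⟩, hac⟩ := h
    refine ⟨⟨hab, by rwa [add_comm], by linarith⟩, ?_⟩
    obtain ⟨u, hu⟩ := Int.not_even_iff_odd.1 hac
    obtain ⟨t, ht⟩ := hce
    simp only at hu
    exact ⟨u + t + 1 - c, by simp only; omega⟩
  · rintro ⟨a, b, c, e⟩ - ⟨a', b', c', e'⟩ - h
    simp only [Prod.mk.injEq] at h ⊢
    tauto

lemma card_sph_add_four {n : ℕ} (hn : Odd n) (k m : ℕ) (hm : 8 * k * m ^ 2 ≤ n) :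
    n * (m + 1) ^ k ≤ 4 * (sph (k + 4) n).card := by
  set Y : Finset (Fin k → ℕ) := Fintype.piFinset fun _ => Finset.range (m + 1) with hY
  have hYc : Y.card = (m + 1) ^ k := by simp [hY]
  have hYn : ∀ y ∈ Y, 4 * ∑ i, (y i) ^ 2 ≤ n ∧ 8 * ∑ i, (y i) ^ 2 ≤ n := by
    intro y hy
    rw [hY, Fintype.mem_piFinset] at hy
    have : ∑ i, (y i) ^ 2 ≤ ∑ _i : Fin k, m ^ 2 := Finset.sum_le_sum fun i _ => by
      have := Finset.mem_range.1 (hy i)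
      exact Nat.pow_le_pow_left (by omega) 2
    simp only [Finset.sum_const, Finset.card_univ, Fintype.card_fin, smul_eq_mul] at this
    constructor <;> nlinarith
  have hinj : (Y.sigma fun y => sph 4 ((n - 4 * ∑ i, (y i) ^ 2 : ℕ) : ℤ)).card ≤ (sph (k + 4) n).card := by
    refine Finset.card_le_card_of_injOn
      (fun w : (Σ _ : Fin k → ℕ, (Fin 4 → ℤ)) => Fin.append (fun i => 2 * (w.1 i : ℤ)) w.2) ?_ ?_
    · rintro ⟨y, x⟩ h
      rw [Finset.mem_coe, Finset.mem_sigma, mem_sph] at h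
      simp only at h
      rw [Finset.mem_coe, mem_sph]
      simp only [normSqZ, Fin.sum_univ_add, Fin.append_left, Fin.append_right] at h ⊢
      rw [h.2]
      have := (hYn y h.1).1
      push_cast [this]
      simp only [mul_pow, ← Finset.mul_sum]
      ring
    · rintro ⟨y, x⟩ - ⟨y', x'⟩ - h
      simp only at h
      have h1 : y = y' := by
        funext i
        have := congrFun h (Fin.castAdd 4 i)
        simp only [Fin.append_left] at this
        omega
      have h2 : x = x' := by
        funext i
        have := congrFun h (Fin.natAdd k i)
        simpa only [Fin.append_right] using this
      rw [h1, h2]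
  rw [Finset.card_sigma] at hinj
  have h4 : ∀ y ∈ Y, n ≤ 4 * (sph 4 ((n - 4 * ∑ i, (y i) ^ 2 : ℕ) : ℤ)).card := by
    intro y hy
    obtain ⟨h1, h2⟩ := hYn y hy
    have hodd : Odd (n - 4 * ∑ i, (y i) ^ 2) := by
      obtain ⟨t, rfl⟩ := hn
      exact ⟨t - 2 * ∑ i, (y i) ^ 2, by omega⟩
    have := le_two_mul_card_sph_four hodd
    omega
  calc n * (m + 1) ^ k = ∑ y ∈ Y, n := by rw [Finset.sum_const, hYc, smul_eq_mul, mul_comm]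
    _ ≤ ∑ y ∈ Y, 4 * (sph 4 ((n - 4 * ∑ i, (y i) ^ 2 : ℕ) : ℤ)).card := Finset.sum_le_sum h4
    _ ≤ _ := by rw [← Finset.mul_sum]; exact Nat.mul_le_mul_left _ hinj

lemma exists_le_card_sph (d : ℕ) (hd : 4 ≤ d) : ∃ c : ℝ, 0 < c ∧ ∀ n : ℕ, Odd n →
    c * (n : ℝ) ^ ((d : ℝ) / 2 - 1) ≤ (sph d n).card := by
  obtain ⟨k, rfl⟩ := Nat.exists_eq_add_of_le' hd
  set D : ℝ := 8 * (k + 1 : ℕ) with hD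
  have hD0 : 0 < D := by positivity
  refine ⟨(D ^ ((k : ℝ) / 2))⁻¹ / 4, by positivity, fun n hn => ?_⟩
  set m := Nat.sqrt (n / (8 * (k + 1))) with hm
  have h1 : 8 * (k + 1) * m ^ 2 ≤ n := by
    have := Nat.sqrt_le' (n / (8 * (k + 1)))
    calc 8 * (k + 1) * m ^ 2 ≤ 8 * (k + 1) * (n / (8 * (k + 1))) := Nat.mul_le_mul_left _ this
      _ ≤ n := Nat.mul_div_le _ _
  have h2 : (n : ℝ) / D ≤ (m + 1 : ℝ) ^ 2 := by
    have := Nat.succ_le_succ_sqrt' (n / (8 * (k + 1)))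
    have h3 : n < (m + 1) ^ 2 * (8 * (k + 1)) := by
      rw [← Nat.div_lt_iff_lt_mul (by positivity)]
      exact this
    rw [div_le_iff₀ hD0, hD]
    exact_mod_cast h3.le
  have h3 := card_sph_add_four hn k m (by nlinarith)
  have h4 : ((n : ℝ) / D) ^ ((k : ℝ) / 2) ≤ (m + 1 : ℝ) ^ k := by
    calc ((n : ℝ) / D) ^ ((k : ℝ) / 2) ≤ ((m + 1 : ℝ) ^ 2) ^ ((k : ℝ) / 2) :=
          Real.rpow_le_rpow (by positivity) h2 (by positivity)
      _ = (m + 1 : ℝ) ^ k := by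
          rw [← Real.rpow_natCast, ← Real.rpow_mul (by positivity), ← Real.rpow_natCast]
          congr 1; push_cast; ring
  have h5 : (n : ℝ) * (m + 1 : ℝ) ^ k ≤ 4 * (sph (k + 4) n).card := by exact_mod_cast h3
  have hn0 : (0 : ℝ) < n := by exact_mod_cast hn.pos
  have h6 : (n : ℝ) ^ (((k + 4 : ℕ) : ℝ) / 2 - 1) = n * (n : ℝ) ^ ((k : ℝ) / 2) := by
    rw [show ((k + 4 : ℕ) : ℝ) / 2 - 1 = 1 + (k : ℝ) / 2 by push_cast; ring, Real.rpow_add hn0, Real.rpow_one]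
  rw [Real.div_rpow hn0.le hD0.le] at h4
  rw [h6]
  have h7 := mul_le_mul_of_nonneg_left h4 hn0.le
  calc _ = (n * ((n : ℝ) ^ ((k : ℝ) / 2) / D ^ ((k : ℝ) / 2))) / 4 := by field_simp
    _ ≤ _ := by linarith

end FourSquares

section Theta

/-- `∑_{k ≥ 1} exp(-π k² X)`. -/
def th (X : ℝ) : ℝ := ∑' k : ℕ, Real.exp (-Real.pi * X * ((k : ℝ) + 1) ^ 2)

lemma th_term_le {X : ℝ} (hX : 0 < X) (k : ℕ) :
    Real.exp (-Real.pi * X * ((k : ℝ) + 1) ^ 2) ≤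
      Real.exp (-Real.pi * X) * Real.exp (-Real.pi * X) ^ k := by
  rw [← Real.exp_nat_mul, ← Real.exp_add]
  apply Real.exp_le_exp.2
  have : 0 < Real.pi * X := mul_pos Real.pi_pos hX
  have hk : (0 : ℝ) ≤ k := Nat.cast_nonneg k
  nlinarith [mul_nonneg this.le hk, mul_nonneg this.le (mul_nonneg hk hk)]

lemma exp_neg_pi_mul_lt_one {X : ℝ} (hX : 0 < X) : Real.exp (-Real.pi * X) < 1 := by
  rw [Real.exp_lt_one_iff]
  nlinarith [mul_pos Real.pi_pos hX]

lemma summable_th {X : ℝ} (hX : 0 < X) :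
    Summable fun k : ℕ => Real.exp (-Real.pi * X * ((k : ℝ) + 1) ^ 2) :=
  Summable.of_nonneg_of_le (fun _ => (Real.exp_pos _).le) (th_term_le hX)
    ((summable_geometric_of_lt_one (Real.exp_pos _).le (exp_neg_pi_mul_lt_one hX)).mul_left _)

lemma th_nonneg (X : ℝ) : 0 ≤ th X := tsum_nonneg fun _ => (Real.exp_pos _).le

lemma th_le {X : ℝ} (hX : 0 < X) :
    th X ≤ Real.exp (-Real.pi * X) * (1 - Real.exp (-Real.pi * X))⁻¹ := by
  rw [← tsum_geometric_of_lt_one (Real.exp_pos _).le (exp_neg_pi_mul_lt_one hX), ← tsum_mul_left]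
  exact (summable_th hX).tsum_le_tsum (th_term_le hX)
    ((summable_geometric_of_lt_one (Real.exp_pos _).le (exp_neg_pi_mul_lt_one hX)).mul_left _)

lemma th_le_two_mul {X : ℝ} (hX : 1 / 4 ≤ X) : th X ≤ 2 * Real.exp (-Real.pi * X) := by
  refine (th_le (by linarith)).trans ?_
  have h1 : Real.exp (-Real.pi * X) ≤ 1 / 2 := by
    have h2 : 2 ≤ Real.exp (Real.pi * X) := by
      have h3 : (0.78 : ℝ) ≤ Real.pi * X := by nlinarith [Real.pi_gt_d2]
      have h4 := Real.quadratic_le_exp_of_nonneg (by linarith : 0 ≤ Real.pi * X)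
      nlinarith
    rw [neg_mul, Real.exp_neg, one_div]
    exact inv_anti₀ two_pos h2
  rw [mul_comm]
  apply mul_le_mul_of_nonneg_right _ (Real.exp_pos _).le
  rw [inv_le_comm₀ (by linarith) two_pos]
  linarith

lemma hasSum_int_exp {X : ℝ} (hX : 0 < X) :
    HasSum (fun k : ℤ => Real.exp (-Real.pi * X * (k : ℝ) ^ 2)) (1 + 2 * th X) := by
  have h : HasSum (fun k : ℕ => Real.exp (-Real.pi * X * ((k : ℝ) + 1) ^ 2)) (th X) :=
    (summable_th hX).hasSum
  have h1 : HasSum (fun k : ℕ => Real.exp (-Real.pi * X * (((k : ℤ) : ℝ)) ^ 2)) (1 + th X) := by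
    have h0 : HasSum (fun k : ℕ => Real.exp (-Real.pi * X * ((((k + 1 : ℕ) : ℤ) : ℝ)) ^ 2)) (th X) := by
      refine h.congr_fun ?_
      intro k; push_cast; rfl
    have := (hasSum_nat_add_iff (f := fun k : ℕ => Real.exp (-Real.pi * X * (((k : ℤ) : ℝ)) ^ 2)) 1).1 h0
    simpa [add_comm] using this
  have h2 : HasSum (fun k : ℕ => Real.exp (-Real.pi * X * (((-((k : ℤ) + 1) : ℤ) : ℝ)) ^ 2)) (th X) := by
    refine h.congr_fun ?_
    intro k
    congr 2
    push_cast; ring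
  have h3 := HasSum.of_nat_of_neg_add_one (f := fun k : ℤ => Real.exp (-Real.pi * X * (k : ℝ) ^ 2)) h1 h2
  rwa [add_assoc, ← two_mul] at h3

lemma th_functional {X : ℝ} (hX : 0 < X) : 1 + 2 * th X = (√X)⁻¹ * (1 + 2 * th X⁻¹) := by
  have h := Real.tsum_exp_neg_mul_int_sq hX
  rw [(hasSum_int_exp hX).tsum_eq, ← Real.sqrt_eq_rpow, one_div,
    show -Real.pi / X = -Real.pi * X⁻¹ from rfl, (hasSum_int_exp (inv_pos.2 hX)).tsum_eq] at h
  exact h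

/-- The smooth cutoff `θ(X) - 2θ(4X) + 1`. -/
def cut (X : ℝ) : ℝ := 2 * th X - 4 * th (4 * X)

lemma abs_cut_sub_one_le {X : ℝ} (hX : 0 < X) (hX1 : X ≤ 1) : |cut X - 1| ≤ 32 * X := by
  have h1 := th_functional hX
  have h2 := th_functional (by linarith : 0 < 4 * X)
  have hs : √(4 * X) = 2 * √X := by
    rw [Real.sqrt_mul (by norm_num), show (4 : ℝ) = 2 ^ 2 by norm_num, Real.sqrt_sq (by norm_num)]
  rw [hs] at h2
  have hs0 : 0 < √X := Real.sqrt_pos.2 hX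
  have h3 : cut X - 1 = (√X)⁻¹ * (2 * th X⁻¹ - 2 * th (4 * X)⁻¹) := by
    have : cut X - 1 = (1 + 2 * th X) - 2 * (1 + 2 * th (4 * X)) := by unfold cut; ring
    rw [this, h1, h2, mul_inv]
    ring
  have hi : 1 / 4 ≤ (4 * X)⁻¹ := by rw [one_div]; exact inv_anti₀ (by linarith) (by linarith)
  have hi' : (4 * X)⁻¹ ≤ X⁻¹ := inv_anti₀ hX (by linarith)
  have h4 := th_le_two_mul hi
  have h5 := th_le_two_mul (hi.trans hi')
  have h6 : Real.exp (-Real.pi * X⁻¹) ≤ Real.exp (-Real.pi * (4 * X)⁻¹) :=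
    Real.exp_le_exp.2 (by nlinarith [Real.pi_pos])
  have h7 : Real.exp (-Real.pi * (4 * X)⁻¹) ≤ 4 * X ^ 2 := by
    have hu : 3 * (4 * X)⁻¹ ≤ Real.pi * (4 * X)⁻¹ :=
      mul_le_mul_of_nonneg_right Real.pi_gt_three.le (by positivity)
    have hq := Real.quadratic_le_exp_of_nonneg (x := Real.pi * (4 * X)⁻¹) (by positivity)
    rw [neg_mul, Real.exp_neg]
    refine inv_le_of_inv_le₀ (by positivity) ?_
    have : (4 * X ^ 2)⁻¹ = 4 * (4 * X)⁻¹ ^ 2 := by field_simp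
    rw [this]
    have hp : 0 < (4 * X)⁻¹ := by positivity
    nlinarith
  have h8 : |2 * th X⁻¹ - 2 * th (4 * X)⁻¹| ≤ 32 * X ^ 2 := by
    rw [abs_le]
    constructor <;> nlinarith [th_nonneg X⁻¹, th_nonneg (4 * X)⁻¹, sq_nonneg X]
  rw [h3, abs_mul, abs_of_pos (inv_pos.2 hs0)]
  calc (√X)⁻¹ * |2 * th X⁻¹ - 2 * th (4 * X)⁻¹| ≤ (√X)⁻¹ * (32 * X ^ 2) :=
        mul_le_mul_of_nonneg_left h8 (by positivity)
    _ ≤ X⁻¹ * (32 * X ^ 2) := by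
        apply mul_le_mul_of_nonneg_right _ (by positivity)
        exact inv_anti₀ hX (Real.le_sqrt_of_sq_le (by nlinarith))
    _ = 32 * X := by field_simp

lemma abs_cut_le {X : ℝ} (hX : 0 < X) : |cut X| ≤ 100 * Real.exp (-X) := by
  rcases le_total X 1 with h | h
  · have h1 := abs_cut_sub_one_le hX h
    have h2 : |cut X| ≤ 33 := by
      rw [abs_le] at h1 ⊢
      constructor <;> linarith
    have h3 : Real.exp (-1) ≤ Real.exp (-X) := Real.exp_le_exp.2 (by linarith)
    have h4 : (0.36 : ℝ) ≤ Real.exp (-1) := by have := Real.exp_neg_one_gt_d9; linarith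
    linarith
  · have h1 := th_le_two_mul (by linarith : 1 / 4 ≤ X)
    have h2 := th_le_two_mul (by linarith : 1 / 4 ≤ 4 * X)
    have h3 : Real.exp (-Real.pi * X) ≤ Real.exp (-X) :=
      Real.exp_le_exp.2 (by nlinarith [Real.pi_gt_three])
    have h4 : Real.exp (-Real.pi * (4 * X)) ≤ Real.exp (-X) :=
      Real.exp_le_exp.2 (by nlinarith [Real.pi_gt_three])
    rw [cut, abs_le]
    constructor <;> nlinarith [th_nonneg X, th_nonneg (4 * X), Real.exp_pos (-X)]

/-- The normalising constant of the delta identity. -/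
def lam (n : ℝ) : ℝ := 4 / √n * (th n⁻¹ - th (4 * n⁻¹))

lemma lam_mem {n : ℝ} (hn : 4 ≤ n) : 1 / 2 ≤ lam n ∧ lam n ≤ 3 := by
  have hn0 : 0 < n := by linarith
  have h1 := th_functional (inv_pos.2 hn0)
  have h2 := th_functional (by positivity : 0 < 4 * n⁻¹)
  have hs0 : 0 < √n := Real.sqrt_pos.2 hn0
  have hs : √(4 * n⁻¹) = 2 / √n := by
    rw [Real.sqrt_mul (by norm_num), show (4 : ℝ) = 2 ^ 2 by norm_num, Real.sqrt_sq (by norm_num),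
      Real.sqrt_inv]; rfl
  rw [Real.sqrt_inv, inv_inv, inv_inv] at h1
  rw [hs, inv_div, mul_inv, inv_inv] at h2
  have h3 : lam n = 1 + 4 * th n - 2 * th (4⁻¹ * n) := by
    have : th n⁻¹ - th (4 * n⁻¹) = ((1 + 2 * th n⁻¹) - (1 + 2 * th (4 * n⁻¹))) / 2 := by ring
    rw [lam, this, h1, h2]
    field_simp
    ring
  have h4 := th_le_two_mul (by linarith : 1 / 4 ≤ 4⁻¹ * n)
  have h5 := th_le_two_mul (by linarith : 1 / 4 ≤ n)
  have h6 : Real.exp (-Real.pi * (4⁻¹ * n)) ≤ 1 / 8 := by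
    have h7 : (8 : ℝ) ≤ Real.exp (Real.pi * (4⁻¹ * n)) := by
      have h8 : (3 : ℝ) ≤ Real.pi * (4⁻¹ * n) := by nlinarith [Real.pi_gt_three]
      have h4 := Real.quadratic_le_exp_of_nonneg (by linarith : 0 ≤ Real.pi * (4⁻¹ * n))
      nlinarith
    rw [neg_mul, Real.exp_neg, one_div]
    exact inv_anti₀ (by norm_num) h7
  have h7 : Real.exp (-Real.pi * n) ≤ Real.exp (-Real.pi * (4⁻¹ * n)) :=
    Real.exp_le_exp.2 (by nlinarith [Real.pi_pos])
  rw [h3]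
  constructor <;> nlinarith [th_nonneg n, th_nonneg (4⁻¹ * n)]

end Theta

section Delta

/-- The Gaussian `exp(-π a (1 + v²))`. -/
def gss (a v : ℝ) : ℝ := Real.exp (-Real.pi * a * (1 + v ^ 2))

lemma gss_eq (a v : ℝ) : gss a v = Real.exp (-Real.pi * a) * Real.exp (-(Real.pi * a) * v ^ 2) := by
  rw [gss, ← Real.exp_add]; congr 1; ring

lemma gss_pos (a v : ℝ) : 0 < gss a v := Real.exp_pos _

lemma integrable_gss {a : ℝ} (ha : 0 < a) : Integrable (gss a) := by
  have : gss a = fun v => Real.exp (-Real.pi * a) * Real.exp (-(Real.pi * a) * v ^ 2) := by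
    funext v; exact gss_eq a v
  rw [this]
  exact (integrable_exp_neg_mul_sq (by positivity)).const_mul _

lemma integral_gss {a : ℝ} (ha : 0 < a) : ∫ v, gss a v = Real.exp (-Real.pi * a) * (√a)⁻¹ := by
  simp_rw [gss_eq]
  rw [integral_const_mul, integral_gaussian, ← Real.sqrt_inv]
  congr 2
  field_simp

lemma continuous_eC : Continuous eC := by
  unfold eC; fun_prop

lemma integrable_mul_eC {F : ℝ → ℝ} (hF : Integrable F) (b : ℝ) :
    Integrable fun v : ℝ => (F v : ℂ) * eC (b * v) := by
  have h := hF.ofReal (𝕜 := ℂ)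
  refine h.mono ?_ ?_
  · exact h.1.mul (continuous_eC.comp (continuous_const.mul continuous_id)).aestronglyMeasurable
  · refine Filter.Eventually.of_forall fun v => ?_
    rw [norm_mul, norm_eC, mul_one]; rfl

lemma integral_gss_mul_eC {a : ℝ} (ha : 0 < a) (b : ℝ) :
    ∫ v : ℝ, (gss a v : ℂ) * eC (b * v) =
      ((Real.exp (-Real.pi * a) * (√a)⁻¹ * Real.exp (-Real.pi * (b ^ 2 / a)) : ℝ) : ℂ) := by
  have h := fourierIntegral_gaussian (b := ((Real.pi * a : ℝ) : ℂ))
    (by rw [Complex.ofReal_re]; positivity) (2 * Real.pi * b : ℝ)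
  have h1 : ∀ v : ℝ, (gss a v : ℂ) * eC (b * v) = (Real.exp (-Real.pi * a) : ℂ) *
      (Complex.exp (Complex.I * ((2 * Real.pi * b : ℝ) : ℂ) * v) *
        Complex.exp (-((Real.pi * a : ℝ) : ℂ) * (v : ℂ) ^ 2)) := by
    intro v
    rw [gss_eq, eC]
    push_cast
    rw [mul_assoc, mul_comm (Complex.exp (-(Real.pi * a) * (v : ℂ) ^ 2))]
    congr 3
    ring
  simp_rw [h1]
  rw [integral_const_mul, h]
  have h2 : (Real.pi : ℂ) / ((Real.pi * a : ℝ) : ℂ) = ((a⁻¹ : ℝ) : ℂ) := by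
    rw [← Complex.ofReal_div]; congr 1; field_simp
  have h3 : ((a⁻¹ : ℝ) : ℂ) ^ (1 / 2 : ℂ) = (((√a)⁻¹ : ℝ) : ℂ) := by
    rw [← Real.sqrt_inv, Real.sqrt_eq_rpow, Complex.ofReal_cpow (inv_nonneg.2 ha.le)]
    norm_num
  have h4 : Complex.exp (-((2 * Real.pi * b : ℝ) : ℂ) ^ 2 / (4 * ((Real.pi * a : ℝ) : ℂ))) =
      ((Real.exp (-Real.pi * (b ^ 2 / a)) : ℝ) : ℂ) := by
    rw [Complex.ofReal_exp]
    congr 1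
    have := Real.pi_ne_zero
    have hr : -(2 * Real.pi * b) ^ 2 / (4 * (Real.pi * a)) = -Real.pi * (b ^ 2 / a) := by field_simp; ring
    rw [← hr]; push_cast; ring
  rw [h2, h3, h4]
  push_cast
  ring

/-- The oscillatory integral in the delta identity. -/
def osc (N : ℝ) (q : ℕ) (h : ℤ) : ℂ :=
  ((2 / N : ℝ) : ℂ) * ∫ v : ℝ, (cut ((q : ℝ) ^ 2 / N * (1 + v ^ 2)) : ℂ) * eC (2 * h / N * v)

/-- The antisymmetric kernel appearing in the delta identity. -/
def antiK (N h D : ℝ) : ℝ :=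
  Real.exp (-Real.pi * (D ^ 2 / N)) * Real.exp (-Real.pi * (4 * h ^ 2 / (N * D ^ 2))) -
    Real.exp (-Real.pi * (4 * D ^ 2 / N)) * Real.exp (-Real.pi * (h ^ 2 / (N * D ^ 2)))

lemma abs_antiK_le {N : ℝ} (hN : 0 < N) (h D : ℝ) :
    |antiK N h D| ≤ Real.exp (-Real.pi * (D ^ 2 / N)) := by
  have hp := Real.pi_pos
  have e1 : Real.exp (-Real.pi * (4 * h ^ 2 / (N * D ^ 2))) ≤ 1 := by
    rw [Real.exp_le_one_iff, neg_mul, neg_nonpos]; positivity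
  have e2 : Real.exp (-Real.pi * (h ^ 2 / (N * D ^ 2))) ≤ 1 := by
    rw [Real.exp_le_one_iff, neg_mul, neg_nonpos]; positivity
  have e3 : Real.exp (-Real.pi * (4 * D ^ 2 / N)) ≤ Real.exp (-Real.pi * (D ^ 2 / N)) := by
    apply Real.exp_le_exp.2
    have : 0 ≤ D ^ 2 / N := by positivity
    rw [mul_div_assoc]
    nlinarith
  have h1 := Real.exp_pos (-Real.pi * (D ^ 2 / N))
  have h2 := Real.exp_pos (-Real.pi * (4 * D ^ 2 / N))
  have h3 := Real.exp_pos (-Real.pi * (4 * h ^ 2 / (N * D ^ 2)))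
  have h4 := Real.exp_pos (-Real.pi * (h ^ 2 / (N * D ^ 2)))
  rw [antiK, abs_le]
  constructor <;> nlinarith [mul_pos h1 h3, mul_pos h2 h4]

lemma antiK_swap {N : ℝ} (h : ℝ) {D D' : ℝ} (hD : D ≠ 0) (hD' : D' ≠ 0) (hh : h = D * D' ∨ h = -(D * D')) :
    antiK N h D' = -antiK N h D := by
  have hsq : h ^ 2 = D ^ 2 * D' ^ 2 := by rcases hh with rfl | rfl <;> ring
  have e1 : 4 * h ^ 2 / (N * D ^ 2) = 4 * D' ^ 2 / N := by rw [hsq]; field_simp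
  have e2 : 4 * h ^ 2 / (N * D' ^ 2) = 4 * D ^ 2 / N := by rw [hsq]; field_simp
  have e3 : h ^ 2 / (N * D ^ 2) = D' ^ 2 / N := by rw [hsq]; field_simp
  have e4 : h ^ 2 / (N * D' ^ 2) = D ^ 2 / N := by rw [hsq]; field_simp
  rw [antiK, antiK, e1, e2, e3, e4]
  ring

lemma hasSum_osc {N : ℝ} (hN : 0 < N) {q : ℕ} (hq : q ≠ 0) (h : ℤ) :
    HasSum (fun k : ℕ => ((4 / √N / (q * ((k : ℝ) + 1)) * antiK N h (q * ((k : ℝ) + 1)) : ℝ) : ℂ))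
      (osc N q h) := by
  have hq0 : (0 : ℝ) < q := by positivity
  have hsN : 0 < √N := Real.sqrt_pos.2 hN
  set F : ℕ → ℝ → ℂ := fun k v =>
    2 * ((gss ((q * ((k : ℝ) + 1)) ^ 2 / N) v : ℂ) * eC (2 * h / N * v)) -
      4 * ((gss (4 * ((q * ((k : ℝ) + 1)) ^ 2 / N)) v : ℂ) * eC (2 * h / N * v)) with hF
  have ha : ∀ k : ℕ, 0 < (q * ((k : ℝ) + 1)) ^ 2 / N := fun k => by positivity
  have hs : ∀ k : ℕ, √((q * ((k : ℝ) + 1)) ^ 2 / N) = q * ((k : ℝ) + 1) / √N := fun k => by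
    rw [Real.sqrt_div (by positivity), Real.sqrt_sq (by positivity)]
  have hs4 : ∀ k : ℕ, √(4 * ((q * ((k : ℝ) + 1)) ^ 2 / N)) = 2 * (q * ((k : ℝ) + 1) / √N) := fun k => by
    rw [Real.sqrt_mul (by norm_num), hs, show (4 : ℝ) = 2 ^ 2 by norm_num, Real.sqrt_sq (by norm_num)]
  have h_int : ∀ k, Integrable (F k) := fun k =>
    ((integrable_mul_eC (integrable_gss (ha k)) _).const_mul 2).sub
      ((integrable_mul_eC (integrable_gss (mul_pos (by norm_num) (ha k))) _).const_mul 4)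
  have hnorm : ∀ k, ∫ v, ‖F k v‖ ≤ 4 * √N / q * Real.exp (-Real.pi * ((q : ℝ) ^ 2 / N) * ((k : ℝ) + 1) ^ 2) := by
    intro k
    have h1 : ∫ v, ‖F k v‖ ≤ ∫ v, (2 * gss ((q * ((k : ℝ) + 1)) ^ 2 / N) v +
        4 * gss (4 * ((q * ((k : ℝ) + 1)) ^ 2 / N)) v) := by
      refine integral_mono (h_int k).norm (((integrable_gss (ha k)).const_mul 2).add
        ((integrable_gss (mul_pos (by norm_num) (ha k))).const_mul 4)) fun v => ?_
      refine (norm_sub_le _ _).trans (le_of_eq ?_)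
      simp only [norm_mul, norm_eC, Complex.norm_real, Real.norm_eq_abs, abs_of_pos (gss_pos _ _)]
      norm_num
    refine h1.trans ?_
    rw [integral_add ((integrable_gss (ha k)).const_mul 2)
      ((integrable_gss (mul_pos (by norm_num) (ha k))).const_mul 4), integral_const_mul,
      integral_const_mul, integral_gss (ha k), integral_gss (mul_pos (by norm_num) (ha k)), hs, hs4]
    have e1 : Real.exp (-Real.pi * (4 * ((q * ((k : ℝ) + 1)) ^ 2 / N))) ≤
        Real.exp (-Real.pi * ((q * ((k : ℝ) + 1)) ^ 2 / N)) :=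
      Real.exp_le_exp.2 (by nlinarith [mul_pos Real.pi_pos (ha k)])
    have e2 : -Real.pi * ((q : ℝ) ^ 2 / N) * ((k : ℝ) + 1) ^ 2 =
        -Real.pi * ((q * ((k : ℝ) + 1)) ^ 2 / N) := by ring
    rw [e2]
    have e3 : (q * ((k : ℝ) + 1) / √N)⁻¹ ≤ √N / q := by
      rw [inv_div]
      exact div_le_div_of_nonneg_left hsN.le hq0 (le_mul_of_one_le_right hq0.le (by linarith [Nat.cast_nonneg (α := ℝ) k]))
    have e4 : (0 : ℝ) < (q * ((k : ℝ) + 1) / √N)⁻¹ := by positivity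
    rw [mul_inv]
    have e5 := Real.exp_pos (-Real.pi * ((q * ((k : ℝ) + 1)) ^ 2 / N))
    have e6 := mul_le_mul e1 le_rfl e4.le e5.le
    have e7 := mul_le_mul_of_nonneg_left e3 e5.le
    rw [show 4 * √N / q = 4 * (√N / q) by ring]
    nlinarith
  have hsum : Summable fun k => ∫ v, ‖F k v‖ :=
    Summable.of_nonneg_of_le (fun k => integral_nonneg fun v => norm_nonneg _) hnorm
      ((summable_th (by positivity)).mul_left _)
  have key := (hasSum_integral_of_summable_integral_norm h_int hsum).mul_left ((2 / N : ℝ) : ℂ)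
  have hval : ((2 / N : ℝ) : ℂ) * ∫ v, (∑' k, F k v) = osc N q h := by
    rw [osc]
    congr 2
    funext v
    have hX : 0 < (q : ℝ) ^ 2 / N * (1 + v ^ 2) := by positivity
    have h1 : HasSum (fun k : ℕ => Real.exp (-Real.pi * ((q : ℝ) ^ 2 / N * (1 + v ^ 2)) * ((k : ℝ) + 1) ^ 2))
      (th ((q : ℝ) ^ 2 / N * (1 + v ^ 2))) := (summable_th hX).hasSum
    have h2 : HasSum (fun k : ℕ => Real.exp (-Real.pi * (4 * ((q : ℝ) ^ 2 / N * (1 + v ^ 2))) * ((k : ℝ) + 1) ^ 2))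
      (th (4 * ((q : ℝ) ^ 2 / N * (1 + v ^ 2)))) := (summable_th (by positivity)).hasSum
    have h3 := (Complex.hasSum_ofReal.2 ((h1.mul_left 2).sub (h2.mul_left 4))).mul_right (eC (2 * h / N * v))
    rw [← cut] at h3
    rw [← h3.tsum_eq]
    congr 1
    funext k
    rw [hF]
    simp only [gss]
    have e1 : -Real.pi * ((q * ((k : ℝ) + 1)) ^ 2 / N) * (1 + v ^ 2) =
      -Real.pi * ((q : ℝ) ^ 2 / N * (1 + v ^ 2)) * ((k : ℝ) + 1) ^ 2 := by ring
    have e2 : -Real.pi * (4 * ((q * ((k : ℝ) + 1)) ^ 2 / N)) * (1 + v ^ 2) =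
      -Real.pi * (4 * ((q : ℝ) ^ 2 / N * (1 + v ^ 2))) * ((k : ℝ) + 1) ^ 2 := by ring
    rw [e1, e2]
    push_cast
    ring
  rw [hval] at key
  refine key.congr_fun fun k => ?_
  rw [hF]
  simp only
  rw [integral_sub ((integrable_mul_eC (integrable_gss (ha k)) _).const_mul 2)
      ((integrable_mul_eC (integrable_gss (mul_pos (by norm_num) (ha k))) _).const_mul 4), integral_const_mul,
      integral_const_mul, integral_gss_mul_eC (ha k), integral_gss_mul_eC (mul_pos (by norm_num) (ha k)),
      hs, hs4, antiK]
  have hk0 : (0 : ℝ) < (k : ℝ) + 1 := by positivity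
  set D : ℝ := q * ((k : ℝ) + 1) with hD
  have hD0 : 0 < D := by positivity
  have e1 : (2 * (h : ℝ) / N) ^ 2 / (D ^ 2 / N) = 4 * (h : ℝ) ^ 2 / (N * D ^ 2) := by field_simp; ring
  have e2 : (2 * (h : ℝ) / N) ^ 2 / (4 * (D ^ 2 / N)) = (h : ℝ) ^ 2 / (N * D ^ 2) := by field_simp; ring
  have e3 : 4 * (D ^ 2 / N) = 4 * D ^ 2 / N := by ring
  rw [e1, e2, e3]
  have hNN : N = √N * √N := (Real.mul_self_sqrt hN.le).symm
  norm_cast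
  generalize Real.exp (-Real.pi * (D ^ 2 / N)) = A
  generalize Real.exp (-Real.pi * (4 * (h : ℝ) ^ 2 / (N * D ^ 2))) = B
  generalize Real.exp (-Real.pi * (4 * D ^ 2 / N)) = A'
  generalize Real.exp (-Real.pi * ((h : ℝ) ^ 2 / (N * D ^ 2))) = B'
  have : (2 / N) = 2 / (√N * √N) := by rw [← hNN]
  rw [this]
  field_simp
  ring

end Delta

section DeltaSum

lemma hasSum_pnat {f : ℕ → ℂ} {a : ℂ} (h : HasSum (fun k : ℕ => f (k + 1)) a) :
    HasSum (fun k : ℕ+ => f k) a := by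
  rw [← Equiv.pnatEquivNat.symm.hasSum_iff]
  exact h

lemma hasSum_of_pnat {f : ℕ → ℂ} {a : ℂ} (h : HasSum (fun k : ℕ+ => f k) a) :
    HasSum (fun k : ℕ => f (k + 1)) a := by
  rw [← Equiv.pnatEquivNat.symm.hasSum_iff] at h
  exact h

lemma summable_exp_pnat {a : ℝ} (ha : 0 < a) : Summable fun k : ℕ+ => Real.exp (-a * (k : ℝ)) := by
  have h : Summable fun k : ℕ => Real.exp (-a * (k : ℝ)) := by
    have := summable_geometric_of_lt_one (Real.exp_pos (-a)).le (Real.exp_lt_one_iff.2 (by linarith))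
    refine this.congr fun k => ?_
    rw [← Real.exp_nat_mul, mul_comm]
  exact h.comp_injective PNat.coe_injective

/-- The double series behind the delta identity. -/
def dbl (N : ℝ) (h : ℤ) (x : ℕ+ × ℕ+) : ℂ :=
  ramanujanSum x.1 h * ((4 / √N / ((x.1 : ℕ) * (x.2 : ℕ)) *
    antiK N h ((x.1 : ℕ) * (x.2 : ℕ)) : ℝ) : ℂ)

lemma summable_dbl {N : ℝ} (hN : 0 < N) (h : ℤ) : Summable (dbl N h) := by
  have hp : 0 < Real.pi / N := div_pos Real.pi_pos hN
  have hs := ((summable_exp_pnat hp).mul_of_nonneg (summable_exp_pnat hp)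
    (fun _ => (Real.exp_pos _).le) (fun _ => (Real.exp_pos _).le)).mul_left
    (4 / √N * Real.exp (Real.pi / N))
  refine Summable.of_norm_bounded hs fun x => ?_
  obtain ⟨q, k⟩ := x
  have hq : (1 : ℝ) ≤ (q : ℕ) := by exact_mod_cast q.2
  have hk : (1 : ℝ) ≤ (k : ℕ) := by exact_mod_cast k.2
  rw [dbl, norm_mul, Complex.norm_real, Real.norm_eq_abs, abs_mul]
  simp only
  have h1 := norm_ramanujanSum_le q h
  have h2 := abs_antiK_le hN h ((q : ℕ) * (k : ℕ))
  have h3 : Real.exp (-Real.pi * (((q : ℕ) * (k : ℕ) : ℝ) ^ 2 / N)) ≤ Real.exp (Real.pi / N) *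
      (Real.exp (-(Real.pi / N) * (q : ℕ)) * Real.exp (-(Real.pi / N) * (k : ℕ))) := by
    rw [← Real.exp_add, ← Real.exp_add]
    apply Real.exp_le_exp.2
    have h4 : (q : ℕ) + (k : ℕ) - 1 ≤ (((q : ℕ) * (k : ℕ) : ℝ)) ^ 2 := by
      nlinarith [mul_nonneg (sub_nonneg.2 hq) (sub_nonneg.2 hk)]
    have h5 := mul_le_mul_of_nonneg_left h4 hp.le
    have h6 : -Real.pi * (((q : ℕ) * (k : ℕ) : ℝ) ^ 2 / N) =
      -(Real.pi / N * (((q : ℕ) * (k : ℕ) : ℝ) ^ 2)) := by ring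
    rw [h6]
    linarith
  have hsN : 0 < √N := Real.sqrt_pos.2 hN
  rw [abs_of_pos (by positivity : (0 : ℝ) < 4 / √N / ((q : ℕ) * (k : ℕ)))]
  calc _ ≤ ((q : ℕ) : ℝ) * (4 / √N / ((q : ℕ) * (k : ℕ)) * Real.exp (-Real.pi * (((q : ℕ) * (k : ℕ) : ℝ) ^ 2 / N))) := by
        gcongr
    _ = 4 / √N * (1 / (k : ℕ)) * Real.exp (-Real.pi * (((q : ℕ) * (k : ℕ) : ℝ) ^ 2 / N)) := by
        field_simp
    _ ≤ 4 / √N * 1 * (Real.exp (Real.pi / N) *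
      (Real.exp (-(Real.pi / N) * (q : ℕ)) * Real.exp (-(Real.pi / N) * (k : ℕ)))) := by
        gcongr
        rw [div_le_one (by linarith)]
        exact hk
    _ = _ := by ring

lemma hasSum_dbl_fiber {N : ℝ} (h : ℤ) {S : ℂ} (hS : HasSum (dbl N h) S) :
    HasSum (fun D : ℕ+ => if ((D : ℕ) : ℤ) ∣ h then ((4 / √N * antiK N h (D : ℕ) : ℝ) : ℂ) else 0)
      S := by
  have h1 := (sigmaAntidiagonalEquivProd.hasSum_iff).2 hS
  refine h1.sigma fun D => ?_
  have h2 : (if ((D : ℕ) : ℤ) ∣ h then ((4 / √N * antiK N h (D : ℕ) : ℝ) : ℂ) else 0) =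
      ∑ x : Nat.divisorsAntidiagonal D, (dbl N h ∘ sigmaAntidiagonalEquivProd) ⟨D, x⟩ := by
    have h3 : ∀ x : Nat.divisorsAntidiagonal D, (dbl N h ∘ sigmaAntidiagonalEquivProd) ⟨D, x⟩ =
        ramanujanSum x.1.1 h * ((4 / √N / (D : ℕ) * antiK N h (D : ℕ) : ℝ) : ℂ) := by
      rintro ⟨⟨q, k⟩, hx⟩
      have hx' := (Nat.mem_divisorsAntidiagonal.1 hx).1
      simp only at hx'
      simp only [Function.comp, dbl]
      have e1 : (((sigmaAntidiagonalEquivProd ⟨D, ⟨(q, k), hx⟩⟩).1 : ℕ+) : ℕ) = q := rfl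
      have e2 : (((sigmaAntidiagonalEquivProd ⟨D, ⟨(q, k), hx⟩⟩).2 : ℕ+) : ℕ) = k := rfl
      rw [e1, e2, ← Nat.cast_mul, hx']
    rw [Finset.sum_congr rfl fun x _ => h3 x, ← Finset.sum_mul,
      Finset.sum_coe_sort (Nat.divisorsAntidiagonal D) (fun x => ramanujanSum x.1 h),
      Nat.sum_divisorsAntidiagonal (fun q _ => ramanujanSum q h), sum_ramanujanSum _ D.ne_zero]
    split_ifs
    · have : ((D : ℕ) : ℂ) ≠ 0 := by exact_mod_cast D.ne_zero
      push_cast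
      field_simp
    · rw [zero_mul]
  rw [h2]
  exact hasSum_fintype _

lemma hasSum_dbl_left {N : ℝ} (hN : 0 < N) (h : ℤ) (q : ℕ+) :
    HasSum (fun k : ℕ+ => dbl N h (q, k)) (ramanujanSum q h * osc N q h) := by
  have h2 := hasSum_osc hN q.ne_zero h
  have h3 : HasSum (fun k : ℕ+ => ((4 / √N / ((q : ℕ) * (k : ℕ)) *
      antiK N h ((q : ℕ) * (k : ℕ)) : ℝ) : ℂ)) (osc N q h) := by
    refine hasSum_pnat (f := fun k => ((4 / √N / ((q : ℕ) * (k : ℕ)) *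
      antiK N h ((q : ℕ) * (k : ℕ)) : ℝ) : ℂ)) ?_
    refine h2.congr_fun fun k => ?_
    push_cast; rfl
  exact h3.mul_left (ramanujanSum q h)

lemma sum_dbl_zero {N : ℝ} (hN : 0 < N) {S : ℂ} (hS : HasSum (dbl N 0) S) : S = (lam N : ℂ) := by
  have h3 := hasSum_dbl_fiber 0 hS
  have h3' : HasSum (fun D : ℕ+ => ((4 / √N * antiK N (0 : ℤ) (D : ℕ) : ℝ) : ℂ)) S := by
    refine h3.congr_fun fun D => ?_
    rw [if_pos (dvd_zero _)]
  have h4 := hasSum_of_pnat (f := fun D => ((4 / √N * antiK N (0 : ℤ) (D : ℕ) : ℝ) : ℂ)) h3'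
  refine h4.unique ?_
  rw [Complex.hasSum_ofReal, lam]
  refine HasSum.mul_left _ ?_
  have h5 : HasSum (fun k : ℕ => Real.exp (-Real.pi * N⁻¹ * ((k : ℝ) + 1) ^ 2)) (th N⁻¹) :=
    (summable_th (inv_pos.2 hN)).hasSum
  have h6 : HasSum (fun k : ℕ => Real.exp (-Real.pi * (4 * N⁻¹) * ((k : ℝ) + 1) ^ 2)) (th (4 * N⁻¹)) :=
    (summable_th (by positivity)).hasSum
  refine (h5.sub h6).congr_fun fun k => ?_
  rw [antiK]
  push_cast
  simp only [ne_eq, OfNat.ofNat_ne_zero, not_false_eq_true, zero_pow, mul_zero, zero_div, Real.exp_zero,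
    mul_one]
  congr 2 <;> ring

/-- The summand over divisors, extended by zero. -/
def divTerm (N : ℝ) (h : ℤ) (D : ℕ) : ℂ :=
  if D = 0 then 0 else if (D : ℤ) ∣ h then ((4 / √N * antiK N h (D : ℕ) : ℝ) : ℂ) else 0

lemma sum_dbl_ne_zero {N : ℝ} {h : ℤ} (h0 : h ≠ 0) {S : ℂ} (hS : HasSum (dbl N h) S) : S = 0 := by
  have h3 := hasSum_dbl_fiber h hS
  have h3' : HasSum (fun D : ℕ+ => divTerm N h D) S := by
    refine h3.congr_fun fun D => ?_
    rw [divTerm, if_neg D.ne_zero]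
  have h4 := hasSum_of_pnat (f := divTerm N h) h3'
  have h5 : HasSum (divTerm N h) S := by
    have := (hasSum_nat_add_iff (f := divTerm N h) 1).1 h4
    rwa [Finset.sum_range_one, show divTerm N h 0 = 0 from if_pos rfl, add_zero] at this
  have hne : h.natAbs ≠ 0 := Int.natAbs_ne_zero.2 h0
  have h6 : HasSum (divTerm N h) (∑ D ∈ h.natAbs.divisors, divTerm N h D) := by
    refine hasSum_sum_of_ne_finset_zero fun D hD => ?_
    rw [divTerm]
    by_cases hD0 : D = 0
    · rw [if_pos hD0]
    · rw [if_neg hD0, if_neg]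
      intro hdv
      exact hD (Nat.mem_divisors.2 ⟨Int.natCast_dvd.1 hdv, hne⟩)
  have h6' : ∑ D ∈ h.natAbs.divisors, divTerm N h D =
      ((4 / √N * ∑ D ∈ h.natAbs.divisors, antiK N h (D : ℕ) : ℝ) : ℂ) := by
    rw [Finset.mul_sum, Complex.ofReal_sum]
    refine Finset.sum_congr rfl fun D hD => ?_
    have hd := Nat.mem_divisors.1 hD
    rw [divTerm, if_neg (by rintro rfl; exact hne (by simpa using hd.1)),
      if_pos (Int.natCast_dvd.2 hd.1)]
  have h7 : ∑ D ∈ h.natAbs.divisors, antiK N h (D : ℕ) = - ∑ D ∈ h.natAbs.divisors, antiK N h (D : ℕ) := by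
    conv_lhs => rw [← Nat.sum_div_divisors]
    rw [← Finset.sum_neg_distrib]
    refine Finset.sum_congr rfl fun D hD => ?_
    obtain ⟨⟨k, hk⟩, -⟩ := Nat.mem_divisors.1 hD
    have hD0 : D ≠ 0 := by rintro rfl; rw [zero_mul] at hk; exact hne hk
    have hk0 : k ≠ 0 := by rintro rfl; rw [mul_zero] at hk; exact hne hk
    have e1 : h.natAbs / D = k := by rw [hk, Nat.mul_div_cancel_left _ (Nat.pos_of_ne_zero hD0)]
    rw [e1]
    refine antiK_swap _ (by exact_mod_cast hD0) (by exact_mod_cast hk0) ?_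
    have hk' : ((h.natAbs : ℤ) : ℝ) = (D : ℝ) * k := by rw [hk]; push_cast; rfl
    rcases Int.natAbs_eq h with h' | h'
    · left; rw [← hk', ← h']
    · right; rw [← hk', h']; push_cast; simp
  have h8 : ∑ D ∈ h.natAbs.divisors, antiK N h (D : ℕ) = 0 := by linarith
  rw [h5.unique h6, h6', h8, mul_zero, Complex.ofReal_zero]

/-- The delta identity detecting `h = 0` through Ramanujan sums. -/
lemma hasSum_delta {N : ℝ} (hN : 0 < N) (h : ℤ) :
    HasSum (fun q : ℕ => ramanujanSum (q + 1) h * osc N (q + 1) h) (if h = 0 then (lam N : ℂ) else 0) := by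
  obtain ⟨S, hS⟩ := summable_dbl hN h
  have h1 : HasSum (fun q : ℕ+ => ramanujanSum q h * osc N q h) S :=
    hS.prod_fiberwise (hasSum_dbl_left hN h)
  have h2 := hasSum_of_pnat (f := fun q => ramanujanSum q h * osc N q h) h1
  have h3 : (if h = 0 then (lam N : ℂ) else 0) = S := by
    by_cases h0 : h = 0
    · subst h0
      rw [if_pos rfl, sum_dbl_zero hN hS]
    · rw [if_neg h0, sum_dbl_ne_zero h0 hS]
  rw [h3]
  exact h2

end DeltaSum

section Theta

lemma th_le_inv {X : ℝ} (hX : 0 < X) : th X ≤ 1 / (Real.pi * X) := by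
  have hp : 0 < Real.pi * X := mul_pos Real.pi_pos hX
  set r := Real.exp (-(Real.pi * X)) with hr
  have hr0 : 0 < r := Real.exp_pos _
  have hr1 : r < 1 := Real.exp_lt_one_iff.2 (by linarith)
  have hg : HasSum (fun k : ℕ => r ^ (k + 1)) (r / (1 - r)) := by
    simpa [pow_succ', div_eq_mul_inv] using (hasSum_geometric_of_lt_one hr0.le hr1).mul_left r
  have h1 : th X ≤ r / (1 - r) := by
    refine hasSum_le (fun k => ?_) (summable_th hX).hasSum hg
    rw [hr, ← Real.exp_nat_mul]
    apply Real.exp_le_exp.2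
    have : ((k : ℝ) + 1) ≤ ((k : ℝ) + 1) ^ 2 := by nlinarith [Nat.cast_nonneg (α := ℝ) k]
    push_cast
    nlinarith
  refine h1.trans ?_
  rw [div_le_div_iff₀ (by linarith) hp]
  have h2 := Real.add_one_le_exp (Real.pi * X)
  have h3 : r * Real.exp (Real.pi * X) = 1 := by rw [hr, ← Real.exp_add]; simp
  nlinarith

lemma summable_nat_gauss {s : ℝ} (hs : 0 < s) :
    HasSum (fun m : ℕ => Real.exp (-Real.pi * s * (m : ℝ) ^ 2)) (1 + th s) := by
  have h := (summable_th hs).hasSum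
  have h2 := (hasSum_nat_add_iff (f := fun m : ℕ => Real.exp (-Real.pi * s * (m : ℝ) ^ 2))
    (g := th s) 1).1 (h.congr_fun fun k => by push_cast; rfl)
  simpa [add_comm] using h2

lemma gauss_shift_nat {s : ℝ} (hs : 0 < s) (t : ℝ) (m : ℕ) :
    Real.exp (-Real.pi * s * (((⌊t⌋ + 1 + (m : ℤ) : ℤ) : ℝ) - t) ^ 2) ≤
      Real.exp (-Real.pi * s * (m : ℝ) ^ 2) ∧
    Real.exp (-Real.pi * s * (((⌊t⌋ + 1 + (-((m : ℤ) + 1)) : ℤ) : ℝ) - t) ^ 2) ≤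
      Real.exp (-Real.pi * s * (m : ℝ) ^ 2) := by
  have hp := mul_pos Real.pi_pos hs
  have h1 := Int.floor_le t
  have h2 := Int.lt_floor_add_one t
  have hm := Nat.cast_nonneg (α := ℝ) m
  constructor
  · apply Real.exp_le_exp.2
    push_cast
    have : (m : ℝ) ^ 2 ≤ ((⌊t⌋ : ℝ) + 1 + m - t) ^ 2 := pow_le_pow_left₀ hm (by linarith) 2
    nlinarith
  · apply Real.exp_le_exp.2
    push_cast
    have : (m : ℝ) ^ 2 ≤ ((⌊t⌋ : ℝ) + 1 + -((m : ℝ) + 1) - t) ^ 2 := by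
      rw [← neg_sq ((⌊t⌋ : ℝ) + 1 + -((m : ℝ) + 1) - t)]
      exact pow_le_pow_left₀ hm (by linarith) 2
    nlinarith

lemma summable_shift_gauss {s : ℝ} (hs : 0 < s) (t : ℝ) :
    Summable fun k : ℤ => Real.exp (-Real.pi * s * ((k : ℝ) - t) ^ 2) := by
  rw [← (Equiv.addLeft (⌊t⌋ + 1)).summable_iff]
  refine Summable.of_nat_of_neg_add_one ?_ ?_
  · exact Summable.of_nonneg_of_le (fun _ => (Real.exp_pos _).le) (fun m => (gauss_shift_nat hs t m).1)
      (summable_nat_gauss hs).summable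
  · exact Summable.of_nonneg_of_le (fun _ => (Real.exp_pos _).le) (fun m => (gauss_shift_nat hs t m).2)
      (summable_nat_gauss hs).summable

lemma tsum_shift_gauss_le {s : ℝ} (hs : 0 < s) (t : ℝ) :
    ∑' k : ℤ, Real.exp (-Real.pi * s * ((k : ℝ) - t) ^ 2) ≤ 2 + 2 * th s := by
  rw [← (Equiv.addLeft (⌊t⌋ + 1)).tsum_eq]
  have hs1 : Summable fun m : ℕ => Real.exp (-Real.pi * s * (((⌊t⌋ + 1 + (m : ℤ) : ℤ) : ℝ) - t) ^ 2) :=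
    Summable.of_nonneg_of_le (fun _ => (Real.exp_pos _).le) (fun m => (gauss_shift_nat hs t m).1)
      (summable_nat_gauss hs).summable
  have hs2 : Summable fun m : ℕ =>
      Real.exp (-Real.pi * s * (((⌊t⌋ + 1 + (-((m : ℤ) + 1)) : ℤ) : ℝ) - t) ^ 2) :=
    Summable.of_nonneg_of_le (fun _ => (Real.exp_pos _).le) (fun m => (gauss_shift_nat hs t m).2)
      (summable_nat_gauss hs).summable
  have h := HasSum.of_nat_of_neg_add_one (f := fun k : ℤ =>
    Real.exp (-Real.pi * s * (((⌊t⌋ + 1 + k : ℤ) : ℝ) - t) ^ 2)) hs1.hasSum hs2.hasSum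
  have h1 := hasSum_le (fun m => (gauss_shift_nat hs t m).1) hs1.hasSum (summable_nat_gauss hs)
  have h2 := hasSum_le (fun m => (gauss_shift_nat hs t m).2) hs2.hasSum (summable_nat_gauss hs)
  have h3 := h.tsum_eq
  simp only [Equiv.coe_addLeft]
  linarith

lemma sum_tsum_shift_gauss_le {q : ℕ} [NeZero q] {s : ℝ} (hs : 0 < s) (t : ℝ) :
    ∑ b : ZMod q, ∑' m : ℤ, Real.exp (-Real.pi * s * ((m : ℝ) - (t - (b.val : ℝ) / q)) ^ 2) ≤
      2 + 2 * th (s / (q : ℝ) ^ 2) := by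
  have hq : (0 : ℝ) < q := by exact_mod_cast Nat.pos_of_ne_zero (NeZero.ne q)
  refine le_trans (le_of_eq ?_) (tsum_shift_gauss_le (div_pos hs (pow_pos hq 2)) (q * t))
  have h0 : ∑ b : ZMod q, ∑' m : ℤ, Real.exp (-Real.pi * s * ((m : ℝ) - (t - (b.val : ℝ) / q)) ^ 2) =
      ∑ b : Fin q, ∑' m : ℤ, Real.exp (-Real.pi * s * ((m : ℝ) - (t - ((b : ℕ) : ℝ) / q)) ^ 2) := by
    obtain ⟨n, rfl⟩ := Nat.exists_eq_succ_of_ne_zero (NeZero.ne q)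
    rfl
  rw [h0]
  have h1 := (((Equiv.prodComm _ _).trans (Int.divModEquiv q).symm).hasSum_iff).2
    (summable_shift_gauss (div_pos hs (pow_pos hq 2)) (q * t)).hasSum
  have h2 : ∀ b : Fin q, HasSum (fun m : ℤ => ((fun k : ℤ =>
      Real.exp (-Real.pi * (s / (q : ℝ) ^ 2) * ((k : ℝ) - q * t) ^ 2)) ∘
        ((Equiv.prodComm _ _).trans (Int.divModEquiv q).symm)) (b, m))
      (∑' m : ℤ, Real.exp (-Real.pi * s * ((m : ℝ) - (t - ((b : ℕ) : ℝ) / q)) ^ 2)) := by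
    intro b
    refine (summable_shift_gauss hs _).hasSum.congr_fun fun m => ?_
    simp only [Function.comp, Equiv.trans_apply, Equiv.prodComm_apply, Prod.swap_prod_mk,
      Int.divModEquiv_symm_apply]
    congr 1
    push_cast
    field_simp
    ring
  exact ((hasSum_fintype _).unique (h1.prod_fiberwise h2)).symm ▸ rfl

lemma norm_theta_le {a : ℂ} (ha : 0 < a.re) (t : ℝ) :
    ‖∑' x : ℤ, eC (x * t) * Complex.exp (-Real.pi * a * (x : ℂ) ^ 2)‖ ≤
      (√‖a‖)⁻¹ * ∑' m : ℤ, Real.exp (-Real.pi * (a⁻¹).re * ((m : ℝ) - t) ^ 2) := by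
  have h := Complex.tsum_exp_neg_quadratic ha (Complex.I * t)
  have h1 : ∑' x : ℤ, eC (x * t) * Complex.exp (-Real.pi * a * (x : ℂ) ^ 2) =
      1 / a ^ (1 / 2 : ℂ) * ∑' n : ℤ, Complex.exp (-Real.pi / a * ((n : ℂ) + Complex.I * (Complex.I * t)) ^ 2) := by
    rw [← h]
    refine tsum_congr fun x => ?_
    rw [eC, ← Complex.exp_add]
    congr 1
    push_cast
    ring
  have hre : 0 < (a⁻¹).re := by
    rw [Complex.inv_re]
    exact div_pos ha (Complex.normSq_pos.2 (by rintro rfl; simp at ha))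
  have h2 : ∀ n : ℤ, ‖Complex.exp (-Real.pi / a * ((n : ℂ) + Complex.I * (Complex.I * t)) ^ 2)‖ =
      Real.exp (-Real.pi * (a⁻¹).re * ((n : ℝ) - t) ^ 2) := by
    intro n
    rw [Complex.norm_exp]
    congr 1
    have : -Real.pi / a * ((n : ℂ) + Complex.I * (Complex.I * t)) ^ 2 =
        ((-Real.pi * ((n : ℝ) - t) ^ 2 : ℝ) : ℂ) * a⁻¹ := by
      rw [← mul_assoc Complex.I, Complex.I_mul_I]
      push_cast
      ring
    rw [this, Complex.re_ofReal_mul]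
    ring
  rw [h1, norm_mul, norm_div, norm_one, Complex.norm_cpow_of_ne_zero (by rintro rfl; simp at ha)]
  have h3 : ‖a‖ ^ (1 / 2 : ℂ).re / Real.exp (a.arg * (1 / 2 : ℂ).im) = √‖a‖ := by
    rw [Real.sqrt_eq_rpow]; norm_num
  rw [h3, one_div]
  refine mul_le_mul_of_nonneg_left ?_ (by positivity)
  refine (norm_tsum_le_tsum_norm ?_).trans (le_of_eq (tsum_congr h2))
  exact (summable_shift_gauss hre t).congr fun n => (h2 n).symm

lemma summable_tsum_pi_prod {ι : Type*} : ∀ {d : ℕ} (f : Fin d → ι → ℂ) (_ : ∀ i, Summable fun k => ‖f i k‖),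
    (Summable fun x : Fin d → ι => ‖∏ i, f i (x i)‖) ∧
      ∑' x : Fin d → ι, ∏ i, f i (x i) = ∏ i, ∑' k, f i k := by
  intro d
  induction d with
  | zero => exact fun f _ => ⟨(hasSum_fintype _).summable, by simp⟩
  | succ d ih =>
    intro f hf
    obtain ⟨h1, h2⟩ := ih (fun i => f i.succ) (fun i => hf i.succ)
    have e : ∀ p : ι × (Fin d → ι), ∏ i, f i (Fin.consEquiv (fun _ => ι) p i) =
        f 0 p.1 * ∏ i : Fin d, f i.succ (p.2 i) := by
      intro p
      rw [Fin.prod_univ_succ]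
      rfl
    constructor
    · rw [← (Fin.consEquiv fun _ => ι).summable_iff]
      refine ((hf 0).mul_norm h1).congr fun p => ?_
      rw [Function.comp, e]
    · rw [← (Fin.consEquiv fun _ => ι).tsum_eq, Fin.prod_univ_succ, ← h2,
        tsum_mul_tsum_of_summable_norm (hf 0) h1]
      exact tsum_congr e

/-- `K` is a combination of characters modulo `q` with coefficients bounded by `κ`. -/
def HasFT {d : ℕ} (q : ℕ) [NeZero q] (K : (Fin d → ℤ) → ℂ) (κ : ℝ) : Prop :=
  ∃ c : (Fin d → ZMod q) → ℂ, (∀ b, ‖c b‖ ≤ κ) ∧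
    ∀ x, K x = ∑ b, c b * eC (-(∑ i, ((b i).val : ℝ) * (x i : ℝ)) / q)

lemma eC_sum {ι : Type*} (s : Finset ι) (f : ι → ℝ) : eC (∑ i ∈ s, f i) = ∏ i ∈ s, eC (f i) := by
  simp only [eC]
  rw [← Complex.exp_sum]
  congr 1
  push_cast
  rw [Finset.mul_sum]

lemma eC_add (s t : ℝ) : eC (s + t) = eC s * eC t := by
  rw [eC, eC, eC, ← Complex.exp_add]; congr 1; push_cast; ring

/-- The one-dimensional factor of a modulated Gaussian. -/
def gfac (a : ℂ) (t : ℝ) (x : ℤ) : ℂ := eC (x * t) * Complex.exp (-Real.pi * a * (x : ℂ) ^ 2)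

lemma norm_gfac (a : ℂ) (t : ℝ) (x : ℤ) : ‖gfac a t x‖ = Real.exp (-Real.pi * a.re * (x : ℝ) ^ 2) := by
  rw [gfac, norm_mul, norm_eC, one_mul, Complex.norm_exp]
  congr 1
  have : -Real.pi * a * (x : ℂ) ^ 2 = ((-Real.pi * (x : ℝ) ^ 2 : ℝ) : ℂ) * a := by push_cast; ring
  rw [this, Complex.re_ofReal_mul]
  ring

lemma summable_gfac {a : ℂ} (ha : 0 < a.re) (t : ℝ) : Summable fun x => ‖gfac a t x‖ :=
  (hasSum_int_exp ha).summable.congr fun x => (norm_gfac a t x).symm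

/-- The complex Gaussian on the lattice. -/
def cgauss {d : ℕ} (a : ℂ) (x : Fin d → ℤ) : ℂ := Complex.exp (-Real.pi * a * (normSqZ x : ℂ))

lemma cgauss_mul_eC {d : ℕ} (a : ℂ) (t : Fin d → ℝ) (x : Fin d → ℤ) :
    cgauss a x * eC (∑ i, (x i : ℝ) * t i) = ∏ i, gfac a (t i) (x i) := by
  simp only [gfac]
  rw [Finset.prod_mul_distrib, eC_sum, mul_comm, ← Complex.exp_sum, ← Finset.mul_sum, cgauss, normSqZ]
  push_cast
  rfl

lemma summable_cgauss {d : ℕ} {a : ℂ} (ha : 0 < a.re) : Summable fun x : Fin d → ℤ => ‖cgauss a x‖ := by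
  refine (summable_tsum_pi_prod (fun _ : Fin d => gfac a 0) fun _ => summable_gfac ha 0).1.congr fun x => ?_
  rw [← cgauss_mul_eC, norm_mul, norm_eC, mul_one]

lemma HasFT.mul_cgauss_eq {d q : ℕ} [NeZero q] {c : (Fin d → ZMod q) → ℂ} {K : (Fin d → ℤ) → ℂ}
    (hK : ∀ x, K x = ∑ b, c b * eC (-(∑ i, ((b i).val : ℝ) * (x i : ℝ)) / q)) (a : ℂ) (ξ : Fin d → ℝ)
    (x : Fin d → ℤ) : K x * cgauss a x * eC (∑ i, (x i : ℝ) * ξ i) =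
      ∑ b, c b * ∏ i, gfac a (ξ i - ((b i).val : ℝ) / q) (x i) := by
  rw [hK, Finset.sum_mul, Finset.sum_mul]
  refine Finset.sum_congr rfl fun b _ => ?_
  rw [← cgauss_mul_eC, mul_assoc, mul_assoc]
  congr 1
  rw [mul_left_comm, ← eC_add]
  congr 2
  rw [neg_div, Finset.sum_div, ← Finset.sum_neg_distrib, ← Finset.sum_add_distrib]
  refine Finset.sum_congr rfl fun i _ => ?_
  ring

/-- The multiplier of a periodic function times a complex Gaussian. -/
lemma HasFT.norm_multiplier_le {d q : ℕ} [NeZero q] {K : (Fin d → ℤ) → ℂ} {κ : ℝ} (hK : HasFT q K κ) {a : ℂ}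
    (ha : 0 < a.re) (ξ : Fin d → ℝ) :
    ‖∑' x, K x * cgauss a x * eC (∑ i, (x i : ℝ) * ξ i)‖ ≤
      κ * ((√‖a‖)⁻¹ * (2 + 2 * th ((a⁻¹).re / (q : ℝ) ^ 2))) ^ d := by
  obtain ⟨c, hc, hK⟩ := hK
  have hre : 0 < (a⁻¹).re := by
    rw [Complex.inv_re]
    exact div_pos ha (Complex.normSq_pos.2 (by rintro rfl; simp at ha))
  have hκ : 0 ≤ κ := (norm_nonneg _).trans (hc 0)
  set Θ : ℝ → ℝ := fun t => (√‖a‖)⁻¹ * ∑' m : ℤ, Real.exp (-Real.pi * (a⁻¹).re * ((m : ℝ) - t) ^ 2) with hΘ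
  have hΘ0 : ∀ t, 0 ≤ Θ t := fun t => mul_nonneg (by positivity) (tsum_nonneg fun _ => (Real.exp_pos _).le)
  have hp := fun b : Fin d → ZMod q => summable_tsum_pi_prod
    (fun i => gfac a (ξ i - ((b i).val : ℝ) / q)) fun i => summable_gfac ha _
  simp_rw [HasFT.mul_cgauss_eq hK]
  rw [Summable.tsum_finsetSum fun b _ => ((hp b).1.of_norm).mul_left _]
  calc ‖∑ b, ∑' x : Fin d → ℤ, c b * ∏ i, gfac a (ξ i - ((b i).val : ℝ) / q) (x i)‖
      ≤ ∑ b : Fin d → ZMod q, κ * ∏ i, Θ (ξ i - ((b i).val : ℝ) / q) := by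
        refine (norm_sum_le _ _).trans (Finset.sum_le_sum fun b _ => ?_)
        rw [tsum_mul_left, (hp b).2, norm_mul, norm_prod]
        refine mul_le_mul (hc b) (Finset.prod_le_prod (fun _ _ => norm_nonneg _) fun i _ => ?_)
          (Finset.prod_nonneg fun _ _ => norm_nonneg _) hκ
        exact norm_theta_le ha _
    _ = κ * ∏ i, ∑ b : ZMod q, Θ (ξ i - (b.val : ℝ) / q) := by
        rw [← Finset.mul_sum, Finset.prod_univ_sum, Fintype.piFinset_univ]
    _ ≤ κ * ∏ _i : Fin d, ((√‖a‖)⁻¹ * (2 + 2 * th ((a⁻¹).re / (q : ℝ) ^ 2))) := by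
        refine mul_le_mul_of_nonneg_left (Finset.prod_le_prod (fun _ _ => Finset.sum_nonneg fun _ _ => hΘ0 _)
          fun i _ => ?_) hκ
        simp only [hΘ]
        rw [← Finset.mul_sum]
        exact mul_le_mul_of_nonneg_left (sum_tsum_shift_gauss_le hre _) (by positivity)
    _ = _ := by rw [Finset.prod_const, Finset.card_univ, Fintype.card_fin]

lemma HasFT.norm_le {d q : ℕ} [NeZero q] {K : (Fin d → ℤ) → ℂ} {κ : ℝ} (hK : HasFT q K κ) :
    ∃ M, ∀ x, ‖K x‖ ≤ M := by
  obtain ⟨c, -, hK⟩ := hK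
  refine ⟨∑ b, ‖c b‖, fun x => ?_⟩
  rw [hK]
  refine (norm_sum_le _ _).trans (Finset.sum_le_sum fun b _ => ?_)
  rw [norm_mul, norm_eC, mul_one]

end Theta

section Wave

/-- The complex parameter of the wave `exp(-π|x|²/N) e(2v|x|²/N)`. -/
def wav (N v : ℝ) : ℂ := ((1 / N : ℝ) : ℂ) - ((4 * v / N : ℝ) : ℂ) * Complex.I

lemma wav_re (N v : ℝ) : (wav N v).re = 1 / N := by
  simp [wav]

lemma wav_im (N v : ℝ) : (wav N v).im = -(4 * v / N) := by
  rw [wav, Complex.sub_im, Complex.im_ofReal_mul, Complex.I_im, Complex.ofReal_im]; ring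

lemma normSq_wav (N v : ℝ) : Complex.normSq (wav N v) = (1 + 16 * v ^ 2) / N ^ 2 := by
  rw [Complex.normSq_apply, wav_re, wav_im]; ring

lemma cgauss_wav {d : ℕ} (N v : ℝ) (x : Fin d → ℤ) : cgauss (wav N v) x =
    (Real.exp (-Real.pi * (normSqZ x / N)) : ℂ) * eC (2 * (normSqZ x) / N * v) := by
  rw [cgauss, wav, eC, Complex.ofReal_exp, ← Complex.exp_add]
  congr 1
  push_cast
  ring

lemma wave_factor_le {d : ℕ} (hd : 4 ≤ d) {N : ℝ} (hN : 0 < N) (v : ℝ) {q : ℕ} (hq : q ≠ 0) :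
    ((√‖wav N v‖)⁻¹ * (2 + 2 * th (((wav N v)⁻¹).re / (q : ℝ) ^ 2))) ^ d ≤
      √N ^ d * ((1 + v ^ 2)⁻¹ * (2 + 17 * ((q : ℝ) ^ 2 / N * (1 + v ^ 2))) ^ d) := by
  have hq0 : (0 : ℝ) < q := by positivity
  have hv : 0 < 1 + 16 * v ^ 2 := by positivity
  have hre : ((wav N v)⁻¹).re / (q : ℝ) ^ 2 = N / ((1 + 16 * v ^ 2) * q ^ 2) := by
    rw [Complex.inv_re, normSq_wav, wav_re]; field_simp
  have h1 : 2 + 2 * th (((wav N v)⁻¹).re / (q : ℝ) ^ 2) ≤ 2 + 17 * ((q : ℝ) ^ 2 / N * (1 + v ^ 2)) := by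
    rw [hre]
    have h2 := th_le_inv (X := N / ((1 + 16 * v ^ 2) * q ^ 2)) (by positivity)
    have h3 : 1 / (Real.pi * (N / ((1 + 16 * v ^ 2) * q ^ 2))) = (1 / Real.pi) * (q ^ 2 / N * (1 + 16 * v ^ 2)) := by
      field_simp
    have h4 : 1 / Real.pi ≤ 1 / 3 := one_div_le_one_div_of_le (by norm_num) Real.pi_gt_three.le
    have h5 : (0 : ℝ) < q ^ 2 / N := by positivity
    have h6 : (q : ℝ) ^ 2 / N * (1 + 16 * v ^ 2) ≤ 16 * (q ^ 2 / N * (1 + v ^ 2)) := by nlinarith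
    have h7 : (1 / Real.pi) * ((q : ℝ) ^ 2 / N * (1 + 16 * v ^ 2)) ≤ 1 / 3 * (16 * (q ^ 2 / N * (1 + v ^ 2))) :=
      mul_le_mul h4 h6 (by positivity) (by norm_num)
    nlinarith [mul_pos h5 (by positivity : 0 < 1 + v ^ 2)]
  set w := √(√(1 + 16 * v ^ 2)) with hw
  have hw0 : 0 < w := Real.sqrt_pos.2 (Real.sqrt_pos.2 hv)
  have hw4 : w ^ 4 = 1 + 16 * v ^ 2 := by
    rw [show (4 : ℕ) = 2 * 2 from rfl, pow_mul, Real.sq_sqrt (Real.sqrt_nonneg _), Real.sq_sqrt hv.le]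
  have hw1 : 1 ≤ w := by
    by_contra hlt
    push Not at hlt
    have : w ^ 4 < 1 := pow_lt_one₀ hw0.le hlt (by norm_num)
    nlinarith [sq_nonneg v]
  have hn : ‖wav N v‖ = √(1 + 16 * v ^ 2) / N := by
    rw [Complex.norm_def, normSq_wav, Real.sqrt_div hv.le, Real.sqrt_sq hN.le]
  have h8 : (√‖wav N v‖)⁻¹ = √N * w⁻¹ := by
    rw [hn, Real.sqrt_div (Real.sqrt_nonneg _), inv_div, div_eq_mul_inv]
  have h9 : w⁻¹ ^ d ≤ (1 + v ^ 2)⁻¹ := by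
    calc w⁻¹ ^ d ≤ w⁻¹ ^ 4 := pow_le_pow_of_le_one (inv_nonneg.2 hw0.le) (inv_le_one_of_one_le₀ hw1) hd
      _ = (1 + 16 * v ^ 2)⁻¹ := by rw [inv_pow, hw4]
      _ ≤ _ := inv_anti₀ (by positivity) (by nlinarith [sq_nonneg v])
  rw [h8, mul_pow, mul_pow, mul_assoc]
  have h10 := th_nonneg (((wav N v)⁻¹).re / (q : ℝ) ^ 2)
  refine mul_le_mul_of_nonneg_left (mul_le_mul h9 (pow_le_pow_left₀ (by linarith) h1 d) (by positivity)
    (by positivity)) (by positivity)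

/-- A superposition of waves with amplitude `F`. -/
def spk (d : ℕ) (N : ℝ) (F : ℝ → ℝ) (x : Fin d → ℤ) : ℂ :=
  ((2 * (√N ^ d)⁻¹ * Real.exp (Real.pi - Real.pi * (normSqZ x / N)) : ℝ) : ℂ) *
    ∫ v : ℝ, (F v : ℂ) * eC (2 * (normSqZ x - N) / N * v)

lemma norm_integral_mul_eC_le (F : ℝ → ℝ) (b : ℝ) : ‖∫ v : ℝ, (F v : ℂ) * eC (b * v)‖ ≤ ∫ v, |F v| := by
  refine (norm_integral_le_integral_norm _).trans (le_of_eq ?_)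
  congr 1; funext v
  rw [norm_mul, norm_eC, mul_one, Complex.norm_real, Real.norm_eq_abs]

lemma summable_gauss_lattice (d : ℕ) {N : ℝ} (hN : 0 < N) :
    Summable fun x : Fin d → ℤ => Real.exp (-Real.pi * (normSqZ x / N)) := by
  refine (summable_cgauss (d := d) (a := wav N 0) (by rw [wav_re]; positivity)).congr fun x => ?_
  rw [cgauss_wav, norm_mul, norm_eC, mul_one, Complex.norm_real, Real.norm_eq_abs,
    abs_of_pos (Real.exp_pos _)]

lemma norm_spk_le {d : ℕ} (N : ℝ) (F : ℝ → ℝ) (x : Fin d → ℤ) :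
    ‖spk d N F x‖ ≤ 2 * (√N ^ d)⁻¹ * Real.exp Real.pi * (∫ v, |F v|) * Real.exp (-Real.pi * (normSqZ x / N)) := by
  rw [spk, norm_mul, Complex.norm_real, Real.norm_eq_abs, abs_of_nonneg (by positivity), sub_eq_add_neg,
    Real.exp_add]
  have h := norm_integral_mul_eC_le F (2 * (normSqZ x - N) / N)
  calc _ ≤ 2 * (√N ^ d)⁻¹ * (Real.exp Real.pi * Real.exp (-(Real.pi * (normSqZ x / N)))) * ∫ v, |F v| := by gcongr
    _ = _ := by rw [neg_mul]; ring

lemma summable_mul_spk {d q : ℕ} [NeZero q] {N : ℝ} (hN : 0 < N) {K : (Fin d → ℤ) → ℂ} {κ : ℝ}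
    (hK : HasFT q K κ) (F : ℝ → ℝ) : Summable fun x => ‖K x * spk d N F x‖ := by
  obtain ⟨M, hM⟩ := hK.norm_le
  refine Summable.of_nonneg_of_le (fun _ => norm_nonneg _) (fun x => ?_)
    ((summable_gauss_lattice d hN).mul_left (M * (2 * (√N ^ d)⁻¹ * Real.exp Real.pi * ∫ v, |F v|)))
  rw [norm_mul, mul_assoc]
  exact mul_le_mul (hM x) (norm_spk_le N F x) (norm_nonneg _) ((norm_nonneg _).trans (hM x))

lemma spk_eq {d : ℕ} {N : ℝ} (hN : 0 < N) (F : ℝ → ℝ) (x : Fin d → ℤ) :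
    spk d N F x = ((2 * (√N ^ d)⁻¹ * Real.exp Real.pi : ℝ) : ℂ) *
      ∫ v : ℝ, ((F v : ℂ) * eC (-2 * v)) * cgauss (wav N v) x := by
  rw [spk, sub_eq_add_neg, Real.exp_add, ← integral_const_mul, ← integral_const_mul]
  congr 1; funext v
  rw [cgauss_wav]
  have : eC (2 * (normSqZ x - N) / N * v) = eC (-2 * v) * eC (2 * normSqZ x / N * v) := by
    rw [← eC_add]; congr 1; field_simp; ring
  rw [this, neg_mul]
  push_cast
  ring_nf

lemma HasFT.norm_spk_multiplier_le {d q : ℕ} (hd : 4 ≤ d) [NeZero q] {N : ℝ} (hN : 0 < N)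
    {K : (Fin d → ℤ) → ℂ} {κ : ℝ} (hK : HasFT q K κ) {F G : ℝ → ℝ} (hF : Integrable F) (hG : Integrable G)
    (hFG : ∀ v, |F v| * ((1 + v ^ 2)⁻¹ * (2 + 17 * ((q : ℝ) ^ 2 / N * (1 + v ^ 2))) ^ d) ≤ G v)
    (ξ : Fin d → ℝ) :
    ‖∑' x, K x * spk d N F x * eC (∑ i, (x i : ℝ) * ξ i)‖ ≤ 2 * Real.exp Real.pi * κ * ∫ v, G v := by
  have hκ : 0 ≤ κ := by obtain ⟨c, hc, -⟩ := hK; exact (norm_nonneg _).trans (hc 0)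
  obtain ⟨M, hM⟩ := hK.norm_le
  set H : (Fin d → ℤ) → ℝ → ℂ := fun x v =>
    (K x * eC (∑ i, (x i : ℝ) * ξ i)) * (((F v : ℂ) * eC (-2 * v)) * cgauss (wav N v) x) with hH
  have hnorm : ∀ x v, ‖H x v‖ = ‖K x‖ * |F v| * Real.exp (-Real.pi * (normSqZ x / N)) := by
    intro x v
    simp only [hH]
    rw [cgauss_wav, norm_mul, norm_mul, norm_mul, norm_mul, norm_mul, norm_eC, norm_eC, norm_eC, mul_one, mul_one,
      mul_one, Complex.norm_real, Complex.norm_real, Real.norm_eq_abs, Real.norm_eq_abs,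
      abs_of_pos (Real.exp_pos _)]
    ring
  have h_int : ∀ x, Integrable (H x) := by
    intro x
    refine Integrable.const_mul ?_ _
    have := (integrable_mul_eC hF (2 * (normSqZ x - N) / N)).const_mul
      (Real.exp (-Real.pi * (normSqZ x / N)) : ℂ)
    refine this.congr (Filter.Eventually.of_forall fun v => ?_)
    simp only
    rw [cgauss_wav]
    have : eC (2 * (normSqZ x - N) / N * v) = eC (-2 * v) * eC (2 * normSqZ x / N * v) := by
      rw [← eC_add]; congr 1; field_simp; ring
    rw [this]; ring
  have hsum : Summable fun x => ∫ v, ‖H x v‖ := by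
    refine Summable.of_nonneg_of_le (fun x => integral_nonneg fun v => norm_nonneg _) (fun x => ?_)
      ((summable_gauss_lattice d hN).mul_left (M * ∫ v, |F v|))
    simp_rw [hnorm]
    rw [integral_mul_const, integral_const_mul]
    have : 0 ≤ ∫ v, |F v| := integral_nonneg fun _ => abs_nonneg _
    gcongr
    exact hM x
  have h1 := hasSum_integral_of_summable_integral_norm h_int hsum
  have h2 : ∀ x, K x * spk d N F x * eC (∑ i, (x i : ℝ) * ξ i) =
      ((2 * (√N ^ d)⁻¹ * Real.exp Real.pi : ℝ) : ℂ) * ∫ v, H x v := by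
    intro x
    simp only [hH]
    rw [spk_eq hN, integral_const_mul]; ring
  simp_rw [h2]
  rw [tsum_mul_left, h1.tsum_eq, norm_mul, Complex.norm_real, Real.norm_eq_abs, abs_of_nonneg (by positivity)]
  have hb : ∀ v, ‖∑' x, H x v‖ ≤ √N ^ d * κ * G v := by
    intro v
    have e : ∑' x, H x v = ((F v : ℂ) * eC (-2 * v)) *
        ∑' x, K x * cgauss (wav N v) x * eC (∑ i, (x i : ℝ) * ξ i) := by
      rw [← tsum_mul_left]
      refine tsum_congr fun x => ?_
      simp only [hH]; ring
    rw [e, norm_mul, norm_mul, norm_eC, mul_one, Complex.norm_real, Real.norm_eq_abs]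
    have h3 := hK.norm_multiplier_le (a := wav N v) (by rw [wav_re]; positivity) ξ
    have h4 := wave_factor_le hd hN v (NeZero.ne q)
    calc _ ≤ |F v| * (κ * (√N ^ d * ((1 + v ^ 2)⁻¹ * (2 + 17 * ((q : ℝ) ^ 2 / N * (1 + v ^ 2))) ^ d))) := by
          refine mul_le_mul_of_nonneg_left (h3.trans (mul_le_mul_of_nonneg_left h4 hκ)) (abs_nonneg _)
      _ = √N ^ d * κ * (|F v| * ((1 + v ^ 2)⁻¹ * (2 + 17 * ((q : ℝ) ^ 2 / N * (1 + v ^ 2))) ^ d)) := by ring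
      _ ≤ _ := mul_le_mul_of_nonneg_left (hFG v) (by positivity)
  have h5 := norm_integral_le_of_norm_le (hG.const_mul (√N ^ d * κ)) (Filter.Eventually.of_forall hb)
  rw [integral_const_mul] at h5
  have hsN : 0 < √N ^ d := pow_pos (Real.sqrt_pos.2 hN) d
  calc _ ≤ 2 * (√N ^ d)⁻¹ * Real.exp Real.pi * (√N ^ d * κ * ∫ v, G v) :=
        mul_le_mul_of_nonneg_left h5 (by positivity)
    _ = _ := by field_simp

lemma HasFT.bilP_spk {d q : ℕ} (hd : 4 ≤ d) [NeZero q] {N : ℝ} (hN : 0 < N)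
    {K : (Fin d → ℤ) → ℂ} {κ : ℝ} (hK : HasFT q K κ) {F G : ℝ → ℝ} (hF : Integrable F) (hG : Integrable G)
    (hFG : ∀ v, |F v| * ((1 + v ^ 2)⁻¹ * (2 + 17 * ((q : ℝ) ^ 2 / N * (1 + v ^ 2))) ^ d) ≤ G v) :
    BilP 2 2 (fun x => K x * spk d N F x) (2 * Real.exp Real.pi * κ * ∫ v, G v) :=
  bilP_two_of_multiplier (summable_mul_spk hN hK F) (hK.norm_spk_multiplier_le hd hN hF hG hFG)

end Wave

section Amplitude

lemma exp_mul_pow_le (d : ℕ) : ∃ C : ℝ, 1 ≤ C ∧ ∀ X : ℝ, 0 ≤ X → Real.exp (-X) * (2 + 17 * X) ^ d ≤ C := by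
  refine ⟨17 ^ d * (d.factorial * Real.exp 1), ?_, fun X hX => ?_⟩
  · have h1 : (1 : ℝ) ≤ 17 ^ d := one_le_pow₀ (by norm_num)
    have h2 : (1 : ℝ) ≤ d.factorial := by exact_mod_cast d.factorial_pos
    have h3 : (1 : ℝ) ≤ Real.exp 1 := Real.one_le_exp (by norm_num)
    exact one_le_mul_of_one_le_of_one_le h1 (one_le_mul_of_one_le_of_one_le h2 h3)
  · have h1 := Real.pow_div_factorial_le_exp (1 + X) (by linarith) d
    have hf : (0 : ℝ) < d.factorial := by exact_mod_cast d.factorial_pos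
    rw [div_le_iff₀ hf] at h1
    have h2 : (2 + 17 * X) ^ d ≤ 17 ^ d * (1 + X) ^ d := by
      rw [← mul_pow]; exact pow_le_pow_left₀ (by positivity) (by linarith) d
    calc Real.exp (-X) * (2 + 17 * X) ^ d ≤ Real.exp (-X) * (17 ^ d * (Real.exp (1 + X) * d.factorial)) := by
          gcongr; exact h2.trans (by gcongr)
      _ = 17 ^ d * (d.factorial * (Real.exp (-X) * Real.exp (1 + X))) := by ring
      _ = _ := by rw [← Real.exp_add]; ring_nf

lemma measurable_th_comp {a : ℝ} (ha : 0 < a) : Measurable fun v : ℝ => th (a * (1 + v ^ 2)) := by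
  refine measurable_of_tendsto_metrizable (f := fun (n : ℕ) (v : ℝ) => ∑ k ∈ Finset.range n,
    Real.exp (-Real.pi * (a * (1 + v ^ 2)) * ((k : ℝ) + 1) ^ 2)) (fun n => by fun_prop) ?_
  rw [tendsto_pi_nhds]
  intro v
  exact (summable_th (X := a * (1 + v ^ 2)) (by positivity)).hasSum.tendsto_sum_nat

/-- The cutoff at modulus `q`. -/
def cutq (q : ℕ) (N v : ℝ) : ℝ := cut ((q : ℝ) ^ 2 / N * (1 + v ^ 2))

/-- The Gaussian of width `L`. -/
def gau (L v : ℝ) : ℝ := Real.exp (-Real.pi * (v ^ 2 / L ^ 2))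

lemma measurable_cutq {q : ℕ} (hq : q ≠ 0) {N : ℝ} (hN : 0 < N) : Measurable (cutq q N) := by
  have hq0 : (0 : ℝ) < q := by positivity
  have h1 := measurable_th_comp (a := (q : ℝ) ^ 2 / N) (by positivity)
  have h2 := measurable_th_comp (a := 4 * ((q : ℝ) ^ 2 / N)) (by positivity)
  have : cutq q N = fun v => 2 * th ((q : ℝ) ^ 2 / N * (1 + v ^ 2)) - 4 * th (4 * ((q : ℝ) ^ 2 / N) * (1 + v ^ 2)) := by
    funext v
    rw [cutq, cut, mul_assoc 4]
  rw [this]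
  exact (h1.const_mul 2).sub (h2.const_mul 4)

lemma integrable_gau {L : ℝ} (hL : 0 < L) : Integrable (gau L) := by
  have := integrable_exp_neg_mul_sq (b := Real.pi / L ^ 2) (by have := Real.pi_pos; positivity)
  refine this.congr (Filter.Eventually.of_forall fun v => ?_)
  simp only [gau]
  congr 1; ring

lemma integrable_cutq {q : ℕ} (hq : q ≠ 0) {N : ℝ} (hN : 0 < N) : Integrable (cutq q N) := by
  have hq0 : (0 : ℝ) < q := by positivity
  have h := (integrable_exp_neg_mul_sq (b := (q : ℝ) ^ 2 / N) (by positivity)).const_mul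
    (100 * Real.exp (-((q : ℝ) ^ 2 / N)))
  refine h.mono' (measurable_cutq hq hN).aestronglyMeasurable (Filter.Eventually.of_forall fun v => ?_)
  rw [Real.norm_eq_abs, mul_assoc, ← Real.exp_add]
  refine (abs_cut_le (by positivity)).trans (le_of_eq ?_)
  congr 2; ring

/-- The amplitude bounds. -/
lemma exists_amplitude_le (d : ℕ) : ∃ C : ℝ, 0 < C ∧ ∀ (q : ℕ) (N v : ℝ), q ≠ 0 → 0 < N →
    (|cutq q N v| * (2 + 17 * ((q : ℝ) ^ 2 / N * (1 + v ^ 2))) ^ d ≤ C) ∧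
    ∀ L : ℝ, 1 ≤ L → (q : ℝ) ^ 2 * L ^ 2 ≤ N →
      (|gau L v| * (2 + 17 * ((q : ℝ) ^ 2 / N * (1 + v ^ 2))) ^ d ≤ C) ∧
      (|cutq q N v - gau L v| * (2 + 17 * ((q : ℝ) ^ 2 / N * (1 + v ^ 2))) ^ d ≤
        C * ((1 + v ^ 2) / L ^ 2) ^ (1 / 4 : ℝ)) := by
  obtain ⟨C, hC1, hC⟩ := exp_mul_pow_le d
  have hE : (1 : ℝ) ≤ Real.exp Real.pi := Real.one_le_exp Real.pi_pos.le
  refine ⟨100 * C + Real.exp Real.pi * C + 36 * 19 ^ d, by positivity, fun q N v hq hN => ?_⟩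
  have hq0 : (0 : ℝ) < q := by positivity
  have hEC : 0 < Real.exp Real.pi * C := by positivity
  have h19 : (0 : ℝ) < 36 * 19 ^ d := by positivity
  set X := (q : ℝ) ^ 2 / N * (1 + v ^ 2) with hX
  have hX0 : 0 < X := by positivity
  have h1 : |cutq q N v| * (2 + 17 * X) ^ d ≤ 100 * C := by
    have : |cutq q N v| ≤ 100 * Real.exp (-X) := abs_cut_le hX0
    calc _ ≤ 100 * Real.exp (-X) * (2 + 17 * X) ^ d := by gcongr
      _ = 100 * (Real.exp (-X) * (2 + 17 * X) ^ d) := by ring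
      _ ≤ _ := by gcongr; exact hC X hX0.le
  refine ⟨by linarith, fun L hL hqL => ?_⟩
  set y := (1 + v ^ 2) / L ^ 2 with hy
  have hL0 : 0 < L := by linarith
  have hy0 : 0 < y := by positivity
  have hXy : X ≤ y := by
    rw [hX, hy, div_mul_eq_mul_div, div_le_div_iff₀ hN (by positivity)]
    nlinarith [sq_nonneg v]
  have hvy : v ^ 2 / L ^ 2 ≤ y := by rw [hy]; gcongr; linarith
  have hvy' : y - 1 ≤ v ^ 2 / L ^ 2 := by
    rw [hy, add_div]
    have : 1 / L ^ 2 ≤ 1 := by rw [div_le_one (by positivity)]; exact one_le_pow₀ hL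
    linarith
  have hg0 : 0 < gau L v := Real.exp_pos _
  have h2 : |gau L v| * (2 + 17 * X) ^ d ≤ Real.exp Real.pi * C := by
    rw [abs_of_pos hg0]
    have h3 : gau L v ≤ Real.exp Real.pi * Real.exp (-y) := by
      rw [gau, ← Real.exp_add]
      apply Real.exp_le_exp.2
      nlinarith [Real.pi_gt_three, mul_le_mul_of_nonneg_left hvy' Real.pi_pos.le]
    calc _ ≤ Real.exp Real.pi * Real.exp (-y) * (2 + 17 * y) ^ d := by gcongr
      _ = Real.exp Real.pi * (Real.exp (-y) * (2 + 17 * y) ^ d) := by ring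
      _ ≤ _ := by gcongr; exact hC y hy0.le
  refine ⟨by linarith, ?_⟩
  rcases le_total 1 y with h | h
  · have h3 : (1 : ℝ) ≤ y ^ (1 / 4 : ℝ) := Real.one_le_rpow h (by norm_num)
    have h4 : |cutq q N v - gau L v| ≤ |cutq q N v| + |gau L v| := abs_sub _ _
    have h5 : |cutq q N v - gau L v| * (2 + 17 * X) ^ d ≤ 100 * C + Real.exp Real.pi * C := by
      calc _ ≤ (|cutq q N v| + |gau L v|) * (2 + 17 * X) ^ d := by gcongr
        _ ≤ _ := by rw [add_mul]; linarith
    nlinarith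
  · have h3 : y ≤ y ^ (1 / 4 : ℝ) := by
      conv_lhs => rw [← Real.rpow_one y]
      exact Real.rpow_le_rpow_of_exponent_ge hy0 h (by norm_num)
    have h4 : |cutq q N v - 1| ≤ 32 * X := abs_cut_sub_one_le hX0 (hXy.trans h)
    have h5 : |1 - gau L v| ≤ 4 * y := by
      have e1 : gau L v ≤ 1 := Real.exp_le_one_iff.2 (by
        have : 0 ≤ v ^ 2 / L ^ 2 := by positivity
        nlinarith [Real.pi_pos])
      rw [abs_of_nonneg (by linarith)]
      have e2 := Real.add_one_le_exp (-Real.pi * (v ^ 2 / L ^ 2))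
      have e3 : Real.pi * (v ^ 2 / L ^ 2) ≤ 4 * y := mul_le_mul Real.pi_le_four hvy (by positivity) (by norm_num)
      simp only [gau] at *
      linarith
    have h6 : |cutq q N v - gau L v| ≤ 36 * y := by
      have : cutq q N v - gau L v = (cutq q N v - 1) + (1 - gau L v) := by ring
      rw [this]
      exact (abs_add_le _ _).trans (by linarith)
    calc _ ≤ 36 * y * 19 ^ d := by gcongr; linarith
      _ = 36 * 19 ^ d * y := by ring
      _ ≤ (100 * C + Real.exp Real.pi * C + 36 * 19 ^ d) * y ^ (1 / 4 : ℝ) := by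
          gcongr; nlinarith

lemma integrable_japanese : Integrable fun v : ℝ => (1 + v ^ 2) ^ (-(3 / 4) : ℝ) := by
  have h := integrable_rpow_neg_one_add_norm_sq (E := ℝ) (μ := volume) (r := 3 / 2) (by norm_num)
  refine h.congr (Filter.Eventually.of_forall fun v => ?_)
  simp only [Real.norm_eq_abs, sq_abs]
  norm_num

/-- The three kernel estimates behind the circle method. -/
lemma exists_spk_bounds {d : ℕ} (hd : 4 ≤ d) : ∃ C : ℝ, 0 < C ∧
    ∀ (q : ℕ) [NeZero q] (N : ℝ) (K : (Fin d → ℤ) → ℂ) (κ : ℝ), 0 < N → HasFT q K κ →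
    BilP 2 2 (fun x => K x * spk d N (cutq q N) x) (C * κ) ∧
    ∀ L : ℝ, 1 ≤ L → (q : ℝ) ^ 2 * L ^ 2 ≤ N →
      ‖∑' x, K x * spk d N (gau L) x‖ ≤ C * κ ∧
      BilP 2 2 (fun x => K x * spk d N (fun v => cutq q N v - gau L v) x) (C * κ * L ^ (-(1 / 2) : ℝ)) := by
  obtain ⟨C, hC0, hC⟩ := exists_amplitude_le d
  set I := ∫ v : ℝ, (1 + v ^ 2) ^ (-(3 / 4) : ℝ) with hI
  have hI0 : 0 ≤ I := integral_nonneg fun v => by positivity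
  refine ⟨2 * Real.exp Real.pi * C * (Real.pi + I), by have := Real.pi_pos; positivity, ?_⟩
  intro q _ N K κ hN hK
  have hκ : 0 ≤ κ := by obtain ⟨c, hc, -⟩ := hK; exact (norm_nonneg _).trans (hc 0)
  have hq : q ≠ 0 := NeZero.ne q
  have hJ : Integrable fun v : ℝ => C * (1 + v ^ 2)⁻¹ := integrable_inv_one_add_sq.const_mul C
  have hJi : ∫ v : ℝ, C * (1 + v ^ 2)⁻¹ = C * Real.pi := by
    rw [integral_const_mul, integral_univ_inv_one_add_sq]
  have hb : 2 * Real.exp Real.pi * κ * (C * Real.pi) ≤ 2 * Real.exp Real.pi * C * (Real.pi + I) * κ := by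
    have : 0 ≤ 2 * Real.exp Real.pi * κ * C * I := by positivity
    nlinarith
  have hmono : ∀ {k : (Fin d → ℤ) → ℂ} {M M' : ℝ}, BilP 2 2 k M → M ≤ M' → BilP 2 2 k M' := by
    intro k M M' h hM S f g
    refine (h S f g).trans ?_
    gcongr
  refine ⟨?_, fun L hL hqL => ⟨?_, ?_⟩⟩
  · have h := hK.bilP_spk hd hN (integrable_cutq hq hN) hJ fun v => by
      rw [mul_left_comm, mul_comm C]
      exact mul_le_mul_of_nonneg_left (hC q N v hq hN).1 (by positivity)
    rw [hJi] at h
    exact hmono h hb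
  · have h := hK.norm_spk_multiplier_le hd hN (integrable_gau (by linarith : 0 < L)) hJ (fun v => by
      rw [mul_left_comm, mul_comm C]
      exact mul_le_mul_of_nonneg_left ((hC q N v hq hN).2 L hL hqL).1 (by positivity)) 0
    rw [hJi] at h
    refine le_trans (le_of_eq ?_) (h.trans hb)
    congr 1
    refine tsum_congr fun x => ?_
    simp [eC]
  · have hL0 : 0 < L := by linarith
    have h := hK.bilP_spk hd hN ((integrable_cutq hq hN).sub (integrable_gau hL0))
      (G := fun v => C * L ^ (-(1 / 2) : ℝ) * (1 + v ^ 2) ^ (-(3 / 4) : ℝ))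
      (integrable_japanese.const_mul _) fun v => by
      rw [mul_left_comm]
      have e := mul_le_mul_of_nonneg_left ((hC q N v hq hN).2 L hL hqL).2 (by positivity : 0 ≤ (1 + v ^ 2)⁻¹)
      refine e.trans (le_of_eq ?_)
      have hv : (0 : ℝ) < 1 + v ^ 2 := by positivity
      rw [Real.div_rpow hv.le (by positivity), ← Real.rpow_natCast L 2, ← Real.rpow_mul hL0.le, ← Real.rpow_neg_one (1 + v ^ 2),
        show (-(3 / 4) : ℝ) = -1 + 1 / 4 by norm_num, Real.rpow_add hv,
        show (-(1 / 2) : ℝ) = -(((2 : ℕ) : ℝ) * (1 / 4)) by norm_num, Real.rpow_neg hL0.le]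
      ring
    rw [integral_const_mul, ← hI] at h
    refine hmono h ?_
    have e1 : 0 ≤ 2 * Real.exp Real.pi * κ * C * L ^ (-(1 / 2) : ℝ) * Real.pi := by
      have := Real.pi_pos; positivity
    nlinarith

end Amplitude

section ErrorKernel

lemma BilP.mono {G : Type*} [AddCommGroup G] {p q : ℝ} {k : G → ℂ} {M M' : ℝ} (h : BilP p q k M)
    (hM : M ≤ M') : BilP p q k M' := by
  intro S f g
  refine (h S f g).trans ?_
  have h1 : 0 ≤ (∑ y ∈ S, ‖f y‖ ^ p) ^ (1 / p) := by positivity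
  have h2 : 0 ≤ (∑ x ∈ S, ‖g x‖ ^ q) ^ (1 / q) := by positivity
  gcongr

lemma BilP.zero {G : Type*} [AddCommGroup G] (p q : ℝ) : BilP p q (fun _ : G => 0) 0 := by
  intro S f g; simp

lemma BilP.add {G : Type*} [AddCommGroup G] {p q : ℝ} {k k' : G → ℂ} {M M' : ℝ} (h : BilP p q k M)
    (h' : BilP p q k' M') : BilP p q (fun x => k x + k' x) (M + M') := by
  intro S f g
  simp_rw [add_mul, Finset.sum_add_distrib]
  exact (norm_add_le _ _).trans (add_le_add (h S f g) (h' S f g))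

lemma BilP.sum {G ι : Type*} [AddCommGroup G] {p q : ℝ} (s : Finset ι) {k : ι → G → ℂ} {M : ι → ℝ}
    (h : ∀ i ∈ s, BilP p q (k i) (M i)) : BilP p q (fun x => ∑ i ∈ s, k i x) (∑ i ∈ s, M i) := by
  classical
  induction s using Finset.induction_on with
  | empty => simpa using BilP.zero p q
  | insert a s ha ih =>
    simp_rw [Finset.sum_insert ha]
    exact (h a (Finset.mem_insert_self _ _)).add (ih fun i hi => h i (Finset.mem_insert_of_mem hi))

lemma BilP.of_tendsto {G : Type*} [AddCommGroup G] {p q : ℝ} {k : ℕ → G → ℂ} {k₀ : G → ℂ} {M : ℝ}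
    (h : ∀ᶠ n in Filter.atTop, BilP p q (k n) M)
    (hk : ∀ x, Filter.Tendsto (fun n => k n x) Filter.atTop (nhds (k₀ x))) : BilP p q k₀ M := by
  intro S f g
  refine le_of_tendsto (x := Filter.atTop) (f := fun n => ‖∑ x ∈ S, ∑ y ∈ S, k n (x - y) * f y * g x‖) ?_
    (h.mono fun n hn => hn S f g)
  refine Filter.Tendsto.norm (tendsto_finsetSum _ fun x _ => tendsto_finsetSum _ fun y _ => ?_)
  exact ((hk (x - y)).mul_const _).mul_const _

/-- The Ramanujan kernel. -/
def cK {d : ℕ} (q : ℕ) (n : ℤ) (x : Fin d → ℤ) : ℂ := ramanujanSum q (normSqZ x - n)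

lemma hasFT_cK {d : ℕ} (q n : ℕ) [NeZero q] : HasFT q (cK (d := d) q n) (kap d q n) := by
  refine ⟨fun b => (q : ℂ)⁻¹ ^ d * tq (n : ZMod q) b, fun b => norm_coeff_le q n b, fun x => ?_⟩
  have h := rs_sum_sq_eq (q := q) (n : ZMod q) fun i => ((x i : ℤ) : ZMod q)
  rw [cK, ramanujanSum_eq_rs, normSqZ]
  push_cast at h ⊢
  rw [h]
  refine Finset.sum_congr rfl fun b _ => ?_
  congr 1
  have := eC_eq_stdAddChar q (-∑ i, ((b i).val : ℤ) * x i)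
  push_cast at this
  rw [this]
  simp

/-- The Gaussian-localised approximation to the spherical density. -/
def bet (d : ℕ) (N L : ℝ) (x : Fin d → ℤ) : ℝ :=
  2 * (√N ^ d)⁻¹ * Real.exp (Real.pi - Real.pi * (normSqZ x / N)) *
    (L * Real.exp (-Real.pi * (4 * L ^ 2 * (normSqZ x / N - 1) ^ 2)))

lemma spk_gau {d : ℕ} {N L : ℝ} (hN : 0 < N) (hL : 0 < L) (x : Fin d → ℤ) :
    spk d N (gau L) x = (bet d N L x : ℂ) := by
  have h := integral_gss_mul_eC (a := 1 / L ^ 2) (by positivity) (2 * (normSqZ x - N) / N)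
  have h1 : ∫ v : ℝ, (gau L v : ℂ) * eC (2 * (normSqZ x - N) / N * v) =
      ((L * Real.exp (-Real.pi * (4 * L ^ 2 * (normSqZ x / N - 1) ^ 2)) : ℝ) : ℂ) := by
    have h2 : ∀ v : ℝ, (gss (1 / L ^ 2) v : ℂ) * eC (2 * (normSqZ x - N) / N * v) =
        (Real.exp (-Real.pi * (1 / L ^ 2)) : ℂ) * ((gau L v : ℂ) * eC (2 * (normSqZ x - N) / N * v)) := by
      intro v
      rw [gss_eq, gau]
      push_cast
      rw [mul_assoc]
      congr 3
      ring
    simp_rw [h2] at h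
    rw [integral_const_mul] at h
    have h3 : (Real.exp (-Real.pi * (1 / L ^ 2)) : ℂ) ≠ 0 := by
      exact_mod_cast (Real.exp_pos _).ne'
    have h4 : (√(1 / L ^ 2))⁻¹ = L := by
      rw [one_div, Real.sqrt_inv, Real.sqrt_sq hL.le, inv_inv]
    have h5 : (2 * ((normSqZ x : ℝ) - N) / N) ^ 2 / (1 / L ^ 2) = 4 * L ^ 2 * (normSqZ x / N - 1) ^ 2 := by
      field_simp; ring
    refine mul_left_cancel₀ h3 (h.trans ?_)
    rw [h4, h5]
    push_cast
    ring
  rw [spk, h1, bet]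
  push_cast
  ring

lemma bet_nonneg {d : ℕ} {N L : ℝ} (hL : 0 ≤ L) (x : Fin d → ℤ) : 0 ≤ bet d N L x := by
  unfold bet; positivity

lemma spk_sub {d : ℕ} (N : ℝ) {F F' : ℝ → ℝ} (hF : Integrable F) (hF' : Integrable F') (x : Fin d → ℤ) :
    spk d N (fun v => F v - F' v) x = spk d N F x - spk d N F' x := by
  rw [spk, spk, spk, ← mul_sub, ← integral_sub (integrable_mul_eC hF _) (integrable_mul_eC hF' _)]
  congr 2; funext v
  push_cast; ring

/-- The difference between the normalised sphere and its main term. -/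
def errK (d n : ℕ) (L : ℝ) (W : ℕ) (x : Fin d → ℤ) : ℂ :=
  ((n / √n ^ d * lam n : ℝ) : ℂ) * (if normSqZ x = n then 1 else 0) -
    ∑ q ∈ Finset.Ioc 0 W, cK q n x * (bet d n L x : ℂ)

lemma sum_range_succ_eq_Ioc (f : ℕ → ℂ) (Q : ℕ) :
    ∑ q ∈ Finset.range Q, f (q + 1) = ∑ q ∈ Finset.Ioc 0 Q, f q := by
  induction Q with
  | zero => simp
  | succ Q ih => rw [Finset.sum_range_succ, ih, Finset.sum_Ioc_succ_top (Nat.zero_le _)]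

lemma tendsto_sphere {d n : ℕ} (hn : 0 < n) (x : Fin d → ℤ) :
    Filter.Tendsto (fun Q : ℕ => ∑ q ∈ Finset.Ioc 0 Q, cK q n x * spk d n (cutq q n) x) Filter.atTop
      (nhds (((n / √n ^ d * lam n : ℝ) : ℂ) * (if normSqZ x = n then 1 else 0))) := by
  have hN : (0 : ℝ) < n := by exact_mod_cast hn
  have h := (hasSum_delta hN (normSqZ x - n)).mul_left
    ((n / √n ^ d * Real.exp (Real.pi - Real.pi * (normSqZ x / n)) : ℝ) : ℂ)
  have h2 := h.tendsto_sum_nat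
  have e : ∀ Q : ℕ, ∑ q ∈ Finset.range Q, ((n / √n ^ d * Real.exp (Real.pi - Real.pi * (normSqZ x / n)) : ℝ) : ℂ) *
      (ramanujanSum (q + 1) (normSqZ x - n) * osc n (q + 1) (normSqZ x - n)) =
      ∑ q ∈ Finset.Ioc 0 Q, cK q n x * spk d n (cutq q n) x := by
    intro Q
    rw [← sum_range_succ_eq_Ioc]
    refine Finset.sum_congr rfl fun q _ => ?_
    have hn0 : (n : ℂ) ≠ 0 := by exact_mod_cast hn.ne'
    have hosc : osc n (q + 1) (normSqZ x - n) = ((2 / n : ℝ) : ℂ) *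
        ∫ v : ℝ, (cutq (q + 1) n v : ℂ) * eC (2 * (normSqZ x - n) / n * v) := by
      rw [osc]
      simp only [cutq]
      push_cast
      rfl
    rw [cK, spk, hosc]
    generalize (∫ v : ℝ, (cutq (q + 1) n v : ℂ) * eC (2 * (normSqZ x - n) / n * v)) = I
    push_cast
    field_simp
  simp_rw [e] at h2
  convert h2 using 2
  by_cases hx : normSqZ x = n
  · rw [if_pos hx, if_pos (by omega), hx]
    have : (((n : ℤ) : ℝ) / (n : ℝ)) = 1 := by push_cast; exact div_self hN.ne'
    rw [this, mul_one Real.pi, sub_self, Real.exp_zero]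
    push_cast
    ring
  · rw [if_neg hx, if_neg (by omega), mul_zero, mul_zero]

lemma errK_partial {d n W Q : ℕ} {L : ℝ} (hN : (0 : ℝ) < n) (hL0 : 0 < L) (hQ : W ≤ Q) (x : Fin d → ℤ) :
    ∑ q ∈ Finset.Ioc 0 Q, cK q n x * spk d n (cutq q n) x -
      ∑ q ∈ Finset.Ioc 0 W, cK q n x * (bet d n L x : ℂ) =
    ∑ q ∈ Finset.Ioc W Q, cK q n x * spk d n (cutq q n) x +
      ∑ q ∈ Finset.Ioc 0 W, cK q n x * spk d n (fun v => cutq q n v - gau L v) x := by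
  rw [← Finset.sum_Ioc_consecutive _ (Nat.zero_le W) hQ, add_comm (∑ i ∈ Finset.Ioc 0 W, _), add_sub_assoc,
    ← Finset.sum_sub_distrib]
  congr 1
  refine Finset.sum_congr rfl fun q hq => ?_
  have hq' := Finset.mem_Ioc.1 hq
  rw [spk_sub _ (integrable_cutq (by omega) hN) (integrable_gau hL0), spk_gau hN hL0, mul_sub]

lemma exists_bilP_errK {d : ℕ} (hd : 4 ≤ d) : ∃ C : ℝ, 0 < C ∧ ∀ (n W : ℕ) (L M : ℝ), 0 < n → 1 ≤ L →
    (W : ℝ) ^ 2 * L ^ 2 ≤ n → (∀ Q, ∑ q ∈ Finset.Ioc W Q, kap d q n ≤ M) →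
    BilP 2 2 (errK d n L W) (C * (M + L ^ (-(1 / 2) : ℝ) * ∑ q ∈ Finset.Ioc 0 W, kap d q n)) := by
  obtain ⟨C, hC0, hC⟩ := exists_spk_bounds hd
  refine ⟨C, hC0, fun n W L M hn hL hWL hM => ?_⟩
  have hN : (0 : ℝ) < n := by exact_mod_cast hn
  have hL0 : 0 < L := by linarith
  refine BilP.of_tendsto (k := fun Q x => ∑ q ∈ Finset.Ioc 0 Q, cK q n x * spk d n (cutq q n) x -
    ∑ q ∈ Finset.Ioc 0 W, cK q n x * (bet d n L x : ℂ)) ?_ fun x => (tendsto_sphere hn x).sub_const _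
  filter_upwards [Filter.eventually_ge_atTop W] with Q hQ
  have h1 : BilP 2 2 (fun x : Fin d → ℤ => ∑ q ∈ Finset.Ioc W Q, cK q n x * spk d n (cutq q n) x)
      (∑ q ∈ Finset.Ioc W Q, C * kap d q n) := by
    refine BilP.sum _ fun q hq => ?_
    have : NeZero q := ⟨by have := Finset.mem_Ioc.1 hq; omega⟩
    exact (hC q n _ _ hN (hasFT_cK q n)).1
  have h2 : BilP 2 2 (fun x : Fin d → ℤ => ∑ q ∈ Finset.Ioc 0 W, cK q n x * spk d n (fun v => cutq q n v - gau L v) x)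
      (∑ q ∈ Finset.Ioc 0 W, C * kap d q n * L ^ (-(1 / 2) : ℝ)) := by
    refine BilP.sum _ fun q hq => ?_
    have hq' := Finset.mem_Ioc.1 hq
    have : NeZero q := ⟨by omega⟩
    refine ((hC q n _ _ hN (hasFT_cK q n)).2 L hL (le_trans ?_ hWL)).2
    have : (q : ℝ) ≤ W := by exact_mod_cast hq'.2
    gcongr
  have h3 := (h1.add h2).mono (M' := C * (M + L ^ (-(1 / 2) : ℝ) * ∑ q ∈ Finset.Ioc 0 W, kap d q n)) (by
    rw [← Finset.mul_sum, ← Finset.sum_mul, ← Finset.mul_sum]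
    nlinarith [mul_le_mul_of_nonneg_left (hM Q) hC0.le])
  have h4 : (fun x : Fin d → ℤ => ∑ q ∈ Finset.Ioc 0 Q, cK q n x * spk d n (cutq q n) x -
      ∑ q ∈ Finset.Ioc 0 W, cK q n x * (bet d n L x : ℂ)) =
      fun x => ∑ q ∈ Finset.Ioc W Q, cK q n x * spk d n (cutq q n) x +
        ∑ q ∈ Finset.Ioc 0 W, cK q n x * spk d n (fun v => cutq q n v - gau L v) x := by
    funext x
    exact errK_partial hN hL0 hQ x
  rw [h4]
  exact h3

end ErrorKernel

/-- The bump `bet` restricted to the sublattice of multiples of `q`, normalised by its covolume. -/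
def wq (d q : ℕ) (N L : ℝ) (x : Fin d → ℤ) : ℝ :=
  if ∀ i, (q : ℤ) ∣ x i then (q : ℝ) ^ d * bet d N L x else 0

lemma wq_nonneg {d q : ℕ} {N L : ℝ} (hL : 0 ≤ L) (x : Fin d → ℤ) : 0 ≤ wq d q N L x := by
  rw [wq]
  split_ifs
  · exact mul_nonneg (by positivity) (bet_nonneg hL x)
  · rfl

lemma multiples_eq_sum {d : ℕ} (q : ℕ) [NeZero q]
    (x : Fin d → ℤ) : (if ∀ i, (q : ℤ) ∣ x i then (q : ℂ) ^ d else 0) =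
      ∑ b : Fin d → ZMod q, (1 : ℂ) * eC (-(∑ i, ((b i).val : ℝ) * (x i : ℝ)) / q) := by
  have h1 : ∀ b : Fin d → ZMod q, (1 : ℂ) * eC (-(∑ i, ((b i).val : ℝ) * (x i : ℝ)) / q) =
      ∏ i, ZMod.stdAddChar (b i * ((-x i : ℤ) : ZMod q)) := by
    intro b
    have := eC_eq_stdAddChar q (-∑ i, ((b i).val : ℤ) * x i)
    push_cast at this
    rw [one_mul, this, ← AddChar.map_finset_sum_eq_prod]
    congr 1
    simp
  simp_rw [h1]
  have h2 := Finset.prod_univ_sum (fun _ : Fin d => (Finset.univ : Finset (ZMod q)))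
    (fun i b => ZMod.stdAddChar (b * ((-x i : ℤ) : ZMod q)))
  rw [Fintype.piFinset_univ] at h2
  rw [← h2]
  simp_rw [sum_stdAddChar_mul]
  have h3 : ∀ i, ((-x i : ℤ) : ZMod q) = 0 ↔ (q : ℤ) ∣ x i := by
    intro i
    rw [ZMod.intCast_zmod_eq_zero_iff_dvd, dvd_neg]
  simp_rw [h3]
  split_ifs with h
  · simp [h]
  · push Not at h
    obtain ⟨i, hi⟩ := h
    exact (Finset.prod_eq_zero (Finset.mem_univ i) (by simp [hi])).symm

lemma hasFT_multiples {d : ℕ} (q : ℕ) [NeZero q] :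
    HasFT q (fun x : Fin d → ℤ => if ∀ i, (q : ℤ) ∣ x i then (q : ℂ) ^ d else 0) 1 :=
  ⟨fun _ => 1, fun b => by simp, multiples_eq_sum q⟩

lemma exists_tsum_wq_le {d : ℕ} (hd : 4 ≤ d) : ∃ C : ℝ, 0 < C ∧ ∀ (q : ℕ) (N L : ℝ), q ≠ 0 → 1 ≤ L →
    (q : ℝ) ^ 2 * L ^ 2 ≤ N → ∑' x : Fin d → ℤ, ENNReal.ofReal (wq d q N L x) ≤ ENNReal.ofReal C := by
  obtain ⟨C, hC, h⟩ := exists_spk_bounds hd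
  refine ⟨C, hC, fun q N L hq hL hN => ?_⟩
  have : NeZero q := ⟨hq⟩
  have hq0 : (0 : ℝ) < q := by positivity
  have hN0 : 0 < N := lt_of_lt_of_le (by positivity) hN
  have hK := hasFT_multiples (d := d) q
  have h1 := ((h q N _ 1 hN0 hK).2 L hL hN).1
  have h2 : ∀ x : Fin d → ℤ, (if ∀ i, (q : ℤ) ∣ x i then (q : ℂ) ^ d else 0) * spk d N (gau L) x =
      (wq d q N L x : ℂ) := by
    intro x
    rw [spk_gau hN0 (by linarith), wq]
    split_ifs <;> simp
  have hs := summable_mul_spk hN0 hK (gau L)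
  simp_rw [h2] at h1 hs
  rw [← Complex.ofReal_tsum, Complex.norm_real] at h1
  have hs' : Summable fun x : Fin d → ℤ => wq d q N L x := by
    refine hs.congr fun x => ?_
    rw [Complex.norm_real, Real.norm_of_nonneg (wq_nonneg (by linarith) x)]
  rw [← ENNReal.ofReal_tsum_of_nonneg (fun x => wq_nonneg (by linarith) x) hs']
  refine ENNReal.ofReal_le_ofReal ?_
  calc _ ≤ _ := le_abs_self _
    _ ≤ _ := h1
    _ = _ := mul_one _

lemma tsum_scaled_gauss_le {q : ℕ} (hq : q ≠ 0) {N : ℝ} (hN : (q : ℝ) ^ 2 ≤ N) (t : ℝ) :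
    (Summable fun k : ℤ => Real.exp (-((q * k + t) ^ 2 / N))) ∧
      ∑' k : ℤ, Real.exp (-((q * k + t) ^ 2 / N)) ≤ 12 * (√N / q) := by
  have hq0 : (0 : ℝ) < q := by positivity
  have hN0 : 0 < N := lt_of_lt_of_le (by positivity) hN
  set s : ℝ := q ^ 2 / (Real.pi * N) with hs
  have hs0 : 0 < s := by positivity
  have h1 : ∀ k : ℤ, Real.exp (-((q * k + t) ^ 2 / N)) =
      Real.exp (-Real.pi * s * ((k : ℝ) - (-(t / q))) ^ 2) := by
    intro k
    congr 1
    rw [hs]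
    have := Real.pi_pos
    field_simp
    ring
  simp_rw [h1]
  refine ⟨summable_shift_gauss hs0 _, (tsum_shift_gauss_le hs0 _).trans ?_⟩
  have h2 := th_functional hs0
  have h3 := th_le_inv (inv_pos.2 hs0)
  have hpi := Real.pi_gt_three
  have hs1 : s ≤ 1 := by
    rw [hs, div_le_one (by positivity)]
    nlinarith
  have h4 : th s⁻¹ ≤ 1 := by
    refine h3.trans ?_
    rw [div_le_one (by positivity)]
    have : 1 ≤ s⁻¹ := (one_le_inv₀ hs0).2 hs1
    nlinarith
  have h5 : (√s)⁻¹ ≤ 2 * (√N / q) := by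
    rw [hs, Real.sqrt_div (by positivity), Real.sqrt_sq hq0.le, inv_div, Real.sqrt_mul (by positivity)]
    rw [← mul_div_assoc]
    gcongr
    rw [Real.sqrt_le_left (by norm_num)]
    linarith [Real.pi_lt_four]
  have h6 : (√s)⁻¹ * th s⁻¹ ≤ (√s)⁻¹ := mul_le_of_le_one_right (by positivity) h4
  have h7 := th_nonneg s
  rw [mul_add] at h2
  linarith

lemma normSqZ_nonneg {d : ℕ} (x : Fin d → ℤ) : (0 : ℝ) ≤ normSqZ x := by
  have : 0 ≤ normSqZ x := Finset.sum_nonneg fun i _ => sq_nonneg _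
  exact_mod_cast this

lemma tsum_lattice_gauss_le {d q : ℕ} (hq : q ≠ 0) {N : ℝ} (hN : (q : ℝ) ^ 2 ≤ N) (t : Fin d → ℤ) :
    ∑' y : Fin d → ℤ, ENNReal.ofReal (Real.exp (-((normSqZ fun i => q * y i + t i) / N))) ≤
      ENNReal.ofReal (12 ^ d * (√N / q) ^ d) := by
  have h1 := fun i => tsum_scaled_gauss_le hq hN (t i)
  set f : Fin d → ℤ → ℂ := fun i k => (Real.exp (-((q * k + t i) ^ 2 / N)) : ℂ) with hf
  have h2 := summable_tsum_pi_prod f (fun i => by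
    refine (h1 i).1.congr fun k => ?_
    rw [hf]
    simp only
    rw [Complex.norm_real, Real.norm_of_nonneg (Real.exp_nonneg _)])
  have h3 : ∀ y : Fin d → ℤ, ∏ i, f i (y i) =
      (Real.exp (-((normSqZ fun i => q * y i + t i) / N)) : ℂ) := by
    intro y
    rw [hf]
    simp only
    rw [← Complex.ofReal_prod, ← Real.exp_sum, normSqZ]
    congr 2
    push_cast
    rw [Finset.sum_div, ← Finset.sum_neg_distrib]
  simp_rw [h3] at h2
  have hs : Summable fun y : Fin d → ℤ => Real.exp (-((normSqZ fun i => q * y i + t i) / N)) := by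
    refine h2.1.congr fun y => ?_
    rw [Complex.norm_real, Real.norm_of_nonneg (Real.exp_nonneg _)]
  have h4 : ∑' y : Fin d → ℤ, Real.exp (-((normSqZ fun i => q * y i + t i) / N)) =
      ∏ i, ∑' k : ℤ, Real.exp (-((q * k + t i) ^ 2 / N)) := by
    have h5 := h2.2
    rw [hf] at h5
    simp only at h5
    simp_rw [← Complex.ofReal_tsum, ← Complex.ofReal_prod] at h5
    exact_mod_cast h5
  rw [← ENNReal.ofReal_tsum_of_nonneg (fun x => Real.exp_nonneg _) hs]
  refine ENNReal.ofReal_le_ofReal ?_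
  rw [h4, ← mul_pow]
  calc _ ≤ ∏ i : Fin d, (12 * (√N / q)) :=
        Finset.prod_le_prod (fun i _ => tsum_nonneg fun k => Real.exp_nonneg _) fun i _ => (h1 i).2
    _ = _ := by simp

lemma tsum_multiples {d q : ℕ} (hq : q ≠ 0) (F : (Fin d → ℤ) → ℝ≥0∞) :
    (∑' x : Fin d → ℤ, if ∀ i, (q : ℤ) ∣ x i then F x else 0) = ∑' y : Fin d → ℤ, F fun i => q * y i := by
  have hq' : (q : ℤ) ≠ 0 := by exact_mod_cast hq
  have hinj : Function.Injective fun (y : Fin d → ℤ) (i : Fin d) => (q : ℤ) * y i := by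
    intro y y' h
    funext i
    exact mul_left_cancel₀ hq' (congrFun h i)
  rw [← hinj.tsum_eq]
  · refine tsum_congr fun y => ?_
    rw [if_pos fun i => dvd_mul_right _ _]
  · intro x hx
    rw [Function.mem_support] at hx
    have h : ∀ i, (q : ℤ) ∣ x i := by
      by_contra h
      exact hx (if_neg h)
    choose y hy using h
    exact ⟨y, by funext i; exact (hy i).symm⟩

/-- Gaussian sums over multiples of `q`, shifted by `t`. -/
lemma tsum_multiples_gauss_le {d q : ℕ} (hq : q ≠ 0) {N : ℝ} (hN : (q : ℝ) ^ 2 ≤ N) (t : Fin d → ℤ) :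
    (∑' x : Fin d → ℤ, if ∀ i, (q : ℤ) ∣ x i then
      ENNReal.ofReal ((q : ℝ) ^ d * (√N ^ d)⁻¹ * Real.exp (-(normSqZ (x + t) / N))) else 0) ≤
      ENNReal.ofReal (12 ^ d) := by
  have hq0 : (0 : ℝ) < q := by positivity
  have hN0 : 0 < N := lt_of_lt_of_le (by positivity) hN
  rw [tsum_multiples hq]
  simp_rw [ENNReal.ofReal_mul (p := (q : ℝ) ^ d * (√N ^ d)⁻¹) (by positivity)]
  rw [ENNReal.tsum_mul_left]
  have h := tsum_lattice_gauss_le hq hN t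
  calc _ ≤ ENNReal.ofReal ((q : ℝ) ^ d * (√N ^ d)⁻¹) * ENNReal.ofReal (12 ^ d * (√N / q) ^ d) := by
        gcongr
        exact h
    _ = _ := by
        rw [← ENNReal.ofReal_mul (by positivity)]
        congr 1
        have : √N ≠ 0 := by positivity
        rw [div_pow]
        field_simp

/-- The Euclidean length of a lattice vector. -/
def en {d : ℕ} (x : Fin d → ℤ) : ℝ := √(normSqZ x)

lemma en_nonneg {d : ℕ} (x : Fin d → ℤ) : 0 ≤ en x := Real.sqrt_nonneg _

lemma en_sq {d : ℕ} (x : Fin d → ℤ) : en x ^ 2 = normSqZ x := Real.sq_sqrt (normSqZ_nonneg x)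

lemma en_eq_norm {d : ℕ} (x : Fin d → ℤ) : en x = ‖WithLp.toLp 2 fun i => (x i : ℝ)‖ := by
  rw [EuclideanSpace.norm_eq, en, normSqZ]
  push_cast
  simp

lemma en_add_le {d : ℕ} (x y : Fin d → ℤ) : en (x + y) ≤ en x + en y := by
  simp_rw [en_eq_norm]
  refine le_trans (le_of_eq ?_) (norm_add_le _ _)
  congr 1
  ext i
  simp

lemma en_neg {d : ℕ} (x : Fin d → ℤ) : en (-x) = en x := by
  rw [en, en, normSqZ, normSqZ]
  simp

/-- The radial profile of `bet`. -/
def prof (L s : ℝ) : ℝ := Real.exp (Real.pi * (1 - s) - 4 * Real.pi * L ^ 2 * (s - 1) ^ 2)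

lemma bet_eq_prof {d : ℕ} (N L : ℝ) (x : Fin d → ℤ) :
    bet d N L x = 2 * (√N ^ d)⁻¹ * L * prof L (normSqZ x / N) := by
  rw [bet, prof, mul_mul_mul_comm, ← Real.exp_add]
  congr 2
  ring

lemma hasDerivAt_prof (L s : ℝ) : HasDerivAt (prof L)
    (prof L s * (-Real.pi - 8 * Real.pi * L ^ 2 * (s - 1))) s := by
  have h1 : HasDerivAt (fun s : ℝ => Real.pi * (1 - s) - 4 * Real.pi * L ^ 2 * (s - 1) ^ 2)
      (Real.pi * (-1) - 4 * Real.pi * L ^ 2 * (2 * (s - 1))) s := by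
    refine HasDerivAt.sub ?_ ?_
    · exact ((hasDerivAt_id s).const_sub 1).const_mul _
    · have := ((hasDerivAt_id s).sub_const 1).pow 2
      refine (this.const_mul _).congr_deriv ?_
      simp
  refine h1.exp.congr_deriv ?_
  rw [prof]
  ring

lemma exp_pi_le : Real.exp Real.pi ≤ 81 := by
  calc Real.exp Real.pi ≤ Real.exp 4 := Real.exp_le_exp.2 Real.pi_lt_four.le
    _ = Real.exp 1 ^ 4 := by rw [← Real.exp_nat_mul]; norm_num
    _ ≤ 3 ^ 4 := by gcongr; exact (Real.exp_one_lt_d9.le.trans (by norm_num))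
    _ = 81 := by norm_num

lemma prof_le {L s : ℝ} (hs : 0 ≤ s) : prof L s ≤ 81 * Real.exp (-(3 * s)) := by
  have hpi := Real.pi_gt_three
  calc prof L s ≤ Real.exp (Real.pi + -(3 * s)) := by
        rw [prof]
        refine Real.exp_le_exp.2 ?_
        have : 0 ≤ 4 * Real.pi * L ^ 2 * (s - 1) ^ 2 := by positivity
        nlinarith
    _ ≤ _ := by
        rw [Real.exp_add]
        gcongr
        exact exp_pi_le

lemma abs_deriv_prof_le {L s : ℝ} (hL : 1 ≤ L) (hs : 0 ≤ s) :
    |prof L s * (-Real.pi - 8 * Real.pi * L ^ 2 * (s - 1))| ≤ 10000 * L ^ 2 * Real.exp (-(2 * s)) := by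
  have hpi := Real.pi_gt_three
  have hpi' := Real.pi_lt_four
  have hp : 0 ≤ prof L s := (Real.exp_pos _).le
  rw [abs_mul, abs_of_nonneg hp]
  have h1 : |-Real.pi - 8 * Real.pi * L ^ 2 * (s - 1)| ≤ 72 * L ^ 2 * Real.exp s := by
    have h2 : 1 + s ≤ Real.exp s := by linarith [Real.add_one_le_exp s]
    have hL2 : 1 ≤ L ^ 2 := by nlinarith
    have h3 : |s - 1| ≤ 1 + s := by rw [abs_le]; constructor <;> linarith
    calc _ ≤ |-Real.pi| + |8 * Real.pi * L ^ 2 * (s - 1)| := abs_sub _ _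
      _ = Real.pi + 8 * Real.pi * L ^ 2 * |s - 1| := by
          rw [abs_neg, abs_mul, abs_of_pos Real.pi_pos, abs_of_pos (by positivity)]
      _ ≤ 4 * L ^ 2 * Real.exp s + 8 * 4 * L ^ 2 * Real.exp s := by
          refine add_le_add ?_ ?_
          · nlinarith
          · gcongr
            linarith
      _ ≤ _ := by nlinarith [mul_nonneg (sq_nonneg L) (Real.exp_pos s).le]
  calc _ ≤ (81 * Real.exp (-(3 * s))) * (72 * L ^ 2 * Real.exp s) := by
        gcongr
        exact prof_le hs
    _ = 5832 * L ^ 2 * Real.exp (-(2 * s)) := by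
        rw [show -(2 * s) = -(3 * s) + s by ring, Real.exp_add]
        ring
    _ ≤ _ := by gcongr; norm_num

lemma abs_prof_sub_le_of_le {L s s' : ℝ} (hL : 1 ≤ L) (hs : 0 ≤ s) (h : s ≤ s') :
    |prof L s' - prof L s| ≤ 10000 * L ^ 2 * Real.exp (-(2 * s)) * (s' - s) := by
  have := (convex_Icc s s').norm_image_sub_le_of_norm_hasDerivWithin_le
    (C := 10000 * L ^ 2 * Real.exp (-(2 * s)))
    (fun x _ => (hasDerivAt_prof L x).hasDerivWithinAt) (fun x hx => by
      refine (abs_deriv_prof_le hL (hs.trans hx.1)).trans ?_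
      gcongr
      exact hx.1) (Set.left_mem_Icc.2 h) (Set.right_mem_Icc.2 h)
  rwa [Real.norm_eq_abs, Real.norm_eq_abs, abs_of_nonneg (sub_nonneg.2 h)] at this

lemma abs_prof_sub_le {L u u' ζ : ℝ} (hL : 1 ≤ L) (hu : 0 ≤ u) (hu' : 0 ≤ u') (h1 : u' ≤ u + ζ)
    (h2 : u ≤ u' + ζ) : |prof L (u' ^ 2) - prof L (u ^ 2)| ≤
      20000 * L ^ 2 * (ζ * (1 + ζ)) * (Real.exp (-u ^ 2) + Real.exp (-u' ^ 2)) := by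
  wlog h : u ≤ u' generalizing u u'
  · rw [abs_sub_comm, add_comm (Real.exp _)]
    exact this hu' hu h2 h1 (not_le.1 h).le
  have hζ : 0 ≤ ζ := by linarith
  refine (abs_prof_sub_le_of_le hL (sq_nonneg u) (by gcongr)).trans ?_
  have h3 : u' ^ 2 - u ^ 2 ≤ ζ * (2 * (1 + ζ) * Real.exp (u ^ 2)) := by
    have h4 : 1 + u ^ 2 ≤ Real.exp (u ^ 2) := by linarith [Real.add_one_le_exp (u ^ 2)]
    have h5 : u' + u ≤ 2 * (1 + ζ) * Real.exp (u ^ 2) := by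
      nlinarith [sq_nonneg (u - 1), mul_nonneg hζ (sq_nonneg u)]
    calc u' ^ 2 - u ^ 2 = (u' - u) * (u' + u) := by ring
      _ ≤ ζ * (2 * (1 + ζ) * Real.exp (u ^ 2)) := by
          gcongr
          linarith
  calc _ ≤ 10000 * L ^ 2 * Real.exp (-(2 * u ^ 2)) * (ζ * (2 * (1 + ζ) * Real.exp (u ^ 2))) := by gcongr
    _ = 20000 * L ^ 2 * (ζ * (1 + ζ)) * Real.exp (-u ^ 2) := by
        rw [show -u ^ 2 = -(2 * u ^ 2) + u ^ 2 by ring, Real.exp_add]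
        ring
    _ ≤ _ := by
        gcongr
        linarith [Real.exp_pos (-u' ^ 2)]

lemma normSqZ_div {d : ℕ} {N : ℝ} (hN : 0 < N) (x : Fin d → ℤ) :
    (normSqZ x : ℝ) / N = (en x / √N) ^ 2 := by
  rw [div_pow, en_sq, Real.sq_sqrt hN.le]

lemma abs_bet_sub_le {d : ℕ} {N L : ℝ} (hN : 0 < N) (hL : 1 ≤ L) (x z : Fin d → ℤ) :
    |bet d N L (x + z) - bet d N L x| ≤ 40000 * L ^ 3 * (en z / √N * (1 + en z / √N)) *
      ((√N ^ d)⁻¹ * Real.exp (-(normSqZ x / N)) + (√N ^ d)⁻¹ * Real.exp (-(normSqZ (x + z) / N))) := by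
  rw [bet_eq_prof, bet_eq_prof, ← mul_sub, abs_mul, abs_of_nonneg (by positivity : (0 : ℝ) ≤ _)]
  rw [normSqZ_div hN, normSqZ_div hN]
  have h1 : en (x + z) / √N ≤ en x / √N + en z / √N := by
    rw [← add_div]
    gcongr
    exact en_add_le x z
  have h2 : en x / √N ≤ en (x + z) / √N + en z / √N := by
    rw [← add_div]
    gcongr
    have := en_add_le (x + z) (-z)
    rwa [en_neg, add_neg_cancel_right] at this
  have h := abs_prof_sub_le hL (div_nonneg (en_nonneg x) (Real.sqrt_nonneg N))
    (div_nonneg (en_nonneg (x + z)) (Real.sqrt_nonneg N)) h1 h2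
  calc _ ≤ 2 * (√N ^ d)⁻¹ * L * _ := mul_le_mul_of_nonneg_left h (by positivity)
    _ = _ := by ring

lemma tsum_bet_sub_le {d q : ℕ} (hq : q ≠ 0) {N L : ℝ} (hN : (q : ℝ) ^ 2 ≤ N) (hL : 1 ≤ L)
    (z : Fin d → ℤ) :
    (∑' x : Fin d → ℤ, if ∀ i, (q : ℤ) ∣ x i then
      ENNReal.ofReal ((q : ℝ) ^ d * |bet d N L (x + z) - bet d N L x|) else 0) ≤
      ENNReal.ofReal (80000 * 12 ^ d * L ^ 3 * (en z / √N * (1 + en z / √N))) := by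
  have hq0 : (0 : ℝ) < q := by positivity
  have hN0 : 0 < N := lt_of_lt_of_le (by positivity) hN
  have hz : 0 ≤ en z / √N := div_nonneg (en_nonneg z) (Real.sqrt_nonneg N)
  set E : ℝ := 40000 * L ^ 3 * (en z / √N * (1 + en z / √N)) with hE
  have hE0 : 0 ≤ E := by positivity
  have h0 := tsum_multiples_gauss_le hq hN (0 : Fin d → ℤ)
  have h1 := tsum_multiples_gauss_le hq hN z
  simp_rw [add_zero] at h0
  calc _ ≤ ∑' x : Fin d → ℤ, ENNReal.ofReal E * ((if ∀ i, (q : ℤ) ∣ x i then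
        ENNReal.ofReal ((q : ℝ) ^ d * (√N ^ d)⁻¹ * Real.exp (-(normSqZ x / N))) else 0) +
        (if ∀ i, (q : ℤ) ∣ x i then
        ENNReal.ofReal ((q : ℝ) ^ d * (√N ^ d)⁻¹ * Real.exp (-(normSqZ (x + z) / N))) else 0)) := by
        refine ENNReal.tsum_le_tsum fun x => ?_
        split_ifs
        · rw [← ENNReal.ofReal_add (by positivity) (by positivity), ← ENNReal.ofReal_mul hE0]
          refine ENNReal.ofReal_le_ofReal ?_
          calc _ ≤ (q : ℝ) ^ d * _ := mul_le_mul_of_nonneg_left (abs_bet_sub_le hN0 hL x z) (by positivity)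
            _ = _ := by rw [hE]; ring
        · simp
    _ ≤ ENNReal.ofReal E * (ENNReal.ofReal (12 ^ d) + ENNReal.ofReal (12 ^ d)) := by
        rw [ENNReal.tsum_mul_left, ENNReal.tsum_add]
        gcongr
    _ = _ := by
        rw [← ENNReal.ofReal_add (by positivity) (by positivity), ← ENNReal.ofReal_mul hE0]
        congr 1
        rw [hE]
        ring

lemma exists_tsum_wq_moment_le (d : ℕ) : ∃ C : ℝ, 0 < C ∧ ∀ (q : ℕ) (N L : ℝ), q ≠ 0 → 0 ≤ L →
    (q : ℝ) ^ 2 ≤ N → ∑' x : Fin d → ℤ, ENNReal.ofReal (wq d q N L x * (1 + en x / √N) ^ d) ≤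
      ENNReal.ofReal (C * L) := by
  obtain ⟨C, hC, h⟩ := exp_mul_pow_le d
  have hC0 : 0 < C := by linarith
  refine ⟨162 * C * 12 ^ d, by positivity, fun q N L hq hL hN => ?_⟩
  have hq0 : (0 : ℝ) < q := by positivity
  have hN0 : 0 < N := lt_of_lt_of_le (by positivity) hN
  have h0 := tsum_multiples_gauss_le hq hN (0 : Fin d → ℤ)
  simp_rw [add_zero] at h0
  calc _ ≤ ∑' x : Fin d → ℤ, ENNReal.ofReal (162 * C * L) * (if ∀ i, (q : ℤ) ∣ x i then
        ENNReal.ofReal ((q : ℝ) ^ d * (√N ^ d)⁻¹ * Real.exp (-(normSqZ x / N))) else 0) := by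
        refine ENNReal.tsum_le_tsum fun x => ?_
        rw [wq]
        split_ifs
        · rw [← ENNReal.ofReal_mul (by positivity)]
          refine ENNReal.ofReal_le_ofReal ?_
          rw [bet_eq_prof, normSqZ_div hN0]
          set u := en x / √N
          have hu : 0 ≤ u := div_nonneg (en_nonneg x) (Real.sqrt_nonneg N)
          have h1 := prof_le (L := L) (sq_nonneg u)
          have h2 : Real.exp (-(3 * u ^ 2)) * (1 + u) ^ d ≤ C * Real.exp (-u ^ 2) := by
            calc _ ≤ Real.exp (-(2 * u ^ 2)) * (2 + 17 * u ^ 2) ^ d := by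
                  gcongr ?_ * ?_ ^ _
                  · exact Real.exp_le_exp.2 (by nlinarith)
                  · nlinarith [sq_nonneg (u - 1)]
              _ = (Real.exp (-u ^ 2) * (2 + 17 * u ^ 2) ^ d) * Real.exp (-u ^ 2) := by
                  rw [show -(2 * u ^ 2) = -u ^ 2 + -u ^ 2 by ring, Real.exp_add]
                  ring
              _ ≤ _ := by
                  gcongr
                  exact h _ (sq_nonneg u)
          calc _ = (q : ℝ) ^ d * (√N ^ d)⁻¹ * (2 * L) * (prof L (u ^ 2) * (1 + u) ^ d) := by ring
            _ ≤ (q : ℝ) ^ d * (√N ^ d)⁻¹ * (2 * L) * (81 * Real.exp (-(3 * u ^ 2)) * (1 + u) ^ d) := by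
                gcongr
            _ = (q : ℝ) ^ d * (√N ^ d)⁻¹ * (162 * L) * (Real.exp (-(3 * u ^ 2)) * (1 + u) ^ d) := by ring
            _ ≤ (q : ℝ) ^ d * (√N ^ d)⁻¹ * (162 * L) * (C * Real.exp (-u ^ 2)) := by gcongr
            _ = _ := by ring
        · simp
    _ ≤ ENNReal.ofReal (162 * C * L) * ENNReal.ofReal (12 ^ d) := by
        rw [ENNReal.tsum_mul_left]
        gcongr
    _ = _ := by
        rw [← ENNReal.ofReal_mul (by positivity)]
        congr 1
        ring

/-- The lift of a residue vector to `{0, …, q - 1}^d`. -/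
def lft {d q : ℕ} (s : Fin d → ZMod q) : Fin d → ℤ := fun i => (s i).val

/-- The discrete tent function: the autocorrelation of the normalised box `{0, …, q - 1}^d`. -/
def tent (d q : ℕ) [NeZero q] (x : Fin d → ℤ) : ℝ :=
  (((q : ℝ) ^ d) ^ 2)⁻¹ * ∑ s : Fin d → ZMod q, ∑ s' : Fin d → ZMod q, if x = lft s - lft s' then 1 else 0

lemma tent_nonneg {d q : ℕ} [NeZero q] (x : Fin d → ℤ) : 0 ≤ tent d q x :=
  mul_nonneg (by positivity) (Finset.sum_nonneg fun s _ => Finset.sum_nonneg fun s' _ => by split_ifs <;> simp)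

lemma hasSum_tent {d q : ℕ} [NeZero q] {E : Type*} [NormedAddCommGroup E] [NormedSpace ℝ E]
    (G : (Fin d → ℤ) → E) : HasSum (fun x => tent d q x • G x)
      ((((q : ℝ) ^ d) ^ 2)⁻¹ • ∑ s : Fin d → ZMod q, ∑ s' : Fin d → ZMod q, G (lft s - lft s')) := by
  have h : (fun x => tent d q x • G x) = fun x => (((q : ℝ) ^ d) ^ 2)⁻¹ • ∑ s : Fin d → ZMod q,
      ∑ s' : Fin d → ZMod q, if x = lft s - lft s' then G x else 0 := by
    funext x
    rw [tent, mul_smul, Finset.sum_smul]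
    congr 1
    refine Finset.sum_congr rfl fun s _ => ?_
    rw [Finset.sum_smul]
    refine Finset.sum_congr rfl fun s' _ => ?_
    rw [ite_smul, one_smul, zero_smul]
  rw [h]
  refine HasSum.const_smul _ (hasSum_sum fun s _ => hasSum_sum fun s' _ => ?_)
  have := hasSum_single (f := fun x => if x = lft s - lft s' then G x else 0) (lft s - lft s')
    fun x hx => if_neg hx
  rwa [if_pos rfl] at this

lemma en_lft_sub_le {d q : ℕ} [NeZero q] (s s' : Fin d → ZMod q) : en (lft s - lft s') ≤ d * q := by
  rw [en, Real.sqrt_le_left (by positivity)]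
  have h1 : ∀ i, (((lft s - lft s') i : ℤ) : ℝ) ^ 2 ≤ (q : ℝ) ^ 2 := by
    intro i
    rw [Pi.sub_apply, lft, lft, ← sq_abs]
    have a1 : ((s i).val : ℤ) < q := by exact_mod_cast ZMod.val_lt (s i)
    have a2 : ((s' i).val : ℤ) < q := by exact_mod_cast ZMod.val_lt (s' i)
    have a3 : |((s i).val : ℤ) - (s' i).val| ≤ q := by rw [abs_le]; constructor <;> omega
    gcongr
    exact_mod_cast a3
  have h2 : (normSqZ (lft s - lft s') : ℝ) ≤ ∑ i : Fin d, (q : ℝ) ^ 2 := by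
    rw [normSqZ]
    push_cast
    exact Finset.sum_le_sum fun i _ => h1 i
  refine h2.trans ?_
  rw [Finset.sum_const, Finset.card_univ, Fintype.card_fin, nsmul_eq_mul, mul_pow]
  gcongr
  have : d ≤ d ^ 2 := Nat.le_self_pow (by norm_num) d
  exact_mod_cast this

lemma cast_lft {d q : ℕ} [NeZero q] (s : Fin d → ZMod q) (i : Fin d) : ((lft s i : ℤ) : ZMod q) = s i := by
  simp [lft]

lemma sum_residue_indicator {d q : ℕ} [NeZero q] (x : Fin d → ℤ) :
    ∑ s : Fin d → ZMod q, ∑ s' : Fin d → ZMod q,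
      (if ∀ i, (q : ℤ) ∣ (x - (lft s - lft s')) i then (1 : ℝ) else 0) = (q : ℝ) ^ d := by
  rw [Finset.sum_comm]
  have h : ∀ s' s : Fin d → ZMod q, (∀ i, (q : ℤ) ∣ (x - (lft s - lft s')) i) ↔
      s = fun i => (x i : ZMod q) + s' i := by
    intro s' s
    rw [funext_iff]
    refine forall_congr' fun i => ?_
    rw [← ZMod.intCast_zmod_eq_zero_iff_dvd, Pi.sub_apply, Pi.sub_apply]
    push_cast
    rw [cast_lft, cast_lft]
    constructor
    · intro h; linear_combination -h
    · intro h; linear_combination -h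
  simp_rw [h]
  simp [ZMod.card]

/-- The kernel `cK` localised to the scale `q`. -/
def Dk {d : ℕ} (q : ℕ) [NeZero q] (n : ℤ) (x : Fin d → ℤ) : ℂ := cK q n x * tent d q x

lemma hasSum_mul_tent {d q : ℕ} [NeZero q] (G : (Fin d → ℤ) → ℂ) : HasSum (fun x => G x * tent d q x)
    ((((q : ℂ) ^ d) ^ 2)⁻¹ * ∑ s : Fin d → ZMod q, ∑ s' : Fin d → ZMod q, G (lft s - lft s')) := by
  have h := hasSum_tent (q := q) G
  have h2 : (fun x => tent d q x • G x) = fun x => G x * tent d q x := by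
    funext x
    rw [Complex.real_smul, mul_comm]
  rw [h2, Complex.real_smul] at h
  push_cast at h
  exact h

lemma hasSum_norm_mul_tent {d q : ℕ} [NeZero q] (G : (Fin d → ℤ) → ℂ) :
    HasSum (fun x => ‖G x * tent d q x‖)
    ((((q : ℝ) ^ d) ^ 2)⁻¹ * ∑ s : Fin d → ZMod q, ∑ s' : Fin d → ZMod q, ‖G (lft s - lft s')‖) := by
  have h := hasSum_tent (q := q) fun x => ‖G x‖
  have h2 : (fun x => tent d q x • ‖G x‖) = fun x => ‖G x * tent d q x‖ := by
    funext x
    rw [norm_mul, Complex.norm_real, Real.norm_of_nonneg (tent_nonneg x), smul_eq_mul, mul_comm]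
  rwa [h2, smul_eq_mul] at h

lemma sum_eC_lft {d q : ℕ} [NeZero q] (s s' : Fin d → ZMod q) :
    ∑ b : Fin d → ZMod q, eC (-(∑ i, ((b i).val : ℝ) * ((lft s - lft s') i : ℝ)) / q) =
      if s = s' then (q : ℂ) ^ d else 0 := by
  obtain ⟨c, hc, h⟩ : ∃ c : (Fin d → ZMod q) → ℂ, (∀ b, c b = 1) ∧ ∀ x : Fin d → ℤ,
      (if ∀ i, (q : ℤ) ∣ x i then (q : ℂ) ^ d else 0) =
        ∑ b, c b * eC (-(∑ i, ((b i).val : ℝ) * (x i : ℝ)) / q) := by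
    refine ⟨fun _ => 1, fun _ => rfl, ?_⟩
    exact multiples_eq_sum q
  have h1 := h (lft s - lft s')
  simp_rw [hc, one_mul] at h1
  rw [← h1]
  have h2 : (∀ i, (q : ℤ) ∣ (lft s - lft s') i) ↔ s = s' := by
    rw [funext_iff]
    refine forall_congr' fun i => ?_
    rw [← ZMod.intCast_zmod_eq_zero_iff_dvd, Pi.sub_apply]
    push_cast
    rw [cast_lft, cast_lft, sub_eq_zero]
  simp_rw [h2]

lemma normSq_sum_eC {d q : ℕ} [NeZero q] (ξ : Fin d → ℝ) :
    ((‖∑ s : Fin d → ZMod q, eC (∑ i, (lft s i : ℝ) * ξ i)‖ ^ 2 : ℝ) : ℂ) =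
      ∑ s : Fin d → ZMod q, ∑ s' : Fin d → ZMod q, eC (∑ i, ((lft s - lft s') i : ℝ) * ξ i) := by
  have h0 : ∀ t : ℝ, (starRingEnd ℂ) (eC t) = eC (-t) := by
    intro t
    rw [eC, eC, ← Complex.exp_conj]
    congr 1
    simp
    exact Or.inl (map_ofNat (starRingEnd ℂ) 2)
  rw [Complex.ofReal_pow, ← Complex.mul_conj', map_sum, Finset.sum_mul_sum]
  refine Finset.sum_congr rfl fun s _ => Finset.sum_congr rfl fun s' _ => ?_
  rw [h0, ← eC_add]
  congr 1
  rw [← sub_eq_add_neg, ← Finset.sum_sub_distrib]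
  refine Finset.sum_congr rfl fun i _ => ?_
  rw [Pi.sub_apply]
  push_cast
  ring

lemma HasFT.norm_tent_multiplier_le {d q : ℕ} [NeZero q] {K : (Fin d → ℤ) → ℂ} {κ : ℝ} (hK : HasFT q K κ)
    (ξ : Fin d → ℝ) :
    ‖∑' x, K x * tent d q x * eC (∑ i, (x i : ℝ) * ξ i)‖ ≤ κ := by
  obtain ⟨c, hc, hKc⟩ := hK
  have hq0 : (0 : ℝ) < q := Nat.cast_pos.2 (NeZero.pos q)
  have h1 := (hasSum_mul_tent (q := q) fun x => K x * eC (∑ i, (x i : ℝ) * ξ i)).tsum_eq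
  have h2 : ∀ x : Fin d → ℤ, K x * tent d q x * eC (∑ i, (x i : ℝ) * ξ i) =
      K x * eC (∑ i, (x i : ℝ) * ξ i) * tent d q x := fun x => by ring
  simp_rw [h2]
  rw [h1]
  have e : ∀ (b : Fin d → ZMod q) (x : Fin d → ℤ),
      eC (-(∑ i, ((b i).val : ℝ) * (x i : ℝ)) / q) * eC (∑ i, (x i : ℝ) * ξ i) =
        eC (∑ i, (x i : ℝ) * (ξ i - (b i).val / q)) := by
    intro b x
    rw [← eC_add]
    congr 1
    rw [neg_div, Finset.sum_div, ← Finset.sum_neg_distrib, ← Finset.sum_add_distrib]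
    exact Finset.sum_congr rfl fun i _ => by ring
  have h3 : ∑ s : Fin d → ZMod q, ∑ s' : Fin d → ZMod q, K (lft s - lft s') *
      eC (∑ i, ((lft s - lft s') i : ℝ) * ξ i) =
      ∑ b, c b * ((‖∑ s : Fin d → ZMod q, eC (∑ i, (lft s i : ℝ) * (ξ i - (b i).val / q))‖ ^ 2 : ℝ) : ℂ) := by
    simp_rw [normSq_sum_eC, hKc, Finset.sum_mul, mul_assoc, e, Finset.mul_sum]
    rw [Finset.sum_congr rfl fun s _ => Finset.sum_comm, Finset.sum_comm]
  have h4 : ∑ b : Fin d → ZMod q,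
      ‖∑ s : Fin d → ZMod q, eC (∑ i, (lft s i : ℝ) * (ξ i - (b i).val / q))‖ ^ 2 = ((q : ℝ) ^ d) ^ 2 := by
    have h5 : ((∑ b : Fin d → ZMod q, ‖∑ s : Fin d → ZMod q,
        eC (∑ i, (lft s i : ℝ) * (ξ i - (b i).val / q))‖ ^ 2 : ℝ) : ℂ) = ((q : ℂ) ^ d) ^ 2 := by
      rw [Complex.ofReal_sum]
      simp_rw [normSq_sum_eC, ← e]
      rw [Finset.sum_comm, Finset.sum_congr rfl fun s _ => Finset.sum_comm]
      simp_rw [← Finset.sum_mul, sum_eC_lft]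
      simp only [ite_mul, zero_mul, Finset.sum_ite_eq, Finset.mem_univ, if_true, sub_self]
      simp [eC, ZMod.card, sq]
    exact_mod_cast h5
  rw [h3, norm_mul]
  calc _ ≤ (((q : ℝ) ^ d) ^ 2)⁻¹ * (κ * ((q : ℝ) ^ d) ^ 2) := by
        refine mul_le_mul (by simp) ?_ (norm_nonneg _) (by positivity)
        refine (norm_sum_le _ _).trans ?_
        rw [← h4, Finset.mul_sum]
        refine Finset.sum_le_sum fun b _ => ?_
        rw [norm_mul, Complex.norm_real, Real.norm_of_nonneg (sq_nonneg _)]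
        exact mul_le_mul_of_nonneg_right (hc b) (sq_nonneg _)
    _ = κ := by field_simp

lemma bilP_Dk {d : ℕ} (q n : ℕ) [NeZero q] : BilP 2 2 (Dk (d := d) q n) (kap d q n) :=
  bilP_two_of_multiplier (hasSum_norm_mul_tent _).summable (hasFT_cK q n).norm_tent_multiplier_le

lemma sum_norm_Dk_eq {d : ℕ} (q : ℕ) [NeZero q] (n : ℤ) :
    HasSum (fun x : Fin d → ℤ => ‖Dk q n x‖)
      (((q : ℝ) ^ d)⁻¹ * ∑ a : Fin d → ZMod q, ‖rs (∑ i, a i ^ 2 - (n : ZMod q))‖) := by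
  have hq0 : (0 : ℝ) < q := Nat.cast_pos.2 (NeZero.pos q)
  have h := hasSum_norm_mul_tent (q := q) (cK (d := d) q n)
  have h1 : ∀ s s' : Fin d → ZMod q, ‖cK q n (lft s - lft s')‖ =
      ‖rs (∑ i, (s - s') i ^ 2 - (n : ZMod q))‖ := by
    intro s s'
    rw [cK, ramanujanSum_eq_rs, normSqZ]
    push_cast
    simp_rw [Pi.sub_apply, Int.cast_sub, cast_lft]
  simp_rw [h1] at h
  have h2 : ∑ s : Fin d → ZMod q, ∑ s' : Fin d → ZMod q, ‖rs (∑ i, (s - s') i ^ 2 - (n : ZMod q))‖ =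
      (q : ℝ) ^ d * ∑ a : Fin d → ZMod q, ‖rs (∑ i, a i ^ 2 - (n : ZMod q))‖ := by
    have h3 : ∀ s : Fin d → ZMod q, ∑ s' : Fin d → ZMod q, ‖rs (∑ i, (s - s') i ^ 2 - (n : ZMod q))‖ =
        ∑ a : Fin d → ZMod q, ‖rs (∑ i, a i ^ 2 - (n : ZMod q))‖ := fun s =>
      (Equiv.subLeft s).sum_comp fun a => ‖rs (∑ i, a i ^ 2 - (n : ZMod q))‖
    simp_rw [h3]
    simp [ZMod.card]
  have h4 : ∀ R : ℝ, (((q : ℝ) ^ d) ^ 2)⁻¹ * ((q : ℝ) ^ d * R) = ((q : ℝ) ^ d)⁻¹ * R := fun R => by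
    field_simp
  rw [h2, h4] at h
  exact h

lemma exists_sum_norm_Dk_le (d : ℕ) (hd : 5 ≤ d) : ∃ C : ℝ, 0 ≤ C ∧ ∀ (q : ℕ) [NeZero q] (n : ℤ),
    ∀ T : Finset (Fin d → ℤ), ∑ x ∈ T, ‖Dk q n x‖ ≤ C * q.divisors.card := by
  obtain ⟨C, hC, h⟩ := exists_sum_norm_rs_le d hd
  refine ⟨C, hC, fun q _ n T => ?_⟩
  have hq0 : (0 : ℝ) < q := Nat.cast_pos.2 (NeZero.pos q)
  refine (sum_le_hasSum T (fun _ _ => norm_nonneg _) (sum_norm_Dk_eq q n)).trans ?_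
  rw [inv_mul_le_iff₀ (by positivity)]
  exact (h q n).trans_eq (by ring)

/-- The convolution of the localised kernel `Dk` with the bump `wq`. -/
def convDk {d : ℕ} (q : ℕ) [NeZero q] (n : ℤ) (N L : ℝ) (x : Fin d → ℤ) : ℂ :=
  ∑' t, Dk q n t * wq d q N L (x - t)

lemma hasSum_convDk {d : ℕ} (q : ℕ) [NeZero q] (n : ℤ) (N L : ℝ) (x : Fin d → ℤ) :
    HasSum (fun t => Dk q n t * wq d q N L (x - t)) (convDk q n N L x) := by
  refine Summable.hasSum ?_
  refine (hasSum_mul_tent (q := q) fun t => cK q n t * wq d q N L (x - t)).summable.congr fun t => ?_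
  rw [Dk]
  ring

/-- The difference between the arithmetic-times-smooth kernel and its lattice convolution model. -/
def errP {d : ℕ} (q : ℕ) [NeZero q] (n : ℤ) (N L : ℝ) (x : Fin d → ℤ) : ℂ :=
  cK q n x * bet d N L x - convDk q n N L x

lemma cK_congr {d : ℕ} (q : ℕ) [NeZero q] (n : ℤ) {x t : Fin d → ℤ} (h : ∀ i, (q : ℤ) ∣ (x - t) i) :
    cK q n t = cK q n x := by
  rw [cK, cK, ramanujanSum_eq_rs, ramanujanSum_eq_rs, normSqZ, normSqZ]
  have h1 : ∀ i, ((t i : ℤ) : ZMod q) = x i := by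
    intro i
    have := (ZMod.intCast_zmod_eq_zero_iff_dvd _ _).2 (h i)
    rw [Pi.sub_apply, Int.cast_sub, sub_eq_zero] at this
    exact this.symm
  push_cast
  simp_rw [h1]

lemma hasSum_errP {d : ℕ} (q : ℕ) [NeZero q] (n : ℤ) (N L : ℝ) (x : Fin d → ℤ) :
    HasSum (fun t => (if ∀ i, (q : ℤ) ∣ (x - t) i then
      (q : ℂ) ^ d * cK q n x * (bet d N L x - bet d N L (x - t) : ℝ) else 0) * tent d q t)
      (errP q n N L x) := by
  have hq : (q : ℂ) ≠ 0 := by exact_mod_cast NeZero.ne q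
  have h1 := hasSum_mul_tent (q := q) fun t : Fin d → ℤ => (if ∀ i, (q : ℤ) ∣ (x - t) i then (1 : ℂ) else 0) *
    ((q : ℂ) ^ d * cK q n x * bet d N L x)
  have h2 : ∑ s : Fin d → ZMod q, ∑ s' : Fin d → ZMod q,
      (if ∀ i, (q : ℤ) ∣ (x - (lft s - lft s')) i then (1 : ℂ) else 0) = (q : ℂ) ^ d := by
    exact_mod_cast congrArg (fun r : ℝ => (r : ℂ)) (sum_residue_indicator (q := q) x)
  simp_rw [← Finset.sum_mul] at h1
  have h3 : (((q : ℂ) ^ d) ^ 2)⁻¹ * ((q : ℂ) ^ d * ((q : ℂ) ^ d * cK q n x * bet d N L x)) =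
      cK q n x * bet d N L x := by
    field_simp
  rw [h2, h3] at h1
  refine (h1.sub (hasSum_convDk q n N L x)).congr_fun fun t => ?_
  rw [Dk, wq]
  split_ifs with h
  · rw [cK_congr q n h]
    push_cast
    ring
  · simp

lemma enorm_errP_le {d : ℕ} (q : ℕ) [NeZero q] (n : ℤ) (N L : ℝ) (x : Fin d → ℤ) :
    ‖errP q n N L x‖ₑ ≤ ∑' t : Fin d → ℤ, ENNReal.ofReal (q * tent d q t) *
      (if ∀ i, (q : ℤ) ∣ (x - t) i then
        ENNReal.ofReal ((q : ℝ) ^ d * |bet d N L x - bet d N L (x - t)|) else 0) := by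
  rw [← (hasSum_errP q n N L x).tsum_eq]
  refine enorm_tsum_le_tsum_enorm.trans (ENNReal.tsum_le_tsum fun t => ?_)
  split_ifs with h
  · rw [← ENNReal.ofReal_mul (mul_nonneg (by positivity) (tent_nonneg t)), ← ofReal_norm]
    refine ENNReal.ofReal_le_ofReal ?_
    rw [norm_mul, norm_mul, norm_mul, Complex.norm_real, Complex.norm_real, norm_pow, Complex.norm_natCast,
      Real.norm_of_nonneg (tent_nonneg t), Real.norm_eq_abs]
    have h1 : ‖cK q n x‖ ≤ q := norm_ramanujanSum_le q _
    calc _ ≤ (q : ℝ) ^ d * q * |bet d N L x - bet d N L (x - t)| * tent d q t := by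
          have := tent_nonneg (q := q) t
          gcongr
      _ = _ := by ring
  · simp

lemma tsum_tent {d : ℕ} (q : ℕ) [NeZero q] : ∑' t : Fin d → ℤ, ENNReal.ofReal (tent d q t) = 1 := by
  have hq0 : (0 : ℝ) < q := Nat.cast_pos.2 (NeZero.pos q)
  have h := hasSum_tent (d := d) (q := q) fun _ => (1 : ℝ)
  simp only [smul_eq_mul, mul_one] at h
  rw [← ENNReal.ofReal_tsum_of_nonneg (fun t => tent_nonneg t) h.summable, h.tsum_eq]
  simp only [Finset.sum_const, Finset.card_univ, Fintype.card_pi, ZMod.card, nsmul_eq_mul, mul_one]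
  rw [← ENNReal.ofReal_one]
  congr 1
  simp
  field_simp

lemma exists_tsum_errP_le (d : ℕ) : ∃ C : ℝ, 0 < C ∧ ∀ (q : ℕ) [NeZero q] (n : ℤ) (N L : ℝ), 1 ≤ L →
    (q : ℝ) ^ 2 ≤ N → ∑' x : Fin d → ℤ, ‖errP q n N L x‖ₑ ≤ ENNReal.ofReal (C * (L ^ 3 * q ^ 2 / √N)) := by
  refine ⟨80000 * 12 ^ d * (d + 1) * (1 + d), by positivity, fun q _ n N L hL hN => ?_⟩
  have hq := NeZero.ne q
  have hq0 : (0 : ℝ) < q := by positivity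
  have hN0 : 0 < N := lt_of_lt_of_le (by positivity) hN
  have hsN : 0 < √N := Real.sqrt_pos.2 hN0
  have hqN : q / √N ≤ 1 := by
    rw [div_le_one hsN]
    exact Real.le_sqrt_of_sq_le hN
  set B : ℝ := 80000 * 12 ^ d * L ^ 3 * ((d * (q / √N)) * (1 + d)) with hB
  calc _ ≤ ∑' x : Fin d → ℤ, ∑' t : Fin d → ℤ, ENNReal.ofReal (q * tent d q t) *
      (if ∀ i, (q : ℤ) ∣ (x - t) i then
        ENNReal.ofReal ((q : ℝ) ^ d * |bet d N L x - bet d N L (x - t)|) else 0) :=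
        ENNReal.tsum_le_tsum fun x => enorm_errP_le q n N L x
    _ ≤ ∑' t : Fin d → ℤ, ENNReal.ofReal (q * tent d q t) * ENNReal.ofReal B := by
        rw [ENNReal.tsum_comm]
        refine ENNReal.tsum_le_tsum fun t => ?_
        rw [ENNReal.tsum_mul_left]
        by_cases ht : ∃ s s' : Fin d → ZMod q, t = lft s - lft s'
        · gcongr
          rw [← (Equiv.addRight t).tsum_eq]
          simp only [Equiv.coe_addRight, add_sub_cancel_right]
          refine (tsum_bet_sub_le hq hN hL t).trans (ENNReal.ofReal_le_ofReal ?_)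
          obtain ⟨s, s', rfl⟩ := ht
          have h1 : en (lft s - lft s') / √N ≤ d * (q / √N) := by
            rw [← mul_div_assoc]
            gcongr
            exact en_lft_sub_le s s'
          have h2 : 0 ≤ en (lft s - lft s') / √N := div_nonneg (en_nonneg _) hsN.le
          have h3 : d * (q / √N) ≤ d := mul_le_of_le_one_right (by positivity) hqN
          rw [hB]
          gcongr
          linarith
        · have : tent d q t = 0 := by
            push Not at ht
            rw [tent]
            simp [ht]
          simp [this]
    _ = ENNReal.ofReal (q * B) := by
        simp_rw [ENNReal.ofReal_mul hq0.le]
        rw [ENNReal.tsum_mul_right, ENNReal.tsum_mul_left, tsum_tent, mul_one]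
    _ ≤ _ := by
        refine ENNReal.ofReal_le_ofReal ?_
        have : q * B = 80000 * 12 ^ d * d * (1 + d) * (L ^ 3 * q ^ 2 / √N) := by
          rw [hB]
          field_simp
        rw [this]
        gcongr
        linarith

lemma enorm_sum_cK_bet_le {d : ℕ} (q : ℕ) [NeZero q] (n : ℤ) (N : ℝ) {L : ℝ} (hL : 0 ≤ L)
    (S : Finset (Fin d → ℤ)) (f : (Fin d → ℤ) → ℂ) (x : Fin d → ℤ) :
    ‖∑ z ∈ S, cK q n (x - z) * bet d N L (x - z) * f z‖ₑ ≤
      cv (fun y => ENNReal.ofReal (wq d q N L y)) (fun v => ‖∑ z ∈ S, Dk q n (v - z) * f z‖ₑ) x +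
        cv (fun y => ‖errP q n N L y‖ₑ) (fun z => ‖f z‖ₑ) x := by
  have h0 : ∑ z ∈ S, cK q n (x - z) * bet d N L (x - z) * f z =
      ∑ z ∈ S, convDk q n N L (x - z) * f z + ∑ z ∈ S, errP q n N L (x - z) * f z := by
    rw [← Finset.sum_add_distrib]
    refine Finset.sum_congr rfl fun z _ => ?_
    rw [errP]
    ring
  rw [h0]
  refine (enorm_add_le _ _).trans (add_le_add ?_ ?_)
  · have h1 : ∀ z, HasSum (fun y => wq d q N L y * (Dk q n (x - y - z) * f z))
        (convDk q n N L (x - z) * f z) := by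
      intro z
      have h := ((Equiv.subLeft (x - z)).hasSum_iff.2 (hasSum_convDk q n N L (x - z))).mul_right (f z)
      refine h.congr_fun fun y => ?_
      simp only [Function.comp, Equiv.subLeft_apply, sub_sub_cancel]
      rw [sub_right_comm]
      ring
    have h2 := hasSum_sum fun z (_ : z ∈ S) => h1 z
    rw [← h2.tsum_eq]
    refine enorm_tsum_le_tsum_enorm.trans_eq ?_
    rw [cv]
    refine tsum_congr fun y => ?_
    rw [← Finset.mul_sum, enorm_mul, ← ofReal_norm, Complex.norm_real, Real.norm_of_nonneg (wq_nonneg hL y)]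
  · refine (enorm_sum_le _ _).trans ((ENNReal.sum_le_tsum S).trans_eq ?_)
    rw [cv, ← (Equiv.subLeft x).tsum_eq]
    refine tsum_congr fun y => ?_
    rw [enorm_mul]
    simp

/-- The ratio between the spherical average and the normalisation used in `errK`. -/
def bj (d n : ℕ) : ℝ := √(n : ℝ) ^ d / (n * lam n * (sph d n).card)

lemma exists_bj_le (d : ℕ) (hd : 4 ≤ d) : ∃ B : ℝ, 0 < B ∧ ∀ n : ℕ, Odd n → 4 ≤ n →
    0 < (sph d n).card ∧ 0 < bj d n ∧ bj d n ≤ B := by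
  obtain ⟨c, hc, h⟩ := exists_le_card_sph d hd
  refine ⟨2 / c, by positivity, fun n hn hn4 => ?_⟩
  have hn0 : (0 : ℝ) < n := by exact_mod_cast (by omega : 0 < n)
  have h1 := h n hn
  have h2 := (lam_mem (n := n) (by exact_mod_cast hn4)).1
  have hX : 0 < (n : ℝ) ^ ((d : ℝ) / 2 - 1) := by positivity
  have h3 : (0 : ℝ) < (sph d n).card := lt_of_lt_of_le (by positivity) h1
  have h4 : √(n : ℝ) ^ d = n * (n : ℝ) ^ ((d : ℝ) / 2 - 1) := by
    rw [Real.rpow_sub_one hn0.ne', Real.sqrt_eq_rpow, ← Real.rpow_natCast, ← Real.rpow_mul hn0.le]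
    field_simp
  refine ⟨by exact_mod_cast h3, by rw [bj]; positivity, ?_⟩
  rw [bj, h4, div_le_div_iff₀ (by positivity) hc]
  have h5 : c * (n : ℝ) ^ ((d : ℝ) / 2 - 1) ≤ 2 * (lam n * (sph d n).card) := by nlinarith
  calc _ = n * (c * (n : ℝ) ^ ((d : ℝ) / 2 - 1)) := by ring
    _ ≤ n * (2 * (lam n * (sph d n).card)) := by gcongr
    _ = _ := by ring

lemma sphere_kernel_eq {d n : ℕ} (hn : 4 ≤ n) (hc : 0 < (sph d n).card) (L : ℝ) (W : ℕ) (x : Fin d → ℤ) :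
    ((sph d n).card : ℂ)⁻¹ * (if normSqZ x = n then 1 else 0) =
      (bj d n : ℂ) * errK d n L W x + (bj d n : ℂ) * ∑ q ∈ Finset.Ioc 0 W, cK q n x * (bet d n L x : ℂ) := by
  have hn0 : (0 : ℝ) < n := by exact_mod_cast (by omega : 0 < n)
  have h2 := (lam_mem (n := n) (by exact_mod_cast hn)).1
  have hc' : (0 : ℝ) < (sph d n).card := by exact_mod_cast hc
  have h : bj d n * (n / √n ^ d * lam n) = ((sph d n).card : ℝ)⁻¹ := by
    have : √(n : ℝ) ≠ 0 := by positivity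
    rw [bj]
    field_simp
  rw [errK, ← mul_add, sub_add_cancel, ← mul_assoc, ← Complex.ofReal_mul, h]
  push_cast
  rfl

lemma BilP.const_mul {G : Type*} [AddCommGroup G] {p q : ℝ} {k : G → ℂ} {M b : ℝ} (hb : 0 ≤ b)
    (h : BilP p q k M) : BilP p q (fun x => (b : ℂ) * k x) (b * M) := by
  intro S f g
  have h1 := mul_le_mul_of_nonneg_left (h S f g) hb
  have h2 : ∑ x ∈ S, ∑ y ∈ S, (b : ℂ) * k (x - y) * f y * g x =
      b * ∑ x ∈ S, ∑ y ∈ S, k (x - y) * f y * g x := by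
    simp_rw [Finset.mul_sum, mul_assoc]
  rw [h2, norm_mul, Complex.norm_real, Real.norm_of_nonneg hb]
  exact h1.trans_eq (by ring)

lemma tsum_enorm_convDk_le {d : ℕ} (q : ℕ) [NeZero q] (n : ℤ) (N : ℝ) {L : ℝ} (hL : 0 ≤ L) :
    ∑' x : Fin d → ℤ, ‖convDk q n N L x‖ₑ ≤
      (∑' t : Fin d → ℤ, ‖Dk q n t‖ₑ) * ∑' x, ENNReal.ofReal (wq d q N L x) := by
  calc _ ≤ ∑' x : Fin d → ℤ, ∑' t, ‖Dk q n t‖ₑ * ENNReal.ofReal (wq d q N L (x - t)) := by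
        refine ENNReal.tsum_le_tsum fun x => enorm_tsum_le_tsum_enorm.trans_eq (tsum_congr fun t => ?_)
        rw [enorm_mul]
        congr 1
        rw [← ofReal_norm, Complex.norm_real, Real.norm_of_nonneg (wq_nonneg hL _)]
    _ = _ := by
        rw [ENNReal.tsum_comm, ← ENNReal.tsum_mul_right]
        refine tsum_congr fun t => ?_
        rw [ENNReal.tsum_mul_left]
        congr 1
        exact (Equiv.subRight t).tsum_eq fun x => ENNReal.ofReal (wq d q N L x)

lemma exists_sum_cK_bet_le (d : ℕ) (hd : 5 ≤ d) : ∃ C : ℝ, 0 < C ∧ ∀ (q : ℕ) [NeZero q] (n : ℤ) (N L : ℝ),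
    1 ≤ L → (q : ℝ) ^ 2 * L ^ 2 ≤ N → L ^ 3 * q ^ 2 ≤ √N → ∀ T : Finset (Fin d → ℤ),
      ∑ x ∈ T, ‖cK q n x * (bet d N L x : ℂ)‖ ≤ C * q.divisors.card := by
  obtain ⟨C₁, hC₁, h₁⟩ := exists_sum_norm_Dk_le d hd
  obtain ⟨A, hA, h₂⟩ := exists_tsum_wq_le (d := d) (by omega)
  obtain ⟨C₃, hC₃, h₃⟩ := exists_tsum_errP_le d
  refine ⟨C₁ * A + C₃, by positivity, fun q _ n N L hL hN hN2 T => ?_⟩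
  have hq := NeZero.ne q
  have hq0 : (0 : ℝ) < q := by positivity
  have hN0 : 0 < N := lt_of_lt_of_le (by positivity) hN
  have hsN : 0 < √N := Real.sqrt_pos.2 hN0
  have hcard : 1 ≤ (q.divisors.card : ℝ) := by
    exact_mod_cast Finset.card_pos.2 (Nat.nonempty_divisors.2 hq)
  have hqN : (q : ℝ) ^ 2 ≤ N := by
    refine le_trans ?_ hN
    have : 1 ≤ L ^ 2 := by nlinarith
    exact le_mul_of_one_le_right (by positivity) this
  have h4 : ∑' t : Fin d → ℤ, ‖Dk q n t‖ₑ ≤ ENNReal.ofReal (C₁ * q.divisors.card) := by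
    rw [ENNReal.tsum_eq_iSup_sum]
    refine iSup_le fun T => ?_
    simp_rw [← ofReal_norm]
    rw [← ENNReal.ofReal_sum_of_nonneg fun _ _ => norm_nonneg _]
    exact ENNReal.ofReal_le_ofReal (h₁ q n T)
  have h5 : ∑ x ∈ T, ‖cK q n x * (bet d N L x : ℂ)‖ₑ ≤ ENNReal.ofReal (C₁ * q.divisors.card * A + C₃) := by
    calc _ ≤ ∑' x, ‖cK q n x * (bet d N L x : ℂ)‖ₑ := ENNReal.sum_le_tsum T
      _ ≤ ∑' x, (‖convDk q n N L x‖ₑ + ‖errP q n N L x‖ₑ) := by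
          refine ENNReal.tsum_le_tsum fun x => ?_
          have : cK q n x * (bet d N L x : ℂ) = convDk q n N L x + errP q n N L x := by
            rw [errP]; ring
          rw [this]
          exact enorm_add_le _ _
      _ ≤ ENNReal.ofReal (C₁ * q.divisors.card) * ENNReal.ofReal A + ENNReal.ofReal C₃ := by
          rw [ENNReal.tsum_add]
          refine add_le_add ((tsum_enorm_convDk_le q n N (by linarith)).trans ?_) ?_
          · gcongr
            exact h₂ q N L hq hL hN
          · refine (h₃ q n N L hL hqN).trans (ENNReal.ofReal_le_ofReal ?_)
            refine mul_le_of_le_one_right hC₃.le ?_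
            rwa [div_le_one hsN]
      _ = _ := by
          rw [← ENNReal.ofReal_mul (by positivity), ← ENNReal.ofReal_add (by positivity) hC₃.le]
  simp_rw [← ofReal_norm] at h5
  rw [← ENNReal.ofReal_sum_of_nonneg fun _ _ => norm_nonneg _,
    ENNReal.ofReal_le_ofReal_iff (by positivity)] at h5
  nlinarith

lemma exists_sum_errK_le (d : ℕ) (hd : 5 ≤ d) : ∃ C : ℝ, 0 < C ∧ ∀ (n W : ℕ) (L : ℝ), Odd n → 4 ≤ n → 1 ≤ W →
    1 ≤ L → L ^ 3 * W ^ 2 ≤ √n → ∀ T : Finset (Fin d → ℤ),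
      ∑ x ∈ T, ‖(bj d n : ℂ) * errK d n L W x‖ ≤ C * (W : ℝ) ^ (3 / 2 : ℝ) := by
  obtain ⟨C₁, hC₁, h₁⟩ := exists_sum_cK_bet_le d hd
  obtain ⟨B, hB, h₂⟩ := exists_bj_le d (by omega)
  obtain ⟨C₃, hC₃, h₃⟩ := exists_card_divisors_le (ε := 1 / 2) (by norm_num)
  refine ⟨1 + B * (C₁ * C₃), by positivity, fun n W L hn hn4 hW hL hLn T => ?_⟩
  obtain ⟨hc0, hb0, hbB⟩ := h₂ n hn hn4
  have hc' : (0 : ℝ) < (sph d n).card := by exact_mod_cast hc0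
  have hW1 : (1 : ℝ) ≤ W := by exact_mod_cast hW
  have hn1 : (1 : ℝ) ≤ n := by exact_mod_cast (by omega : 1 ≤ n)
  have h4 : ∀ q ∈ Finset.Ioc 0 W, ∑ x ∈ T, ‖cK q n x * (bet d n L x : ℂ)‖ ≤
      C₁ * C₃ * (W : ℝ) ^ (1 / 2 : ℝ) := by
    intro q hq
    rw [Finset.mem_Ioc] at hq
    have : NeZero q := ⟨by omega⟩
    have hqW : (q : ℝ) ≤ W := by exact_mod_cast hq.2
    have hq3 : L ^ 3 * q ^ 2 ≤ √(n : ℝ) := le_trans (by gcongr) hLn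
    have hq2 : (q : ℝ) ^ 2 * L ^ 2 ≤ n := by
      calc (q : ℝ) ^ 2 * L ^ 2 ≤ L ^ 3 * q ^ 2 := by
            rw [mul_comm]
            have : L ^ 2 ≤ L ^ 3 := pow_le_pow_right₀ hL (by norm_num)
            gcongr
        _ ≤ √(n : ℝ) := hq3
        _ ≤ n := by
            rw [Real.sqrt_le_left (by linarith)]
            nlinarith
    refine (h₁ q n n L hL hq2 hq3 T).trans ?_
    rw [mul_assoc]
    gcongr
    refine (h₃ q (by omega)).trans ?_
    gcongr
  have h5 : ∀ x, ‖(bj d n : ℂ) * errK d n L W x‖ ≤ ((sph d n).card : ℝ)⁻¹ * (if x ∈ sph d n then 1 else 0) +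
      B * ∑ q ∈ Finset.Ioc 0 W, ‖cK q n x * (bet d n L x : ℂ)‖ := by
    intro x
    rw [← sub_eq_of_eq_add (sphere_kernel_eq hn4 hc0 L W x)]
    refine (norm_sub_le _ _).trans (add_le_add ?_ ?_)
    · rw [norm_mul, norm_inv, Complex.norm_natCast]
      gcongr
      simp_rw [mem_sph]
      split_ifs <;> simp
    · rw [norm_mul, Complex.norm_real, Real.norm_of_nonneg hb0.le]
      exact mul_le_mul hbB (norm_sum_le _ _) (norm_nonneg _) hB.le
  calc _ ≤ ∑ x ∈ T, (((sph d n).card : ℝ)⁻¹ * (if x ∈ sph d n then 1 else 0) +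
        B * ∑ q ∈ Finset.Ioc 0 W, ‖cK q n x * (bet d n L x : ℂ)‖) := Finset.sum_le_sum fun x _ => h5 x
    _ ≤ 1 + B * ∑ q ∈ Finset.Ioc 0 W, C₁ * C₃ * (W : ℝ) ^ (1 / 2 : ℝ) := by
        rw [Finset.sum_add_distrib, ← Finset.mul_sum, ← Finset.mul_sum, Finset.sum_comm]
        refine add_le_add ?_ (mul_le_mul_of_nonneg_left (Finset.sum_le_sum h4) hB.le)
        rw [inv_mul_le_iff₀ hc', mul_one, Finset.sum_ite_mem, Finset.sum_const, nsmul_eq_mul, mul_one]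
        exact_mod_cast Finset.card_le_card Finset.inter_subset_right
    _ = 1 + B * (C₁ * C₃) * (W : ℝ) ^ (3 / 2 : ℝ) := by
        rw [Finset.sum_const, Nat.card_Ioc, Nat.sub_zero, nsmul_eq_mul, show (3 / 2 : ℝ) = 1 + 1 / 2 by norm_num,
          Real.rpow_add (by linarith), Real.rpow_one]
        ring
    _ ≤ _ := by
        have : 1 ≤ (W : ℝ) ^ (3 / 2 : ℝ) := Real.one_le_rpow hW1 (by norm_num)
        linarith

lemma exists_nseq_scales {η : ℝ} (hη : 1 < η) (d : ℕ) : ∃ j₀ : ℕ, 2 ≤ j₀ ∧ ∀ l, j₀ ≤ l →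
    4 ≤ nseq η l ∧ ((2 : ℝ) ^ l) ^ (4 * d + 2) ≤ √(nseq η l) ∧
      ∀ j, j < l → ((2 : ℝ) ^ l) ^ (4 * d + 2) * √(nseq η j) ≤ √(nseq η l) := by
  obtain ⟨j₀, h2, h⟩ := exists_nseq_growth hη (4 * d + 2)
  refine ⟨j₀, h2, fun l hl => ⟨?_, ?_, h l hl⟩⟩
  · have h1 : 2 ≤ primeLen η l :=
      (by omega : 2 ≤ l).trans ((Nat.lt_two_pow_self).le.trans (two_pow_le_primeLen hη l))
    calc 4 = 2 ^ 2 := by norm_num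
      _ ≤ 2 ^ primeLen η l := Nat.pow_le_pow_right (by norm_num) h1
      _ ≤ _ := two_pow_le_nseq η l
  · have h1 := h l hl 0 (by omega)
    refine le_trans ?_ h1
    refine le_mul_of_one_le_right (by positivity) (Real.one_le_sqrt.2 ?_)
    exact_mod_cast (Nat.one_le_two_pow.trans (two_pow_le_nseq η 0))

lemma exists_bilP_errK_of_five_le {d : ℕ} (hd : 5 ≤ d) : ∃ C : ℝ, 0 < C ∧ ∀ n W : ℕ, Odd n → 4 ≤ n →
    1 ≤ W → ((W : ℝ) ^ d) ^ 3 * W ^ 2 ≤ √n → (W : ℝ) ^ 2 * ((W : ℝ) ^ d) ^ 2 ≤ n →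
    BilP ((d : ℝ) / (d - 2)) ((d : ℝ) / 2) (fun x => (bj d n : ℂ) * errK d n ((W : ℝ) ^ d) W x)
      (C * (W : ℝ) ^ (-(((d : ℝ) - 4) / (2 * d)))) := by
  obtain ⟨C₁, hC₁, h₁⟩ := exists_sum_errK_le d hd
  obtain ⟨C₂, hC₂, h₂⟩ := exists_bilP_errK (d := d) (by omega)
  obtain ⟨B, hB, hb⟩ := exists_bj_le d (by omega)
  have hd5 : (5 : ℝ) ≤ d := by exact_mod_cast hd
  set s : ℝ := (d : ℝ) / 2 - 2 with hs
  have hs0 : 0 < s := by rw [hs]; linarith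
  set K : ℝ := 2 ^ ((d : ℝ) / 2) with hK
  have hK0 : 0 < K := by positivity
  set C₃ : ℝ := B * (C₂ * (K * (1 / s) + K)) with hC₃
  have hC₃0 : 0 < C₃ := by positivity
  refine ⟨C₁ ^ (1 - 4 / (d : ℝ)) * C₃ ^ (4 / (d : ℝ)), by positivity, fun n W hn hn4 hW hLn hWL => ?_⟩
  have hW1 : (1 : ℝ) ≤ W := by exact_mod_cast hW
  have hW0 : (0 : ℝ) < W := by linarith
  obtain ⟨-, hb0, hbB⟩ := hb n hn hn4
  have hkap : ∀ q, kap d q n = K * (q : ℝ) ^ (1 - (d : ℝ) / 2) := fun q => by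
    rw [kap, if_neg (by omega)]
  have hM : ∀ Q, ∑ q ∈ Finset.Ioc W Q, kap d q n ≤ K * (1 / s) * (W : ℝ) ^ (-s) := fun Q => by
    simp_rw [hkap]
    rw [← Finset.mul_sum, mul_assoc]
    refine mul_le_mul_of_nonneg_left ?_ hK0.le
    have := sum_Ioc_rpow_le' hs0 hW Q
    rwa [show -1 - s = 1 - (d : ℝ) / 2 by rw [hs]; ring] at this
  have hlow : ∑ q ∈ Finset.Ioc 0 W, kap d q n ≤ K * W := by
    refine (Finset.sum_le_card_nsmul _ _ K fun q hq => ?_).trans_eq ?_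
    · rw [hkap]
      refine mul_le_of_le_one_right hK0.le (Real.rpow_le_one_of_one_le_of_nonpos ?_ (by linarith))
      exact_mod_cast (Finset.mem_Ioc.1 hq).1
    · rw [Nat.card_Ioc, nsmul_eq_mul, Nat.sub_zero, mul_comm]
  have h3 := (h₂ n W _ _ (by omega) (one_le_pow₀ hW1) hWL hM).const_mul (b := bj d n) hb0.le
  have h4 : bj d n * (C₂ * (K * (1 / s) * (W : ℝ) ^ (-s) + ((W : ℝ) ^ d) ^ (-(1 / 2) : ℝ) *
      ∑ q ∈ Finset.Ioc 0 W, kap d q n)) ≤ C₃ * (W : ℝ) ^ (-s) := by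
    have h5 : ((W : ℝ) ^ d) ^ (-(1 / 2) : ℝ) * ∑ q ∈ Finset.Ioc 0 W, kap d q n ≤ K * (W : ℝ) ^ (-s) := by
      calc _ ≤ ((W : ℝ) ^ d) ^ (-(1 / 2) : ℝ) * (K * W) := by gcongr
        _ = K * (W : ℝ) ^ (-((d : ℝ) / 2) + 1) := by
          rw [← Real.rpow_natCast, ← Real.rpow_mul hW0.le, Real.rpow_add_one hW0.ne']
          ring_nf
        _ ≤ _ := by
          refine mul_le_mul_of_nonneg_left (Real.rpow_le_rpow_of_exponent_le hW1 ?_) hK0.le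
          rw [hs]; linarith
    calc _ ≤ B * (C₂ * (K * (1 / s) * (W : ℝ) ^ (-s) + K * (W : ℝ) ^ (-s))) := by
          refine mul_le_mul hbB (mul_le_mul_of_nonneg_left (by linarith) hC₂.le) ?_ hB.le
          have : 0 ≤ ∑ q ∈ Finset.Ioc 0 W, kap d q n := Finset.sum_nonneg fun q _ => kap_nonneg d q n
          positivity
      _ = _ := by rw [hC₃]; ring
  have h6 := bilP_interpolate (θ := 4 / (d : ℝ)) (p := (d : ℝ) / (d - 2)) (q := (d : ℝ) / 2)
    (M₁ := C₁ * (W : ℝ) ^ (3 / 2 : ℝ)) (by positivity)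
    (h₁ n W _ hn hn4 hW (one_le_pow₀ hW1) hLn) (by positivity) (h3.mono h4) (by positivity)
    (by rw [div_le_one (by linarith)]; linarith) (by field_simp; ring) (by field_simp; ring)
  have h7 : (C₁ * (W : ℝ) ^ (3 / 2 : ℝ)) ^ (1 - 4 / (d : ℝ)) * (C₃ * (W : ℝ) ^ (-s)) ^ (4 / (d : ℝ)) =
      C₁ ^ (1 - 4 / (d : ℝ)) * C₃ ^ (4 / (d : ℝ)) * (W : ℝ) ^ (-(((d : ℝ) - 4) / (2 * d))) := by
    rw [Real.mul_rpow hC₁.le (by positivity), Real.mul_rpow hC₃0.le (by positivity),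
      ← Real.rpow_mul hW0.le, ← Real.rpow_mul hW0.le,
      show -(((d : ℝ) - 4) / (2 * d)) = 3 / 2 * (1 - 4 / (d : ℝ)) + -s * (4 / (d : ℝ)) by
        rw [hs]; field_simp; ring, Real.rpow_add hW0]
    ring
  rwa [h7] at h6

lemma exists_bilP_errK_four : ∃ C : ℝ, 0 < C ∧ ∀ n W : ℕ, Odd n → 4 ≤ n →
    1 ≤ W → (W : ℝ) ^ 2 * ((W : ℝ) ^ 4) ^ 2 ≤ n →
    BilP 2 2 (fun x => (bj 4 n : ℂ) * errK 4 n ((W : ℝ) ^ 4) W x)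
      (C * ((W : ℝ) ^ (-(1 / 16) : ℝ) + ∑ g ∈ n.divisors.erase 1, ((g.divisors.card : ℝ) / g))) := by
  obtain ⟨C₂, hC₂, h₂⟩ := exists_bilP_errK (d := 4) le_rfl
  obtain ⟨B, hB, hb⟩ := exists_bj_le 4 le_rfl
  obtain ⟨C₁, hC₁, h₁⟩ := exists_sum_kap_four_le
  refine ⟨B * (C₂ * (C₁ + 5)), by positivity, fun n W hn hn4 hW hWL => ?_⟩
  have hW1 : (1 : ℝ) ≤ W := by exact_mod_cast hW
  have hW0 : (0 : ℝ) < W := by linarith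
  obtain ⟨-, hb0, hbB⟩ := hb n hn hn4
  set D := ∑ g ∈ n.divisors.erase 1, ((g.divisors.card : ℝ) / g) with hD
  have hD0 : 0 ≤ D := Finset.sum_nonneg fun g _ => by positivity
  have hlow : ∑ q ∈ Finset.Ioc 0 W, kap 4 q n ≤ 5 * W := by
    refine (Finset.sum_le_card_nsmul _ _ 5 fun q hq => ?_).trans_eq ?_
    · have hq := Finset.mem_Ioc.1 hq
      have hq1 : (1 : ℝ) ≤ q := by exact_mod_cast hq.1
      have hq0 : (0 : ℝ) < q := by linarith
      rw [kap, if_pos rfl]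
      have h1 : ((Nat.gcd n q : ℕ) : ℝ) ≤ q := by exact_mod_cast Nat.gcd_le_right n hq.1
      have h2 : (q.divisors.card : ℝ) ≤ q := by exact_mod_cast Nat.card_divisors_le_self q
      calc _ ≤ 5 * (q : ℝ) * (q : ℝ) ^ (-9 / 8 : ℝ) * (q : ℝ) ^ (1 / 8 : ℝ) := by gcongr
        _ = 5 * ((q : ℝ) ^ (1 : ℝ) * (q : ℝ) ^ (-9 / 8 : ℝ) * (q : ℝ) ^ (1 / 8 : ℝ)) := by
            rw [Real.rpow_one]; ring
        _ = 5 := by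
            rw [← Real.rpow_add hq0, ← Real.rpow_add hq0]; norm_num
    · rw [Nat.card_Ioc, nsmul_eq_mul, Nat.sub_zero, mul_comm]
  have h3 := (h₂ n W _ _ (by omega) (one_le_pow₀ hW1) hWL
    (fun Q => h₁ n W Q (by omega) hW)).const_mul (b := bj 4 n) hb0.le
  refine h3.mono ?_
  have h5 : ((W : ℝ) ^ 4) ^ (-(1 / 2) : ℝ) * ∑ q ∈ Finset.Ioc 0 W, kap 4 q n ≤
      5 * (W : ℝ) ^ (-(1 / 16) : ℝ) := by
    calc _ ≤ ((W : ℝ) ^ 4) ^ (-(1 / 2) : ℝ) * (5 * W) := by gcongr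
      _ = 5 * (W : ℝ) ^ (-2 + 1 : ℝ) := by
        rw [← Real.rpow_natCast, ← Real.rpow_mul hW0.le, Real.rpow_add_one hW0.ne']
        push_cast; ring_nf
      _ ≤ _ := by
        refine mul_le_mul_of_nonneg_left (Real.rpow_le_rpow_of_exponent_le hW1 ?_) (by norm_num)
        norm_num
  have hlow0 : 0 ≤ ∑ q ∈ Finset.Ioc 0 W, kap 4 q n := Finset.sum_nonneg fun q _ => kap_nonneg 4 q n
  have hlow1 : 0 ≤ ((W : ℝ) ^ 4) ^ (-(1 / 2) : ℝ) * ∑ q ∈ Finset.Ioc 0 W, kap 4 q n := by positivity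
  generalize ((W : ℝ) ^ 4) ^ (-(1 / 2) : ℝ) * ∑ q ∈ Finset.Ioc 0 W, kap 4 q n = Y at h5 hlow1 ⊢
  rw [← hD]
  clear_value D
  have h6 : 0 < (W : ℝ) ^ (-(1 / 16) : ℝ) := by positivity
  generalize (W : ℝ) ^ (-(1 / 16) : ℝ) = u at h5 h6 ⊢
  calc bj 4 n * (C₂ * (C₁ * (u + D) + Y)) ≤ B * (C₂ * (C₁ * (u + D) + 5 * (u + D))) :=
        mul_le_mul hbB (mul_le_mul_of_nonneg_left (by linarith) hC₂.le) (by positivity) hB.le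
    _ = _ := by ring

lemma scale_bounds {d n W : ℕ} (hW : 1 ≤ W) (h : (W : ℝ) ^ (4 * d + 2) ≤ √n) :
    ((W : ℝ) ^ d) ^ 3 * W ^ 2 ≤ √n ∧ (W : ℝ) ^ 2 * ((W : ℝ) ^ d) ^ 2 ≤ n := by
  have hW1 : (1 : ℝ) ≤ W := by exact_mod_cast hW
  constructor
  · refine le_trans ?_ h
    rw [← pow_mul, ← pow_add]
    exact pow_le_pow_right₀ hW1 (by omega)
  · have h1 : 1 ≤ √(n : ℝ) := (one_le_pow₀ hW1).trans h
    have h2 : √(n : ℝ) ≤ n := by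
      nlinarith [Real.sq_sqrt (Nat.cast_nonneg (α := ℝ) n)]
    refine le_trans ?_ (h.trans h2)
    rw [← pow_mul, ← pow_add]
    exact pow_le_pow_right₀ hW1 (by omega)

/-- The error kernels are bounded on `ℓ^{d/(d-2)}` with summable `p`-th powers of the bounds. -/
lemma exists_bilP_nseq_errK {d : ℕ} (hd : 4 ≤ d) {η : ℝ} (hη : 1 < η) :
    ∃ ρ : ℕ → ℝ, (∀ j, 0 ≤ ρ j) ∧ Summable (fun j => ρ j ^ ((d : ℝ) / (d - 2))) ∧
      ∀ j, 1 ≤ j → 4 ≤ nseq η j → ((2 : ℝ) ^ j) ^ (4 * d + 2) ≤ √(nseq η j) →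
      BilP ((d : ℝ) / (d - 2)) ((d : ℝ) / 2)
        (fun x => (bj d (nseq η j) : ℂ) * errK d (nseq η j) (((2 : ℝ) ^ j) ^ d) (2 ^ j) x) (ρ j) := by
  rcases hd.eq_or_lt with rfl | hd
  · obtain ⟨C, hC, h⟩ := exists_bilP_errK_four
    refine ⟨fun j => C * (((2 : ℝ) ^ j) ^ (-(1 / 16) : ℝ) + 120 / (j : ℝ) ^ η),
      fun j => by positivity, ?_, fun j hj hn hs => ?_⟩
    · norm_num only [Nat.cast_ofNat]
      simp_rw [Real.rpow_two]
      refine Summable.of_nonneg_of_le (fun j => by positivity)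
        (f := fun j : ℕ => 2 * C ^ 2 * (((2 : ℝ) ^ (-(1 / 8) : ℝ)) ^ j + 120 ^ 2 * (1 / (j : ℝ) ^ (2 * η))))
        (fun j => ?_) ?_
      · have h1 : (((2 : ℝ) ^ j) ^ (-(1 / 16) : ℝ)) ^ 2 = ((2 : ℝ) ^ (-(1 / 8) : ℝ)) ^ j := by
          rw [← Real.rpow_natCast, ← Real.rpow_natCast, ← Real.rpow_natCast, ← Real.rpow_mul (by norm_num),
            ← Real.rpow_mul (by norm_num), ← Real.rpow_mul (by norm_num)]
          congr 1; push_cast; ring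
        have h2 : (1 / (j : ℝ) ^ η) ^ 2 = 1 / (j : ℝ) ^ (2 * η) := by
          rw [div_pow, one_pow, ← Real.rpow_natCast, ← Real.rpow_mul (by positivity), mul_comm η]
          push_cast; rfl
        rw [← h1, ← h2, mul_pow, mul_assoc 2, mul_left_comm]
        refine mul_le_mul_of_nonneg_left ?_ (by positivity)
        have h3 : 120 / (j : ℝ) ^ η = 120 * (1 / (j : ℝ) ^ η) := by ring
        rw [h3]
        nlinarith [sq_nonneg (((2 : ℝ) ^ j) ^ (-(1 / 16) : ℝ) - 120 * (1 / (j : ℝ) ^ η))]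
      · refine Summable.mul_left _ (Summable.add ?_ (Summable.mul_left _ ?_))
        · refine summable_geometric_of_lt_one (by positivity) ?_
          exact Real.rpow_lt_one_of_one_lt_of_neg (by norm_num) (by norm_num)
        · exact Real.summable_one_div_nat_rpow.2 (by linarith)
    · have h1 : (((2 ^ j : ℕ) : ℕ) : ℝ) = (2 : ℝ) ^ j := by push_cast; rfl
      have h2 := scale_bounds (d := 4) (n := nseq η j) (W := 2 ^ j) Nat.one_le_two_pow (by rwa [h1])
      have h3 := h (nseq η j) (2 ^ j) (nseq_odd hη j) hn Nat.one_le_two_pow h2.2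
      rw [h1] at h3
      norm_num only [Nat.cast_ofNat]
      refine h3.mono ?_
      have := sum_divisors_nseq_le hη j hj
      norm_num at this ⊢
      gcongr
  · obtain ⟨C, hC, h⟩ := exists_bilP_errK_of_five_le hd
    have hd5 : (5 : ℝ) ≤ d := by exact_mod_cast hd
    set a : ℝ := ((d : ℝ) - 4) / (2 * d) with ha
    have ha0 : 0 < a := div_pos (by linarith) (by linarith)
    have hp0 : 0 < (d : ℝ) / (d - 2) := div_pos (by linarith) (by linarith)
    refine ⟨fun j => C * ((2 : ℝ) ^ j) ^ (-a), fun j => by positivity, ?_, fun j hj hn hs => ?_⟩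
    · have h1 : ∀ j : ℕ, (C * ((2 : ℝ) ^ j) ^ (-a)) ^ ((d : ℝ) / (d - 2)) =
          C ^ ((d : ℝ) / (d - 2)) * ((2 : ℝ) ^ (-a * ((d : ℝ) / (d - 2)))) ^ j := fun j => by
        rw [Real.mul_rpow hC.le (by positivity), ← Real.rpow_natCast, ← Real.rpow_natCast,
          ← Real.rpow_mul (by norm_num), ← Real.rpow_mul (by norm_num), ← Real.rpow_mul (by norm_num)]
        congr 2; ring
      simp_rw [h1]
      refine Summable.mul_left _ (summable_geometric_of_lt_one (by positivity) ?_)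
      exact Real.rpow_lt_one_of_one_lt_of_neg (by norm_num) (by nlinarith)
    · have h1 : (((2 ^ j : ℕ) : ℕ) : ℝ) = (2 : ℝ) ^ j := by push_cast; rfl
      have h2 := scale_bounds (d := d) (n := nseq η j) (W := 2 ^ j) Nat.one_le_two_pow (by rwa [h1])
      have h3 := h (nseq η j) (2 ^ j) (nseq_odd hη j) hn Nat.one_le_two_pow h2.1 h2.2
      rwa [h1] at h3

lemma exists_bilP_Dk {d : ℕ} (hd : 4 ≤ d) : ∃ a C : ℝ, 1 < a ∧ 1 < 2 * a - 2 * (1 - 2 / (d : ℝ)) ∧ 0 < C ∧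
    ∀ (q : ℕ) [NeZero q] (n : ℕ), Nat.Coprime n q →
      BilP ((d : ℝ) / (d - 2)) ((d : ℝ) / 2) (Dk (d := d) q n) (C * (q : ℝ) ^ (-a)) := by
  rcases hd.eq_or_lt with rfl | hd
  · obtain ⟨C, hC1, hC⟩ := exists_card_divisors_le (ε := 3 / 40) (by norm_num)
    refine ⟨21 / 20, 5 * C, by norm_num, by norm_num, by positivity, fun q _ n hnq => ?_⟩
    have hq0 : (0 : ℝ) < q := by exact_mod_cast NeZero.pos q
    norm_num only [Nat.cast_ofNat]
    refine (bilP_Dk q n).mono ?_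
    rw [kap, if_pos rfl, hnq, Nat.cast_one, Real.one_rpow, mul_one]
    calc _ ≤ 5 * (C * (q : ℝ) ^ (3 / 40 : ℝ)) * (q : ℝ) ^ (-9 / 8 : ℝ) := by
          gcongr; exact hC q (NeZero.ne q)
      _ = 5 * C * (q : ℝ) ^ (3 / 40 + -9 / 8 : ℝ) := by rw [Real.rpow_add hq0]; ring
      _ = _ := by norm_num
  · obtain ⟨C, hC1, hC⟩ := exists_card_divisors_le (ε := 1 / 20) (by norm_num)
    obtain ⟨C₁, hC₁, h₁⟩ := exists_sum_norm_Dk_le d hd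
    have hd5 : (5 : ℝ) ≤ d := by exact_mod_cast hd
    have hdd : 4 / (d : ℝ) ≤ 4 / 5 := div_le_div_of_nonneg_left (by norm_num) (by norm_num) hd5
    have hdd0 : 0 < 4 / (d : ℝ) := by positivity
    set K : ℝ := 2 ^ ((d : ℝ) / 2) with hK
    refine ⟨2 - 4 / (d : ℝ) - 1 / 20, (C₁ * C + 1) ^ (1 - 4 / (d : ℝ)) * K ^ (4 / (d : ℝ)), by linarith, ?_,
      by positivity, fun q _ n _ => ?_⟩
    · have : 2 / (d : ℝ) = 4 / d / 2 := by ring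
      rw [this]; linarith
    have hq1 : (1 : ℝ) ≤ q := by exact_mod_cast NeZero.pos q
    have hq0 : (0 : ℝ) < q := by linarith
    have h2 := bilP_interpolate (θ := 4 / (d : ℝ)) (p := (d : ℝ) / (d - 2)) (q := (d : ℝ) / 2)
      (k := Dk (d := d) q (n : ℤ)) (M₁ := (C₁ * C + 1) * (q : ℝ) ^ (1 / 20 : ℝ)) (by positivity)
      (fun T => (h₁ q n T).trans ?_) (kap_nonneg d q n) (bilP_Dk q n) (by positivity) (by linarith)
      (by field_simp; ring) (by field_simp; ring)
    · refine h2.mono ?_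
      rw [kap, if_neg (by omega), Real.mul_rpow (by positivity) (by positivity), ← hK,
        Real.mul_rpow (by positivity) (by positivity), ← Real.rpow_mul hq0.le, ← Real.rpow_mul hq0.le]
      calc _ = (C₁ * C + 1) ^ (1 - 4 / (d : ℝ)) * K ^ (4 / (d : ℝ)) *
            (q : ℝ) ^ (1 / 20 * (1 - 4 / (d : ℝ)) + (1 - (d : ℝ) / 2) * (4 / d)) := by
            rw [Real.rpow_add hq0]; ring
        _ ≤ _ := by
            refine mul_le_mul_of_nonneg_left (Real.rpow_le_rpow_of_exponent_le hq1 ?_) (by positivity)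
            have : (1 - (d : ℝ) / 2) * (4 / d) = 4 / d - 2 := by field_simp; ring
            rw [this]; linarith
    · have h3 := hC q (NeZero.ne q)
      have h4 : 0 < (q : ℝ) ^ (1 / 20 : ℝ) := by positivity
      nlinarith [mul_le_mul_of_nonneg_left h3 hC₁]

/-- Lower bounds on the gaps of the sequence of radii at stage `j`. -/
structure ScaleGap (d : ℕ) (η : ℝ) (j : ℕ) : Prop where
  one_le : 1 ≤ j
  four_le : 4 ≤ nseq η j
  pow_le : ((2 : ℝ) ^ j) ^ (4 * d + 2) ≤ √(nseq η j)
  pow_mul_le : ∀ i, i < j → ((2 : ℝ) ^ j) ^ (4 * d + 2) * √(nseq η i) ≤ √(nseq η j)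

/-- The weights at stage `j`. -/
def wj (d : ℕ) (η : ℝ) (q j : ℕ) (x : Fin d → ℤ) : ℝ≥0∞ :=
  ENNReal.ofReal (wq d q (nseq η j) (((2 : ℝ) ^ j) ^ d) x)

lemma ScaleGap.sq_le {d j : ℕ} {η : ℝ} (h : ScaleGap d η j) {q : ℕ} (hq : q ≤ 2 ^ j) :
    (q : ℝ) ^ 2 * (((2 : ℝ) ^ j) ^ d) ^ 2 ≤ nseq η j := by
  have h1 : (((2 ^ j : ℕ) : ℕ) : ℝ) = (2 : ℝ) ^ j := by push_cast; rfl
  have h2 := (scale_bounds (d := d) (n := nseq η j) (W := 2 ^ j) Nat.one_le_two_pow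
    (by rw [h1]; exact h.pow_le)).2
  rw [h1] at h2
  have h3 : (q : ℝ) ≤ 2 ^ j := by exact_mod_cast hq
  refine le_trans ?_ h2
  gcongr

lemma one_le_two_pow_pow (d j : ℕ) : (1 : ℝ) ≤ ((2 : ℝ) ^ j) ^ d :=
  one_le_pow₀ (one_le_pow₀ one_le_two)

lemma ScaleGap.sq_le' {d j : ℕ} {η : ℝ} (h : ScaleGap d η j) {q : ℕ} (hq : q ≤ 2 ^ j) :
    (q : ℝ) ^ 2 ≤ nseq η j := by
  refine le_trans ?_ (h.sq_le hq)
  exact le_mul_of_one_le_right (by positivity) (one_le_pow₀ (one_le_two_pow_pow d j))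

lemma modulus_wj_le {d q l j : ℕ} (hq : q ≠ 0) {η : ℝ} (hl : ScaleGap d η l) (hql : q ≤ 2 ^ l) (hjl : j < l)
    (hj : 0 < √(nseq η j : ℝ)) (z : Fin d → ℤ) (hz : ∀ i, (q : ℤ) ∣ z i) :
    modulus (wj d η q l) z ≤ ENNReal.ofReal (80000 * 12 ^ d * (1 + en z / √(nseq η j)) ^ 2 *
      ((1 / 2 : ℝ) ^ (d + 2)) ^ l) := by
  set L : ℝ := ((2 : ℝ) ^ l) ^ d with hL
  have hL1 : 1 ≤ L := one_le_two_pow_pow d l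
  have h1 : modulus (wj d η q l) z ≤ ∑' x : Fin d → ℤ, if ∀ i, (q : ℤ) ∣ x i then
      ENNReal.ofReal ((q : ℝ) ^ d * |bet d (nseq η l) L (x + z) - bet d (nseq η l) L x|) else 0 := by
    refine ENNReal.tsum_le_tsum fun x => ?_
    by_cases hx : ∀ i, (q : ℤ) ∣ x i
    · have hxz : ∀ i, (q : ℤ) ∣ (x + z) i := fun i => dvd_add (hx i) (hz i)
      rw [if_pos hx, wj, wj, ← ENNReal.ofReal_sub _ (wq_nonneg (by positivity) _), wq, wq, if_pos hx, if_pos hxz,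
        ← mul_sub]
      refine ENNReal.ofReal_le_ofReal (mul_le_mul_of_nonneg_left (le_abs_self _) (by positivity))
    · have hxz : ¬ ∀ i, (q : ℤ) ∣ (x + z) i := fun h => hx fun i => by
        simpa using dvd_sub (h i) (hz i)
      rw [if_neg hx, wj, wj, wq, wq, if_neg hx, if_neg hxz, tsub_self]
  refine h1.trans ((tsum_bet_sub_le hq (hl.sq_le' hql) hL1 z).trans (ENNReal.ofReal_le_ofReal ?_))
  set r := √(nseq η j : ℝ) with hr
  set R := √(nseq η l : ℝ) with hR
  have h2 := hl.pow_mul_le j hjl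
  rw [← hr, ← hR] at h2
  have hX : (0 : ℝ) < (2 : ℝ) ^ l := by positivity
  have hX1 : (1 : ℝ) ≤ (2 : ℝ) ^ l := one_le_pow₀ one_le_two
  have hrR : r ≤ R := le_trans (le_mul_of_one_le_left hj.le (one_le_pow₀ hX1)) h2
  have hR0 : 0 < R := hj.trans_le hrR
  have he := en_nonneg z
  have h3 : en z / R ≤ en z / r := div_le_div_of_nonneg_left he hj hrR
  have h4 : L ^ 3 * (en z / R) ≤ ((1 / 2 : ℝ) ^ (d + 2)) ^ l * (en z / r) := by
    rw [mul_div_assoc', mul_div_assoc', div_le_div_iff₀ hR0 hj]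
    have h5 : ((1 / 2 : ℝ) ^ (d + 2)) ^ l * ((2 : ℝ) ^ l) ^ (4 * d + 2) = L ^ 3 := by
      rw [hL, ← pow_mul, ← pow_mul, ← pow_mul, ← pow_mul, show l * (4 * d + 2) = (d + 2) * l + l * d * 3 by ring,
        pow_add, ← mul_assoc, ← mul_pow]
      norm_num [mul_assoc]
    calc _ = ((1 / 2 : ℝ) ^ (d + 2)) ^ l * en z * (((2 : ℝ) ^ l) ^ (4 * d + 2) * r) := by rw [← h5]; ring
      _ ≤ _ := by gcongr
  have h5 : 0 ≤ en z / r := by positivity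
  have h6 : 0 ≤ en z / R := by positivity
  calc _ = 80000 * 12 ^ d * (L ^ 3 * (en z / R)) * (1 + en z / R) := by ring
    _ ≤ 80000 * 12 ^ d * (((1 / 2 : ℝ) ^ (d + 2)) ^ l * (en z / r)) * (1 + en z / r) := by gcongr
    _ ≤ 80000 * 12 ^ d * (((1 / 2 : ℝ) ^ (d + 2)) ^ l * (1 + en z / r)) * (1 + en z / r) := by
        gcongr; linarith
    _ = _ := by ring

lemma sum_Ico_pow_le {y : ℝ} (hy0 : 0 ≤ y) (hy : y ≤ 1 / 2) (j J : ℕ) :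
    ∑ l ∈ Finset.Ico (j + 1) J, y ^ l ≤ y ^ j := by
  rcases le_total J (j + 1) with h | h
  · rw [Finset.Ico_eq_empty (by omega), Finset.sum_empty]; positivity
  · have h1 := geom_sum_Ico_le_of_lt_one (m := j + 1) (n := J) hy0 (by linarith)
    refine h1.trans ?_
    rw [div_le_iff₀ (by linarith), pow_succ]
    exact mul_le_mul_of_nonneg_left (by linarith) (by positivity)

lemma exists_tsum_wj_mul_modulus_le {d : ℕ} (hd : 4 ≤ d) : ∃ C : ℝ, 0 < C ∧ ∀ (η : ℝ) (q J j : ℕ)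
    (P : ℕ → Prop) [DecidablePred P], q ≠ 0 → (∀ l, P l → ScaleGap d η l ∧ q ≤ 2 ^ l) → P j →
    ∑' z, wj d η q j z * (∑ l ∈ Finset.Ico (j + 1) J,
      modulus (fun x => if P l then wj d η q l x else 0) z) ^ ((d : ℝ) / 2 - 1) ≤
      ENNReal.ofReal (C * (1 / 4) ^ j) := by
  obtain ⟨C, hC, h⟩ := exists_tsum_wq_moment_le d
  have hd4 : (4 : ℝ) ≤ d := by exact_mod_cast hd
  set k₁ : ℝ := (d : ℝ) / 2 - 1 with hk₁
  have hk1 : 1 ≤ k₁ := by rw [hk₁]; linarith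
  set K : ℝ := (80000 * 12 ^ d) ^ k₁ with hK
  refine ⟨K * C, by positivity, fun η q J j P _ hq hP hPj => ?_⟩
  obtain ⟨hj, hqj⟩ := hP j hPj
  set r := √(nseq η j : ℝ) with hr
  have hr0 : 0 < r := Real.sqrt_pos.2 (by exact_mod_cast (by have := hj.four_le; omega))
  set y : ℝ := (1 / 2 : ℝ) ^ (d + 2) with hy
  have hy0 : 0 ≤ y := by positivity
  have hy1 : y ≤ 1 / 2 := by
    calc y ≤ (1 / 2 : ℝ) ^ 1 := pow_le_pow_of_le_one (by norm_num) (by norm_num) (by omega)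
      _ = _ := pow_one _
  have hterm : ∀ z : Fin d → ℤ, wj d η q j z * (∑ l ∈ Finset.Ico (j + 1) J,
      modulus (fun x => if P l then wj d η q l x else 0) z) ^ k₁ ≤
      ENNReal.ofReal (K * y ^ j) *
        ENNReal.ofReal (wq d q (nseq η j) (((2 : ℝ) ^ j) ^ d) z * (1 + en z / √(nseq η j)) ^ d) := by
    intro z
    by_cases hz : ∀ i, (q : ℤ) ∣ z i
    swap
    · rw [wj, wq, if_neg hz]; simp
    have he : 0 ≤ en z / r := div_nonneg (en_nonneg z) hr0.le
    have h1 : ∑ l ∈ Finset.Ico (j + 1) J, modulus (fun x => if P l then wj d η q l x else 0) z ≤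
        ENNReal.ofReal (80000 * 12 ^ d * (1 + en z / r) ^ 2 * y ^ j) := by
      calc _ ≤ ∑ l ∈ Finset.Ico (j + 1) J, ENNReal.ofReal (80000 * 12 ^ d * (1 + en z / r) ^ 2 * y ^ l) := by
            refine Finset.sum_le_sum fun l hl => ?_
            by_cases hPl : P l
            · simp only [hPl, if_true]
              exact modulus_wj_le hq (hP l hPl).1 (hP l hPl).2 (by have := Finset.mem_Ico.1 hl; omega) hr0 z hz
            · simp [hPl, modulus]
        _ = ENNReal.ofReal (80000 * 12 ^ d * (1 + en z / r) ^ 2 * ∑ l ∈ Finset.Ico (j + 1) J, y ^ l) := by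
            rw [Finset.mul_sum, ENNReal.ofReal_sum_of_nonneg fun l _ => by positivity]
        _ ≤ _ := ENNReal.ofReal_le_ofReal (by gcongr; exact sum_Ico_pow_le hy0 hy1 j J)
    have h2 : (80000 * 12 ^ d * (1 + en z / r) ^ 2 * y ^ j) ^ k₁ ≤ K * y ^ j * (1 + en z / r) ^ d := by
      rw [Real.mul_rpow (by positivity) (by positivity), Real.mul_rpow (by positivity) (by positivity), ← hK]
      have h3 : (y ^ j) ^ k₁ ≤ y ^ j := by
        have := Real.rpow_le_rpow_of_exponent_ge' (x := y ^ j) (by positivity)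
          (pow_le_one₀ hy0 (by linarith)) zero_le_one hk1
        rwa [Real.rpow_one] at this
      have h4 : ((1 + en z / r) ^ 2) ^ k₁ ≤ (1 + en z / r) ^ d := by
        rw [← Real.rpow_natCast, ← Real.rpow_natCast, ← Real.rpow_mul (by linarith)]
        refine Real.rpow_le_rpow_of_exponent_le (by linarith) ?_
        rw [hk₁]; push_cast; linarith
      calc _ ≤ K * (1 + en z / r) ^ d * y ^ j := by gcongr
        _ = _ := by ring
    calc _ ≤ wj d η q j z * ENNReal.ofReal (K * y ^ j * (1 + en z / r) ^ d) := by
          gcongr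
          refine (ENNReal.rpow_le_rpow h1 (by linarith)).trans ?_
          rw [ENNReal.ofReal_rpow_of_nonneg (by positivity) (by linarith)]
          exact ENNReal.ofReal_le_ofReal h2
      _ = _ := by
          rw [wj, ← ENNReal.ofReal_mul (wq_nonneg (by positivity) _), ← ENNReal.ofReal_mul (by positivity)]
          congr 1; ring
  calc _ ≤ _ := ENNReal.tsum_le_tsum hterm
    _ = ENNReal.ofReal (K * y ^ j) * ∑' z, _ := ENNReal.tsum_mul_left
    _ ≤ ENNReal.ofReal (K * y ^ j) * ENNReal.ofReal (C * ((2 : ℝ) ^ j) ^ d) := by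
        gcongr; exact h q _ _ hq (by positivity) (hj.sq_le' hqj)
    _ = _ := by
        rw [← ENNReal.ofReal_mul (by positivity)]
        congr 1
        have : y ^ j * ((2 : ℝ) ^ j) ^ d = (1 / 4 : ℝ) ^ j := by
          rw [hy, ← pow_mul, ← pow_mul, mul_comm j d, add_mul, pow_add, mul_right_comm, ← mul_pow, pow_mul _ 2 j]
          norm_num
        calc _ = K * C * (y ^ j * ((2 : ℝ) ^ j) ^ d) := by ring
          _ = _ := by rw [this]

lemma holderConjugate_half {d : ℕ} (hd : 4 ≤ d) : ((d : ℝ) / 2).HolderConjugate ((d : ℝ) / (d - 2)) := by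
  have hd4 : (4 : ℝ) ≤ d := by exact_mod_cast hd
  rw [Real.holderConjugate_iff]
  refine ⟨by linarith, ?_⟩
  field_simp; ring

/-- Maximal inequality for the weights attached to a fixed modulus. -/
lemma exists_nrm_sup_wj_le {d : ℕ} (hd : 4 ≤ d) : ∃ C : ℝ, 0 < C ∧ ∀ (η : ℝ) (q J : ℕ)
    (P : ℕ → Prop) [DecidablePred P], q ≠ 0 → (∀ l, P l → ScaleGap d η l ∧ q ≤ 2 ^ l) →
    ∀ F : (Fin d → ℤ) → ℝ≥0∞, nrm ((d : ℝ) / (d - 2)) (fun x => (Finset.range J).sup fun j =>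
      cv (fun x => if P j then wj d η q j x else 0) F x) ≤ ENNReal.ofReal C * nrm ((d : ℝ) / (d - 2)) F := by
  obtain ⟨C₁, hC₁, h₁⟩ := exists_tsum_wj_mul_modulus_le hd
  obtain ⟨A, hA, hA'⟩ := exists_tsum_wq_le hd
  have hd4 : (4 : ℝ) ≤ d := by exact_mod_cast hd
  set k : ℝ := (d : ℝ) / 2 with hk
  refine ⟨1 + k * 4 ^ k * (A ^ k + A + C₁ * 2), by positivity, fun η q J P _ hq hP F => ?_⟩
  refine (superlacunary_maximal (holderConjugate_half hd) J _ (A := ENNReal.ofReal A)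
    (B := ENNReal.ofReal (C₁ * 2)) (fun j => ?_) ?_ ENNReal.ofReal_ne_top F).trans_eq ?_
  · by_cases hPj : P j
    · simp only [hPj, if_true]
      exact hA' q _ _ hq (one_le_two_pow_pow d j) ((hP j hPj).1.sq_le (hP j hPj).2)
    · simp [hPj]
  · calc _ ≤ ∑ j ∈ Finset.range J, ENNReal.ofReal (C₁ * (1 / 4) ^ j) := by
          refine Finset.sum_le_sum fun j _ => ?_
          by_cases hPj : P j
          · simpa only [hPj, if_true] using h₁ η q J j P hq hP hPj
          · simp [hPj]
      _ = ENNReal.ofReal (C₁ * ∑ j ∈ Finset.range J, (1 / 4) ^ j) := by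
          rw [Finset.mul_sum, ENNReal.ofReal_sum_of_nonneg fun l _ => by positivity]
      _ ≤ _ := by
          refine ENNReal.ofReal_le_ofReal (mul_le_mul_of_nonneg_left ?_ hC₁.le)
          have : (0 : ℝ) ≤ (1 / 4) ^ J := by positivity
          rw [geom_sum_eq (by norm_num), div_le_iff_of_neg (by norm_num)]
          linarith
  · congr 1
    rw [ENNReal.ofReal_rpow_of_nonneg hA.le (by positivity), ← ENNReal.ofReal_add (by positivity) hA.le,
      ← ENNReal.ofReal_add (by positivity) (by positivity),
      show (4 : ℝ≥0∞) = ENNReal.ofReal 4 by simp, ENNReal.ofReal_rpow_of_nonneg (by positivity) (by positivity),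
      ← ENNReal.ofReal_mul (by positivity), ← ENNReal.ofReal_mul (by positivity), ← ENNReal.ofReal_one,
      ← ENNReal.ofReal_add (by positivity) (by positivity)]

lemma cK_mod {d : ℕ} (q : ℕ) [NeZero q] (n : ℕ) (x : Fin d → ℤ) :
    cK q ((n % q : ℕ) : ℤ) x = cK q (n : ℤ) x := by
  rw [cK, cK, ramanujanSum_eq_rs, ramanujanSum_eq_rs]
  congr 1
  push_cast
  simp

lemma Dk_mod {d : ℕ} (q : ℕ) [NeZero q] (n : ℕ) (x : Fin d → ℤ) :
    Dk q ((n % q : ℕ) : ℤ) x = Dk q (n : ℤ) x := by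
  rw [Dk, Dk, cK_mod]

lemma exists_sum_sq_part_le {a b : ℝ} (ha : 1 < a) (hb : 1 < 2 * a - b) : ∃ C : ℝ, 0 < C ∧
    ∀ s t : ℕ → ℕ, (∀ q, t q ^ 2 * s q = q) → ∀ Q,
      ∑ i ∈ Finset.range Q, (t (i + 1) : ℝ) ^ b * ((i + 1 : ℕ) : ℝ) ^ (-a) ≤ C := by
  have h1 : Summable fun n : ℕ => (n : ℝ) ^ (-a) := Real.summable_nat_rpow.2 (by linarith)
  have h2 : Summable fun n : ℕ => (n : ℝ) ^ (-(2 * a - b)) := Real.summable_nat_rpow.2 (by linarith)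
  have h3 := h1.mul_of_nonneg h2 (fun n => by positivity) (fun n => by positivity)
  set H : ℕ × ℕ → ℝ := fun x => (x.1 : ℝ) ^ (-a) * (x.2 : ℝ) ^ (-(2 * a - b)) with hH
  have hH0 : ∀ x, 0 ≤ H x := fun x => by positivity
  refine ⟨∑' x, H x + 1, by have : 0 ≤ ∑' x, H x := tsum_nonneg hH0; linarith, fun s t hst Q => ?_⟩
  have h4 : ∀ i, (t (i + 1) : ℝ) ^ b * ((i + 1 : ℕ) : ℝ) ^ (-a) = H (s (i + 1), t (i + 1)) := fun i => by
    have h := hst (i + 1)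
    have ht : (0 : ℝ) < t (i + 1) := by
      rcases Nat.eq_zero_or_pos (t (i + 1)) with h0 | h0
      · rw [h0] at h; simp at h
      · exact_mod_cast h0
    nth_rw 2 [← h]
    push_cast
    rw [hH, Real.mul_rpow (by positivity) (by positivity), ← Real.rpow_natCast, ← Real.rpow_mul ht.le, ← mul_assoc,
      ← Real.rpow_add ht, mul_comm]
    congr 2; push_cast; ring
  have hinj : Set.InjOn (fun i => (s (i + 1), t (i + 1))) (Finset.range Q : Set ℕ) := fun i _ k _ h => by
    have h := Prod.mk.inj h
    have h5 := hst (i + 1)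
    rw [h.1, h.2, hst] at h5
    omega
  calc _ = ∑ i ∈ Finset.range Q, H (s (i + 1), t (i + 1)) := Finset.sum_congr rfl fun i _ => h4 i
    _ = ∑ x ∈ (Finset.range Q).image fun i => (s (i + 1), t (i + 1)), H x := (Finset.sum_image hinj).symm
    _ ≤ ∑' x, H x := h3.sum_le_tsum _ fun x _ => hH0 x
    _ ≤ _ := by linarith

lemma card_residues_le {s t q : ℕ} (hq : t ^ 2 * s = q) (hq0 : q ≠ 0) (T : Finset ℕ)
    (hT : ∀ c ∈ T, c < q ∧ c ≡ 1 [MOD s]) : T.card ≤ t ^ 2 := by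
  have hs : 0 < s := Nat.pos_of_ne_zero (by rintro rfl; simp at hq; exact hq0 hq.symm)
  rw [← Finset.card_range (t ^ 2)]
  refine Finset.card_le_card_of_injOn (fun c => c / s) (fun c hc => ?_) fun c hc c' hc' h => ?_
  · rw [Finset.coe_range, Set.mem_Iio, Nat.div_lt_iff_lt_mul hs, hq]
    exact (hT c hc).1
  · have h1 : c % s = c' % s := (hT c hc).2.trans (hT c' hc').2.symm
    rw [← Nat.div_add_mod c s, ← Nat.div_add_mod c' s, h1]
    simp only at h
    rw [h]

lemma nrm_sup_le_sum {G ι : Type*} {p : ℝ} (hp : 0 < p) (T : Finset ι) (F : ι → G → ℝ≥0∞) :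
    nrm p (fun x => T.sup fun i => F i x) ≤ (∑ i ∈ T, nrm p (F i) ^ p) ^ (1 / p) := by
  have h1 : ∀ x, (T.sup fun i => F i x) = ⨆ i : T, F i x := fun x => by
    rw [Finset.sup_eq_iSup, iSup_subtype']
  simp_rw [h1]
  refine (nrm_iSup_le hp _).trans_eq ?_
  rw [tsum_fintype, Finset.sum_coe_sort T fun i => nrm p (F i) ^ p]

lemma nrm_sup_le_card {G ι : Type*} {p : ℝ} (hp : 0 < p) (T : Finset ι) (F : ι → G → ℝ≥0∞) {M : ℝ≥0∞}
    (h : ∀ i ∈ T, nrm p (F i) ≤ M) :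
    nrm p (fun x => T.sup fun i => F i x) ≤ (T.card : ℝ≥0∞) ^ (1 / p) * M := by
  refine (nrm_sup_le_sum hp T F).trans ?_
  calc _ ≤ (∑ i ∈ T, M ^ p) ^ (1 / p) := by
        gcongr with i hi
        exact h i hi
    _ = _ := by
        rw [Finset.sum_const, nsmul_eq_mul,
          ENNReal.mul_rpow_of_nonneg _ _ (by positivity), ← ENNReal.rpow_mul, mul_one_div_cancel hp.ne',
          ENNReal.rpow_one]

open Classical in
/-- The main terms with a fixed denominator. -/
lemma exists_nrm_sup_main_le {d : ℕ} (hd : 4 ≤ d) : ∃ a C : ℝ, 1 < a ∧ 1 < 2 * a - 2 * (1 - 2 / (d : ℝ)) ∧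
    0 < C ∧ ∀ (η : ℝ) (q J s t : ℕ) [NeZero q], 1 < η → t ^ 2 * s = q → Squarefree s →
    ∀ (S : Finset (Fin d → ℤ)) (f : (Fin d → ℤ) → ℂ),
    nrm ((d : ℝ) / (d - 2)) (fun x => ((Finset.range J).filter fun j => ScaleGap d η j ∧ q ≤ 2 ^ j).sup fun j =>
      cv (wj d η q j) (fun v => ‖∑ z ∈ S, Dk q (nseq η j : ℤ) (v - z) * f z‖ₑ) x) ≤
      ENNReal.ofReal (C * ((t : ℝ) ^ (2 * (1 - 2 / (d : ℝ))) * (q : ℝ) ^ (-a)) *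
        (∑ y ∈ S, ‖f y‖ ^ ((d : ℝ) / (d - 2))) ^ (1 / ((d : ℝ) / (d - 2)))) := by
  obtain ⟨a, C₁, ha, ha2, hC₁, h₁⟩ := exists_bilP_Dk hd
  obtain ⟨C₂, hC₂, h₂⟩ := exists_nrm_sup_wj_le hd
  have hd4 : (4 : ℝ) ≤ d := by exact_mod_cast hd
  refine ⟨a, C₁ * C₂, ha, ha2, by positivity, fun η q J s t _ hη hst hs S f => ?_⟩
  have hq0 : q ≠ 0 := NeZero.ne q
  set p : ℝ := (d : ℝ) / (d - 2) with hp
  have hp0 : 0 < p := div_pos (by linarith) (by linarith)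
  have hp1 : 1 / p = 1 - 2 / (d : ℝ) := by rw [hp]; field_simp
  set I := (Finset.range J).filter fun j => ScaleGap d η j ∧ q ≤ 2 ^ j with hI
  set T := I.image fun j => nseq η j % q with hT
  have hlen : ∀ j, q ≤ 2 ^ j → q ≤ primeLen η j := fun j hj => hj.trans (two_pow_le_primeLen hη j)
  have hcard : T.card ≤ t ^ 2 := by
    refine card_residues_le hst hq0 T fun c hc => ?_
    obtain ⟨j, hj, rfl⟩ := Finset.mem_image.1 hc
    have hj := (Finset.mem_filter.1 hj).2
    refine ⟨Nat.mod_lt _ (NeZero.pos q), ?_⟩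
    have hsq : s ∣ q := ⟨t ^ 2, by rw [← hst, mul_comm]⟩
    have h1 := squarefree_dvd_nseq_sub_one (η := η) (j := j) hs
      ((Nat.le_of_dvd (NeZero.pos q) hsq).trans (hlen j hj.2))
    have h2 : nseq η j ≡ 1 [MOD s] := by
      refine (Nat.modEq_iff_dvd.2 ?_).symm
      simpa using h1
    exact ((Nat.mod_modEq _ _).of_dvd hsq).trans h2
  set g : ℕ → (Fin d → ℤ) → ℝ≥0∞ := fun c v => ‖∑ z ∈ S, Dk q (c : ℤ) (v - z) * f z‖ₑ with hg
  set N : ℝ := (∑ y ∈ S, ‖f y‖ ^ p) ^ (1 / p) with hN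
  have hN0 : 0 ≤ N := by positivity
  have hclass : ∀ c ∈ T, nrm p (fun x => (Finset.range J).sup fun j =>
      cv (fun x => if (ScaleGap d η j ∧ q ≤ 2 ^ j) ∧ nseq η j % q = c then wj d η q j x else 0) (g c) x) ≤
      ENNReal.ofReal (C₂ * (C₁ * (q : ℝ) ^ (-a) * N)) := by
    intro c hc
    obtain ⟨j, hj, rfl⟩ := Finset.mem_image.1 hc
    have hj := (Finset.mem_filter.1 hj).2
    refine (h₂ η q J (fun l => (ScaleGap d η l ∧ q ≤ 2 ^ l) ∧ nseq η l % q = nseq η j % q) hq0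
      (fun l hl => hl.1) _).trans ?_
    rw [ENNReal.ofReal_mul hC₂.le]
    gcongr
    have hcop : Nat.Coprime (nseq η j % q) q := by
      have := coprime_nseq (η := η) hq0 (hlen j hj.2)
      rwa [Nat.Coprime, ← Nat.gcd_rec, Nat.gcd_comm]
    exact (h₁ q _ hcop).nrm_le (holderConjugate_half hd).symm (by positivity) S f
  calc _ ≤ nrm p (fun x => T.sup fun c => (Finset.range J).sup fun j =>
        cv (fun x => if (ScaleGap d η j ∧ q ≤ 2 ^ j) ∧ nseq η j % q = c then wj d η q j x else 0) (g c) x) := by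
        refine nrm_mono hp0 fun x => Finset.sup_le fun j hj => ?_
        have hj' := Finset.mem_filter.1 hj
        refine le_trans ?_ (Finset.le_sup (f := fun c => (Finset.range J).sup fun j =>
          cv (fun x => if (ScaleGap d η j ∧ q ≤ 2 ^ j) ∧ nseq η j % q = c then wj d η q j x else 0) (g c) x)
          (Finset.mem_image_of_mem _ hj))
        refine le_trans ?_ (Finset.le_sup (f := fun l =>
          cv (fun x => if (ScaleGap d η l ∧ q ≤ 2 ^ l) ∧ nseq η l % q = nseq η j % q then wj d η q l x else 0)
            (g (nseq η j % q)) x) hj'.1)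
        refine cv_mono (fun y => ?_) (fun v => ?_) x
        · rw [if_pos ⟨hj'.2, rfl⟩]
        · simp only [hg, Dk_mod, le_refl]
    _ ≤ (T.card : ℝ≥0∞) ^ (1 / p) * ENNReal.ofReal (C₂ * (C₁ * (q : ℝ) ^ (-a) * N)) :=
        nrm_sup_le_card hp0 T _ hclass
    _ ≤ ENNReal.ofReal (((t : ℝ) ^ 2) ^ (1 / p)) * ENNReal.ofReal (C₂ * (C₁ * (q : ℝ) ^ (-a) * N)) := by
        gcongr
        rw [← ENNReal.ofReal_rpow_of_nonneg (by positivity) (by positivity)]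
        refine ENNReal.rpow_le_rpow ?_ (by positivity)
        rw [← ENNReal.ofReal_natCast]
        exact ENNReal.ofReal_le_ofReal (by exact_mod_cast hcard)
    _ = _ := by
        rw [← ENNReal.ofReal_mul (by positivity), ← Real.rpow_natCast, ← Real.rpow_mul (by positivity), hp1]
        congr 1; push_cast; ring

open Classical in
/-- The main terms, summed over all denominators. -/
lemma exists_nrm_sum_sup_main_le {d : ℕ} (hd : 4 ≤ d) : ∃ C : ℝ, 0 < C ∧ ∀ (η : ℝ) (Q J : ℕ), 1 < η →
    ∀ (S : Finset (Fin d → ℤ)) (f : (Fin d → ℤ) → ℂ),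
    nrm ((d : ℝ) / (d - 2)) (fun x => ∑ i ∈ Finset.range Q,
      ((Finset.range J).filter fun j => ScaleGap d η j ∧ i + 1 ≤ 2 ^ j).sup fun j =>
        cv (wj d η (i + 1) j) (fun v => ‖∑ z ∈ S, Dk (i + 1) (nseq η j : ℤ) (v - z) * f z‖ₑ) x) ≤
      ENNReal.ofReal (C * (∑ y ∈ S, ‖f y‖ ^ ((d : ℝ) / (d - 2))) ^ (1 / ((d : ℝ) / (d - 2)))) := by
  obtain ⟨a, C₁, ha, ha2, hC₁, h₁⟩ := exists_nrm_sup_main_le hd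
  obtain ⟨C₂, hC₂, h₂⟩ := exists_sum_sq_part_le ha ha2
  have hd4 : (4 : ℝ) ≤ d := by exact_mod_cast hd
  have hp1 : 1 ≤ (d : ℝ) / (d - 2) := by rw [le_div_iff₀ (by linarith)]; linarith
  choose s t hst using Nat.sq_mul_squarefree
  refine ⟨C₁ * C₂, by positivity, fun η Q J hη S f => ?_⟩
  set N : ℝ := (∑ y ∈ S, ‖f y‖ ^ ((d : ℝ) / (d - 2))) ^ (1 / ((d : ℝ) / (d - 2))) with hN
  have hN0 : 0 ≤ N := by positivity
  refine (nrm_sum_le hp1 _ _).trans ?_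
  calc _ ≤ ∑ i ∈ Finset.range Q, ENNReal.ofReal (C₁ * ((t (i + 1) : ℝ) ^ (2 * (1 - 2 / (d : ℝ))) *
        ((i + 1 : ℕ) : ℝ) ^ (-a)) * N) :=
        Finset.sum_le_sum fun i _ => h₁ η (i + 1) J (s (i + 1)) (t (i + 1)) hη (hst _).1 (hst _).2 S f
    _ = ENNReal.ofReal (C₁ * N * ∑ i ∈ Finset.range Q, ((t (i + 1) : ℝ) ^ (2 * (1 - 2 / (d : ℝ))) *
        ((i + 1 : ℕ) : ℝ) ^ (-a))) := by
        rw [← ENNReal.ofReal_sum_of_nonneg fun i _ => by positivity, Finset.mul_sum]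
        congr 1
        exact Finset.sum_congr rfl fun i _ => by ring
    _ ≤ _ := by
        refine ENNReal.ofReal_le_ofReal ?_
        calc _ ≤ C₁ * N * C₂ := by gcongr; exact h₂ s t (fun q => (hst q).1) Q
          _ = _ := by ring

/-- The normalised indicator function of a lattice sphere. -/
def sphKernel (d n : ℕ) (x : Fin d → ℤ) : ℂ :=
  ((sph d (n : ℤ)).card : ℂ)⁻¹ * if normSqZ x = (n : ℤ) then 1 else 0

lemma enorm_sum_sphKernel_le {d n W : ℕ} (hn : 4 ≤ n) (hc : 0 < (sph d (n : ℤ)).card) {B L : ℝ} (hb : 0 ≤ bj d n)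
    (hB : bj d n ≤ B) (hL : 0 ≤ L) (S : Finset (Fin d → ℤ)) (f : (Fin d → ℤ) → ℂ) (x : Fin d → ℤ) :
    ‖∑ z ∈ S, sphKernel d n (x - z) * f z‖ₑ ≤ ‖∑ z ∈ S, (bj d n : ℂ) * errK d n L W (x - z) * f z‖ₑ +
      ENNReal.ofReal B * ∑ i ∈ Finset.range W,
        (cv (fun y => ENNReal.ofReal (wq d (i + 1) n L y)) (fun v => ‖∑ z ∈ S, Dk (i + 1) n (v - z) * f z‖ₑ) x +
          cv (fun y => ‖errP (i + 1) n n L y‖ₑ) (fun z => ‖f z‖ₑ) x) := by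
  have h1 : ∑ z ∈ S, sphKernel d n (x - z) * f z = ∑ z ∈ S, (bj d n : ℂ) * errK d n L W (x - z) * f z +
      (bj d n : ℂ) * ∑ i ∈ Finset.range W, ∑ z ∈ S, cK (i + 1) n (x - z) * (bet d n L (x - z) : ℂ) * f z := by
    rw [Finset.sum_comm, Finset.mul_sum, ← Finset.sum_add_distrib]
    refine Finset.sum_congr rfl fun z _ => ?_
    rw [sphKernel, sphere_kernel_eq hn hc L W, ← sum_range_succ_eq_Ioc, add_mul, mul_assoc _ (∑ i ∈ _, _),
      Finset.sum_mul]
  rw [h1]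
  refine (enorm_add_le _ _).trans (add_le_add le_rfl ?_)
  rw [enorm_mul]
  refine mul_le_mul' ?_ ((enorm_sum_le _ _).trans
    (Finset.sum_le_sum fun i _ => enorm_sum_cK_bet_le (i + 1) n n hL S f x))
  rw [← ofReal_norm, Complex.norm_real, Real.norm_of_nonneg hb]
  exact ENNReal.ofReal_le_ofReal hB

lemma nrm_enorm_eq {G : Type*} {p : ℝ} (hp : 0 < p) (S : Finset G) (f : G → ℂ) (hf : ∀ z, z ∉ S → f z = 0) :
    nrm p (fun z => ‖f z‖ₑ) = ENNReal.ofReal ((∑ y ∈ S, ‖f y‖ ^ p) ^ (1 / p)) := by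
  rw [nrm, tsum_eq_sum (s := S) fun z hz => by rw [hf z hz, enorm_zero, ENNReal.zero_rpow_of_pos hp],
    ← ENNReal.ofReal_rpow_of_nonneg (by positivity) (by positivity), ENNReal.ofReal_sum_of_nonneg fun i _ => by positivity]
  congr 1
  refine Finset.sum_congr rfl fun z _ => ?_
  rw [← ofReal_norm, ENNReal.ofReal_rpow_of_nonneg (by positivity) hp.le]

open Classical in
lemma exists_nrm_sup_errK_le {d : ℕ} (hd : 4 ≤ d) {η : ℝ} (hη : 1 < η) : ∃ C : ℝ, 0 < C ∧ ∀ (J : ℕ)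
    (S : Finset (Fin d → ℤ)) (f : (Fin d → ℤ) → ℂ),
    nrm ((d : ℝ) / (d - 2)) (fun x => ((Finset.range J).filter (ScaleGap d η)).sup fun j =>
      ‖∑ z ∈ S, (bj d (nseq η j) : ℂ) * errK d (nseq η j) (((2 : ℝ) ^ j) ^ d) (2 ^ j) (x - z) * f z‖ₑ) ≤
      ENNReal.ofReal (C * (∑ y ∈ S, ‖f y‖ ^ ((d : ℝ) / (d - 2))) ^ (1 / ((d : ℝ) / (d - 2)))) := by
  obtain ⟨ρ, hρ0, hρ, h⟩ := exists_bilP_nseq_errK hd hη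
  have hd4 : (4 : ℝ) ≤ d := by exact_mod_cast hd
  set p : ℝ := (d : ℝ) / (d - 2) with hp
  have hp0 : 0 < p := div_pos (by linarith) (by linarith)
  have hs0 : 0 ≤ ∑' j, ρ j ^ p := tsum_nonneg fun j => Real.rpow_nonneg (hρ0 j) p
  refine ⟨(∑' j, ρ j ^ p) ^ (1 / p) + 1, by positivity, fun J S f => ?_⟩
  set N : ℝ := (∑ y ∈ S, ‖f y‖ ^ p) ^ (1 / p) with hN
  have hN0 : 0 ≤ N := by positivity
  refine (nrm_sup_le_sum hp0 _ _).trans ?_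
  calc _ ≤ (∑ j ∈ (Finset.range J).filter (ScaleGap d η), ENNReal.ofReal (ρ j * N) ^ p) ^ (1 / p) := by
        gcongr with j hj
        have hj := (Finset.mem_filter.1 hj).2
        exact (h j hj.one_le hj.four_le hj.pow_le).nrm_le (holderConjugate_half hd).symm (hρ0 j) S f
    _ = ENNReal.ofReal ((∑ j ∈ (Finset.range J).filter (ScaleGap d η), (ρ j * N) ^ p) ^ (1 / p)) := by
        rw [← ENNReal.ofReal_rpow_of_nonneg (Finset.sum_nonneg fun j _ =>
            Real.rpow_nonneg (mul_nonneg (hρ0 j) hN0) p) (by positivity),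
          ENNReal.ofReal_sum_of_nonneg fun j _ => Real.rpow_nonneg (mul_nonneg (hρ0 j) hN0) p]
        congr 1
        exact Finset.sum_congr rfl fun j _ =>
          ENNReal.ofReal_rpow_of_nonneg (mul_nonneg (hρ0 j) hN0) hp0.le
    _ ≤ ENNReal.ofReal ((∑' j, ρ j ^ p) ^ (1 / p) * N) := by
        refine ENNReal.ofReal_le_ofReal ?_
        have h1 : ∑ j ∈ (Finset.range J).filter (ScaleGap d η), (ρ j * N) ^ p ≤ (∑' j, ρ j ^ p) * N ^ p := by
          rw [Finset.sum_congr rfl fun j _ => Real.mul_rpow (hρ0 j) hN0, ← Finset.sum_mul]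
          gcongr
          exact hρ.sum_le_tsum _ fun j _ => Real.rpow_nonneg (hρ0 j) p
        refine (Real.rpow_le_rpow (Finset.sum_nonneg fun j _ =>
            Real.rpow_nonneg (mul_nonneg (hρ0 j) hN0) p) h1 (by positivity)).trans_eq ?_
        rw [Real.mul_rpow hs0 (by positivity), ← Real.rpow_mul hN0, mul_one_div_cancel hp0.ne', Real.rpow_one]
    _ ≤ _ := ENNReal.ofReal_le_ofReal (by nlinarith)

open Classical in
lemma exists_nrm_sum_errP_le (d : ℕ) (hd : 4 ≤ d) : ∃ C : ℝ, 0 < C ∧ ∀ (η : ℝ) (J : ℕ) {p : ℝ} (_ : 1 ≤ p)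
    (F : (Fin d → ℤ) → ℝ≥0∞),
    nrm p (fun x => ∑ j ∈ (Finset.range J).filter (ScaleGap d η), ∑ i ∈ Finset.range (2 ^ j),
      cv (fun y => ‖errP (i + 1) (nseq η j) (nseq η j) (((2 : ℝ) ^ j) ^ d) y‖ₑ) F x) ≤
      ENNReal.ofReal C * nrm p F := by
  obtain ⟨C, hC, h⟩ := exists_tsum_errP_le d
  refine ⟨C * 2, by positivity, fun η J p hp F => ?_⟩
  have hterm : ∀ j, ScaleGap d η j → ∀ i ∈ Finset.range (2 ^ j),
      nrm p (cv (fun y => ‖errP (i + 1) (nseq η j) (nseq η j) (((2 : ℝ) ^ j) ^ d) y‖ₑ) F) ≤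
      ENNReal.ofReal (C * (1 / 4) ^ j) * nrm p F := by
    intro j hj i hi
    have hi : i + 1 ≤ 2 ^ j := Finset.mem_range.1 hi
    refine (nrm_cv_le hp _ _).trans ?_
    gcongr
    refine (h (i + 1) _ _ _ (one_le_two_pow_pow d j) (hj.sq_le' hi)).trans (ENNReal.ofReal_le_ofReal ?_)
    refine mul_le_mul_of_nonneg_left ?_ hC.le
    have h1 := hj.pow_le
    set X : ℝ := (2 : ℝ) ^ j with hX
    have hX1 : 1 ≤ X := one_le_pow₀ one_le_two
    have hX0 : 0 < X := by linarith
    have hiX : ((i + 1 : ℕ) : ℝ) ≤ X := by rw [hX]; exact_mod_cast hi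
    have hr : 0 < √(nseq η j : ℝ) := lt_of_lt_of_le (by positivity) h1
    rw [div_le_iff₀ hr]
    have h2 : (1 / 4 : ℝ) ^ j * X ^ 2 = 1 := by
      rw [hX, ← pow_mul, mul_comm j 2, pow_mul, ← mul_pow]; norm_num
    calc (X ^ d) ^ 3 * ((i + 1 : ℕ) : ℝ) ^ 2 ≤ (X ^ d) ^ 3 * X ^ 2 := by gcongr
      _ = (1 / 4 : ℝ) ^ j * X ^ 2 * ((X ^ d) ^ 3 * X ^ 2) := by rw [h2, one_mul]
      _ = (1 / 4 : ℝ) ^ j * X ^ (3 * d + 4) := by rw [← pow_mul, mul_assoc]; ring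
      _ ≤ (1 / 4 : ℝ) ^ j * X ^ (4 * d + 2) := by
          refine mul_le_mul_of_nonneg_left (pow_le_pow_right₀ hX1 ?_) (by positivity)
          omega
      _ ≤ _ := by gcongr
  calc _ ≤ ∑ j ∈ (Finset.range J).filter (ScaleGap d η), nrm p (fun x => ∑ i ∈ Finset.range (2 ^ j),
      cv (fun y => ‖errP (i + 1) (nseq η j) (nseq η j) (((2 : ℝ) ^ j) ^ d) y‖ₑ) F x) := nrm_sum_le hp _ _
    _ ≤ ∑ j ∈ (Finset.range J).filter (ScaleGap d η), ENNReal.ofReal (C * (1 / 2) ^ j) * nrm p F := by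
        refine Finset.sum_le_sum fun j hj => (nrm_sum_le hp _ _).trans ?_
        refine (Finset.sum_le_sum (hterm j (Finset.mem_filter.1 hj).2)).trans_eq ?_
        rw [Finset.sum_const, Finset.card_range, nsmul_eq_mul, ← mul_assoc, ← ENNReal.ofReal_natCast,
          ← ENNReal.ofReal_mul (by positivity)]
        congr 2
        push_cast
        rw [mul_left_comm, ← mul_pow]
        norm_num
    _ = ENNReal.ofReal (C * ∑ j ∈ (Finset.range J).filter (ScaleGap d η), (1 / 2) ^ j) * nrm p F := by
        rw [Finset.mul_sum, ENNReal.ofReal_sum_of_nonneg fun l _ => by positivity, Finset.sum_mul]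
    _ ≤ _ := by
        gcongr
        calc ∑ j ∈ (Finset.range J).filter (ScaleGap d η), (1 / 2 : ℝ) ^ j ≤ ∑ j ∈ Finset.range J, (1 / 2 : ℝ) ^ j :=
              Finset.sum_le_sum_of_subset_of_nonneg (Finset.filter_subset _ _) fun _ _ _ => by positivity
          _ ≤ 2 := by
              have : (0 : ℝ) ≤ (1 / 2) ^ J := by positivity
              rw [geom_sum_eq (by norm_num), div_le_iff_of_neg (by norm_num)]
              linarith

open Classical in
/-- The maximal inequality at the endpoint exponent for the large radii. -/
lemma exists_nrm_sup_sphKernel_le {d : ℕ} (hd : 4 ≤ d) {η : ℝ} (hη : 1 < η) : ∃ C : ℝ, 0 < C ∧ ∀ (J : ℕ)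
    (S : Finset (Fin d → ℤ)) (f : (Fin d → ℤ) → ℂ), (∀ z, z ∉ S → f z = 0) →
    nrm ((d : ℝ) / (d - 2)) (fun x => ((Finset.range J).filter (ScaleGap d η)).sup fun j =>
      ‖∑ z ∈ S, sphKernel d (nseq η j) (x - z) * f z‖ₑ) ≤
      ENNReal.ofReal C * nrm ((d : ℝ) / (d - 2)) (fun z => ‖f z‖ₑ) := by
  obtain ⟨C₁, hC₁, h₁⟩ := exists_nrm_sup_errK_le hd hη
  obtain ⟨C₂, hC₂, h₂⟩ := exists_nrm_sum_sup_main_le hd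
  obtain ⟨C₃, hC₃, h₃⟩ := exists_nrm_sum_errP_le d hd
  obtain ⟨B, hB, hb⟩ := exists_bj_le d hd
  have hd4 : (4 : ℝ) ≤ d := by exact_mod_cast hd
  have hp1 : 1 ≤ (d : ℝ) / (d - 2) := by rw [le_div_iff₀ (by linarith)]; linarith
  set p : ℝ := (d : ℝ) / (d - 2) with hp
  have hp0 : 0 < p := by linarith
  refine ⟨C₁ + B * (C₂ + C₃), by positivity, fun J S f hf => ?_⟩
  have hN := nrm_enorm_eq hp0 S f hf
  set I := (Finset.range J).filter (ScaleGap d η) with hI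
  set E₁ : (Fin d → ℤ) → ℝ≥0∞ := fun x => I.sup fun j =>
      ‖∑ z ∈ S, (bj d (nseq η j) : ℂ) * errK d (nseq η j) (((2 : ℝ) ^ j) ^ d) (2 ^ j) (x - z) * f z‖ₑ with hE₁
  set E₂ : (Fin d → ℤ) → ℝ≥0∞ := fun x => ∑ i ∈ Finset.range (2 ^ J),
      ((Finset.range J).filter fun j => ScaleGap d η j ∧ i + 1 ≤ 2 ^ j).sup fun j =>
        cv (wj d η (i + 1) j) (fun v => ‖∑ z ∈ S, Dk (i + 1) (nseq η j : ℤ) (v - z) * f z‖ₑ) x with hE₂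
  set E₃ : (Fin d → ℤ) → ℝ≥0∞ := fun x => ∑ j ∈ I, ∑ i ∈ Finset.range (2 ^ j),
      cv (fun y => ‖errP (i + 1) (nseq η j) (nseq η j) (((2 : ℝ) ^ j) ^ d) y‖ₑ) (fun z => ‖f z‖ₑ) x with hE₃
  have hpt : ∀ x, (I.sup fun j => ‖∑ z ∈ S, sphKernel d (nseq η j) (x - z) * f z‖ₑ) ≤
      E₁ x + ENNReal.ofReal B * (E₂ x + E₃ x) := by
    refine fun x => Finset.sup_le fun j hj => ?_
    have hjJ := Finset.mem_range.1 (Finset.mem_filter.1 hj).1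
    have hjs := (Finset.mem_filter.1 hj).2
    obtain ⟨hc, hb0, hbB⟩ := hb (nseq η j) (nseq_odd hη j) hjs.four_le
    refine (enorm_sum_sphKernel_le (W := 2 ^ j) (L := ((2 : ℝ) ^ j) ^ d) hjs.four_le hc hb0.le hbB
      (by positivity) S f x).trans ?_
    refine add_le_add (Finset.le_sup (f := fun j => ‖∑ z ∈ S, (bj d (nseq η j) : ℂ) *
      errK d (nseq η j) (((2 : ℝ) ^ j) ^ d) (2 ^ j) (x - z) * f z‖ₑ) hj) ?_
    rw [Finset.sum_add_distrib]
    gcongr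
    · calc _ ≤ ∑ i ∈ Finset.range (2 ^ j),
          ((Finset.range J).filter fun j => ScaleGap d η j ∧ i + 1 ≤ 2 ^ j).sup fun j =>
          cv (wj d η (i + 1) j) (fun v => ‖∑ z ∈ S, Dk (i + 1) (nseq η j : ℤ) (v - z) * f z‖ₑ) x := by
            refine Finset.sum_le_sum fun i hi => Finset.le_sup (f := fun j => cv (wj d η (i + 1) j)
              (fun v => ‖∑ z ∈ S, Dk (i + 1) (nseq η j : ℤ) (v - z) * f z‖ₑ) x) ?_
            exact Finset.mem_filter.2 ⟨Finset.mem_range.2 hjJ, hjs, Finset.mem_range.1 hi⟩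
        _ ≤ _ := Finset.sum_le_sum_of_subset
            (Finset.range_mono (Nat.pow_le_pow_right (by norm_num) hjJ.le))
    · exact Finset.single_le_sum (f := fun j => ∑ i ∈ Finset.range (2 ^ j),
        cv (fun y => ‖errP (i + 1) (nseq η j) (nseq η j) (((2 : ℝ) ^ j) ^ d) y‖ₑ) (fun z => ‖f z‖ₑ) x)
        (fun _ _ => zero_le) hj
  calc _ ≤ nrm p (fun x => E₁ x + ENNReal.ofReal B * (E₂ x + E₃ x)) := nrm_mono hp0 hpt
    _ ≤ nrm p E₁ + ENNReal.ofReal B * (nrm p E₂ + nrm p E₃) := by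
        refine (nrm_add_le hp1 _ _).trans (add_le_add le_rfl ?_)
        rw [nrm_const_mul hp0]
        gcongr
        exact nrm_add_le hp1 _ _
    _ ≤ ENNReal.ofReal C₁ * nrm p (fun z => ‖f z‖ₑ) + ENNReal.ofReal B *
        (ENNReal.ofReal C₂ * nrm p (fun z => ‖f z‖ₑ) + ENNReal.ofReal C₃ * nrm p (fun z => ‖f z‖ₑ)) := by
        gcongr
        · rw [hN, ← ENNReal.ofReal_mul hC₁.le]; exact h₁ J S f
        · rw [hN, ← ENNReal.ofReal_mul hC₂.le]; exact h₂ η (2 ^ J) J hη S f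
        · exact h₃ η J hp1 _
    _ = _ := by
        rw [ENNReal.ofReal_add hC₁.le (by positivity), ENNReal.ofReal_mul hB.le, ENNReal.ofReal_add hC₂.le hC₃.le]
        ring

/-- Averages over a lattice sphere, on nonnegative functions. -/
def sphMean (d n : ℕ) (F : (Fin d → ℤ) → ℝ≥0∞) (x : Fin d → ℤ) : ℝ≥0∞ :=
  cv (fun y => ‖sphKernel d n y‖ₑ) F x

lemma enorm_sphKernel (d n : ℕ) (y : Fin d → ℤ) :
    ‖sphKernel d n y‖ₑ = if y ∈ sph d (n : ℤ) then ‖((sph d (n : ℤ)).card : ℂ)⁻¹‖ₑ else 0 := by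
  rw [sphKernel]
  by_cases h : normSqZ y = (n : ℤ)
  · rw [if_pos h, if_pos (mem_sph.2 h), mul_one]
  · rw [if_neg h, if_neg (mt mem_sph.1 h), mul_zero, enorm_zero]

lemma sphMean_eq_sum (d n : ℕ) (F : (Fin d → ℤ) → ℝ≥0∞) (x : Fin d → ℤ) :
    sphMean d n F x = ∑ y ∈ sph d (n : ℤ), ‖sphKernel d n y‖ₑ * F (x - y) :=
  tsum_eq_sum fun y hy => by simp only [enorm_sphKernel, if_neg hy, zero_mul]

lemma sum_enorm_sphKernel {d n : ℕ} (hc : (sph d (n : ℤ)).card ≠ 0) :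
    ∑ y ∈ sph d (n : ℤ), ‖sphKernel d n y‖ₑ = 1 := by
  rw [Finset.sum_congr rfl fun y hy => by rw [enorm_sphKernel, if_pos hy], Finset.sum_const, nsmul_eq_mul,
    enorm_inv (by exact_mod_cast hc), ← ofReal_norm, Complex.norm_natCast, ENNReal.ofReal_natCast]
  exact ENNReal.mul_inv_cancel (by exact_mod_cast hc) (ENNReal.natCast_ne_top _)

lemma tsum_enorm_sphKernel_le (d n : ℕ) : ∑' y, ‖sphKernel d n y‖ₑ ≤ 1 := by
  rw [tsum_eq_sum (s := sph d (n : ℤ)) fun y hy => by rw [enorm_sphKernel, if_neg hy]]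
  by_cases hc : (sph d (n : ℤ)).card = 0
  · rw [Finset.card_eq_zero.1 hc, Finset.sum_empty]; exact zero_le_one
  · exact (sum_enorm_sphKernel hc).le

lemma sphMean_rpow_le (d n : ℕ) {s : ℝ} (hs : 1 ≤ s) (F : (Fin d → ℤ) → ℝ≥0∞) (x : Fin d → ℤ) :
    sphMean d n F x ^ s ≤ sphMean d n (fun z => F z ^ s) x := by
  rw [sphMean_eq_sum, sphMean_eq_sum]
  by_cases hc : (sph d (n : ℤ)).card = 0
  · rw [Finset.card_eq_zero.1 hc, Finset.sum_empty, ENNReal.zero_rpow_of_pos (by linarith)]; exact zero_le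
  · exact ENNReal.rpow_arith_mean_le_arith_mean_rpow _ _ _ (sum_enorm_sphKernel hc) hs

lemma nrm_sphMean_le (d n : ℕ) {p : ℝ} (hp : 1 ≤ p) (F : (Fin d → ℤ) → ℝ≥0∞) :
    nrm p (sphMean d n F) ≤ nrm p F := by
  refine (nrm_cv_le hp _ F).trans ?_
  calc _ ≤ 1 * nrm p F := by gcongr; exact tsum_enorm_sphKernel_le d n
    _ = _ := one_mul _

lemma enorm_sphAvg_le {d n : ℕ} {r : ℝ} (hr : r ^ 2 = n) (f : (Fin d → ℤ) → ℂ) (x : Fin d → ℤ) :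
    ‖sphAvg d r f x‖ₑ ≤ sphMean d n (fun z => ‖f z‖ₑ) x := by
  have h1 : radSq r = n := by rw [radSq, hr, Nat.floor_natCast]
  have h2 : sphereCount d r = (sph d (n : ℤ)).card := by
    rw [sphereCount, h1, ← Nat.card_eq_finsetCard]
    exact Nat.card_congr (Equiv.subtypeEquivRight fun x => mem_sph.symm)
  rw [sphAvg, enorm_mul, sphMean, cv, h2, h1]
  calc _ ≤ ‖((sph d (n : ℤ)).card : ℂ)⁻¹‖ₑ * ∑' y, ‖if normSqZ y = (n : ℤ) then f (x - y) else 0‖ₑ := by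
        gcongr; exact enorm_tsum_le_tsum_enorm
    _ = ∑' y, ‖((sph d (n : ℤ)).card : ℂ)⁻¹‖ₑ * ‖if normSqZ y = (n : ℤ) then f (x - y) else 0‖ₑ :=
        ENNReal.tsum_mul_left.symm
    _ ≤ _ := ENNReal.tsum_le_tsum fun y => by
        rw [sphKernel]
        split_ifs <;> simp

lemma nrm_iSup_le_of_sup {G : Type*} {p : ℝ} (hp : 0 < p) (F : ℕ → G → ℝ≥0∞) {M : ℝ≥0∞}
    (h : ∀ J, nrm p (fun x => (Finset.range J).sup fun j => F j x) ≤ M) :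
    nrm p (fun x => ⨆ j, F j x) ≤ M := by
  refine nrm_le_of_finset hp fun s => ?_
  have h1 : ∀ x, (⨆ j, F j x) ^ p = ⨆ J, ((Finset.range J).sup fun j => F j x) ^ p := fun x => by
    have : (⨆ j, F j x) = ⨆ J, (Finset.range J).sup fun j => F j x := by
      refine le_antisymm (iSup_le fun j => ?_) (iSup_le fun J => Finset.sup_le fun j _ => le_iSup (fun j => F j x) j)
      exact le_iSup_of_le (j + 1) (Finset.le_sup (f := fun j => F j x) (Finset.self_mem_range_succ j))
    rw [this]
    exact (ENNReal.orderIsoRpow p hp).map_iSup _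
  simp_rw [h1]
  rw [ENNReal.finsetSum_iSup_of_monotone (f := fun x J => ((Finset.range J).sup fun j => F j x) ^ p) fun x J K hJK =>
    ENNReal.rpow_le_rpow (Finset.sup_mono (Finset.range_mono hJK)) hp.le]
  refine iSup_le fun J => ?_
  calc _ ≤ ∑' x, ((Finset.range J).sup fun j => F j x) ^ p := ENNReal.sum_le_tsum s
    _ = nrm p (fun x => (Finset.range J).sup fun j => F j x) ^ p := (nrm_rpow hp _).symm
    _ ≤ _ := ENNReal.rpow_le_rpow (h J) hp.le

open Classical in
lemma exists_nrm_iSup_sphMean_le {d : ℕ} (hd : 4 ≤ d) {η : ℝ} (hη : 1 < η) : ∃ C : ℝ, 0 < C ∧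
    ∀ F : (Fin d → ℤ) → ℝ≥0∞, (∀ x, F x ≠ ∞) →
    nrm ((d : ℝ) / (d - 2)) (fun x => ⨆ j, if ScaleGap d η j then sphMean d (nseq η j) F x else 0) ≤
      ENNReal.ofReal C * nrm ((d : ℝ) / (d - 2)) F := by
  obtain ⟨C, hC, h⟩ := exists_nrm_sup_sphKernel_le hd hη
  have hd4 : (4 : ℝ) ≤ d := by exact_mod_cast hd
  have hp0 : 0 < (d : ℝ) / (d - 2) := div_pos (by linarith) (by linarith)
  set p : ℝ := (d : ℝ) / (d - 2) with hp
  refine ⟨C, hC, fun F hF => nrm_iSup_le_of_sup hp0 _ fun J => nrm_le_of_finset hp0 fun s => ?_⟩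
  set S : Finset (Fin d → ℤ) := s.biUnion fun x => (Finset.range J).biUnion fun j =>
    (sph d (nseq η j : ℤ)).image fun y => x - y with hS
  set f : (Fin d → ℤ) → ℂ := fun z => if z ∈ S then ((F z).toReal : ℂ) else 0 with hf
  have hfS : ∀ z, z ∉ S → f z = 0 := fun z hz => if_neg hz
  have hfe : ∀ z ∈ S, ‖f z‖ₑ = F z := fun z hz => by
    rw [hf]
    simp only [if_pos hz]
    rw [← ofReal_norm, Complex.norm_real, Real.norm_of_nonneg ENNReal.toReal_nonneg, ENNReal.ofReal_toReal (hF z)]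
  have hfF : ∀ z, ‖f z‖ₑ ≤ F z := fun z => by
    by_cases hz : z ∈ S
    · exact (hfe z hz).le
    · rw [hfS z hz, enorm_zero]; exact zero_le
  have hpt : ∀ x ∈ s, ((Finset.range J).sup fun j => if ScaleGap d η j then sphMean d (nseq η j) F x else 0) ≤
      ((Finset.range J).filter (ScaleGap d η)).sup fun j =>
        ‖∑ z ∈ S, sphKernel d (nseq η j) (x - z) * f z‖ₑ := by
    intro x hx
    refine Finset.sup_le fun j hj => ?_
    split_ifs with hjs
    swap
    · exact zero_le
    refine le_trans (le_of_eq ?_) (Finset.le_sup (f := fun j => ‖∑ z ∈ S, sphKernel d (nseq η j) (x - z) * f z‖ₑ)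
      (Finset.mem_filter.2 ⟨hj, hjs⟩))
    set c : ℝ := ((sph d (nseq η j : ℤ)).card : ℝ)⁻¹ with hc
    have hker : ∀ y, sphKernel d (nseq η j) y = ((c * if y ∈ sph d (nseq η j : ℤ) then 1 else 0 : ℝ) : ℂ) := fun y => by
      rw [sphKernel, hc]
      by_cases h : normSqZ y = (nseq η j : ℤ)
      · rw [if_pos h, if_pos (mem_sph.2 h)]; push_cast; rfl
      · rw [if_neg h, if_neg (mt mem_sph.1 h)]; simp
    have hc0 : 0 ≤ c := by positivity
    have hreal : ∑ z ∈ S, sphKernel d (nseq η j) (x - z) * f z =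
        ((∑ z ∈ S, (c * if x - z ∈ sph d (nseq η j : ℤ) then 1 else 0) * (F z).toReal : ℝ) : ℂ) := by
      rw [Complex.ofReal_sum]
      refine Finset.sum_congr rfl fun z hz => ?_
      rw [hker, hf]
      simp only [if_pos hz]
      rw [← Complex.ofReal_mul]
    have hnn : ∀ z, 0 ≤ (c * if x - z ∈ sph d (nseq η j : ℤ) then 1 else 0) * (F z).toReal := fun z => by
      have := ENNReal.toReal_nonneg (a := F z)
      split_ifs <;> positivity
    rw [hreal, ← ofReal_norm, Complex.norm_real, Real.norm_of_nonneg (Finset.sum_nonneg fun z _ => hnn z),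
      ENNReal.ofReal_sum_of_nonneg fun z _ => hnn z]
    have hsub : (sph d (nseq η j : ℤ)).image (fun y => x - y) ⊆ S := fun z hz =>
      Finset.mem_biUnion.2 ⟨x, hx, Finset.mem_biUnion.2 ⟨j, hj, hz⟩⟩
    rw [← Finset.sum_subset hsub, Finset.sum_image fun a _ b _ h => sub_right_injective h, sphMean_eq_sum]
    · refine Finset.sum_congr rfl fun y hy => ?_
      rw [sub_sub_cancel, if_pos hy, mul_one, ENNReal.ofReal_mul hc0, ENNReal.ofReal_toReal (hF _), hker, if_pos hy,
        mul_one, ← ofReal_norm, Complex.norm_real, Real.norm_of_nonneg hc0]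
    · intro z _ hz
      rw [if_neg, mul_zero, zero_mul, ENNReal.ofReal_zero]
      exact fun h => hz (Finset.mem_image.2 ⟨x - z, h, sub_sub_cancel x z⟩)
  calc _ ≤ ∑ x ∈ s, (((Finset.range J).filter (ScaleGap d η)).sup fun j =>
        ‖∑ z ∈ S, sphKernel d (nseq η j) (x - z) * f z‖ₑ) ^ p :=
        Finset.sum_le_sum fun x hx => ENNReal.rpow_le_rpow (hpt x hx) hp0.le
    _ ≤ _ := ENNReal.sum_le_tsum s
    _ = _ := (nrm_rpow hp0 _).symm
    _ ≤ _ := ENNReal.rpow_le_rpow ((h J S f hfS).trans (by gcongr; exact nrm_mono hp0 hfF)) hp0.le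

lemma nrm_rpow_rpow {G : Type*} {p s : ℝ} (hs : 0 < s) (F : G → ℝ≥0∞) :
    nrm (s * p) F ^ s = nrm p fun x => F x ^ s := by
  rw [nrm, nrm, ← ENNReal.rpow_mul]
  simp_rw [← ENNReal.rpow_mul]
  congr 1
  rw [one_div_mul_eq_div, one_div, div_mul_cancel_left₀ hs.ne']

open Classical in
lemma exists_nrm_iSup_sphMean_le' {d : ℕ} (hd : 4 ≤ d) {η : ℝ} (hη : 1 < η) {p : ℝ}
    (hp : (d : ℝ) / (d - 2) ≤ p) : ∃ C : ℝ, 0 < C ∧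
    ∀ F : (Fin d → ℤ) → ℝ≥0∞, (∀ x, F x ≠ ∞) →
    nrm p (fun x => ⨆ j, if ScaleGap d η j then sphMean d (nseq η j) F x else 0) ≤
      ENNReal.ofReal C * nrm p F := by
  obtain ⟨C, hC, h⟩ := exists_nrm_iSup_sphMean_le hd hη
  have hd4 : (4 : ℝ) ≤ d := by exact_mod_cast hd
  have hp0 : 0 < (d : ℝ) / (d - 2) := div_pos (by linarith) (by linarith)
  set p₀ : ℝ := (d : ℝ) / (d - 2) with hp₀
  set s : ℝ := p / p₀ with hs
  have hs1 : 1 ≤ s := by rwa [hs, one_le_div hp0]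
  have hs0 : 0 < s := by linarith
  have hsp : p = s * p₀ := by rw [hs]; field_simp
  refine ⟨C ^ (1 / s), by positivity, fun F hF => ?_⟩
  rw [← ENNReal.rpow_le_rpow_iff hs0, ENNReal.mul_rpow_of_nonneg _ _ hs0.le, hsp, nrm_rpow_rpow hs0, nrm_rpow_rpow hs0,
    ENNReal.ofReal_rpow_of_nonneg (by positivity) hs0.le, ← Real.rpow_mul hC.le, one_div_mul_cancel hs0.ne',
    Real.rpow_one]
  refine le_trans (nrm_mono hp0 fun x => ?_) (h (fun z => F z ^ s) fun x => ENNReal.rpow_ne_top_of_nonneg hs0.le (hF x))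
  refine le_trans (le_of_eq ((ENNReal.orderIsoRpow s hs0).map_iSup _)) (iSup_mono fun j => ?_)
  change (if ScaleGap d η j then sphMean d (nseq η j) F x else 0) ^ s ≤ _
  split_ifs
  · exact sphMean_rpow_le d _ hs1 F x
  · rw [ENNReal.zero_rpow_of_pos hs0]

theorem statement2 (d : ℕ) (hd : 4 ≤ d) (η : ℝ) (hη : 1 < η) (p : ℝ)
    (hp : (d : ℝ) / ((d : ℝ) - 2) ≤ p) :
    ∃ C : ℝ, 0 < C ∧ ∀ f : (Fin d → ℤ) → ℂ,
      (∑' x : Fin d → ℤ,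
          (⨆ r : {r : ℝ | 0 < r ∧ ∃ j : ℕ, 1 ≤ j ∧ r ^ 2 = (nseq η j : ℝ)},
            ((‖sphAvg d (r : ℝ) f x‖₊ : ℝ≥0∞))) ^ p) ^ (1 / p)
        ≤ ENNReal.ofReal C * lpNorm d p f := by
  classical
  obtain ⟨C, hC, h⟩ := exists_nrm_iSup_sphMean_le' hd hη hp
  obtain ⟨j₀, hj₀, hgap⟩ := exists_nseq_scales hη d
  have hd4 : (4 : ℝ) ≤ d := by exact_mod_cast hd
  have hp1 : 1 ≤ p := le_trans (by rw [le_div_iff₀ (by linarith)]; linarith) hp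
  have hp0 : 0 < p := by linarith
  refine ⟨j₀ + C, by positivity, fun f => ?_⟩
  set F : (Fin d → ℤ) → ℝ≥0∞ := fun z => ‖f z‖ₑ with hF
  change nrm p (fun x => ⨆ r : {r : ℝ | 0 < r ∧ ∃ j : ℕ, 1 ≤ j ∧ r ^ 2 = (nseq η j : ℝ)},
    ‖sphAvg d (r : ℝ) f x‖ₑ) ≤ ENNReal.ofReal (j₀ + C) * nrm p F
  calc _ ≤ nrm p (fun x => ∑ j ∈ Finset.range j₀, sphMean d (nseq η j) F x +
        ⨆ j, if ScaleGap d η j then sphMean d (nseq η j) F x else 0) := by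
        refine nrm_mono hp0 fun x => iSup_le fun r => ?_
        obtain ⟨-, j, hj1, hj⟩ := r.2
        refine (enorm_sphAvg_le hj f x).trans ?_
        rcases lt_or_ge j j₀ with hlt | hge
        · exact le_add_right (Finset.single_le_sum (f := fun j => sphMean d (nseq η j) F x)
            (fun _ _ => zero_le) (Finset.mem_range.2 hlt))
        · have hs : ScaleGap d η j := ⟨hj1, (hgap j hge).1, (hgap j hge).2.1, (hgap j hge).2.2⟩
          refine le_add_left (le_trans ?_ (le_iSup _ j))
          rw [if_pos hs]
    _ ≤ ∑ j ∈ Finset.range j₀, nrm p F + ENNReal.ofReal C * nrm p F := by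
        refine (nrm_add_le hp1 _ _).trans (add_le_add ?_ (h F fun x => enorm_ne_top))
        exact (nrm_sum_le hp1 _ _).trans (Finset.sum_le_sum fun j _ => nrm_sphMean_le d _ hp1 F)
    _ = _ := by
        rw [Finset.sum_const, Finset.card_range, nsmul_eq_mul, ← add_mul, ENNReal.ofReal_add (by positivity) hC.le,
          ENNReal.ofReal_natCast]

end
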